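/- Let X ⊆ P^r_K be an arithmetically normal variety of almost minimal degree which is not a cone. Then X is arithmetically Gorenstein (a maximal Del Pezzo variety); moreover, if codim X ≥ 3 then dim X ≤ 6, and if codim X ≥ 4 then dim X ≤ 4. -/

import Mathlib

noncomputable section

open MvPolynomial

/-- The polynomial ring `S = K[x_0, …, x_r]`, the homogeneous coordinate ring of `ℙ^r_K`. -/
abbrev PS (K : Type) [Field K] (r : ℕ) : Type := MvPolynomial (Fin (r + 1)) K

namespace AMD

variable (K : Type) [Field K] (r : ℕ)

/-- `I` is a homogeneous ideal of `S = K[x_0, …, x_r]`. -/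
def IsHomIdeal (I : Ideal (PS K r)) : Prop :=
  ∀ p ∈ I, ∀ n : ℕ, homogeneousComponent n p ∈ I

/-- `X = V_+(I)` is non-degenerate: `I` contains no nonzero linear form. -/
def Nondeg (I : Ideal (PS K r)) : Prop :=
  ∀ p ∈ I, p.IsHomogeneous 1 → p = 0

/-- The irrelevant maximal ideal of the homogeneous coordinate ring `A_X = S/I`. -/
def maxIdl (I : Ideal (PS K r)) : Ideal (PS K r ⧸ I) :=
  (Ideal.span (Set.range (X : Fin (r + 1) → PS K r))).map (Ideal.Quotient.mk I)

/-- `dim X = d`, i.e. the Krull dimension of `A_X = S/I` equals `d + 1`. -/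
def DimEq (I : Ideal (PS K r)) (d : ℕ) : Prop :=
  ringKrullDim (PS K r ⧸ I) = (((d : ℕ∞) + 1 : ℕ∞) : WithBot ℕ∞)

/-- The degree-`n` homogeneous component of `A_X = S/I`, as a `K`-subspace. -/
def quotComponent (I : Ideal (PS K r)) (n : ℕ) : Submodule K (PS K r ⧸ I) :=
  (homogeneousSubmodule (Fin (r + 1)) K n).map (Ideal.Quotient.mkₐ K I).toLinearMap

/-- The Hilbert series of the graded algebra `A_X = S/I`. -/
def hilbSeries (I : Ideal (PS K r)) : PowerSeries ℤ :=
  PowerSeries.mk fun n => (Module.finrank K (quotComponent K r I n) : ℤ)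

/-- `deg X = e`, where `d = dim X`:  the numerator polynomial of the Hilbert series of
`A_X` with respect to the denominator `(1 - λ)^(d+1)` takes the value `e` at `λ = 1`. -/
def DegreeEq (I : Ideal (PS K r)) (d e : ℕ) : Prop :=
  ∃ h : Polynomial ℤ,
    hilbSeries K r I * (1 - PowerSeries.X) ^ (d + 1) = PowerSeries.mk (fun n => h.coeff n) ∧
    h.eval 1 = (e : ℤ)

/-- A graded automorphism of `S`, i.e. a linear change of coordinates of `ℙ^r_K`. -/
def IsGrAut (φ : PS K r ≃ₐ[K] PS K r) : Prop :=
  ∀ i, (φ (X i)).IsHomogeneous 1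

/-- `X = V_+(I) ⊆ ℙ^r_K` is a cone (over a variety lying in some hyperplane): after a
linear change of coordinates, `I` is generated by polynomials not involving the last
variable. -/
def IsConeIdeal (I : Ideal (PS K r)) : Prop :=
  ∃ φ : PS K r ≃ₐ[K] PS K r, IsGrAut K r φ ∧
    ∃ J : Ideal (MvPolynomial (Fin r) K),
      Ideal.map φ I = Ideal.map (rename (Fin.castSucc : Fin r → Fin (r + 1))) J

/-- A (weakly) regular sequence on the ring `A`. -/
def IsRegSeq {A : Type} [CommRing A] (rs : List A) : Prop :=
  ∀ (i : Fin rs.length) (y : A),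
    rs.get i * y ∈ Ideal.span {x | x ∈ rs.take i.1} → y ∈ Ideal.span {x | x ∈ rs.take i.1}

/-- `depth A_X = t`: the maximal length of a regular sequence on `A_X = S/I` consisting
of elements of the irrelevant maximal ideal is `t`. -/
def DepthEq (I : Ideal (PS K r)) (t : ℕ) : Prop :=
  (∃ rs : List (PS K r ⧸ I), rs.length = t ∧ (∀ x ∈ rs, x ∈ maxIdl K r I) ∧ IsRegSeq rs) ∧
  ∀ rs : List (PS K r ⧸ I), (∀ x ∈ rs, x ∈ maxIdl K r I) → IsRegSeq rs → rs.length ≤ t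

/-- `X` is arithmetically Cohen-Macaulay: `depth A_X = dim A_X`. -/
def IsACM (I : Ideal (PS K r)) : Prop :=
  ∃ t : ℕ, ringKrullDim (PS K r ⧸ I) = ((t : ℕ∞) : WithBot ℕ∞) ∧ DepthEq K r I t

/-- The socle `{y | m·y = 0}` of `B`, as a `K`-subspace of `B`. -/
def socle (B : Type) [CommRing B] [Algebra K B] (m : Ideal B) : Submodule K B where
  carrier := {y | ∀ z ∈ m, z * y = 0}
  add_mem' := by
    intro a b ha hb z hz
    rw [mul_add, ha z hz, hb z hz, add_zero]
  zero_mem' := by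
    intro z hz
    rw [mul_zero]
  smul_mem' := by
    intro c y hy z hz
    rw [mul_smul_comm, hy z hz, smul_zero]

/-- `X` is arithmetically Gorenstein: `A_X = S/I` is Cohen-Macaulay and its Artinian
reduction by a maximal regular sequence has a one-dimensional socle. -/
def IsArithGorenstein (I : Ideal (PS K r)) : Prop :=
  ∃ (t : ℕ) (rs : List (PS K r ⧸ I)),
    ringKrullDim (PS K r ⧸ I) = ((t : ℕ∞) : WithBot ℕ∞) ∧ rs.length = t ∧
    (∀ x ∈ rs, x ∈ maxIdl K r I) ∧ IsRegSeq rs ∧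
    Module.finrank K
      (socle K ((PS K r ⧸ I) ⧸ Ideal.span {x | x ∈ rs})
        (Ideal.map (Ideal.Quotient.mk (Ideal.span {x | x ∈ rs})) (maxIdl K r I))) = 1

/-- The graded free `S`-module with `β j` generators in "row `j`" for each `j : ℕ`. -/
abbrev FreeGr (β : ℕ → ℕ) : Type := ((j : ℕ) × Fin (β j)) →₀ PS K r

/-- `φ` is a minimal graded homomorphism of graded free modules, where the generator
`(j, t)` of the source has degree `m₁ + j` and the generator `(j', t')` of the target
has degree `m₂ + j'`: every matrix entry of `φ` is either zero or homogeneous of the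
appropriate positive degree. -/
def IsMinGrMap (b₁ b₂ : ℕ → ℕ) (m₁ m₂ : ℕ)
    (φ : FreeGr K r b₁ →ₗ[PS K r] FreeGr K r b₂) : Prop :=
  ∀ (j : ℕ) (t : Fin (b₁ j)) (j' : ℕ) (t' : Fin (b₂ j')),
    (φ (Finsupp.single ⟨j, t⟩ 1)) ⟨j', t'⟩ = 0 ∨
      ∃ dd : ℕ, 1 ≤ dd ∧ dd + (m₂ + j') = m₁ + j ∧
        ((φ (Finsupp.single ⟨j, t⟩ 1)) ⟨j', t'⟩).IsHomogeneous dd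

/-- `b` is the Betti diagram of the ideal `I ⊆ S`, i.e.
`b i j = dim_K Tor_i^S(K, S/I)_{i+j}` for all `i ≥ 1`.  This is expressed by the
existence of a minimal graded free resolution `⋯ → F₂ → F₁ → S → S/I → 0` of `S/I`
in which, for `i ≥ 1`, the free module `F_i` has exactly `b i j` generators of degree
`i + j`. -/
def HasBettiDiagram (I : Ideal (PS K r)) (b : ℕ → ℕ → ℕ) : Prop :=
  ∃ (φ : (i : ℕ) → (FreeGr K r (b (i + 2)) →ₗ[PS K r] FreeGr K r (b (i + 1))))
    (ε : FreeGr K r (b 1) →ₗ[PS K r] PS K r),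
    (∀ (j : ℕ) (t : Fin (b 1 j)), (ε (Finsupp.single ⟨j, t⟩ 1)).IsHomogeneous (1 + j)) ∧
    (∀ i, IsMinGrMap K r (b (i + 2)) (b (i + 1)) (i + 2) (i + 1) (φ i)) ∧
    LinearMap.range ε = I ∧
    LinearMap.ker ε = LinearMap.range (φ 0) ∧
    ∀ i, LinearMap.ker (φ i) = LinearMap.range (φ (i + 1))

/-- The Pfaffian of a (skew-symmetric) `4 × 4` matrix. -/
def pfaff4 {R : Type} [CommRing R] (N : Matrix (Fin 4) (Fin 4) R) : R :=
  N 0 1 * N 2 3 - N 0 2 * N 1 3 + N 0 3 * N 1 2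

/-- The five submaximal (`4 × 4`) Pfaffians of a skew-symmetric `5 × 5` matrix. -/
def subPfaffian {R : Type} [CommRing R] (M : Matrix (Fin 5) (Fin 5) R) (i : Fin 5) : R :=
  pfaff4 (M.submatrix i.succAbove i.succAbove)

/-- `X = V_+(I)` is the Pfaffian variety defined by the five `4 × 4` Pfaffians of a
skew-symmetric `5 × 5` matrix of linear forms. -/
def IsPfaffianVariety (I : Ideal (PS K r)) : Prop :=
  ∃ M : Matrix (Fin 5) (Fin 5) (PS K r),
    M.transpose = -M ∧ (∀ i j, (M i j).IsHomogeneous 1) ∧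
    I = Ideal.span (Set.range (subPfaffian M))

/-- The vanishing ideal of the coordinate point `(0 : ⋯ : 0 : 1) ∈ ℙ^{r+1}_K`. -/
def pointIdl : Ideal (PS K (r + 1)) :=
  Ideal.span ((X : Fin (r + 2) → PS K (r + 1)) '' {i : Fin (r + 2) | i ≠ Fin.last (r + 1)})

/-- `X = V_+(I) ⊆ ℙ^r_K` is the image of `Z = V_+(J) ⊆ ℙ^{r+1}_K` under the projection
from a point `P ∈ ℙ^{r+1}_K ∖ Z`: after a linear change of coordinates moving `P` to
`(0 : ⋯ : 0 : 1)`, the ideal `I` is the contraction of `J` to `K[x_0, …, x_r]`. -/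
def IsProjectionOf (I : Ideal (PS K r)) (J : Ideal (PS K (r + 1))) : Prop :=
  ∃ ψ : PS K (r + 1) ≃ₐ[K] PS K (r + 1), IsGrAut K (r + 1) ψ ∧
    ¬ Ideal.map ψ J ≤ pointIdl K r ∧
    I = Ideal.comap (rename (Fin.castSucc : Fin (r + 1) → Fin (r + 2))) (Ideal.map ψ J)

/-- The ideal of the Veronese surface `F ⊆ ℙ^5_K`, generated by the `2 × 2` minors of
the generic symmetric `3 × 3` matrix with rows `(x₀,x₁,x₂), (x₁,x₃,x₄), (x₂,x₄,x₅)`. -/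
def veroneseIdeal : Ideal (PS K 5) :=
  Ideal.span {X 0 * X 3 - X 1 * X 1, X 0 * X 4 - X 1 * X 2, X 1 * X 4 - X 2 * X 3,
    X 0 * X 5 - X 2 * X 2, X 1 * X 5 - X 2 * X 4, X 3 * X 5 - X 4 * X 4}

/-- The determinant of the generic symmetric `3 × 3` matrix defining the Veronese
surface; it cuts out the secant variety of `F ⊆ ℙ^5_K`. -/
def veroneseDet : PS K 5 :=
  X 0 * X 3 * X 5 - X 0 * X 4 * X 4 - X 1 * X 1 * X 5 + 2 * (X 1 * X 2 * X 4) -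
    X 2 * X 2 * X 3

/-- `X = V_+(I) ⊆ ℙ^4_K` is a generic projection of the Veronese surface `F ⊆ ℙ^5_K`,
i.e. the projection of `F` from a point `P ∈ ℙ^5_K ∖ F` at which the generic symmetric
`3 × 3` matrix `M` has rank `3` (equivalently, `P` does not lie on the secant variety
`{det M = 0}` of `F`). -/
def IsGenProjVeronese4 (I : Ideal (PS K 4)) : Prop :=
  ∃ ψ : PS K 5 ≃ₐ[K] PS K 5, IsGrAut K 5 ψ ∧
    ¬ Ideal.map ψ (Ideal.span {veroneseDet K}) ≤ pointIdl K 4 ∧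
    I = Ideal.comap (rename (Fin.castSucc : Fin 5 → Fin 6)) (Ideal.map ψ (veroneseIdeal K))

/-- `X = V_+(I) ⊆ ℙ^r_K` is a generic projection of the Veronese surface (which forces
`r = 4`). -/
def IsGenProjVeronese (I : Ideal (PS K r)) : Prop :=
  ∃ h : r + 1 = 5, IsGenProjVeronese4 K (Ideal.map (rename (Fin.cast h)) I)

/-- `X = V_+(I) ⊆ ℙ^r_K` is a generic projection of (a cone over) the Veronese surface
`F ⊆ ℙ^5_K`:  `X` is the projection of a cone `Z ⊆ ℙ^{r+1}_K` over `F` from a point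
not lying on the (cone over the) secant variety of `F`. -/
def IsGenProjVeroneseCone (I : Ideal (PS K r)) : Prop :=
  ∃ (h : 6 ≤ r + 2) (ψ : PS K (r + 1) ≃ₐ[K] PS K (r + 1)), IsGrAut K (r + 1) ψ ∧
    ¬ Ideal.map ψ (Ideal.map (rename (Fin.castLE h))
        (Ideal.span {veroneseDet K})) ≤ pointIdl K r ∧
    I = Ideal.comap (rename (Fin.castSucc : Fin (r + 1) → Fin (r + 2)))
      (Ideal.map ψ (Ideal.map (rename (Fin.castLE h)) (veroneseIdeal K)))

/-- The ideal of the rational normal scroll `S(a_1, …, a_k)`, generated by the `2 × 2`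
minors of the standard `2 × (Σ a_i)` matrix of indeterminates. -/
def scrollIdeal (k : ℕ) (a : Fin k → ℕ) :
    Ideal (MvPolynomial ((i : Fin k) × Fin (a i + 1)) K) :=
  Ideal.span {p | ∃ (i : Fin k) (j : Fin (a i)) (i' : Fin k) (j' : Fin (a i')),
    p = X ⟨i, j.castSucc⟩ * X ⟨i', j'.succ⟩ - X ⟨i, j.succ⟩ * X ⟨i', j'.castSucc⟩}

/-- The affine cone in `K^{r+2}` of the projective scheme `V_+(J) ⊆ ℙ^{r+1}_K`. -/
def zeroSet (J : Ideal (PS K (r + 1))) : Set (Fin (r + 2) → K) :=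
  {v | ∀ f ∈ J, MvPolynomial.eval v f = 0}

/-- Restriction of polynomials to the plane spanned by the vectors `p` and `q`
(i.e. to the line through the corresponding projective points). -/
def lineRestrict (p q : Fin (r + 2) → K) : PS K (r + 1) →ₐ[K] MvPolynomial (Fin 2) K :=
  aeval fun i => MvPolynomial.C (p i) * X 0 + MvPolynomial.C (q i) * X 1

/-- The line through the (independent) points `p`, `q` is a secant line of
`Z = V_+(J)`: the scheme `Z ∩ L ⊆ L ≅ ℙ^1` has length at least `2`, i.e. the
restriction of `J` to the line is contained in a principal ideal generated by a
form of degree `≥ 2` (or is zero, in which case `L ⊆ Z`). -/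
def IsSecantLine (J : Ideal (PS K (r + 1))) (p q : Fin (r + 2) → K) : Prop :=
  ∃ h : MvPolynomial (Fin 2) K,
    (∀ f ∈ J, lineRestrict K r p q f ∈ Ideal.span {h}) ∧
    (h = 0 ∨ ∃ dd : ℕ, 2 ≤ dd ∧ h.IsHomogeneous dd)

/-- The (affine cone over the) secant cone `Sec_P(Z)` of `Z = V_+(J)` with respect to
the point `P = [p]`: the union of `{P}` and of all secant lines of `Z` through `P`. -/
def secantCone (J : Ideal (PS K (r + 1))) (p : Fin (r + 2) → K) : Set (Fin (r + 2) → K) :=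
  {v | ∃ a : K, v = a • p} ∪
    {v | ∃ q : Fin (r + 2) → K, LinearIndependent K ![p, q] ∧ IsSecantLine K r J p q ∧
      ∃ a b : K, v = a • p + b • q}

/-- The (homogeneous) vanishing ideal of a subset of the affine cone `K^{r+2}`. -/
def vanishingIdl (T : Set (Fin (r + 2) → K)) : Ideal (PS K (r + 1)) where
  carrier := {f | ∀ v ∈ T, MvPolynomial.eval v f = 0}
  add_mem' := by
    intro a b ha hb v hv
    rw [map_add, ha v hv, hb v hv, add_zero]
  zero_mem' := by
    intro v hv
    rw [map_zero]
  smul_mem' := by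
    intro c f hf v hv
    rw [smul_eq_mul, map_mul, hf v hv, mul_zero]

/-- `X = V_+(I) ⊆ ℙ^r_K` is the image of `Z = V_+(J) ⊆ ℙ^{r+1}_K` under the linear
projection `π : ℙ^{r+1}_K ∖ {P} → ℙ^r_K` from the point `P = [p]`:  `I` is the
contraction of `J` along the substitution homomorphism induced by a surjective linear
map `K^{r+2} → K^{r+1}` with kernel `K·p`. -/
def IsProjectionFromPoint (I : Ideal (PS K r)) (J : Ideal (PS K (r + 1)))
    (p : Fin (r + 2) → K) : Prop :=
  ∃ π : (Fin (r + 2) → K) →ₗ[K] (Fin (r + 1) → K),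
    Function.Surjective π ∧ LinearMap.ker π = Submodule.span K {p} ∧
    I = Ideal.comap
      (aeval (fun j : Fin (r + 1) =>
        ∑ i : Fin (r + 2), MvPolynomial.C (π (Pi.single i 1) j) * X i) :
          PS K r →ₐ[K] PS K (r + 1)) J

end AMD

noncomputable section
namespace DP
set_option linter.all false
open scoped Polynomial
open MvPolynomial

section Gen
/-- integrally closed: element of fraction type that is integral is in the image. -/
theorem intclosed_mem {R L : Type*} [CommRing R] [IsDomain R] [IsIntegrallyClosed R] [Field L]
    (f : R →+* L) (hf : Function.Injective f) (a b : R) (hb : b ≠ 0) (x : L)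
    (h : f b * x = f a) (hx : f.IsIntegralElem x) : ∃ r, f r = x := by
  let g : FractionRing R →+* L := IsFractionRing.lift (A := R) hf
  have hg : ∀ r, g (algebraMap R (FractionRing R) r) = f r := fun r =>
    IsFractionRing.lift_algebraMap hf r
  have hxg : x = g (algebraMap R _ a / algebraMap R _ b) := by
    rw [map_div₀, hg, hg, ← h, mul_div_cancel_left₀]
    exact (map_ne_zero_iff f hf).2 hb
  have hc : g.comp (algebraMap R (FractionRing R)) = f := RingHom.ext hg
  rw [← hc, hxg] at hx
  have := RingHom.IsIntegralElem.of_map g.injective hx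
  obtain ⟨r, hr⟩ := IsIntegrallyClosed.algebraMap_eq_of_integral (R := R) this
  exact ⟨r, by rw [hxg, ← hr, hg]⟩

theorem coeff_integral {R F L : Type*} [CommRing R] [Field F] [Field L] [Algebra F L]
    (f : R →+* F) (x : L) (hx : ((algebraMap F L).comp f).IsIntegralElem x) (i : ℕ) :
    f.IsIntegralElem ((minpoly F x).coeff i) := by
  letI := f.toAlgebra
  obtain ⟨p, hp, hpx⟩ := hx
  have hd : minpoly F x ∣ p.map (algebraMap R F) := by
    apply minpoly.dvd
    rw [Polynomial.aeval_def, Polynomial.eval₂_map]; exact hpx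
  have hInteg : IsIntegral F x := ⟨p.map (algebraMap R F), hp.map _, by rw [Polynomial.eval₂_map]; exact hpx⟩
  have := integralClosure.mem_lifts_of_monic_of_dvd_map F hp (minpoly.monic hInteg) hd
  obtain ⟨q, hq⟩ := (Polynomial.lifts_iff_coeff_lifts _).1 this i
  rw [← hq]
  exact q.2
end Gen

variable {k L : Type*} [Field k] [Field L] [Algebra k L]

variable (k) in
/-- integral over `k[ρ]` -/
def IP (ρ x : L) : Prop := (Polynomial.aeval ρ : k[X] →ₐ[k] L).toRingHom.IsIntegralElem x

variable (k) in
/-- locally integral at infinity -/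
def EI (ρ x : L) : Prop := ∃ q : k[X], q.coeff 0 ≠ 0 ∧ IP k ρ⁻¹ (Polynomial.aeval ρ⁻¹ q * x)

variable (k) in
def BB (ρ : L) (n : ℕ) (x : L) : Prop := IP k ρ x ∧ EI k ρ (x / ρ ^ n)

theorem IP.add {ρ x y : L} (hx : IP k ρ x) (hy : IP k ρ y) : IP k ρ (x + y) :=
  RingHom.IsIntegralElem.add _ hx hy
theorem IP.sub {ρ x y : L} (hx : IP k ρ x) (hy : IP k ρ y) : IP k ρ (x - y) :=
  RingHom.IsIntegralElem.sub _ hx hy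
theorem IP.mul {ρ x y : L} (hx : IP k ρ x) (hy : IP k ρ y) : IP k ρ (x * y) :=
  RingHom.IsIntegralElem.mul _ hx hy
theorem IP.pol (ρ : L) (p : k[X]) : IP k ρ (Polynomial.aeval ρ p) :=
  RingHom.isIntegralElem_map (f := (Polynomial.aeval ρ : k[X] →ₐ[k] L).toRingHom)
theorem IP.sum {ι : Type*} {ρ : L} (s : Finset ι) (f : ι → L) (h : ∀ i ∈ s, IP k ρ (f i)) :
    IP k ρ (∑ i ∈ s, f i) := by
  classical
  induction s using Finset.induction_on with
  | empty => simpa using IP.pol ρ (0 : k[X])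
  | insert a s ha ih =>
    rw [Finset.sum_insert ha]
    exact (h a (by simp)).add (ih fun i hi => h i (by simp [hi]))

theorem EI.of_IP {ρ x : L} (h : IP k ρ⁻¹ x) : EI k ρ x := ⟨1, by simp, by simpa using h⟩
theorem EI.add {ρ x y : L} (hx : EI k ρ x) (hy : EI k ρ y) : EI k ρ (x + y) := by
  obtain ⟨p, hp, hx⟩ := hx
  obtain ⟨q, hq, hy⟩ := hy
  refine ⟨p * q, by simp [Polynomial.mul_coeff_zero, hp, hq], ?_⟩
  have := ((IP.pol ρ⁻¹ q).mul hx).add ((IP.pol ρ⁻¹ p).mul hy)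
  convert this using 1
  simp; ring
theorem EI.mul {ρ x y : L} (hx : EI k ρ x) (hy : EI k ρ y) : EI k ρ (x * y) := by
  obtain ⟨p, hp, hx⟩ := hx
  obtain ⟨q, hq, hy⟩ := hy
  refine ⟨p * q, by simp [Polynomial.mul_coeff_zero, hp, hq], ?_⟩
  have := hx.mul hy
  convert this using 1
  simp; ring
theorem EI.sum {ι : Type*} {ρ : L} (s : Finset ι) (f : ι → L) (h : ∀ i ∈ s, EI k ρ (f i)) :
    EI k ρ (∑ i ∈ s, f i) := by
  classical
  induction s using Finset.induction_on with
  | empty => simpa using EI.of_IP (IP.pol ρ⁻¹ (0 : k[X]))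
  | insert a s ha ih =>
    rw [Finset.sum_insert ha]
    exact (h a (by simp)).add (ih fun i hi => h i (by simp [hi]))
theorem EI.const (ρ : L) (a : k) : EI k ρ (algebraMap k L a) := by
  refine EI.of_IP ?_
  simpa using IP.pol ρ⁻¹ (Polynomial.C a)
theorem EI.ipow (ρ : L) (n : ℕ) : EI k ρ (ρ⁻¹ ^ n) := by
  refine EI.of_IP ?_
  simpa using IP.pol ρ⁻¹ (Polynomial.X ^ n : k[X])
theorem EI.neg {ρ x : L} (hx : EI k ρ x) : EI k ρ (-x) := by
  have := (EI.const ρ (-1 : k)).mul hx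
  simpa using this
theorem EI.sub {ρ x y : L} (hx : EI k ρ x) (hy : EI k ρ y) : EI k ρ (x - y) := by
  rw [sub_eq_add_neg]; exact hx.add hy.neg
theorem EI.mono {ρ x : L} (h0 : ρ ≠ 0) {m n : ℕ} (hmn : m ≤ n) (hx : EI k ρ (x / ρ ^ m)) :
    EI k ρ (x / ρ ^ n) := by
  have := hx.mul (EI.ipow (k := k) ρ (n - m))
  convert this using 1
  obtain ⟨j, rfl⟩ := Nat.exists_eq_add_of_le hmn
  rw [Nat.add_sub_cancel_left, inv_pow]
  field_simp
  ring
/-- polynomial of degree `≤ n` over `ρ^n` -/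
theorem EI.poly {ρ : L} (h0 : ρ ≠ 0) (f : k[X]) (n : ℕ) (hn : f.natDegree ≤ n) :
    EI k ρ (Polynomial.aeval ρ f / ρ ^ n) := by
  rw [Polynomial.aeval_eq_sum_range, Finset.sum_div]
  refine EI.sum _ _ fun i hi => ?_
  rw [Algebra.smul_def, mul_div_assoc]
  refine (EI.const ρ _).mul ?_
  have hi' : i ≤ n := by simp at hi; omega
  have := EI.mono (k := k) (x := ρ ^ i) h0 hi' (by
    rw [div_self (pow_ne_zero _ h0)]; simpa using EI.const ρ (1:k))
  exact this
theorem BB.mono {ρ x : L} (h0 : ρ ≠ 0) {m n : ℕ} (hmn : m ≤ n) (hx : BB k ρ m x) : BB k ρ n x :=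
  ⟨hx.1, hx.2.mono h0 hmn⟩
theorem BB.mul {ρ x y : L} {m n : ℕ} (hx : BB k ρ m x) (hy : BB k ρ n y) : BB k ρ (m + n) (x * y) := by
  refine ⟨hx.1.mul hy.1, ?_⟩
  have := hx.2.mul hy.2
  rwa [div_mul_div_comm, ← pow_add] at this
theorem BB.add {ρ x y : L} {n : ℕ} (hx : BB k ρ n x) (hy : BB k ρ n y) : BB k ρ n (x + y) := by
  refine ⟨hx.1.add hy.1, ?_⟩
  rw [add_div]; exact hx.2.add hy.2
theorem BB.const (ρ : L) (a : k) : BB k ρ 0 (algebraMap k L a) := by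
  refine ⟨by simpa using IP.pol ρ (Polynomial.C a), ?_⟩
  simpa using EI.const ρ a

theorem ne_zero_of_tr {ρ : L} (h : Transcendental k ρ) : ρ ≠ 0 := by
  rintro rfl; exact h isAlgebraic_zero
theorem tr_inj {ρ : L} (h : Transcendental k ρ) :
    Function.Injective (Polynomial.aeval ρ : k[X] →ₐ[k] L).toRingHom :=
  transcendental_iff_injective.1 h
theorem tr_inv {ρ : L} (h : Transcendental k ρ) : Transcendental k ρ⁻¹ := by
  intro h'; exact h (by simpa using h'.inv)

/-- reverse trick -/
theorem aeval_reverse {ρ : L} (h0 : ρ ≠ 0) (p : k[X]) :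
    Polynomial.aeval ρ⁻¹ p.reverse * ρ ^ p.natDegree = Polynomial.aeval ρ p := by
  letI := invertibleOfNonzero h0
  have := Polynomial.eval₂_reverse_mul_pow (algebraMap k L) ρ p
  rwa [invOf_eq_inv] at this

theorem coeff_integral' {R F L : Type*} [CommRing R] [Field F] [Field L] [Algebra F L]
    (f : R →+* F) (x : L) (hi : IsIntegral F x) (a : F) (ha : a ≠ 0)
    (hx : ((algebraMap F L).comp f).IsIntegralElem (algebraMap F L a * x)) (i : ℕ) :
    f.IsIntegralElem ((minpoly F x).coeff i * a ^ ((minpoly F x).natDegree - i)) := by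
  letI := f.toAlgebra
  obtain ⟨p, hp, hpx⟩ := hx
  have hd : minpoly F x ∣ (p.map (algebraMap R F)).scaleRoots a⁻¹ := by
    apply minpoly.dvd
    have := Polynomial.scaleRoots_aeval_eq_zero (p := p.map (algebraMap R F)) (a := algebraMap F L a * x) (r := a⁻¹) (by
      rw [Polynomial.aeval_def, Polynomial.eval₂_map]; exact hpx)
    rw [map_inv₀, inv_mul_cancel_left₀] at this
    · exact this
    · simpa using ha
  have hd2 : (minpoly F x).scaleRoots a ∣ p.map (algebraMap R F) := by
    have := (Polynomial.scaleRoots_dvd_iff _ _ (isUnit_iff_ne_zero.2 ha)).2 hd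
    rwa [← Polynomial.scaleRoots_mul, inv_mul_cancel₀ ha, Polynomial.scaleRoots_one] at this
  have := integralClosure.mem_lifts_of_monic_of_dvd_map F hp
    ((Polynomial.monic_scaleRoots_iff a).2 (minpoly.monic hi)) hd2
  obtain ⟨q, hq⟩ := (Polynomial.lifts_iff_coeff_lifts _).1 this i
  rw [Polynomial.coeff_scaleRoots] at hq
  rw [← hq]
  exact q.2

theorem B0_alg {ρ x : L} (hρ : Transcendental k ρ) (hx : BB k ρ 0 x) : IsIntegral k x := by
  obtain ⟨h1, q, hq, h2⟩ := hx
  have h0 := ne_zero_of_tr hρ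
  rw [pow_zero, div_one] at h2
  set F := IntermediateField.adjoin k {ρ} with hF
  let g : F := IntermediateField.AdjoinSimple.gen k ρ
  have hgρ : algebraMap F L g = ρ := IntermediateField.AdjoinSimple.algebraMap_gen k ρ
  let f1 : k[X] →+* F := (Polynomial.aeval g : k[X] →ₐ[k] F).toRingHom
  let f2 : k[X] →+* F := (Polynomial.aeval g⁻¹ : k[X] →ₐ[k] F).toRingHom
  have e1 : (algebraMap F L).comp f1 = (Polynomial.aeval ρ : k[X] →ₐ[k] L).toRingHom := by
    ext a
    · simp [f1]
    · simp [f1, hgρ]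
  have e2 : (algebraMap F L).comp f2 = (Polynomial.aeval ρ⁻¹ : k[X] →ₐ[k] L).toRingHom := by
    ext a
    · simp [f2]
    · simp [f2, hgρ]
  have i1 : ((algebraMap F L).comp f1).IsIntegralElem x := by rw [e1]; exact h1
  have hInteg : IsIntegral F x := by
    have := RingHom.IsIntegralElem.of_comp i1
    exact this
  have e2a : ∀ p, algebraMap F L (f2 p) = Polynomial.aeval ρ⁻¹ p := fun p => RingHom.congr_fun e2 p
  have e1a : ∀ p, algebraMap F L (f1 p) = Polynomial.aeval ρ p := fun p => RingHom.congr_fun e1 p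
  have inj1 : Function.Injective f1 := by
    have := tr_inj hρ
    rw [← e1] at this
    exact Function.Injective.of_comp (f := algebraMap F L) this
  have inj2 : Function.Injective f2 := by
    have := tr_inj (tr_inv hρ)
    rw [← e2] at this
    exact Function.Injective.of_comp (f := algebraMap F L) this
  have hq0 : q ≠ 0 := by rintro rfl; simp at hq
  have i2 : ((algebraMap F L).comp f2).IsIntegralElem (algebraMap F L (f2 q) * x) := by
    rw [e2a, e2]; exact h2
  have hfq : f2 q ≠ 0 := (map_ne_zero_iff f2 inj2).2 hq0
  -- every element of F is a quotient
  have quo : ∀ (u : F), ∃ a b : k[X], b ≠ 0 ∧ f1 b * u = f1 a := by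
    intro u
    obtain ⟨a, b, hab⟩ := (IntermediateField.mem_adjoin_simple_iff k (u : L)).1 u.2
    by_cases hb : b = 0
    · refine ⟨0, 1, one_ne_zero, ?_⟩
      have : (u : L) = 0 := by rw [hab, hb]; simp
      have : u = 0 := by exact_mod_cast this
      simp [this]
    · refine ⟨a, b, hb, ?_⟩
      apply (algebraMap F L).injective
      have hb' : Polynomial.aeval ρ b ≠ 0 := by
        intro h; exact hb (tr_inj hρ (by simpa using h))
      rw [map_mul, e1a, e1a]
      change _ * (u : L) = _
      rw [hab]; field_simp
  have quo2 : ∀ (u : F), ∃ a b : k[X], b ≠ 0 ∧ f2 b * u = f2 a := by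
    intro u
    obtain ⟨a, b, hb, h⟩ := quo u
    refine ⟨a.reverse * Polynomial.X ^ b.natDegree, b.reverse * Polynomial.X ^ a.natDegree, by simpa using hb, ?_⟩
    apply (algebraMap F L).injective
    have h' := congrArg (algebraMap F L) h
    rw [map_mul, e1a, e1a, ← aeval_reverse h0, ← aeval_reverse h0] at h'
    rw [map_mul, e2a, e2a]
    simp only [map_mul, map_pow, Polynomial.aeval_X]
    have ia : ρ⁻¹ ^ a.natDegree * ρ ^ a.natDegree = 1 := by rw [← mul_pow, inv_mul_cancel₀ h0, one_pow]
    have ib : ρ⁻¹ ^ b.natDegree * ρ ^ b.natDegree = 1 := by rw [← mul_pow, inv_mul_cancel₀ h0, one_pow]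
    linear_combination ρ⁻¹ ^ a.natDegree * ρ⁻¹ ^ b.natDegree * h' + (Polynomial.aeval ρ⁻¹ a.reverse * ρ⁻¹ ^ b.natDegree) * ia - (Polynomial.aeval ρ⁻¹ b.reverse * ρ⁻¹ ^ a.natDegree * algebraMap F L u) * ib
  -- coefficients are constants
  have key : ∀ i, ∃ a : k, (minpoly F x).coeff i = algebraMap k F a := by
    intro i
    have j1 := coeff_integral f1 x i1 i
    have j2 := coeff_integral' f2 x hInteg (f2 q) hfq i2 i
    obtain ⟨a, b, hb, h⟩ := quo ((minpoly F x).coeff i)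
    obtain ⟨P, hP⟩ := intclosed_mem f1 inj1 a b hb _ h j1
    obtain ⟨a', b', hb', h'⟩ := quo2 ((minpoly F x).coeff i * f2 q ^ ((minpoly F x).natDegree - i))
    obtain ⟨D, hD⟩ := intclosed_mem f2 inj2 a' b' hb' _ h' j2
    rw [← hP] at hD
    by_cases hP0 : P = 0
    · exact ⟨0, by rw [← hP, hP0]; simp⟩
    have hdeg : P.natDegree = 0 := by
      by_contra hne
      have h3 : D * Polynomial.X ^ P.natDegree = P.reverse * q ^ ((minpoly F x).natDegree - i) := by
        apply inj2
        apply (algebraMap F L).injective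
        have h' := congrArg (algebraMap F L) hD
        rw [map_mul, e1a, map_pow, e2a, e2a, ← aeval_reverse h0] at h'
        rw [e2a, e2a, map_mul, map_mul, h']
        simp only [map_mul, map_pow, Polynomial.aeval_X]
        have ia : ρ⁻¹ ^ P.natDegree * ρ ^ P.natDegree = 1 := by rw [← mul_pow, inv_mul_cancel₀ h0, one_pow]
        linear_combination (Polynomial.aeval ρ⁻¹ P.reverse * Polynomial.aeval ρ⁻¹ q ^ ((minpoly F x).natDegree - i)) * ia
      have h4 := congrArg (fun p => p.coeff 0) h3
      simp only [Polynomial.mul_coeff_zero, Polynomial.coeff_X_pow, Polynomial.coeff_zero_reverse] at h4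
      rw [if_neg (Ne.symm hne), mul_zero] at h4
      rw [Polynomial.coeff_zero_eq_eval_zero, Polynomial.eval_pow, ← Polynomial.coeff_zero_eq_eval_zero] at h4
      exact mul_ne_zero (by simpa using hP0) (pow_ne_zero _ hq) h4.symm
    rw [Polynomial.eq_C_of_natDegree_eq_zero hdeg] at hP
    refine ⟨P.coeff 0, ?_⟩
    rw [← hP]
    simp [f1]
  choose a ha using key
  have hlift : minpoly F x ∈ Polynomial.lifts (algebraMap k F) := by
    rw [Polynomial.lifts_iff_coeff_lifts]
    intro i; exact ⟨a i, (ha i).symm⟩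
  obtain ⟨m, hm1, _, hm2⟩ := Polynomial.lifts_and_natDegree_eq_and_monic hlift (minpoly.monic hInteg)
  refine ⟨m, hm2, ?_⟩
  have := minpoly.aeval F x
  rw [← hm1, Polynomial.aeval_map_algebraMap] at this
  exact this
end DP
end

noncomputable section
namespace DP
set_option linter.all false
open scoped Polynomial
open MvPolynomial
variable {k L : Type*} [Field k] [Field L] [Algebra k L]

theorem IP.const (ρ : L) (a : k) : IP k ρ (algebraMap k L a) := by simpa using IP.pol ρ (Polynomial.C a)
theorem IP.rpow (ρ : L) (n : ℕ) : IP k ρ (ρ ^ n) := by simpa using IP.pol ρ (Polynomial.X ^ n : k[X])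

theorem ls_deg {ι : Type*} [Fintype ι] {ρ : L} (hρ : Transcendental k ρ) (u : ι → L) (n : ι → ℕ)
    (b : ℕ) (hb : 1 ≤ b) (hn : ∀ i, n i ≤ b) (hu : ∀ i, BB k ρ (n i) (u i))
    (star : ∀ a : ι → k, BB k ρ (b-1) (∑ i, algebraMap k L (a i) * ρ^(b - n i) * u i) → a = 0)
    (f : ι → k[X]) (N : ℕ) (hx : EI k ρ ((∑ i, Polynomial.aeval ρ (f i) * u i) / ρ ^ N)) (i : ι) (j : ℕ)
    (hj : N < j + n i) : (f i).coeff j = 0 := by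
  have h0 := ne_zero_of_tr hρ
  have step : ∀ m, N < m → (∀ i j, m < j + n i → (f i).coeff j = 0) →
      (∀ i j, m ≤ j + n i → (f i).coeff j = 0) := by
    intro m hm hh
    let a : ι → k := fun i => if n i ≤ m then (f i).coeff (m - n i) else 0
    let g : ι → k[X] := fun i => f i - Polynomial.C (a i) * Polynomial.X ^ (m - n i)
    have hg : ∀ i j, m ≤ j + n i → (g i).coeff j = 0 := by
      intro i j hj
      simp only [g, Polynomial.coeff_sub, Polynomial.coeff_C_mul, Polynomial.coeff_X_pow]
      rcases hj.eq_or_lt with h | h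
      · have h1 : n i ≤ m := by omega
        have h2 : j = m - n i := by omega
        simp [a, h1, h2]
      · rw [hh i j h]
        by_cases h1 : n i ≤ m
        · rw [if_neg (by omega)]; simp
        · simp [a, h1]
    have hlow : EI k ρ ((∑ i, Polynomial.aeval ρ (g i) * u i) / ρ ^ (m-1)) := by
      rw [Finset.sum_div]
      refine EI.sum _ _ fun i _ => ?_
      by_cases h : g i = 0
      · rw [h]; simpa using EI.const ρ (0 : k)
      have hd : (g i).natDegree + n i ≤ m - 1 := by
        by_contra hc
        exact h (Polynomial.leadingCoeff_eq_zero.1 (hg i _ (by omega)))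
      refine EI.mono h0 hd ?_
      rw [pow_add, ← div_mul_div_comm]
      exact (EI.poly h0 _ _ le_rfl).mul (hu i).2
    have hx' := (EI.mono h0 (show N ≤ m - 1 by omega) hx).sub hlow
    have ha : a = 0 := by
      apply star
      refine ⟨IP.sum _ _ fun i _ => ((IP.const ρ _).mul (IP.rpow ρ _)).mul (hu i).1, ?_⟩
      convert hx' using 1
      rw [← sub_div, ← Finset.sum_sub_distrib, Finset.sum_div, Finset.sum_div]
      refine Finset.sum_congr rfl fun i _ => ?_
      rw [← sub_mul, ← map_sub]
      simp only [g, sub_sub_cancel, map_mul, Polynomial.aeval_C, map_pow, Polynomial.aeval_X]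
      by_cases h1 : n i ≤ m
      · have : ρ ^ (b - n i) * ρ ^ (m - 1) = ρ ^ (m - n i) * ρ ^ (b - 1) := by
          rw [← pow_add, ← pow_add]; congr 1; have := hn i; omega
        rw [div_eq_div_iff (pow_ne_zero _ h0) (pow_ne_zero _ h0)]
        linear_combination (algebraMap k L (a i) * u i) * this
      · simp [a, h1]
    intro i j hj
    rcases hj.eq_or_lt with h | h
    · have h1 : n i ≤ m := by omega
      have h2 : j = m - n i := by omega
      have := congrFun ha i
      simpa [a, h1, ← h2] using this
    · exact hh i j h
  have big : ∀ t, ∀ m, N + t = m → (∀ i j, m < j + n i → (f i).coeff j = 0) →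
      (∀ i j, N < j + n i → (f i).coeff j = 0) := by
    intro t
    induction t with
    | zero => intro m hm h; obtain rfl : N = m := by omega
              exact h
    | succ t ih =>
      intro m hm h
      refine ih (N + t) rfl ?_
      intro i j hj
      exact step m (by omega) h i j (by omega)
  let M := ∑ i, ((f i).natDegree + n i)
  refine big M (N + M) rfl ?_ i j hj
  intro i j h
  apply Polynomial.coeff_eq_zero_of_natDegree_lt
  have : (f i).natDegree + n i ≤ M :=
    Finset.single_le_sum (f := fun i => (f i).natDegree + n i) (fun _ _ => Nat.zero_le _) (Finset.mem_univ i)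
  omega

theorem EI.inv_poly {ρ : L} (h0 : ρ ≠ 0) (Q : k[X]) (hQ : Polynomial.aeval ρ Q ≠ 0) :
    EI k ρ (ρ ^ Q.natDegree / Polynomial.aeval ρ Q) := by
  have hQ0 : Q ≠ 0 := by rintro rfl; simp at hQ
  refine ⟨Q.reverse, by simpa using hQ0, ?_⟩
  rw [← aeval_reverse h0] at hQ ⊢
  have h1 : Polynomial.aeval ρ⁻¹ Q.reverse ≠ 0 := left_ne_zero_of_mul hQ
  have h2 := pow_ne_zero Q.natDegree h0
  have : Polynomial.aeval ρ⁻¹ Q.reverse * (ρ ^ Q.natDegree / (Polynomial.aeval ρ⁻¹ Q.reverse * ρ ^ Q.natDegree)) = 1 := by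
    rw [← mul_div_assoc, div_self hQ]
  rw [this]; simpa using IP.pol ρ⁻¹ (1 : k[X])

theorem ls_int {ι : Type*} [Fintype ι] {ρ : L} (hρ : Transcendental k ρ) (u : ι → L) (n : ι → ℕ)
    (b : ℕ) (hb : 1 ≤ b) (hn : ∀ i, n i ≤ b) (hu : ∀ i, BB k ρ (n i) (u i))
    (dstar : ∀ x, BB k ρ (b-1) x → ∃ f : ι → k[X], x = ∑ i, Polynomial.aeval ρ (f i) * u i)
    (Q : k[X]) (hQ : Q ≠ 0) (x : L) (hx : IP k ρ x) (f : ι → k[X])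
    (h : Polynomial.aeval ρ Q * x = ∑ i, Polynomial.aeval ρ (f i) * u i) : ∃ f : ι → k[X], x = ∑ i, Polynomial.aeval ρ (f i) * u i := by
  have h0 := ne_zero_of_tr hρ
  have hQ' : Polynomial.aeval ρ Q ≠ 0 := fun h => hQ (tr_inj hρ (by simpa using h))
  let x' := x - ∑ i, Polynomial.aeval ρ (f i / Q) * u i
  have hx' : BB k ρ (b-1) x' := by
    refine ⟨hx.sub (IP.sum _ _ fun i _ => (IP.pol ρ _).mul (hu i).1), ?_⟩
    have e : Polynomial.aeval ρ Q * x' = ∑ i, Polynomial.aeval ρ (f i % Q) * u i := by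
      simp only [x', mul_sub, h, Finset.mul_sum, ← Finset.sum_sub_distrib]
      refine Finset.sum_congr rfl fun i _ => ?_
      have : f i % Q = f i - Q * (f i / Q) := by
        rw [eq_sub_iff_add_eq]; exact EuclideanDomain.mod_add_div _ _
      rw [this]; simp; ring
    have e2 : x' / ρ ^ (b-1) = (ρ ^ Q.natDegree / Polynomial.aeval ρ Q) *
        ∑ i, (Polynomial.aeval ρ (f i % Q) * u i) / ρ ^ (Q.natDegree + (b - 1)) := by
      rw [← Finset.sum_div, ← e, pow_add]; field_simp
    rw [e2]
    refine (EI.inv_poly h0 Q hQ').mul (EI.sum _ _ fun i _ => ?_)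
    by_cases h : f i % Q = 0
    · rw [h]; simpa using EI.const ρ (0 : k)
    have hd : (f i % Q).natDegree < Q.natDegree :=
      Polynomial.natDegree_lt_natDegree h (EuclideanDomain.mod_lt _ hQ)
    refine EI.mono h0 (show (f i % Q).natDegree + n i ≤ _ by have := hn i; omega) ?_
    rw [pow_add, ← div_mul_div_comm]
    exact (EI.poly h0 _ _ le_rfl).mul (hu i).2
  obtain ⟨g, hg⟩ := dstar x' hx'
  refine ⟨fun i => g i + f i / Q, ?_⟩
  simp only [map_add, add_mul, Finset.sum_add_distrib, ← hg]
  simp [x']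
end DP
end

noncomputable section
namespace DP
set_option linter.all false
open MvPolynomial

section
variable {K L ι : Type*} [Field K] [Field L] [Algebra K L] [Fintype ι] [DecidableEq ι]

/-- field generated by all `y i`, `i ≠ e`. -/
abbrev ke (K : Type*) {L ι : Type*} [Field K] [Field L] [Algebra K L] (y : ι → L) (e : ι) : IntermediateField K L :=
  IntermediateField.adjoin K (Set.range fun i : {i // i ≠ e} => y i)

theorem degreeOf_eq_zero_iff {σ : Type*} {R : Type*} [CommRing R] (e : σ) (P : MvPolynomial σ R) :
    degreeOf e P = 0 ↔ ∀ m ∈ P.support, m e = 0 := by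
  rw [← Nat.le_zero, degreeOf_le_iff]; simp

theorem monic_mk {R : Type*} [CommRing R] (n : ℕ) (g : ℕ → R) :
    (Polynomial.X ^ n + ∑ i ∈ Finset.range n, Polynomial.C (g i) * Polynomial.X ^ i : Polynomial R).Monic := by
  apply Polynomial.monic_X_pow_add
  refine (Polynomial.degree_sum_le _ _).trans_lt ?_
  refine (Finset.sup_lt_iff (WithBot.bot_lt_coe n)).2 ?_
  intro i hi
  refine (Polynomial.degree_C_mul_X_pow_le _ _).trans_lt ?_
  exact WithBot.coe_lt_coe.2 (Finset.mem_range.1 hi)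

theorem degreeOf_rename_ne (e : ι) (P : MvPolynomial {i // i ≠ e} K) :
    degreeOf e (rename Subtype.val P) = 0 := by
  by_contra h
  have h1 : e ∈ (rename (Subtype.val : {i // i ≠ e} → ι) P).vars := by
    rw [degreeOf_eq_zero_iff] at h
    push_neg at h
    obtain ⟨m, hm, hme⟩ := h
    exact (mem_vars e).2 ⟨m, hm, by simpa using hme⟩
  have h2 := vars_rename (Subtype.val : {i // i ≠ e} → ι) P h1
  simp at h2

theorem clear_ke1 {y : ι → L} (hy : AlgebraicIndependent K y) (e : ι) (v : L) (hv : v ∈ ke K y e) :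
    ∃ M N : MvPolynomial ι K, M ≠ 0 ∧ degreeOf e M = 0 ∧ degreeOf e N = 0 ∧ aeval y M * v = aeval y N := by
  rw [IntermediateField.mem_adjoin_range_iff] at hv
  obtain ⟨r, s, rfl⟩ := hv
  have h : ∀ p : MvPolynomial {i // i ≠ e} K, aeval (fun i : {i // i ≠ e} => y i) p = aeval y (rename Subtype.val p) := by
    intro p; rw [aeval_rename]; rfl
  by_cases hs : s = 0
  · subst hs
    refine ⟨1, 0, one_ne_zero, by simp, by simp, by simp⟩
  · have h1 : rename (Subtype.val : {i // i ≠ e} → ι) s ≠ 0 := by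
      intro h0; exact hs (rename_injective _ Subtype.val_injective (by simpa using h0))
    refine ⟨rename Subtype.val s, rename Subtype.val r, h1, degreeOf_rename_ne e s, degreeOf_rename_ne e r, ?_⟩
    rw [h, h]
    refine mul_div_cancel₀ _ ?_
    intro h0
    exact h1 ((map_eq_zero_iff (aeval y) hy).1 h0)

theorem degreeOf_zero_mul {e : ι} {P Q : MvPolynomial ι K} (hP : degreeOf e P = 0) (hQ : degreeOf e Q = 0) :
    degreeOf e (P * Q) = 0 := by
  have := degreeOf_mul_le e P Q; omega
theorem degreeOf_zero_prod {e : ι} {o : Type*} (s : Finset o) (P : o → MvPolynomial ι K)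
    (hP : ∀ i ∈ s, degreeOf e (P i) = 0) : degreeOf e (∏ i ∈ s, P i) = 0 := by
  classical
  induction s using Finset.induction_on with
  | empty => simp
  | insert a s ha ih =>
    rw [Finset.prod_insert ha]
    exact degreeOf_zero_mul (hP a (by simp)) (ih fun i hi => hP i (by simp [hi]))

theorem clear_ke {y : ι → L} (hy : AlgebraicIndependent K y) (e : ι) {o : Type*} [Fintype o] (v : o → L)
    (hv : ∀ i, v i ∈ ke K y e) :
    ∃ (M : MvPolynomial ι K) (N : o → MvPolynomial ι K), M ≠ 0 ∧ degreeOf e M = 0 ∧ (∀ i, degreeOf e (N i) = 0) ∧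
      ∀ i, aeval y M * v i = aeval y (N i) := by
  classical
  choose M N hM hM0 hN0 h using fun i => clear_ke1 hy e (v i) (hv i)
  refine ⟨∏ i, M i, fun i => (∏ j ∈ Finset.univ.erase i, M j) * N i, ?_, ?_, ?_, ?_⟩
  · exact Finset.prod_ne_zero_iff.2 fun i _ => hM i
  · exact degreeOf_zero_prod _ _ fun i _ => hM0 i
  · intro i; exact degreeOf_zero_mul (degreeOf_zero_prod _ _ fun j _ => hM0 j) (hN0 i)
  · intro i
    rw [map_mul, ← h i, ← mul_assoc, ← map_mul, Finset.prod_erase_mul _ _ (Finset.mem_univ i)]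

theorem clear_poly {y : ι → L} (hy : AlgebraicIndependent K y) (e : ι) {o : Type*} [Fintype o]
    (f : o → Polynomial (ke K y e)) :
    ∃ (M : MvPolynomial ι K) (N : o → MvPolynomial ι K), M ≠ 0 ∧ degreeOf e M = 0 ∧
      (∀ i, degreeOf e (N i) ≤ (f i).natDegree) ∧
      ∀ i, aeval y M * Polynomial.aeval (y e) (f i) = aeval y (N i) := by
  classical
  obtain ⟨M, N, hM, hM0, hN0, h⟩ := clear_ke hy e
    (o := o × Fin (Finset.univ.sup (fun i => (f i).natDegree) + 1))
    (fun p => ((f p.1).coeff p.2 : L)) (fun p => ((f p.1).coeff p.2).2)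
  have hb : ∀ i, (f i).natDegree ≤ Finset.univ.sup (fun i => (f i).natDegree) :=
    fun i => Finset.le_sup (f := fun i => (f i).natDegree) (Finset.mem_univ i)
  refine ⟨M, fun i => ∑ j : Fin ((f i).natDegree + 1), N (i, ⟨j, by have := hb i; omega⟩) * X e ^ (j:ℕ), hM, hM0, ?_, ?_⟩
  · intro i
    refine (degreeOf_sum_le _ _ _).trans (Finset.sup_le fun j _ => ?_)
    refine (degreeOf_mul_le _ _ _).trans ?_
    rw [hN0, zero_add]
    refine (degreeOf_pow_le _ _ _).trans ?_
    have := j.2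
    rw [degreeOf_X, if_pos rfl]; omega
  · intro i
    rw [Polynomial.aeval_eq_sum_range, Finset.mul_sum, map_sum, Finset.sum_range]
    refine Finset.sum_congr rfl fun j _ => ?_
    have := h (i, ⟨j, by have := hb i; omega⟩)
    simp only at this
    rw [map_mul, ← this, map_pow, aeval_X, Algebra.smul_def]
    rw [mul_assoc]; rfl

theorem ke_mem (y : ι → L) {e i : ι} (h : i ≠ e) : y i ∈ ke K y e :=
  IntermediateField.subset_adjoin _ _ ⟨⟨i, h⟩, rfl⟩

/-- the expansion of a polynomial w.r.t. the variable `e` -/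
def phi (K : Type*) {L ι : Type*} [Field K] [Field L] [Algebra K L] [Fintype ι] [DecidableEq ι]
   (y : ι → L) (e : ι) : MvPolynomial ι K →ₐ[K] Polynomial (ke K y e) :=
  aeval fun i => if h : i = e then Polynomial.X else Polynomial.C ⟨y i, ke_mem y h⟩

theorem phi_aeval (y : ι → L) (e : ι) (P : MvPolynomial ι K) :
    Polynomial.aeval (y e) (phi K y e P) = aeval y P := by
  have : ((Polynomial.aeval (y e) : Polynomial (ke K y e) →ₐ[ke K y e] L).restrictScalars K).comp (phi K y e) = aeval y := by
    apply algHom_ext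
    intro i
    simp only [AlgHom.comp_apply, phi, aeval_X]
    split_ifs with h
    · subst h; simp
    · simp
  exact DFunLike.congr_fun this P

theorem tr_ke {y : ι → L} (hy : AlgebraicIndependent K y) (e : ι) : Transcendental (ke K y e) (y e) := by
  rw [transcendental_iff]
  intro f hf
  -- clear denominators coefficientwise
  obtain ⟨M, N, hM, hM0, hN0, h⟩ := clear_ke hy e (o := Fin (f.natDegree + 1)) (fun p => (f.coeff p : L)) (fun p => (f.coeff p).2)
  have h1 : ∑ j : Fin (f.natDegree + 1), N j * X e ^ (j:ℕ) = 0 := by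
    apply (map_eq_zero_iff (aeval y) hy).1
    rw [Polynomial.aeval_eq_sum_range, Finset.sum_range] at hf
    have := congrArg (fun t => aeval y M * t) hf
    simp only [mul_zero, Finset.mul_sum] at this
    rw [← this, map_sum]
    refine Finset.sum_congr rfl fun j _ => ?_
    rw [map_mul, ← h j, map_pow, aeval_X, Algebra.smul_def, mul_assoc]; rfl
  have h2 : ∀ j, N j = 0 := by
    intro j
    ext m
    rw [coeff_zero]
    by_cases hm : m e = 0
    · have h3 := congrArg (coeff (m + Finsupp.single e (j:ℕ))) h1
      rw [coeff_sum, coeff_zero, Finset.sum_eq_single j] at h3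
      · rw [X_pow_eq_monomial, coeff_mul_monomial] at h3
        simpa using h3
      · intro i _ hij
        rw [X_pow_eq_monomial, coeff_mul_monomial']
        split_ifs with hle
        · rw [mul_one]
          by_contra hc
          have h4 := (degreeOf_eq_zero_iff e (N i)).1 (hN0 i) _ (mem_support_iff.2 hc)
          have h5 := hle e
          simp at h4 h5
          apply hij; ext; omega
        · rfl
      · simp
    · by_contra hc
      exact hm ((degreeOf_eq_zero_iff e (N j)).1 (hN0 j) _ (mem_support_iff.2 hc))
  ext j
  by_cases hj : j < f.natDegree + 1
  · have := h ⟨j, hj⟩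
    rw [h2, map_zero, mul_eq_zero] at this
    rcases this with h0 | h0
    · exact absurd ((map_eq_zero_iff (aeval y) hy).1 h0) hM
    · simpa using h0
  · rw [Polynomial.coeff_eq_zero_of_natDegree_lt (by omega)]; simp

/-- integrality over `K[y]` -/
def Int (K : Type*) {L ι : Type*} [Field K] [Field L] [Algebra K L] (y : ι → L) (x : L) : Prop :=
  (aeval y : MvPolynomial ι K →ₐ[K] L).toRingHom.IsIntegralElem x

/-- homogeneous integral equation in degree one -/
def HI1 (K : Type*) {L ι : Type*} [Field K] [Field L] [Algebra K L] (y : ι → L) (x : L) : Prop :=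
  ∃ (n : ℕ) (c : ℕ → MvPolynomial ι K), (∀ i, (c i).IsHomogeneous i) ∧
    x ^ n + ∑ i ∈ Finset.range n, aeval y (c (n - i)) * x ^ i = 0

theorem Int.add {y : ι → L} {a b : L} (ha : Int K y a) (hb : Int K y b) : Int K y (a + b) :=
  RingHom.IsIntegralElem.add _ ha hb
theorem Int.sub {y : ι → L} {a b : L} (ha : Int K y a) (hb : Int K y b) : Int K y (a - b) :=
  RingHom.IsIntegralElem.sub _ ha hb
theorem Int.mul {y : ι → L} {a b : L} (ha : Int K y a) (hb : Int K y b) : Int K y (a * b) :=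
  RingHom.IsIntegralElem.mul _ ha hb
theorem Int.pol (y : ι → L) (P : MvPolynomial ι K) : Int K y (aeval y P) :=
  RingHom.isIntegralElem_map (f := (aeval y : MvPolynomial ι K →ₐ[K] L).toRingHom)
theorem Int.sum {o : Type*} {y : ι → L} (s : Finset o) (f : o → L) (h : ∀ i ∈ s, Int K y (f i)) :
    Int K y (∑ i ∈ s, f i) := by
  classical
  induction s using Finset.induction_on with
  | empty => simpa using Int.pol y (0 : MvPolynomial ι K)
  | insert a s ha ih =>
    rw [Finset.sum_insert ha]
    exact (h a (by simp)).add (ih fun i hi => h i (by simp [hi]))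

theorem Int.IP {y : ι → L} {x : L} (hx : Int K y x) (e : ι) : IP (ke K y e) (y e) x := by
  obtain ⟨p, hp, h⟩ := hx
  refine ⟨p.map (phi K y e).toRingHom, hp.map _, ?_⟩
  rw [Polynomial.eval₂_map]
  have : (Polynomial.aeval (y e) : Polynomial (ke K y e) →ₐ[ke K y e] L).toRingHom.comp (phi K y e).toRingHom
      = (aeval y : MvPolynomial ι K →ₐ[K] L).toRingHom := RingHom.ext fun P => phi_aeval y e P
  rw [this]; exact h

theorem pol_mem_of_deg0 (y : ι → L) (e : ι) (P : MvPolynomial ι K) (h : degreeOf e P = 0) : aeval y P ∈ ke K y e := by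
  rw [aeval_def, eval₂_eq]
  refine sum_mem fun m hm => mul_mem ?_ (prod_mem fun i hi => ?_)
  · exact (ke K y e).algebraMap_mem _
  · by_cases hie : i = e
    · subst hie
      rw [(degreeOf_eq_zero_iff i P).1 h m hm, pow_zero]; exact one_mem _
    · exact pow_mem (ke_mem y hie) _

/-- homogeneous polys scaled -/
theorem hom_IP (y : ι → L) (e : ι) (h0 : y e ≠ 0) (P : MvPolynomial ι K) (n : ℕ) (hP : P.IsHomogeneous n) :
    ∃ g : Polynomial (ke K y e), Polynomial.aeval (y e)⁻¹ g = aeval y P / y e ^ n := by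
  classical
  have : ∀ m ∈ P.support, ∃ g : Polynomial (ke K y e), Polynomial.aeval (y e)⁻¹ g = aeval y (monomial m (P.coeff m)) / y e ^ n := by
    intro m hm
    have hd : m.degree = n := by
      have := hP (mem_support_iff.1 hm)
      rw [Finsupp.degree_eq_weight_one]; exact this
    have hdd : degreeOf e (monomial (m.erase e) (P.coeff m) : MvPolynomial ι K) = 0 := by
      rw [degreeOf_eq_zero_iff]
      intro m' hm'
      have := support_monomial_subset hm'
      simp at this; subst this; simp
    refine ⟨Polynomial.C ⟨aeval y (monomial (m.erase e) (P.coeff m)), pol_mem_of_deg0 y e _ hdd⟩ * Polynomial.X ^ (n - m e), ?_⟩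
    · have hle : m e ≤ n := hd ▸ Finsupp.le_degree e m
      rw [map_mul, Polynomial.aeval_C, map_pow, Polynomial.aeval_X]
      change aeval y (monomial (m.erase e) (P.coeff m)) * _ = _
      have : (monomial m (P.coeff m) : MvPolynomial ι K) = monomial (m.erase e) (P.coeff m) * X e ^ (m e) := by
        rw [X_pow_eq_monomial, monomial_mul, mul_one, Finsupp.erase_add_single]
      rw [this, map_mul, map_pow, aeval_X, mul_div_assoc]
      congr 1
      rw [inv_pow, eq_div_iff (pow_ne_zero _ h0)]
      nth_rewrite 2 [← Nat.sub_add_cancel hle]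
      rw [pow_add, ← mul_assoc, inv_mul_cancel₀ (pow_ne_zero _ h0), one_mul]
  choose! g hg using this
  refine ⟨∑ m ∈ P.support, g m, ?_⟩
  rw [map_sum]
  conv_rhs => rw [as_sum P, map_sum, Finset.sum_div]
  exact Finset.sum_congr rfl hg

theorem HI1.Int {y : ι → L} {x : L} (hx : HI1 K y x) : Int K y x := by
  obtain ⟨n, c, hc, h⟩ := hx
  refine ⟨Polynomial.X ^ n + ∑ i ∈ Finset.range n, Polynomial.C (c (n - i)) * Polynomial.X ^ i, ?_, ?_⟩
  · exact monic_mk n (fun i => c (n - i))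
  · rw [Polynomial.eval₂_add, Polynomial.eval₂_finset_sum]
    simpa using h

theorem HI1.BB {y : ι → L} (hy : AlgebraicIndependent K y) {x : L} (hx : HI1 K y x) (e : ι) : BB (ke K y e) (y e) 1 x := by
  refine ⟨hx.Int.IP e, EI.of_IP ?_⟩
  have h0 : y e ≠ 0 := ne_zero_of_tr (tr_ke hy e)
  obtain ⟨n, c, hc, h⟩ := hx
  choose g hg using fun i => hom_IP y e h0 (c i) i (hc i)
  refine ⟨Polynomial.X ^ n + ∑ i ∈ Finset.range n, Polynomial.C (g (n - i)) * Polynomial.X ^ i, ?_, ?_⟩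
  · exact monic_mk n (fun i => g (n - i))
  · rw [Polynomial.eval₂_add, Polynomial.eval₂_finset_sum]
    simp only [Polynomial.eval₂_mul, Polynomial.eval₂_C, Polynomial.eval₂_pow, Polynomial.eval₂_X]
    have : ∀ i, (Polynomial.aeval (y e)⁻¹ : Polynomial (ke K y e) →ₐ[ke K y e] L).toRingHom (g i) = aeval y (c i) / y e ^ i := hg
    simp only [this, pow_one]
    have := congrArg (fun t => t / y e ^ n) h
    simp only [zero_div, add_div, Finset.sum_div] at this
    rw [← this]
    congr 1
    · rw [div_pow]
    · refine Finset.sum_congr rfl fun i hi => ?_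
      have hi := Finset.mem_range.1 hi
      rw [div_pow, div_mul_div_comm, ← pow_add, Nat.sub_add_cancel hi.le]

theorem int_F {y : ι → L} (hy : AlgebraicIndependent K y) {x : L} (hx : Int K y x) (D N : MvPolynomial ι K)
    (hD : D ≠ 0) (h : aeval y D * x = aeval y N) : ∃ P : MvPolynomial ι K, aeval y P = x := by
  exact
  intclosed_mem (aeval y : MvPolynomial ι K →ₐ[K] L).toRingHom hy N D hD x h hx

end
end DP
end

noncomputable section
namespace DP
set_option linter.all false
open scoped Polynomial
open MvPolynomial

section
variable {k L : Type*} [Field k] [Field L] [Algebra k L]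

theorem hensel_ps (g : (PowerSeries k)[X]) (hg : g.Monic) (ζ : k)
    (h1 : (g.map PowerSeries.constantCoeff).eval ζ = 0)
    (h2 : (g.map PowerSeries.constantCoeff).derivative.eval ζ ≠ 0) :
    ∃ a : PowerSeries k, g.eval a = 0 := by
  have H := IsAdicComplete.henselianRing (PowerSeries k) (Ideal.span {PowerSeries.X})
  have key : ∀ f : (PowerSeries k)[X], PowerSeries.constantCoeff (f.eval (PowerSeries.C ζ)) = (f.map PowerSeries.constantCoeff).eval ζ := by
    intro f
    rw [Polynomial.eval_map, ← Polynomial.eval₂_at_apply]; simp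
  obtain ⟨a, ha, -⟩ := H.is_henselian g hg (PowerSeries.C ζ) (by
    rw [Ideal.mem_span_singleton, PowerSeries.X_dvd_iff, key, h1]) (by
    apply IsUnit.map
    rw [PowerSeries.isUnit_iff_constantCoeff, key, ← Polynomial.derivative_map]
    exact isUnit_iff_ne_zero.2 h2)
  exact ⟨a, ha⟩

theorem AC_abs (t θ : L) (ht : Transcendental k t) (g : k[X][X]) (hg : g.Monic)
    (hroot : Polynomial.eval₂ (Polynomial.aeval t : k[X] →ₐ[k] L).toRingHom θ g = 0)
    (hind : ∀ P : k[X][X], P.degree < g.degree → Polynomial.eval₂ (Polynomial.aeval t : k[X] →ₐ[k] L).toRingHom θ P = 0 → P = 0)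
    (hgen : ∀ v : L, ∃ (D : k[X]) (P : k[X][X]), D ≠ 0 ∧ Polynomial.aeval t D * v = Polynomial.eval₂ (Polynomial.aeval t : k[X] →ₐ[k] L).toRingHom θ P)
    (ζ : k) (h1 : (g.map (Polynomial.evalRingHom 0)).eval ζ = 0)
    (h2 : (g.map (Polynomial.evalRingHom 0)).derivative.eval ζ ≠ 0) (v : L) (hv : IsIntegral k v) :
    v ∈ (algebraMap k L).range := by
  set σ : k[X] →+* PowerSeries k := Polynomial.coeToPowerSeries.ringHom with hσ
  have hcc : (PowerSeries.constantCoeff : PowerSeries k →+* k).comp σ = Polynomial.evalRingHom 0 := by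
    apply Polynomial.ringHom_ext <;> simp [σ]
  obtain ⟨a, ha⟩ := hensel_ps (g.map σ) (hg.map _) ζ (by rw [Polynomial.map_map, hcc]; exact h1)
    (by rw [Polynomial.map_map, hcc]; exact h2)
  set Φ : k[X][X] →+* L := Polynomial.eval₂RingHom (Polynomial.aeval t : k[X] →ₐ[k] L).toRingHom θ with hΦ
  set Ψ : k[X][X] →+* PowerSeries k := Polynomial.eval₂RingHom σ a with hΨ
  have hker : ∀ P, Φ P = 0 → Ψ P = 0 := by
    intro P hP
    have hm := Polynomial.modByMonic_add_div P g
    have hr : P %ₘ g = 0 := by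
      apply hind _ (Polynomial.degree_modByMonic_lt P hg)
      have : Φ (P %ₘ g) = 0 := by
        have := congrArg Φ hm
        rw [map_add, map_mul, hP] at this
        have hz : Φ g = 0 := hroot
        rwa [hz, zero_mul, add_zero] at this
      exact this
    rw [← hm, hr, zero_add, map_mul]
    have : Ψ g = 0 := by
      have : Polynomial.eval₂ σ a g = 0 := by rw [Polynomial.eval₂_eq_eval_map]; exact ha
      exact this
    rw [this, zero_mul]
  obtain ⟨D, P, hD, hDP⟩ := hgen v
  set μ := minpoly k v with hμ
  have hμm : μ.Monic := minpoly.monic hv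
  have hD' : Polynomial.aeval t D ≠ 0 := fun h => hD (transcendental_iff.1 ht D h)
  -- homogenization
  have hk : Φ.comp ((Polynomial.C : k[X] →+* k[X][X]).comp (Polynomial.C : k →+* k[X])) = algebraMap k L := by
    ext x; simp [Φ]
  have hk2 : Ψ.comp ((Polynomial.C : k[X] →+* k[X][X]).comp (Polynomial.C : k →+* k[X])) = (PowerSeries.C : k →+* PowerSeries k) := by
    ext x; simp [Ψ, σ]
  set Q : k[X][X] := ((μ.map ((Polynomial.C : k[X] →+* k[X][X]).comp (Polynomial.C : k →+* k[X]))).scaleRoots (Polynomial.C D)).eval P with hQ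
  have hQ0 : Φ Q = 0 := by
    rw [hQ, ← Polynomial.eval₂_at_apply]
    have e1 : Φ P = Φ (Polynomial.C D) * v := by
      have : Φ (Polynomial.C D) = Polynomial.aeval t D := by simp [Φ]
      rw [this, hDP]; rfl
    rw [e1]
    apply Polynomial.scaleRoots_eval₂_eq_zero
    rw [Polynomial.eval₂_map, hk]
    exact minpoly.aeval k v
  have hQ1 := hker Q hQ0
  have hσD : Ψ (Polynomial.C D) ≠ 0 := by
    have : Ψ (Polynomial.C D) = σ D := by simp [Ψ]
    rw [this]
    simpa [σ] using hD
  -- go to the fraction field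
  set j := algebraMap (PowerSeries k) (FractionRing (PowerSeries k)) with hj
  have hjD : j (Ψ (Polynomial.C D)) ≠ 0 := by
    rw [hj]; exact (map_ne_zero_iff _ (IsFractionRing.injective _ _)).2 hσD
  set w := j (Ψ P) / j (Ψ (Polynomial.C D)) with hw
  have hwr : Polynomial.eval₂ (j.comp PowerSeries.C) w μ = 0 := by
    have e2 : Polynomial.eval₂ (j.comp Ψ) (j (Ψ P)) ((μ.map ((Polynomial.C : k[X] →+* k[X][X]).comp (Polynomial.C : k →+* k[X]))).scaleRoots (Polynomial.C D)) = 0 := by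
      have e3 := Polynomial.eval₂_at_apply (p := (μ.map ((Polynomial.C : k[X] →+* k[X][X]).comp (Polynomial.C : k →+* k[X]))).scaleRoots (Polynomial.C D)) (j.comp Ψ) P
      simp only [RingHom.comp_apply] at e3
      rw [e3, ← hQ, hQ1, map_zero]
    have e4 : j (Ψ P) = (j.comp Ψ) (Polynomial.C D) * w := by
      rw [hw, RingHom.comp_apply, mul_div_cancel₀ _ hjD]
    rw [e4, Polynomial.scaleRoots_eval₂_mul, Polynomial.eval₂_map, RingHom.comp_assoc, hk2] at e2
    rcases mul_eq_zero.1 e2 with h | h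
    · exact absurd (eq_zero_of_pow_eq_zero h) hjD
    · exact h
  have hInteg : IsIntegral (PowerSeries k) w := by
    refine ⟨μ.map PowerSeries.C, hμm.map _, ?_⟩
    rw [Polynomial.eval₂_map]; exact hwr
  obtain ⟨s, hs⟩ := (IsIntegrallyClosed.isIntegral_iff).1 hInteg
  have hs0 : Polynomial.eval₂ (PowerSeries.C : k →+* PowerSeries k) s μ = 0 := by
    apply IsFractionRing.injective (PowerSeries k) (FractionRing (PowerSeries k))
    rw [map_zero, Polynomial.hom_eval₂, hs]; exact hwr
  have hs1 : μ.eval (PowerSeries.constantCoeff s) = 0 := by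
    have := congrArg PowerSeries.constantCoeff hs0
    rw [Polynomial.hom_eval₂, map_zero] at this
    have e : (PowerSeries.constantCoeff : PowerSeries k →+* k).comp PowerSeries.C = RingHom.id k := by ext; simp
    rw [e] at this
    exact this
  have hd := Polynomial.degree_eq_one_of_irreducible_of_root (minpoly.irreducible hv) hs1
  exact minpoly.mem_range_of_degree_eq_one k v hd
end
end DP
end

noncomputable section
namespace DP
set_option linter.all false
open MvPolynomial

theorem hom_scale {K B ι : Type*} [CommSemiring K] [CommSemiring B] [Algebra K B] (y : ι → B) (t : B)
    (c : MvPolynomial ι K) (n : ℕ) (hc : c.IsHomogeneous n) :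
    aeval (fun j => t * y j) c = t ^ n * aeval y c := by
  classical
  conv_lhs => rw [as_sum c]
  conv_rhs => rw [as_sum c]
  rw [map_sum, map_sum, Finset.mul_sum]
  refine Finset.sum_congr rfl fun m hm => ?_
  have hd : m.degree = n := by
    have := hc (mem_support_iff.1 hm)
    rw [Finsupp.degree_eq_weight_one]; exact this
  rw [aeval_monomial, aeval_monomial, Finsupp.prod, Finsupp.prod]
  simp only [mul_pow, Finset.prod_mul_distrib]
  rw [Finset.prod_pow_eq_pow_sum, ← Finsupp.degree_apply, hd]
  ring

section
variable {K L ι : Type*} [Field K] [Field L] [Algebra K L] [Fintype ι] [DecidableEq ι]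

def chi (K : Type*) {L ι : Type*} [Field K] [Field L] [Algebra K L] [Fintype ι] [DecidableEq ι]
   (y : ι → L) (e : ι) : MvPolynomial ι K →ₐ[K] Polynomial (ke K y e) :=
  aeval fun i => if h : i = e then 1 else Polynomial.C ⟨y i, ke_mem y h⟩ * Polynomial.X

theorem chi_aeval (y : ι → L) (e : ι) (h0 : y e ≠ 0) (c : MvPolynomial ι K) (n : ℕ) (hc : c.IsHomogeneous n) :
    Polynomial.aeval (y e)⁻¹ (chi K y e c) = (y e)⁻¹ ^ n * aeval y c := by
  rw [← hom_scale _ _ _ _ hc]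
  have : ((Polynomial.aeval (y e)⁻¹ : Polynomial (ke K y e) →ₐ[ke K y e] L).restrictScalars K).comp (chi K y e)
      = aeval (fun j => (y e)⁻¹ * y j) := by
    apply algHom_ext
    intro i
    simp only [AlgHom.comp_apply, chi, aeval_X]
    split_ifs with h
    · subst h; rw [map_one, inv_mul_cancel₀ h0]
    · rw [AlgHom.restrictScalars_apply, map_mul, Polynomial.aeval_C, Polynomial.aeval_X, mul_comm]; rfl
  exact DFunLike.congr_fun this c

theorem chi_zero (y : ι → L) (e : ι) (c : MvPolynomial ι K) :
    (chi K y e c).eval 0 = algebraMap K (ke K y e) (eval (Pi.single e 1) c) := by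
  have : (Polynomial.evalRingHom 0).comp (chi K y e).toRingHom = (algebraMap K (ke K y e)).comp (eval (Pi.single e 1)) := by
    apply MvPolynomial.ringHom_ext
    · intro r
      simp [chi, Polynomial.algebraMap_apply]
    · intro i
      simp only [RingHom.comp_apply, chi, AlgHom.toRingHom_eq_coe, RingHom.coe_coe, aeval_X]
      split_ifs with h
      · subst h; simp
      · simp [h]
  exact DFunLike.congr_fun this c

theorem aeval_reflect {k : Type*} [Field k] [Algebra k L] {ρ : L} (h0 : ρ ≠ 0) (f : Polynomial k) (N : ℕ) (hN : f.natDegree ≤ N) :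
    Polynomial.aeval ρ⁻¹ (f.reflect N) * ρ ^ N = Polynomial.aeval ρ f := by
  letI := invertibleOfNonzero h0
  have := Polynomial.eval₂_reflect_mul_pow (algebraMap k L) ρ N f hN
  rwa [invOf_eq_inv] at this

/-- The monic polynomial with coefficients `c (n-i)`. -/
def gpol {R : Type*} [CommRing R] (n : ℕ) (c : ℕ → R) : Polynomial R :=
  Polynomial.X ^ n + ∑ i ∈ Finset.range n, Polynomial.C (c (n - i)) * Polynomial.X ^ i

theorem gpol_deg {R : Type*} [CommRing R] [Nontrivial R] (n : ℕ) (c : ℕ → R) : (gpol n c).Monic ∧ (gpol n c).natDegree = n := by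
  have hlt : (∑ i ∈ Finset.range n, Polynomial.C (c (n - i)) * Polynomial.X ^ i).degree < (n : WithBot ℕ) := by
    refine (Polynomial.degree_sum_le _ _).trans_lt ?_
    rw [Finset.sup_lt_iff (WithBot.bot_lt_coe _)]
    intro i hi
    exact (Polynomial.degree_C_mul_X_pow_le _ _).trans_lt (by exact_mod_cast Finset.mem_range.1 hi)
  have hm : (gpol n c).Monic := Polynomial.monic_X_pow_add hlt
  refine ⟨hm, ?_⟩
  apply Polynomial.natDegree_eq_of_degree_eq_some
  rw [gpol, Polynomial.degree_add_eq_left_of_degree_lt] <;> simp [hlt]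

theorem gpol_map {R S : Type*} [CommRing R] [CommRing S] (f : R →+* S) (n : ℕ) (c : ℕ → R) :
    (gpol n c).map f = gpol n (fun i => f (c i)) := by
  simp [gpol, Polynomial.map_sum]

theorem gpol_eval₂ {R S : Type*} [CommRing R] [CommRing S] (f : R →+* S) (n : ℕ) (c : ℕ → R) (x : S) :
    (gpol n c).eval₂ f x = x ^ n + ∑ i ∈ Finset.range n, f (c (n - i)) * x ^ i := by
  simp [gpol, Polynomial.eval₂_finset_sum]

theorem AC_main {y : ι → L} (hy : AlgebraicIndependent K y) (θ : L) (n : ℕ) (c : ℕ → MvPolynomial ι K)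
    (hc : ∀ i, (c i).IsHomogeneous i)
    (hroot : (gpol n c).eval₂ (aeval y : MvPolynomial ι K →ₐ[K] L).toRingHom θ = 0)
    (hind : ∀ P : ℕ → MvPolynomial ι K, ∑ i ∈ Finset.range n, aeval y (P i) * θ ^ i = 0 → ∀ i < n, P i = 0)
    (hgen : ∀ v : L, ∃ (D : MvPolynomial ι K) (P : ℕ → MvPolynomial ι K), D ≠ 0 ∧
      aeval y D * v = ∑ i ∈ Finset.range n, aeval y (P i) * θ ^ i)
    (e : ι) (ζ : K) (h1 : ((gpol n c).map (eval (Pi.single e 1))).eval ζ = 0)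
    (h2 : ((gpol n c).map (eval (Pi.single e 1))).derivative.eval ζ ≠ 0)
    (v : L) (hv : IsIntegral (ke K y e) v) : v ∈ ke K y e := by
  classical
  have htr := tr_ke hy e
  set ρ := y e with hρ
  have h0 : ρ ≠ 0 := ne_zero_of_tr htr
  set g : Polynomial (Polynomial (ke K y e)) := gpol n (fun i => chi K y e (c i)) with hg
  have hgm : (gpol n (fun i => chi K y e (c i))).map (Polynomial.evalRingHom 0) =
      ((gpol n c).map (eval (Pi.single e 1))).map (algebraMap K (ke K y e)) := by
    rw [gpol_map, gpol_map, gpol_map]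
    congr 1; funext i
    exact chi_zero y e (c i)
  obtain ⟨hmon, hdeg⟩ := gpol_deg n (fun i => chi K y e (c i))
  have hgd : g.degree = n := by rw [Polynomial.degree_eq_natDegree hmon.ne_zero, hdeg]
  have := AC_abs (k := ke K y e) ρ⁻¹ (θ / ρ) (tr_inv htr) g hmon ?_ ?_ ?_ (algebraMap K _ ζ) ?_ ?_ v hv
  · obtain ⟨a, ha⟩ := this
    rw [← ha]; exact a.2
  · rw [hg, gpol_eval₂]
    rw [gpol_eval₂] at hroot
    have : (θ / ρ) ^ n + ∑ i ∈ Finset.range n, Polynomial.aeval ρ⁻¹ (chi K y e (c (n - i))) * (θ / ρ) ^ i =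
        ρ⁻¹ ^ n * (θ ^ n + ∑ i ∈ Finset.range n, aeval y (c (n - i)) * θ ^ i) := by
      rw [mul_add, Finset.mul_sum]
      congr 1
      · rw [div_eq_mul_inv, mul_pow, mul_comm]
      · refine Finset.sum_congr rfl fun i hi => ?_
        rw [chi_aeval y e h0 _ _ (hc _), div_eq_mul_inv, mul_pow]
        have : ρ⁻¹ ^ n = ρ⁻¹ ^ (n - i) * ρ⁻¹ ^ i := by
          rw [← pow_add, Nat.sub_add_cancel (Finset.mem_range.1 hi).le]
        rw [this]; ring
    refine this.trans ?_
    have h3 : θ ^ n + ∑ i ∈ Finset.range n, aeval y (c (n - i)) * θ ^ i = 0 := hroot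
    rw [h3, mul_zero]
  · intro P hP hP0
    rw [hgd] at hP
    by_cases hPz : P = 0
    · exact hPz
    set N := ∑ i ∈ Finset.range n, (P.coeff i).natDegree with hN
    have hNi : ∀ i < n, (P.coeff i).natDegree ≤ N := fun i hi =>
      (Finset.single_le_sum (f := fun i => (P.coeff i).natDegree) (fun _ _ => Nat.zero_le _) (Finset.mem_range.2 hi))
    have hsum : ∑ i ∈ Finset.range n, Polynomial.aeval ρ⁻¹ (P.coeff i) * (θ / ρ) ^ i = 0 := by
      rw [← hP0, Polynomial.eval₂_eq_sum_range' _ ((Polynomial.natDegree_lt_iff_degree_lt (n := n) ?_).2 hP)]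
      · rfl
      · exact hPz
    set f : ℕ → Polynomial (ke K y e) := fun i => (P.coeff i).reflect N * Polynomial.X ^ (n - i) with hf
    have hfa : ∀ i < n, Polynomial.aeval ρ (f i) = ρ ^ (N + n) * (Polynomial.aeval ρ⁻¹ (P.coeff i) * ρ⁻¹ ^ i) := by
      intro i hi
      have := aeval_reflect (inv_ne_zero h0) (P.coeff i) N (hNi i hi)
      rw [inv_inv] at this
      rw [hf, ← this]
      simp only [map_mul, map_pow, Polynomial.aeval_X]
      have e1 : ρ ^ n = ρ ^ (n - i) * ρ ^ i := by rw [← pow_add, Nat.sub_add_cancel hi.le]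
      rw [pow_add, e1, inv_pow, inv_pow]
      field_simp
    obtain ⟨M, Nn, hM, -, -, hMN⟩ := clear_poly hy e (o := Fin n) (fun i => f i)
    have hz := hind (fun i => if h : i < n then Nn ⟨i, h⟩ else 0) (by
      have : ∀ i ∈ Finset.range n, aeval y (if h : i < n then Nn ⟨i, h⟩ else 0) * θ ^ i =
          (aeval y M * ρ ^ (N + n)) * (Polynomial.aeval ρ⁻¹ (P.coeff i) * (θ / ρ) ^ i) := by
        intro i hi
        have hi' := Finset.mem_range.1 hi
        rw [dif_pos hi', ← hMN ⟨i, hi'⟩, hfa i hi', div_eq_mul_inv, mul_pow]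
        ring
      rw [Finset.sum_congr rfl this, ← Finset.mul_sum, hsum, mul_zero])
    ext1 i
    rw [Polynomial.coeff_zero]
    by_cases hi : i < n
    · have h3 := hz i hi
      simp only [dif_pos hi] at h3
      have h4 := hMN ⟨i, hi⟩
      rw [h3, map_zero, mul_eq_zero] at h4
      rcases h4 with h4 | h4
      · exact absurd ((map_eq_zero_iff (aeval y) hy).1 h4) hM
      · have h5 := transcendental_iff.1 htr _ h4
        rcases mul_eq_zero.1 h5 with h6 | h6
        · exact Polynomial.reflect_eq_zero_iff.1 h6
        · exact absurd h6 (pow_ne_zero _ Polynomial.X_ne_zero)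
    · apply Polynomial.coeff_eq_zero_of_degree_lt
      exact hP.trans_le (by exact_mod_cast not_lt.1 hi)
  · intro v
    obtain ⟨D, P, hD, h⟩ := hgen v
    set N := (phi K y e D).natDegree + ∑ i ∈ Finset.range n, (phi K y e (P i) * Polynomial.X ^ i).natDegree with hN
    have hNi : ∀ i ∈ Finset.range n, (phi K y e (P i) * Polynomial.X ^ i).natDegree ≤ N := fun i hi =>
      (Finset.single_le_sum (f := fun i => (phi K y e (P i) * Polynomial.X ^ i).natDegree) (fun _ _ => Nat.zero_le _) hi).trans (Nat.le_add_left _ _)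
    refine ⟨(phi K y e D).reflect N, ∑ i ∈ Finset.range n, Polynomial.C ((phi K y e (P i) * Polynomial.X ^ i).reflect N) * Polynomial.X ^ i, ?_, ?_⟩
    · rw [Ne, Polynomial.reflect_eq_zero_iff]
      intro h'
      have := phi_aeval y e D
      rw [h', map_zero] at this
      exact hD ((map_eq_zero_iff (aeval y) hy).1 this.symm)
    · apply mul_right_cancel₀ (pow_ne_zero N h0)
      rw [mul_right_comm, aeval_reflect h0 _ _ (Nat.le_add_right _ _), phi_aeval, h, Polynomial.eval₂_finset_sum, Finset.sum_mul]
      refine Finset.sum_congr rfl fun i hi => ?_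
      rw [Polynomial.eval₂_mul, Polynomial.eval₂_C, Polynomial.eval₂_pow, Polynomial.eval₂_X]
      change _ = Polynomial.aeval ρ⁻¹ _ * _ * _
      rw [mul_right_comm, aeval_reflect h0 _ _ (hNi i hi), map_mul, phi_aeval, map_pow, Polynomial.aeval_X, mul_assoc, ← mul_pow,
        mul_div_cancel₀ _ h0]
  · rw [hg, hgm, Polynomial.eval_map, Polynomial.eval₂_at_apply, h1, map_zero]
  · rw [hg, hgm, Polynomial.derivative_map, Polynomial.eval_map, Polynomial.eval₂_at_apply]
    exact (map_ne_zero_iff _ (algebraMap K _).injective).2 h2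
end
end DP
end

noncomputable section
namespace DP
set_option linter.all false
open MvPolynomial

section
variable {K A ι : Type*} [Field K] [CommRing A] [Algebra K A] (𝒜 : ℕ → Submodule K A) [GradedAlgebra 𝒜]

/-- projection to degree n -/
def pr (n : ℕ) : A →ₗ[K] A := GradedAlgebra.proj 𝒜 n

theorem pr_same {n : ℕ} {x : A} (h : x ∈ 𝒜 n) : pr 𝒜 n x = x := by
  rw [pr, GradedAlgebra.proj_apply, DirectSum.decompose_of_mem_same _ h]
theorem pr_ne {m n : ℕ} {x : A} (h : x ∈ 𝒜 m) (hmn : m ≠ n) : pr 𝒜 n x = 0 := by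
  rw [pr, GradedAlgebra.proj_apply, DirectSum.decompose_of_mem_ne _ h hmn]
theorem pr_mem (n : ℕ) (x : A) : pr 𝒜 n x ∈ 𝒜 n := by
  rw [pr, GradedAlgebra.proj_apply]; exact SetLike.coe_mem _
theorem pr_ext {x : A} (h : ∀ n, pr 𝒜 n x = 0) : x = 0 := by
  classical
  rw [← DirectSum.sum_support_decompose 𝒜 x]
  exact Finset.sum_eq_zero fun n _ => by simpa [pr, GradedAlgebra.proj_apply] using h n

variable {y : ι → A}


theorem aeval_mem (hy : ∀ i, y i ∈ 𝒜 1) (P : MvPolynomial ι K) (n : ℕ) (hP : P.IsHomogeneous n) : aeval y P ∈ 𝒜 n := by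
  classical
  rw [as_sum P, map_sum]
  refine Submodule.sum_mem _ fun m hm => ?_
  have hd : m.degree = n := by
    have := hP (mem_support_iff.1 hm)
    rw [Finsupp.degree_eq_weight_one]; exact this
  rw [aeval_monomial, ← Algebra.smul_def]
  refine Submodule.smul_mem _ _ ?_
  rw [Finsupp.prod]
  have : ∀ s : Finset ι, ∏ i ∈ s, y i ^ m i ∈ 𝒜 (∑ i ∈ s, m i) := by
    intro s
    induction s using Finset.induction_on with
    | empty => simpa using SetLike.GradedOne.one_mem (A := 𝒜)
    | insert a s ha ih =>
      rw [Finset.prod_insert ha, Finset.sum_insert ha]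
      refine SetLike.GradedMul.mul_mem ?_ ih
      have := SetLike.pow_mem_graded (A := 𝒜) (m a) (hy a)
      simpa using this
  have h2 := this m.support
  rwa [← Finsupp.degree_apply, hd] at h2

theorem pr_aeval_mul (hy : ∀ i, y i ∈ 𝒜 1) (P : MvPolynomial ι K) (δ n : ℕ) (b : A) (hb : b ∈ 𝒜 δ) :
    pr 𝒜 n (aeval y P * b) = if δ ≤ n then aeval y (homogeneousComponent (n - δ) P) * b else 0 := by
  classical
  conv_lhs => rw [← sum_homogeneousComponent P]
  rw [map_sum, Finset.sum_mul, map_sum]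
  have hm : ∀ i, aeval y (homogeneousComponent i P) * b ∈ 𝒜 (i + δ) := fun i =>
    SetLike.GradedMul.mul_mem (aeval_mem 𝒜 hy _ i (homogeneousComponent_isHomogeneous i P)) hb
  split_ifs with h
  · by_cases hi : n - δ ∈ Finset.range (P.totalDegree + 1)
    · rw [Finset.sum_eq_single_of_mem _ hi]
      · have := hm (n - δ)
        rw [Nat.sub_add_cancel h] at this
        exact pr_same 𝒜 this
      · intro i _ hne
        exact pr_ne 𝒜 (hm i) (by omega)
    · rw [Finset.sum_eq_zero]
      · rw [homogeneousComponent_eq_zero, map_zero, zero_mul]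
        simp at hi; omega
      · intro i hi'
        refine pr_ne 𝒜 (hm i) ?_
        rintro rfl
        apply hi
        simpa using hi'
  · exact Finset.sum_eq_zero fun i _ => pr_ne 𝒜 (hm i) (by omega)

theorem pr_aeval (hy : ∀ i, y i ∈ 𝒜 1) (P : MvPolynomial ι K) (n : ℕ) : pr 𝒜 n (aeval y P) = aeval y (homogeneousComponent n P) := by
  have := pr_aeval_mul 𝒜 hy P 0 n 1 (SetLike.GradedOne.one_mem)
  simpa using this

/-- homogeneous coordinates -/
theorem hom_coords (hy : ∀ i, y i ∈ 𝒜 1) {o : Type*} (s : Finset o) (P : o → MvPolynomial ι K) (b : o → A) (δ : o → ℕ) (hb : ∀ k ∈ s, b k ∈ 𝒜 (δ k)) (n : ℕ) :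
    pr 𝒜 n (∑ k ∈ s, aeval y (P k) * b k) = ∑ k ∈ s, aeval y (if δ k ≤ n then homogeneousComponent (n - δ k) (P k) else 0) * b k := by
  rw [map_sum]
  refine Finset.sum_congr rfl fun k hk => ?_
  rw [pr_aeval_mul 𝒜 hy _ _ _ _ (hb k hk)]
  split_ifs <;> simp

/-- a monic integral equation of a degree one element can be made homogeneous -/
theorem hom_eqn (hy : ∀ i, y i ∈ 𝒜 1) (x : A) (hx : x ∈ 𝒜 1) (G : Polynomial (MvPolynomial ι K)) (hG : G.Monic)
    (h : G.eval₂ (aeval y : MvPolynomial ι K →ₐ[K] A).toRingHom x = 0) :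
    ∃ c : ℕ → MvPolynomial ι K, (∀ i, (c i).IsHomogeneous i) ∧
      (gpol G.natDegree c).eval₂ (aeval y : MvPolynomial ι K →ₐ[K] A).toRingHom x = 0 := by
  set n := G.natDegree with hn
  refine ⟨fun i => homogeneousComponent i (G.coeff (n - i)), fun i => homogeneousComponent_isHomogeneous _ _, ?_⟩
  rw [gpol_eval₂]
  have hp : ∀ i, x ^ i ∈ 𝒜 i := fun i => by
    have := SetLike.pow_mem_graded (A := 𝒜) i hx; simpa using this
  rw [Polynomial.eval₂_eq_sum_range, Finset.sum_range_succ, ← hn, hG.coeff_natDegree, map_one, one_mul] at h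
  have h2 := congrArg (pr 𝒜 n) h
  have h3 := hom_coords 𝒜 hy (Finset.range n) (fun i => G.coeff i) (fun i => x ^ i) (fun i => i) (fun i _ => hp i) n
  rw [map_add, map_zero, pr_same 𝒜 (hp n)] at h2
  rw [add_comm, ← h2]
  congr 1
  refine Eq.trans ?_ h3.symm
  refine Finset.sum_congr rfl fun i hi => ?_
  have hi' := Finset.mem_range.1 hi
  rw [if_pos hi'.le, Nat.sub_sub_self hi'.le]
  rfl
end
end DP
end

noncomputable section
namespace DP
open MvPolynomial
set_option linter.all false

section
variable {R A o : Type*} [CommRing R] [IsDomain R] [CommRing A] [IsDomain A] [Algebra R A] [Fintype o]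

def uA {A o : Type*} [One A] (z : o → A) : Option o → A := fun a => a.elim 1 z
@[simp] theorem uA_none {A o : Type*} [One A] (z : o → A) : uA z none = 1 := rfl
@[simp] theorem uA_some {A o : Type*} [One A] (z : o → A) (j : o) : uA z (some j) = z j := rfl

abbrev WW (R : Type*) {A o : Type*} [CommRing R] [CommRing A] [Algebra R A] (z : o → A) : Submodule R A :=
  Submodule.span R (Set.range (uA z))

structure Ctx (R : Type*) {A o : Type*} [CommRing R] [IsDomain R] [CommRing A] [IsDomain A] [Algebra R A] [Fintype o] (z : o → A) : Prop where
  li : LinearIndependent R (uA z)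
  sat : ∀ (r : R) (x : A), r ≠ 0 → r • x ∈ WW R z → x ∈ WW R z
  rank : ∀ x1 x2 : A, ∃ r1 r2 : R, (r1 ≠ 0 ∨ r2 ≠ 0) ∧ r1 • x1 + r2 • x2 ∈ WW R z
  neT : ∃ x, x ∉ WW R z
  gen : Algebra.adjoin R (Set.range z) = ⊤
  fin : Module.Finite R A

theorem one_WW (z : o → A) : (1 : A) ∈ WW R z := Submodule.subset_span ⟨none, rfl⟩
theorem z_WW (z : o → A) (j : o) : z j ∈ WW R z := Submodule.subset_span ⟨some j, rfl⟩

theorem Ctx.inj {z : o → A} (h : Ctx R z) : Function.Injective (algebraMap R A) := by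
  rw [injective_iff_map_eq_zero]
  intro r hr
  have := (Fintype.linearIndependent_iff.1 h.li) (fun a => a.elim r (fun _ => 0)) (by
    rw [Fintype.sum_option]; simp [← Algebra.algebraMap_eq_smul_one, hr])
  exact this none

/-- `λ` is a functional with kernel exactly `W`. -/
def IsLam (z : o → A) (lam : A →ₗ[R] R) : Prop := ∀ x, lam x = 0 ↔ x ∈ WW R z

theorem exists_lam {z : o → A} (h : Ctx R z) : ∃ lam : A →ₗ[R] R, IsLam z lam := by
  classical
  obtain ⟨x1, hx1⟩ := h.neT
  have huniq : ∀ s : R, s • x1 ∈ WW R z → s = 0 := by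
    intro s hs; by_contra h0; exact hx1 (h.sat s x1 h0 hs)
  have hx : ∀ x, ∃ r s : R, r ≠ 0 ∧ r • x - s • x1 ∈ WW R z := by
    intro x
    obtain ⟨r1, r2, h12, hm⟩ := h.rank x x1
    refine ⟨r1, -r2, ?_, by simpa using hm⟩
    rintro rfl
    rw [zero_smul, zero_add] at hm
    have := huniq _ hm
    simp [this] at h12
  choose r s hr hrs using hx
  obtain ⟨G, hG⟩ := h.fin
  set D := ∏ g ∈ G, r g with hD
  have hD0 : D ≠ 0 := Finset.prod_ne_zero_iff.2 fun g _ => hr g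
  have hall : ∀ x : A, ∃ t : R, D • x - t • x1 ∈ WW R z := by
    intro x
    have : x ∈ Submodule.span R (G : Set A) := hG ▸ Submodule.mem_top
    induction this using Submodule.span_induction with
    | mem g hg =>
      refine ⟨(∏ i ∈ G.erase g, r i) * s g, ?_⟩
      rw [hD, ← Finset.prod_erase_mul _ _ hg, mul_smul, mul_smul, ← smul_sub]
      exact Submodule.smul_mem _ _ (hrs g)
    | zero => exact ⟨0, by simp⟩
    | add a b _ _ ha hb =>
      obtain ⟨t, ht⟩ := ha
      obtain ⟨t', ht'⟩ := hb
      refine ⟨t + t', ?_⟩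
      convert Submodule.add_mem _ ht ht' using 1
      rw [smul_add, add_smul]; abel
    | smul c a _ ha =>
      obtain ⟨t, ht⟩ := ha
      refine ⟨c * t, ?_⟩
      convert Submodule.smul_mem _ c ht using 1
      rw [smul_sub, smul_smul, smul_smul, smul_smul, mul_comm c D]
  choose l hl using hall
  have hu : ∀ x t, D • x - t • x1 ∈ WW R z → l x = t := by
    intro x t ht
    have := Submodule.sub_mem _ ht (hl x)
    rw [sub_sub_sub_cancel_left, ← sub_smul] at this
    exact sub_eq_zero.1 (huniq _ this)
  refine ⟨{ toFun := l, map_add' := ?_, map_smul' := ?_ }, ?_⟩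
  · intro a b
    refine hu _ _ ?_
    convert Submodule.add_mem _ (hl a) (hl b) using 1
    rw [smul_add, add_smul]; abel
  · intro c a
    refine hu _ _ ?_
    convert Submodule.smul_mem _ c (hl a) using 1
    simp only [RingHom.id_apply, smul_eq_mul]
    rw [smul_sub, smul_smul, smul_smul, smul_smul, mul_comm c D]
  · intro x
    change l x = 0 ↔ _
    constructor
    · intro h0
      have := hl x
      rw [h0, zero_smul, sub_zero] at this
      exact h.sat D x hD0 this
    · intro hx
      refine hu _ _ ?_
      rw [zero_smul, sub_zero]
      exact Submodule.smul_mem _ _ hx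

theorem exists_lam_min [UniqueFactorizationMonoid R] {z : o → A} (h : Ctx R z) :
    ∃ lam : A →ₗ[R] R, IsLam z lam ∧ ∀ p : R, Prime p → ∃ x, ¬ p ∣ lam x := by
  obtain ⟨x1, hx1⟩ := h.neT
  obtain ⟨lam0, hlam0⟩ := exists_lam h
  have main : ∀ a : R, ∀ lam : A →ₗ[R] R, IsLam z lam → lam x1 = a →
      ∃ lam : A →ₗ[R] R, IsLam z lam ∧ ∀ p : R, Prime p → ∃ x, ¬ p ∣ lam x := by
    intro a
    induction a using (wellFounded_dvdNotUnit (α := R)).induction with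
    | _ a ih =>
      intro lam hlam ha
      by_cases hp : ∀ p : R, Prime p → ∃ x, ¬ p ∣ lam x
      · exact ⟨lam, hlam, hp⟩
      · push_neg at hp
        obtain ⟨p, hp, hpd⟩ := hp
        choose l hl using hpd
        have ha0 : a ≠ 0 := by rw [← ha]; intro h0; exact hx1 ((hlam x1).1 h0)
        have hla : a = p * l x1 := by rw [← ha, hl]
        refine ih (l x1) ⟨?_, p, hp.not_unit, by rw [hla, mul_comm]⟩
          { toFun := l, map_add' := ?_, map_smul' := ?_ } ?_ rfl
        · rintro h0; rw [h0, mul_zero] at hla; exact ha0 hla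
        · intro x y; apply mul_left_cancel₀ hp.ne_zero; rw [← hl, mul_add, ← hl, ← hl, map_add]
        · intro c x; apply mul_left_cancel₀ hp.ne_zero
          simp only [RingHom.id_apply, smul_eq_mul]
          rw [← hl, mul_left_comm, ← hl, map_smul, smul_eq_mul]
        · intro x
          rw [← hlam x, hl x]
          simp [hp.ne_zero]
  exact main _ lam0 hlam0 rfl

theorem lam_mul_WW {z : o → A} (lam : A →ₗ[R] R) (hl : IsLam z lam) (P : Ideal R) (j : o)
    (hq : ∀ i, lam (z i * z j) ∈ P) (x : A) (hx : x ∈ WW R z) : lam (x * z j) ∈ P := by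
  induction hx using Submodule.span_induction with
  | mem g hg =>
    obtain ⟨a, rfl⟩ := hg
    rcases a with _ | i
    · rw [uA_none, one_mul, (hl _).2 (z_WW z j)]; exact P.zero_mem
    · exact hq i
  | zero => simp
  | add a b _ _ ha hb => rw [add_mul, map_add]; exact P.add_mem ha hb
  | smul c a _ ha => rw [smul_mul_assoc, map_smul]; exact P.mul_mem_left c ha

theorem lam_comm {z : o → A} (lam : A →ₗ[R] R) (hl : IsLam z lam) (x x1 : A) :
    lam x1 • x - lam x • x1 ∈ WW R z := by
  rw [← hl, map_sub, map_smul, map_smul, smul_eq_mul, smul_eq_mul, mul_comm, sub_self]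

theorem single_lemma {z : o → A} (h : Ctx R z) (lam : A →ₗ[R] R) (hl : IsLam z lam) (P : Ideal R) (hP : P.IsPrime)
    (hq : ∀ i j, lam (z i * z j) ∈ P) (x : A) : lam x ∈ P := by
  by_contra hx1
  have key : ∀ x, lam x ∈ P → ∀ j, lam (x * z j) ∈ P := by
    intro x' hx' j
    have h1 := lam_mul_WW lam hl P j (fun i => hq i j) _ (lam_comm lam hl x' x)
    rw [sub_mul, smul_mul_assoc, smul_mul_assoc, map_sub, map_smul, map_smul, smul_eq_mul, smul_eq_mul] at h1
    have h2 := P.add_mem h1 (P.mul_mem_right (lam (x * z j)) hx')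
    rw [sub_add_cancel] at h2
    exact (hP.mem_or_mem h2).resolve_left hx1
  apply hx1
  have all : ∀ x' ∈ Algebra.adjoin R (Set.range z), lam x' ∈ P := by
    intro x' hx'
    rw [← Subalgebra.mem_toSubmodule, Algebra.adjoin_eq_span] at hx'
    induction hx' using Submodule.span_induction with
    | mem g hg =>
      induction hg using Submonoid.closure_induction_right with
      | one => rw [(hl _).2 (one_WW z)]; exact P.zero_mem
      | mul_right a ha b hb ih =>
        obtain ⟨j, rfl⟩ := hb
        exact key _ ih j
    | zero => simp
    | add a b _ _ ha hb => rw [map_add]; exact P.add_mem ha hb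
    | smul c a _ ha => rw [map_smul]; exact P.mul_mem_left c ha
  exact all x (h.gen ▸ Algebra.mem_top)

theorem q_noprime [UniqueFactorizationMonoid R] {z : o → A} (h : Ctx R z) (lam : A →ₗ[R] R) (hl : IsLam z lam)
    (hp : ∀ p : R, Prime p → ∃ x, ¬ p ∣ lam x) (p : R) (hpp : Prime p) : ∃ i j, ¬ p ∣ lam (z i * z j) := by
  by_contra hc
  push_neg at hc
  obtain ⟨x, hx⟩ := hp p hpp
  have := single_lemma h lam hl (Ideal.span {p}) ((Ideal.span_singleton_prime hpp.ne_zero).2 hpp)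
    (fun i j => Ideal.mem_span_singleton.2 (hc i j)) x
  exact hx (Ideal.mem_span_singleton.1 this)

/-- elements multiplying `W` into `W` are in `R` -/
theorem nondeg {z : o → A} (h : Ctx R z) (lam : A →ₗ[R] R) (hl : IsLam z lam) (v : A) (hv : v ∈ WW R z)
    (hvz : ∀ j, v * z j ∈ WW R z) : ∃ r, v = algebraMap R A r := by
  have hvW : ∀ x ∈ WW R z, lam (v * x) = 0 := by
    intro x hx
    induction hx using Submodule.span_induction with
    | mem g hg =>
      obtain ⟨a, rfl⟩ := hg
      rcases a with _ | i
      · rw [uA_none, mul_one]; exact (hl _).2 hv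
      · exact (hl _).2 (hvz i)
    | zero => simp
    | add a b _ _ ha hb => rw [mul_add, map_add, ha, hb, add_zero]
    | smul c a _ ha => rw [mul_smul_comm, map_smul, ha, smul_zero]
  obtain ⟨x1, hx1⟩ := h.neT
  have h0 : lam x1 ≠ 0 := fun h0 => hx1 ((hl _).1 h0)
  set t := lam x1 • v - algebraMap R A (lam (v * x1)) with ht
  have htx : ∀ x, lam (t * x) = 0 := by
    intro x
    have h1 := hvW _ (lam_comm lam hl x x1)
    rw [mul_sub, mul_smul_comm, mul_smul_comm, map_sub, map_smul, map_smul, smul_eq_mul, smul_eq_mul] at h1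
    rw [ht, sub_mul, smul_mul_assoc, ← Algebra.smul_def, map_sub, map_smul, map_smul, smul_eq_mul, smul_eq_mul]
    linear_combination h1
  have ht0 : t = 0 := by
    by_contra ht0
    have hfin := h.fin
    have halg : IsAlgebraic R t := (Algebra.IsIntegral.isIntegral (R := R) t).isAlgebraic
    obtain ⟨y, hy0, r, hy⟩ : ∃ y : A, y ≠ 0 ∧ ∃ r : R, t * y = algebraMap R A r := by
      have := halg.exists_nonzero_dvd (mem_nonZeroDivisors_of_ne_zero ht0)
      obtain ⟨r, hr, s, hs⟩ := this
      refine ⟨s, ?_, r, hs.symm⟩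
      rintro rfl
      rw [mul_zero] at hs
      exact hr (h.inj (by rw [hs, map_zero]))
    have hr : r ≠ 0 := by
      rintro rfl; rw [map_zero] at hy; exact (mul_ne_zero ht0 hy0) hy
    apply hx1
    apply h.sat r x1 hr
    rw [← hl, Algebra.smul_def, ← hy, mul_assoc]
    exact htx _
  obtain ⟨f, hf⟩ := (Submodule.mem_span_range_iff_exists_fun R).1 hv
  have h2 := Fintype.linearIndependent_iff.1 h.li (fun a => lam x1 * f a - (a.elim (lam (v * x1)) (fun _ => 0))) (by
    simp only [sub_smul, Finset.sum_sub_distrib, mul_smul, ← Finset.smul_sum, hf]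
    rw [Fintype.sum_option]
    simp only [Option.elim, uA_none, zero_smul, Finset.sum_const_zero, add_zero, ← Algebra.algebraMap_eq_smul_one]
    exact ht0)
  refine ⟨f none, ?_⟩
  rw [← hf, Fintype.sum_option]
  have h3 : ∀ j, f (some j) = 0 := by
    intro j
    have := h2 (some j)
    simpa [h0] using this
  simp [h3, Algebra.algebraMap_eq_smul_one]

end
end DP
end

noncomputable section
namespace DP
open MvPolynomial
set_option linter.all false

section
variable {R A : Type*} [CommRing R] [IsDomain R] [UniqueFactorizationMonoid R] [CommRing A] [IsDomain A] [Algebra R A]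

theorem coprime_lemma [IsIntegrallyClosed A] [Algebra.IsIntegral R A] (hinj : Function.Injective (algebraMap R A)) (a b : R) (ha : a ≠ 0) (hb : b ≠ 0)
    (hab : IsRelPrime a b) (x x' : A) (h : b • x = a • x') : ∃ v : A, x = a • v := by
  let F := FractionRing R
  let L := FractionRing A
  have hinj' : Function.Injective (algebraMap R L) := by
    rw [IsScalarTower.algebraMap_eq R A L]
    exact (IsFractionRing.injective A L).comp hinj
  haveI : FaithfulSMul R L := (faithfulSMul_iff_algebraMap_injective R L).2 hinj'
  letI : Algebra F L := FractionRing.liftAlgebra R L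
  haveI : IsScalarTower R F L := FractionRing.isScalarTower_liftAlgebra R L
  have ha' : algebraMap R L a ≠ 0 := by simpa using fun h => ha (hinj' (by simpa using h))
  have hb' : algebraMap R L b ≠ 0 := by simpa using fun h => hb (hinj' (by simpa using h))
  set v : L := algebraMap A L x / algebraMap R L a with hv
  have hcomp : (algebraMap F L).comp (algebraMap R F) = algebraMap R L := (IsScalarTower.algebraMap_eq R F L).symm
  have hintA : ∀ x : A, (algebraMap R L).IsIntegralElem (algebraMap A L x) := by
    intro x
    have : IsIntegral R (algebraMap A L x) := (Algebra.IsIntegral.isIntegral (R := R) x).algebraMap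
    exact this
  have h1 : algebraMap R L a * v = algebraMap A L x := by rw [hv, mul_div_cancel₀ _ ha']
  have h2 : algebraMap R L b * v = algebraMap A L x' := by
    rw [Algebra.smul_def, Algebra.smul_def] at h
    have := congrArg (algebraMap A L) h
    simp only [map_mul, ← IsScalarTower.algebraMap_apply R A L] at this
    rw [hv, ← mul_div_assoc, this, mul_div_cancel_left₀ _ ha']
  have hF : ∀ r : R, algebraMap F L (algebraMap R F r) = algebraMap R L r := fun r => (IsScalarTower.algebraMap_apply R F L r).symm
  have hvF : IsIntegral F v := by
    have : IsIntegral R (algebraMap R L a * v) := by rw [h1]; exact hintA x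
    have h3 : IsIntegral F (algebraMap F L (algebraMap R F a) * v) := by rw [hF]; exact this.tower_top
    have h4 := (isIntegral_algebraMap (R := F) (A := L) (x := (algebraMap R F a)⁻¹)).mul h3
    rwa [map_inv₀, inv_mul_cancel_left₀ (by rw [hF]; exact ha')] at h4
  have hco : ∀ i, ∃ r : R, algebraMap R F r = (minpoly F v).coeff i := by
    intro i
    set m := (minpoly F v).natDegree - i
    set c := (minpoly F v).coeff i
    have haF : algebraMap R F a ≠ 0 := by simpa using ha
    have hbF : algebraMap R F b ≠ 0 := by simpa using hb
    have i1 := coeff_integral' (algebraMap R F) v hvF (algebraMap R F a) haF (by rw [hcomp, hF, h1]; exact hintA x) i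
    have i2 := coeff_integral' (algebraMap R F) v hvF (algebraMap R F b) hbF (by rw [hcomp, hF, h2]; exact hintA x') i
    obtain ⟨r0, hr0⟩ := IsIntegrallyClosed.isIntegral_iff.1 (show IsIntegral R _ from i1)
    obtain ⟨r1, hr1⟩ := IsIntegrallyClosed.isIntegral_iff.1 (show IsIntegral R _ from i2)
    have e : r0 * b ^ m = r1 * a ^ m := by
      apply IsFractionRing.injective R F
      simp only [map_mul, map_pow, hr0, hr1]; ring
    have hd : a ^ m ∣ r0 := by
      have : IsRelPrime (a ^ m) (b ^ m) := hab.pow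
      exact this.dvd_of_dvd_mul_right ⟨r1, by rw [e, mul_comm]⟩
    obtain ⟨t, ht⟩ := hd
    refine ⟨t, ?_⟩
    apply mul_right_cancel₀ (pow_ne_zero m haF)
    rw [← hr0, ht, map_mul, map_pow]; ring
  have hvR : IsIntegral R v := by
    have hl : minpoly F v ∈ Polynomial.lifts (algebraMap R F) := (Polynomial.lifts_iff_coeff_lifts _).2 fun i => hco i
    obtain ⟨q, hq, -, hqm⟩ := Polynomial.lifts_and_natDegree_eq_and_monic hl (minpoly.monic hvF)
    refine ⟨q, hqm, ?_⟩
    have := minpoly.aeval F v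
    rw [← hq, Polynomial.aeval_def, Polynomial.eval₂_map, hcomp] at this
    exact this
  obtain ⟨w, hw⟩ := IsIntegrallyClosed.isIntegral_iff.1 (hvR.tower_top (A := A))
  refine ⟨w, ?_⟩
  apply IsFractionRing.injective A L
  rw [Algebra.smul_def, map_mul, ← IsScalarTower.algebraMap_apply R A L, hw, h1]
end

open MvPolynomial
section
variable {K ι : Type*} [Field K] [Fintype ι]

/-- linear forms -/
def lf : (ι → K) →ₗ[K] MvPolynomial ι K where
  toFun a := ∑ i, C (a i) * X i
  map_add' a b := by simp [add_mul, Finset.sum_add_distrib]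
  map_smul' c a := by simp [MvPolynomial.smul_eq_C_mul, mul_assoc, Finset.mul_sum]

theorem lf_apply (a : ι → K) : lf a = ∑ i, C (a i) * X i := rfl

theorem lf_hom (a : ι → K) : (lf a).IsHomogeneous 1 := by
  refine IsHomogeneous.sum _ _ _ fun i _ => ?_
  simpa using (isHomogeneous_C ι (a i)).mul (isHomogeneous_X K i)

theorem lf_single [DecidableEq ι] (i : ι) : lf (Pi.single i (1:K)) = X i := by
  rw [lf_apply, Finset.sum_eq_single i]
  · simp
  · intro j _ hj; simp [hj]
  · simp

theorem deg_one {ι : Type*} (m : ι →₀ ℕ) (hm : m.degree = 1) : ∃ i, m = Finsupp.single i 1 := by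
  classical
  have hm0 : m ≠ 0 := by rintro rfl; simp at hm
  obtain ⟨i, hi⟩ := Finsupp.ne_iff.1 hm0
  refine ⟨i, ?_⟩
  have h1 : Finsupp.single i 1 ≤ m := by
    rw [Finsupp.single_le_iff]; simp at hi; omega
  obtain ⟨n, rfl⟩ := exists_add_of_le h1
  rw [map_add, Finsupp.degree_single] at hm
  have : n = 0 := (Finsupp.degree_eq_zero_iff n).1 (by omega)
  rw [this, add_zero]

theorem lf_of_hom (q : MvPolynomial ι K) (hq : q.IsHomogeneous 1) : q = lf (fun i => coeff (Finsupp.single i 1) q) := by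
  classical
  ext m
  by_cases hm : m.degree = 1
  · obtain ⟨i, rfl⟩ : ∃ i, m = Finsupp.single i 1 := deg_one m hm
    rw [lf_apply, coeff_sum, Finset.sum_eq_single i]
    · simp [coeff_C_mul, coeff_X']
    · intro j _ hj
      rw [coeff_C_mul, coeff_X']
      rw [if_neg, mul_zero]
      intro h; exact hj (by simpa using Finsupp.single_left_injective one_ne_zero h)
    · simp
  · rw [hq.coeff_eq_zero hm, (lf_hom _).coeff_eq_zero hm]

theorem lf_coeff (a : ι → K) (i : ι) : coeff (Finsupp.single i 1) (lf a) = a i := by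
  classical
  rw [lf_apply, coeff_sum, Finset.sum_eq_single i]
  · simp [coeff_C_mul, coeff_X']
  · intro j _ hj
    rw [coeff_C_mul, coeff_X']
    rw [if_neg, mul_zero]
    intro h; exact hj (by simpa using Finsupp.single_left_injective one_ne_zero h)
  · simp

theorem lf_inj : Function.Injective (lf : (ι → K) →ₗ[K] MvPolynomial ι K) := by
  intro a b h
  funext i
  rw [← lf_coeff a i, h, lf_coeff]

/-- substitution by a linear map -/
theorem aeval_lf {A : Type*} [CommRing A] [Algebra K A] (f : ι → A) (a : ι → K) :
    aeval f (lf a) = ∑ i, algebraMap K A (a i) * f i := by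
  simp [lf_apply]

theorem lin_prime (U : Submodule K (ι → K)) : (Ideal.span (lf '' (U : Set (ι → K)))).IsPrime := by
  classical
  obtain ⟨V, hUV⟩ := Submodule.exists_isCompl U
  -- projection onto `V` along `U`
  have hex : ∃ π : (ι → K) →ₗ[K] (ι → K), (∀ a ∈ U, π a = 0) ∧ ∀ a, a - π a ∈ U := by
    refine ⟨(U.subtype ∘ₗ (Submodule.projectionOnto U V hUV)) |> fun f => LinearMap.id - f, ?_, ?_⟩
    · intro a ha
      have := Submodule.projectionOnto_apply_left hUV ⟨a, ha⟩
      simp only at this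
      simp [this]
    · intro a
      simp
  obtain ⟨π, hπU, hπ⟩ := hex
  let g : MvPolynomial ι K →ₐ[K] MvPolynomial ι K := aeval fun i => lf (π (Pi.single i 1))
  have hg : ∀ a, g (lf a) = lf (π a) := by
    intro a
    have : a = ∑ i, a i • Pi.single i (1:K) := by
      funext j; simp [Finset.sum_apply, Pi.single_apply]
    conv_rhs => rw [this, map_sum, map_sum]
    simp only [g, aeval_lf]
    refine Finset.sum_congr rfl fun i _ => ?_
    rw [map_smul, map_smul, Algebra.smul_def]
  have hker : Ideal.span (lf '' (U : Set (ι → K))) = RingHom.ker g := by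
    apply le_antisymm
    · rw [Ideal.span_le]
      rintro _ ⟨a, ha, rfl⟩
      rw [SetLike.mem_coe, RingHom.mem_ker, hg, hπU a ha, map_zero]
    · intro f hf
      have : ∀ f, f - g f ∈ Ideal.span (lf '' (U : Set (ι → K))) := by
        intro f
        induction f using MvPolynomial.induction_on with
        | C a => simp [g]
        | add p q hp hq => rw [map_add, add_sub_add_comm]; exact Ideal.add_mem _ hp hq
        | mul_X p i hp =>
          have h1 : X i - g (X i) ∈ Ideal.span (lf '' (U : Set (ι → K))) := by
            rw [← lf_single, hg, ← map_sub]
            exact Ideal.subset_span ⟨_, hπ _, rfl⟩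
          have : p * X i - g (p * X i) = (p - g p) * X i + g p * (X i - g (X i)) := by rw [map_mul]; ring
          rw [this]
          exact Ideal.add_mem _ (Ideal.mul_mem_right _ _ hp) (Ideal.mul_mem_left _ _ h1)
      have h2 := this f
      rwa [(RingHom.mem_ker).1 hf, sub_zero] at h2
  rw [hker]
  exact RingHom.ker_isPrime _

theorem lf_ideal_mem (U : Submodule K (ι → K)) (a : ι → K) (h : lf a ∈ Ideal.span (lf '' (U : Set (ι → K)))) : a ∈ U := by
  classical
  obtain ⟨V, hUV⟩ := Submodule.exists_isCompl U
  have h1 : ∀ f ∈ Ideal.span (lf '' (U : Set (ι → K))), ∃ u ∈ U, homogeneousComponent 1 f = lf u := by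
    intro f hf
    induction hf using Submodule.span_induction with
    | mem f hf =>
      obtain ⟨u, hu, rfl⟩ := hf
      exact ⟨u, hu, homogeneousComponent_of_mem (by exact lf_hom u) |>.trans (if_pos rfl)⟩
    | zero => exact ⟨0, U.zero_mem, by simp⟩
    | add x y _ _ hx hy =>
      obtain ⟨u, hu, h⟩ := hx
      obtain ⟨u', hu', h'⟩ := hy
      exact ⟨u + u', U.add_mem hu hu', by rw [map_add, h, h', map_add]⟩
    | smul c x hx0 hx =>
      obtain ⟨u, hu, h⟩ := hx
      refine ⟨coeff 0 c • u, U.smul_mem _ hu, ?_⟩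
      have h0 : coeff 0 x = 0 := by
        have : Ideal.span (lf '' (U : Set (ι → K))) ≤ RingHom.ker (constantCoeff : MvPolynomial ι K →+* K) := by
          rw [Ideal.span_le]
          rintro _ ⟨a, ha, rfl⟩
          simp [lf_apply]
        exact this hx0
      rw [show lf (coeff 0 c • u) = coeff 0 c • lf u from map_smul lf _ _, ← h, smul_eq_mul]
      ext m
      rw [coeff_homogeneousComponent, coeff_smul, coeff_homogeneousComponent]
      split_ifs with hm
      · obtain ⟨i, rfl⟩ : ∃ i, Finsupp.single i 1 = m := by
          obtain ⟨i, h⟩ := deg_one m hm; exact ⟨i, h.symm⟩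
        rw [coeff_mul, Finsupp.antidiagonal_single]
        simp [Finset.Nat.antidiagonal_succ, h0]
      · simp
  obtain ⟨u, hu, h2⟩ := h1 _ h
  have h3 : homogeneousComponent 1 (lf a) = lf a := homogeneousComponent_of_mem (by exact lf_hom a) |>.trans (if_pos rfl)
  rw [h3] at h2
  rw [lf_inj h2]; exact hu

theorem lf_prime (a : ι → K) (ha : a ≠ 0) : Prime (lf a) := by
  have := lin_prime (Submodule.span K {a})
  have h2 : Ideal.span (lf '' (Submodule.span K {a} : Set (ι → K))) = Ideal.span {lf a} := by
    apply le_antisymm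
    · rw [Ideal.span_le]
      rintro _ ⟨b, hb, rfl⟩
      obtain ⟨c, rfl⟩ := Submodule.mem_span_singleton.1 hb
      rw [map_smul]
      rw [MvPolynomial.smul_eq_C_mul]
      exact Ideal.mul_mem_left _ _ (Ideal.mem_span_singleton_self _)
    · rw [Ideal.span_le, Set.singleton_subset_iff]
      exact Ideal.subset_span ⟨a, Submodule.mem_span_singleton_self a, rfl⟩
  rw [h2] at this
  exact (Ideal.span_singleton_prime (fun h => ha (lf_inj (by rw [h, map_zero])))).1 this

theorem lf_dvd (a b : ι → K) (h : lf a ∣ lf b) : b ∈ Submodule.span K {a} := by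
  apply lf_ideal_mem
  have : lf a ∈ Ideal.span (lf '' (Submodule.span K {a} : Set (ι → K))) :=
    Ideal.subset_span ⟨a, Submodule.mem_span_singleton_self a, rfl⟩
  obtain ⟨c, hc⟩ := h
  rw [hc]; exact Ideal.mul_mem_right _ _ this
end
end DP
end

noncomputable section
namespace DP
set_option linter.all false
open MvPolynomial

theorem good_basis {K ι : Type*} [Field K] [Infinite K] [Fintype ι] [DecidableEq ι] (T : MvPolynomial ι K) (hT : T ≠ 0) :
    ∃ b : Module.Basis ι K (ι → K), ∀ i, eval (b i) T ≠ 0 := by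
  classical
  set s : Set (ι → K) := {p | eval p T ≠ 0} with hs
  have hsp : ⊤ ≤ Submodule.span K s := by
    by_contra hcon
    have hlt : Submodule.span K s < ⊤ := lt_of_le_of_ne le_top (fun h => hcon h.ge)
    obtain ⟨f, hf0, hf⟩ := Submodule.exists_le_ker_of_lt_top _ hlt
    set l : MvPolynomial ι K := lf (fun i => f (Pi.single i 1)) with hl
    have hev : ∀ p, eval p l = f p := by
      intro p
      rw [hl, lf_apply, map_sum]
      conv_rhs => rw [← LinearMap.sum_single_apply (fun _ : ι => K) p, map_sum]
      refine Finset.sum_congr rfl fun i _ => ?_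
      have : (Pi.single i (p i) : ι → K) = p i • (Pi.single i (1:K)) := by
        ext j; simp [Pi.single_apply]
      rw [this, map_smul]
      simp [mul_comm]
    have hTl : T * l = 0 := by
      apply MvPolynomial.funext
      intro p
      rw [map_mul, map_zero, hev]
      by_cases hp : eval p T = 0
      · rw [hp, zero_mul]
      · have : f p = 0 := hf (Submodule.subset_span hp)
        rw [this, mul_zero]
    rcases mul_eq_zero.1 hTl with h | h
    · exact hT h
    · apply hf0
      ext i
      have := hev (Pi.single i 1)
      rw [h, map_zero] at this
      simpa using this.symm
  set b0 := Module.Basis.ofSpan hsp with hb0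
  have hsub := Module.Basis.ofSpan_subset hsp
  set e := b0.indexEquiv (Pi.basisFun K ι)
  refine ⟨b0.reindex e, fun i => ?_⟩
  rw [Module.Basis.reindex_apply]
  exact hsub ⟨_, rfl⟩

section
variable {K ι : Type*} [Field K] [Fintype ι] [DecidableEq ι]

/-- linear substitution -/
def lsub (M : Matrix ι ι K) : MvPolynomial ι K →ₐ[K] MvPolynomial ι K := aeval fun j => lf (fun i => M i j)

theorem aeval_lsub {A : Type*} [CommRing A] [Algebra K A] (M : Matrix ι ι K) (y : ι → A) (P : MvPolynomial ι K) :
    aeval y (lsub M P) = aeval (fun j => ∑ i, algebraMap K A (M i j) * y i) P := by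
  have : (aeval y).comp (lsub M) = aeval (fun j => ∑ i, algebraMap K A (M i j) * y i) := by
    apply algHom_ext
    intro j
    simp [lsub, lf_apply]
  exact DFunLike.congr_fun this P

theorem lsub_comp (M N : Matrix ι ι K) (h : N * M = 1) (P : MvPolynomial ι K) : lsub N (lsub M P) = P := by
  have : (lsub N).comp (lsub M) = AlgHom.id K _ := by
    apply algHom_ext
    intro j
    simp only [AlgHom.comp_apply, lsub, aeval_X]
    rw [aeval_lf]
    simp only [lf_apply]
    have e1 : ∀ k, ∑ x, N k x * M x j = (1 : Matrix ι ι K) k j := fun k => by rw [← h, Matrix.mul_apply]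
    simp only [AlgHom.id_apply]
    simp only [algebraMap_eq, Finset.mul_sum, ← mul_assoc, ← C_mul]
    rw [Finset.sum_comm]
    have e2 : ∀ k, ∑ x, (C (M x j * N k x) * X k : MvPolynomial ι K) = C ((1 : Matrix ι ι K) k j) * X k := by
      intro k
      rw [← Finset.sum_mul, ← map_sum, ← e1 k]
      simp only [mul_comm]
    rw [Finset.sum_congr rfl fun k _ => e2 k, Finset.sum_eq_single j]
    · simp
    · intro k _ hk; simp [Matrix.one_apply, hk]
    · simp
  exact DFunLike.congr_fun this P

theorem lsub_hom (M : Matrix ι ι K) (P : MvPolynomial ι K) (n : ℕ) (hP : P.IsHomogeneous n) : (lsub M P).IsHomogeneous n := by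
  letI : GradedAlgebra (homogeneousSubmodule ι K) := MvPolynomial.gradedAlgebra
  have := aeval_mem (homogeneousSubmodule ι K) (y := fun j => (lf (fun i => M i j) : MvPolynomial ι K)) (fun i => lf_hom _) P n hP
  exact this

theorem eval_lsub (M : Matrix ι ι K) (P : MvPolynomial ι K) (e : ι) : eval (Pi.single e 1) (lsub M P) = eval (M e) P := by
  have : (eval (Pi.single e 1) : MvPolynomial ι K →+* K) (lsub M P) = aeval (Pi.single e (1:K)) (lsub M P) := by rw [aeval_eq_eval]
  rw [this, aeval_lsub, aeval_eq_eval]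
  have h : (fun j => ∑ i, algebraMap K K (M i j) * (Pi.single e (1:K) : ι → K) i) = M e := by
    funext j
    rw [Finset.sum_eq_single e] <;> simp +contextual
  rw [h]

variable {A : Type*} [CommRing A] [Algebra K A]

structure NN (𝒜 : ℕ → Submodule K A) (y : ι → A) (θ : A) (n : ℕ) (c : ℕ → MvPolynomial ι K) (H : MvPolynomial ι K) : Prop where
  hy1 : ∀ i, y i ∈ 𝒜 1
  hθ : θ ∈ 𝒜 1
  ind : AlgebraicIndependent K y
  int : ∀ x : A, (aeval y : MvPolynomial ι K →ₐ[K] A).toRingHom.IsIntegralElem x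
  hc : ∀ i, (c i).IsHomogeneous i
  root : (gpol n c).eval₂ (aeval y : MvPolynomial ι K →ₐ[K] A).toRingHom θ = 0
  tind : ∀ P : ℕ → MvPolynomial ι K, ∑ i ∈ Finset.range n, aeval y (P i) * θ ^ i = 0 → ∀ i < n, P i = 0
  gen : ∀ x : A, ∃ (D : MvPolynomial ι K) (P : ℕ → MvPolynomial ι K), D ≠ 0 ∧
      aeval y D * x = ∑ i ∈ Finset.range n, aeval y (P i) * θ ^ i
  hH : ∃ a b : Polynomial (MvPolynomial ι K), a * gpol n c + b * (gpol n c).derivative = Polynomial.C H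
  H0 : H ≠ 0

theorem NN.change {𝒜 : ℕ → Submodule K A} {y : ι → A} {θ : A} {n : ℕ} {c : ℕ → MvPolynomial ι K} {H : MvPolynomial ι K}
    (h : NN 𝒜 y θ n c H) (M N : Matrix ι ι K) (hMN : M * N = 1) (hNM : N * M = 1) :
    (∀ P, aeval (fun j => ∑ i, algebraMap K A (N i j) * y i) (lsub M P) = aeval y P) ∧
    NN 𝒜 (fun j => ∑ i, algebraMap K A (N i j) * y i) θ n (fun i => lsub M (c i)) (lsub M H) := by
  set y' : ι → A := fun j => ∑ i, algebraMap K A (N i j) * y i with hy'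
  have h1 : ∀ P, aeval y' P = aeval y (lsub N P) := fun P => (aeval_lsub N y P).symm
  have h2 : ∀ P, aeval y' (lsub M P) = aeval y P := fun P => by rw [h1, lsub_comp M N hNM]
  have hinjM : ∀ P, lsub M P = 0 → P = 0 := fun P hP => by rw [← lsub_comp M N hNM P, hP, map_zero]
  have hinjN : ∀ P, lsub N P = 0 → P = 0 := fun P hP => by rw [← lsub_comp N M hMN P, hP, map_zero]
  refine ⟨h2, ?_⟩
  have hcomp : (aeval y' : MvPolynomial ι K →ₐ[K] A).toRingHom.comp (lsub M).toRingHom = (aeval y : MvPolynomial ι K →ₐ[K] A).toRingHom := by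
    apply RingHom.ext; intro P; exact h2 P
  have hgm : gpol n (fun i => lsub M (c i)) = (gpol n c).map (lsub M).toRingHom := (gpol_map _ _ _).symm
  constructor
  · intro i
    refine Submodule.sum_mem _ fun j _ => ?_
    rw [← Algebra.smul_def]
    exact Submodule.smul_mem _ _ (h.hy1 j)
  · exact h.hθ
  · rw [algebraicIndependent_iff]
    intro P hP
    rw [h1] at hP
    exact hinjN P (algebraicIndependent_iff.1 h.ind _ hP)
  · intro x
    obtain ⟨p, hp, hx⟩ := h.int x
    refine ⟨p.map (lsub M).toRingHom, hp.map _, ?_⟩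
    rw [Polynomial.eval₂_map, hcomp]; exact hx
  · exact fun i => lsub_hom M _ _ (h.hc i)
  · rw [hgm, Polynomial.eval₂_map, hcomp]; exact h.root
  · intro P hP i hi
    simp only [h1] at hP
    exact hinjN _ (h.tind (fun i => lsub N (P i)) hP i hi)
  · intro x
    obtain ⟨D, P, hD, hx⟩ := h.gen x
    refine ⟨lsub M D, fun i => lsub M (P i), fun h0 => hD (hinjM _ h0), ?_⟩
    simp only [h2]; exact hx
  · obtain ⟨a, b, hab⟩ := h.hH
    refine ⟨a.map (lsub M).toRingHom, b.map (lsub M).toRingHom, ?_⟩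
    rw [hgm, Polynomial.derivative_map, ← Polynomial.map_mul, ← Polynomial.map_mul, ← Polynomial.map_add, hab, Polynomial.map_C]
    rfl
  · exact fun h0 => h.H0 (hinjM _ h0)

/-- base change to coordinates in which all coordinate points are good -/
theorem NN.good [Infinite K] {𝒜 : ℕ → Submodule K A} {y : ι → A} {θ : A} {n : ℕ} {c : ℕ → MvPolynomial ι K} {H : MvPolynomial ι K}
    (h : NN 𝒜 y θ n c H) (T : MvPolynomial ι K) (hT : T ≠ 0) :
    ∃ (M N : Matrix ι ι K) (y' : ι → A), M * N = 1 ∧ N * M = 1 ∧ (∀ P, aeval y' (lsub M P) = aeval y P) ∧ (∀ P, aeval y (lsub N P) = aeval y' P) ∧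
      NN 𝒜 y' θ n (fun i => lsub M (c i)) (lsub M H) ∧ (∀ e, eval (Pi.single e 1) (lsub M H) ≠ 0) ∧ (∀ e, eval (M e) T ≠ 0) := by
  obtain ⟨b, hb⟩ := good_basis (H * T) (mul_ne_zero h.H0 hT)
  set M : Matrix ι ι K := fun i j => b i j with hM
  have hM1 : M = ((Pi.basisFun K ι).toMatrix b).transpose := by
    ext i j; simp [hM, Module.Basis.toMatrix_apply, Matrix.transpose_apply]
  set N : Matrix ι ι K := (b.toMatrix (Pi.basisFun K ι)).transpose with hN
  have hMN : M * N = 1 := by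
    rw [hM1, hN, ← Matrix.transpose_mul, Module.Basis.toMatrix_mul_toMatrix_flip, Matrix.transpose_one]
  have hNM : N * M = 1 := by
    rw [hM1, hN, ← Matrix.transpose_mul, Module.Basis.toMatrix_mul_toMatrix_flip, Matrix.transpose_one]
  obtain ⟨h1, h2⟩ := h.change M N hMN hNM
  refine ⟨M, N, _, hMN, hNM, h1, fun P => aeval_lsub N y P, h2, fun e => ?_, fun e => ?_⟩
  · rw [eval_lsub]
    have := hb e
    rw [map_mul] at this
    exact left_ne_zero_of_mul this
  · have := hb e
    rw [map_mul] at this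
    exact right_ne_zero_of_mul this
end
end DP
end

noncomputable section
namespace DP
set_option linter.all false
open MvPolynomial

section
variable {K L ι o : Type*} [Field K] [Field L] [Algebra K L] [Fintype ι] [DecidableEq ι] [Fintype o]

structure Setup (K : Type*) {L ι o : Type*} [Field K] [Field L] [Algebra K L] [Fintype ι] [DecidableEq ι] [Fintype o]
    (y : ι → L) (z : o → L) : Prop where
  hy : AlgebraicIndependent K y
  AC : ∀ e v, IsIntegral (ke K y e) v → v ∈ ke K y e
  hz : ∀ j, HI1 K y (z j)
  hz0 : ∀ (a : o → K) (P : MvPolynomial ι K), ∑ j, algebraMap K L (a j) * z j = aeval y P → a = 0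

def uu (z : o → L) : Option o → L := fun a => a.elim 1 z
@[simp] theorem uu_none (z : o → L) : uu z none = 1 := rfl
@[simp] theorem uu_some (z : o → L) (j : o) : uu z (some j) = z j := rfl

theorem totalDegree_le_iff {σ : Type*} {R : Type*} [CommRing R] {P : MvPolynomial σ R} {n : ℕ} :
    P.totalDegree ≤ n ↔ ∀ m ∈ P.support, m.degree ≤ n := by
  rw [totalDegree, Finset.sup_le_iff]; rfl

theorem mod_deg0 (e : ι) (P : MvPolynomial ι K) : degreeOf e (P.modMonomial (Finsupp.single e 1)) = 0 := by
  rw [degreeOf_eq_zero_iff]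
  intro m hm
  by_contra h
  have := coeff_modMonomial_of_le (s := Finsupp.single e 1) (s' := m) P (by
    rw [Finsupp.single_le_iff]; omega)
  exact mem_support_iff.1 hm this

theorem divmod_aeval (y : ι → L) (e : ι) (P : MvPolynomial ι K) :
    aeval y P = y e * aeval y (P.divMonomial (Finsupp.single e 1)) + aeval y (P.modMonomial (Finsupp.single e 1)) := by
  conv_lhs => rw [← divMonomial_add_modMonomial_single P e]
  simp

theorem div_totalDegree (e : ι) (P : MvPolynomial ι K) (n : ℕ) (h : P.totalDegree ≤ n + 1) :
    (P.divMonomial (Finsupp.single e 1)).totalDegree ≤ n := by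
  rw [totalDegree_le_iff]
  intro m hm
  have hm := mem_support_iff.1 hm
  rw [coeff_divMonomial] at hm
  have := (totalDegree_le_iff.1 h) _ (mem_support_iff.2 hm)
  have h2 : (Finsupp.single e 1 + m).degree = 1 + m.degree := by simp [map_add]
  omega

theorem indep {y : ι → L} {z : o → L} (S : Setup K y z) (n : ℕ) : ∀ (P : o → MvPolynomial ι K) (P0 : MvPolynomial ι K),
    (∀ j, (P j).totalDegree ≤ n) → ∑ j, aeval y (P j) * z j = aeval y P0 → P = 0 := by
  induction n with
  | zero =>
    intro P P0 hP h
    have h1 : ∀ j, P j = C (coeff 0 (P j)) := fun j => totalDegree_eq_zero_iff_eq_C.1 (Nat.le_zero.1 (hP j))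
    have := S.hz0 (fun j => coeff 0 (P j)) P0 (by
      rw [← h]; refine Finset.sum_congr rfl fun j _ => ?_
      conv_rhs => rw [h1 j]
      simp)
    ext1 j
    rw [h1 j, congrFun this j]; simp
  | succ n ih =>
    intro P P0 hP h
    have key : ∀ e, (fun j => (P j).divMonomial (Finsupp.single e 1)) = 0 := by
      intro e
      have h0 : y e ≠ 0 := ne_zero_of_tr (tr_ke S.hy e)
      set v := aeval y (P0.divMonomial (Finsupp.single e 1)) - ∑ j, aeval y ((P j).divMonomial (Finsupp.single e 1)) * z j with hv
      have h1 : y e * v = ∑ j, aeval y ((P j).modMonomial (Finsupp.single e 1)) * z j - aeval y (P0.modMonomial (Finsupp.single e 1)) := by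
        have h2 := h
        rw [divmod_aeval y e P0] at h2
        simp only [fun j => divmod_aeval y e (P j), add_mul, Finset.sum_add_distrib] at h2
        rw [hv, mul_sub, Finset.mul_sum]
        simp only [← mul_assoc]
        linear_combination -h2
      have hvI : Int K y v := (Int.pol y _).sub (Int.sum _ _ fun j _ => (Int.pol y _).mul (S.hz j).Int)
      have hB : BB (ke K y e) (y e) 0 v := by
        refine ⟨hvI.IP e, ?_⟩
        have : v / y e ^ 0 = ∑ j, aeval y ((P j).modMonomial (Finsupp.single e 1)) * (z j / y e ^ 1) - aeval y (P0.modMonomial (Finsupp.single e 1)) * (y e)⁻¹ ^ 1 := by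
          rw [pow_zero, div_one, pow_one, pow_one]
          have : v = (y e * v) / y e := by field_simp
          rw [this, h1, sub_div, Finset.sum_div, ← div_eq_mul_inv]
          simp only [mul_div_assoc]
        rw [this]
        refine (EI.sum _ _ fun j _ => ?_).sub ?_
        · exact (EI.const (k := ke K y e) (y e) ⟨_, pol_mem_of_deg0 y e _ (mod_deg0 e (P j))⟩).mul ((S.hz j).BB S.hy e).2
        · exact (EI.const (k := ke K y e) (y e) ⟨_, pol_mem_of_deg0 y e _ (mod_deg0 e P0)⟩).mul (EI.ipow _ _)
      have hk := S.AC e v (B0_alg (tr_ke S.hy e) hB)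
      obtain ⟨M, N, hM, -, -, hMN⟩ := clear_ke1 S.hy e v hk
      obtain ⟨Q, hQ⟩ := int_F S.hy hvI M N hM hMN
      refine ih _ (P0.divMonomial (Finsupp.single e 1) - Q) (fun j => div_totalDegree e _ n (hP j)) ?_
      rw [map_sub, hQ, hv]; ring
    refine ih P P0 (fun j => ?_) h
    rw [totalDegree_le_iff]
    intro m hm
    by_contra hc
    have hm0 : m ≠ 0 := by rintro rfl; simp at hc
    obtain ⟨e, he⟩ := Finsupp.ne_iff.1 hm0
    have h3 := congrArg (coeff (m - Finsupp.single e 1)) (congrFun (key e) j)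
    rw [coeff_divMonomial] at h3
    rw [add_comm, Finsupp.sub_add_single_one_cancel he] at h3
    exact mem_support_iff.1 hm h3

theorem Setup.indep' {y : ι → L} {z : o → L} (S : Setup K y z) (P : Option o → MvPolynomial ι K)
    (h : ∑ j, aeval y (P j) * uu z j = 0) : P = 0 := by
  rw [Fintype.sum_option] at h
  simp only [uu_none, uu_some, mul_one] at h
  have h1 := indep S (Finset.univ.sup fun j => (P (some j)).totalDegree) (fun j => P (some j)) (-P none)
    (fun j => Finset.le_sup (f := fun j => (P (some j)).totalDegree) (Finset.mem_univ j)) (by rw [map_neg]; linear_combination h)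
  have h2 : ∀ j, P (some j) = 0 := fun j => congrFun h1 j
  funext j
  rcases j with _ | j
  · simp only [h2, map_zero, zero_mul, Finset.sum_const_zero, add_zero] at h
    exact (map_eq_zero_iff (aeval y) S.hy).1 h
  · exact h2 j

theorem Setup.indep2 {y : ι → L} {z : o → L} (S : Setup K y z) (P Q : Option o → MvPolynomial ι K)
    (h : ∑ j, aeval y (P j) * uu z j = ∑ j, aeval y (Q j) * uu z j) : P = Q := by
  rw [← sub_eq_zero]
  apply S.indep'
  simp only [Pi.sub_apply, map_sub, sub_mul, Finset.sum_sub_distrib, h, sub_self]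

def nn : Option o → ℕ := fun a => a.elim 0 (fun _ => 1)

theorem BB_uu {y : ι → L} {z : o → L} (S : Setup K y z) (e : ι) (i : Option o) : BB (ke K y e) (y e) (nn i) (uu z i) := by
  rcases i with _ | j
  · simpa [nn, uu] using BB.const (y e) (1 : ke K y e)
  · exact (S.hz j).BB S.hy e

theorem star1 {y : ι → L} {z : o → L} (S : Setup K y z) (e : ι) (a : Option o → ke K y e)
    (h : BB (ke K y e) (y e) (1-1) (∑ i, algebraMap (ke K y e) L (a i) * y e ^ (1 - nn i) * uu z i)) : a = 0 := by
  have hk := S.AC e _ (B0_alg (tr_ke S.hy e) h)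
  rw [Fintype.sum_option] at hk
  simp only [nn, Option.elim, uu_none, uu_some, mul_one, Nat.sub_zero, pow_one, Nat.sub_self, pow_zero] at hk
  set v := algebraMap (ke K y e) L (a none) * y e + ∑ j, algebraMap (ke K y e) L (a (some j)) * z j with hv
  obtain ⟨M, N, hM, -, -, hMN⟩ := clear_ke S.hy e (o := Option (Option o)) (fun i => i.elim v (fun i => (a i : L)))
    (by rintro (_ | i); exacts [hk, (a i).2])
  have h1 : ∀ i, aeval y M * (a i : L) = aeval y (N (some i)) := fun i => hMN (some i)
  have h2 : aeval y M * v = aeval y (N none) := hMN none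
  have hM' : aeval y M ≠ 0 := fun h => hM ((map_eq_zero_iff (aeval y) S.hy).1 h)
  have h3 := S.indep' (fun i => i.elim (N (some none) * X e - N none) (fun j => N (some (some j)))) (by
    rw [Fintype.sum_option]
    simp only [Option.elim, uu_none, uu_some, mul_one, map_sub, map_mul, aeval_X, ← h1, ← h2]
    rw [hv, mul_add, Finset.mul_sum]
    simp only [mul_assoc]
    simp only [IntermediateField.algebraMap_apply]
    ring)
  have h4 : ∀ j, a (some j) = 0 := by
    intro j
    have : N (some (some j)) = 0 := congrFun h3 (some j)
    have h5 := h1 (some j)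
    rw [this, map_zero, mul_eq_zero] at h5
    exact Subtype.ext (h5.resolve_left hM')
  have h5 : a none = 0 := by
    simp only [h4, map_zero, zero_mul, Finset.sum_const_zero, add_zero] at hv
    by_contra h0
    refine tr_ke S.hy e ?_
    have h6 : y e = algebraMap (ke K y e) L ((a none)⁻¹ * ⟨v, hk⟩) := by
      rw [map_mul, map_inv₀]
      rw [eq_inv_mul_iff_mul_eq₀ (by simpa using h0), ← hv]; rfl
    rw [h6]
    exact isAlgebraic_algebraMap _
  funext i
  rcases i with _ | j
  exacts [h5, h4 j]

theorem dstar1 {y : ι → L} {z : o → L} (S : Setup K y z) (e : ι) (x : L) (h : BB (ke K y e) (y e) (1-1) x) :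
    ∃ f : Option o → Polynomial (ke K y e), x = ∑ i, Polynomial.aeval (y e) (f i) * uu z i := by
  have hk := S.AC e _ (B0_alg (tr_ke S.hy e) h)
  refine ⟨fun i => i.elim (Polynomial.C ⟨x, hk⟩) 0, ?_⟩
  rw [Fintype.sum_option]
  simp

theorem nn_le (i : Option o) : nn i ≤ 1 := by rcases i with _ | j <;> simp [nn]

theorem L2_int {y : ι → L} {z : o → L} (S : Setup K y z) (e : ι) (x : L) (hx : IP (ke K y e) (y e) x) (Q : Polynomial (ke K y e)) (hQ : Q ≠ 0)
    (f : Option o → Polynomial (ke K y e)) (h : Polynomial.aeval (y e) Q * x = ∑ i, Polynomial.aeval (y e) (f i) * uu z i) :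
    ∃ f : Option o → Polynomial (ke K y e), x = ∑ i, Polynomial.aeval (y e) (f i) * uu z i :=
  ls_int (tr_ke S.hy e) (uu z) nn 1 le_rfl nn_le (BB_uu S e) (dstar1 S e) Q hQ x hx f h

theorem phi_ne {y : ι → L} (hy : AlgebraicIndependent K y) (e : ι) {D : MvPolynomial ι K} (hD : D ≠ 0) : phi K y e D ≠ 0 := by
  intro h
  have := phi_aeval y e D
  rw [h, map_zero] at this
  exact hD ((map_eq_zero_iff (aeval y) hy).1 this.symm)

theorem deg_le_of_dvd {e : ι} {a b : MvPolynomial ι K} (hb : b ≠ 0) (h : a ∣ b) : degreeOf e a ≤ degreeOf e b := by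
  obtain ⟨c, rfl⟩ := h
  rw [degreeOf_mul_eq (left_ne_zero_of_mul hb) (right_ne_zero_of_mul hb)]; omega

theorem sat_ufd (D P : MvPolynomial ι K) (hD : D ≠ 0)
    (h : ∀ e, ∃ M, M ≠ 0 ∧ degreeOf e M = 0 ∧ D ∣ M * P) : D ∣ P := by
  obtain ⟨a, b, c, hr, h1, h2⟩ := UniqueFactorizationMonoid.exists_reduced_factors D hD P
  have hc : c ≠ 0 := by rintro rfl; simp at h1; exact hD h1.symm
  have ha : a ≠ 0 := by rintro rfl; simp at h1; exact hD h1.symm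
  have h3 : ∀ e, degreeOf e a = 0 := by
    intro e
    obtain ⟨M, hM, hM0, hd⟩ := h e
    rw [← h1, ← h2, mul_left_comm, mul_dvd_mul_iff_left hc] at hd
    have := deg_le_of_dvd (e := e) hM (hr.dvd_of_dvd_mul_right hd)
    omega
  have h4 : a = C (coeff 0 a) := by
    ext m
    rw [coeff_C]
    split_ifs with hm
    · rw [hm]
    · by_contra hc
      apply hm; symm
      ext e
      exact (degreeOf_eq_zero_iff e a).1 (h3 e) m (mem_support_iff.2 hc)
  have h5 : coeff 0 a ≠ 0 := by intro h0; rw [h0] at h4; simp at h4; exact ha h4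
  have h6 : IsUnit a := by rw [h4]; exact (IsUnit.mk0 _ h5).map C
  rw [← h1, ← h2]
  exact mul_dvd_mul_left c h6.dvd

theorem Setup.sat {y : ι → L} {z : o → L} (S : Setup K y z) (x : L) (hx : Int K y x) (D : MvPolynomial ι K) (hD : D ≠ 0)
    (P : Option o → MvPolynomial ι K) (h : aeval y D * x = ∑ i, aeval y (P i) * uu z i) :
    ∃ N : Option o → MvPolynomial ι K, x = ∑ i, aeval y (N i) * uu z i := by
  have hD' : aeval y D ≠ 0 := fun h => hD ((map_eq_zero_iff (aeval y) S.hy).1 h)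
  have : ∀ i, D ∣ P i := by
    intro i
    refine sat_ufd D (P i) hD fun e => ?_
    obtain ⟨f, hf⟩ := L2_int S e x (hx.IP e) (phi K y e D) (phi_ne S.hy e hD) (fun i => phi K y e (P i))
      (by simpa only [phi_aeval] using h)
    obtain ⟨M, N, hM, hM0, -, hMN⟩ := clear_poly S.hy e f
    refine ⟨M, hM, hM0, N i, ?_⟩
    have := S.indep2 (fun i => M * P i) (fun i => D * N i) (by
      simp only [map_mul, ← hMN]
      have h1 := congrArg (fun t => aeval y M * t) h
      simp only [Finset.mul_sum] at h1
      simp only [mul_assoc]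
      rw [← h1, hf, Finset.mul_sum, Finset.mul_sum]
      refine Finset.sum_congr rfl fun j _ => by ring)
    exact congrFun this i
  choose N hN using this
  refine ⟨N, mul_left_cancel₀ hD' ?_⟩
  rw [h, Finset.mul_sum]
  refine Finset.sum_congr rfl fun i _ => ?_
  rw [hN i, map_mul, mul_assoc]

end
end DP
end

noncomputable section
namespace DP
set_option linter.all false
open MvPolynomial

section
variable {K L ι o : Type*} [Field K] [Field L] [Algebra K L] [Fintype ι] [DecidableEq ι] [Fintype o]

def inW (K : Type*) {L ι o : Type*} [Field K] [Field L] [Algebra K L] [Fintype ι] [DecidableEq ι] [Fintype o]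
   (y : ι → L) (z : o → L) (e : ι) (x : L) : Prop :=
  ∃ f : Option o → Polynomial (ke K y e), x = ∑ i, Polynomial.aeval (y e) (f i) * uu z i

theorem L3 {y : ι → L} {z : o → L} (S : Setup K y z) (e : ι) {J : Type*} [Fintype J] (xs : J → L)
    (hx : ∀ i, BB (ke K y e) (y e) 2 (xs i)) (i0 : J)
    (hi0 : ∀ (D : MvPolynomial ι K) (P : Option o → MvPolynomial ι K), D ≠ 0 → aeval y D * xs i0 ≠ ∑ i, aeval y (P i) * uu z i)
    (hrank : ∀ x1 x2 : L, ∃ (D1 D2 : MvPolynomial ι K) (P : Option o → MvPolynomial ι K), (D1 ≠ 0 ∨ D2 ≠ 0) ∧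
      aeval y D1 * x1 + aeval y D2 * x2 = ∑ i, aeval y (P i) * uu z i) :
    ∃ F : J → MvPolynomial ι K, (∃ i, F i ≠ 0) ∧ (∀ i, degreeOf e (F i) ≤ 1) ∧ ∃ M : MvPolynomial ι K, M ≠ 0 ∧
      ∀ i k, ∃ P : Option o → MvPolynomial ι K,
        aeval y M * (aeval y (F k) * xs i - aeval y (F i) * xs k) = ∑ i, aeval y (P i) * uu z i := by
  classical
  have htr := tr_ke S.hy e
  have hi0' : ¬ inW K y z e (xs i0) := by
    rintro ⟨f, hf⟩
    obtain ⟨M, N, hM, hM0, -, hMN⟩ := clear_poly S.hy e f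
    refine hi0 M N hM ?_
    rw [hf, Finset.mul_sum]
    simp only [← hMN, mul_assoc]
  have hex : ∃ b, ∃ w, BB (ke K y e) (y e) b w ∧ ¬ inW K y z e w := ⟨2, _, hx i0, hi0'⟩
  obtain ⟨w, hw, hwW⟩ := Nat.find_spec hex
  have hmin := fun m => Nat.find_min hex (m := m)
  set b := Nat.find hex with hbdef
  have hb1 : 1 ≤ b := by
    by_contra h
    have : b = 0 := by omega
    rw [this] at hw
    exact hwW (dstar1 S e w hw)
  have hsmall : ∀ x, BB (ke K y e) (y e) (b-1) x → inW K y z e x := by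
    intro x hx
    by_contra h
    exact hmin (b-1) (by omega) ⟨x, hx, h⟩
  let u' : Option (Option o) → L := fun i => i.elim w (uu z)
  let n' : Option (Option o) → ℕ := fun i => i.elim b nn
  have hn' : ∀ i, n' i ≤ b := by
    rintro (_ | i)
    · exact le_rfl
    · exact (nn_le i).trans hb1
  have hu' : ∀ i, BB (ke K y e) (y e) (n' i) (u' i) := by
    rintro (_ | i)
    · exact hw
    · exact BB_uu S e i
  have star : ∀ a : Option (Option o) → ke K y e, BB (ke K y e) (y e) (b-1) (∑ i, algebraMap (ke K y e) L (a i) * y e ^(b - n' i) * u' i) → a = 0 := by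
    intro a ha
    have hW := hsmall _ ha
    rw [Fintype.sum_option] at ha hW
    simp only [n', u', Option.elim, Nat.sub_self, pow_zero, mul_one] at ha hW
    have hsum : ∑ i, algebraMap (ke K y e) L (a (some i)) * y e ^(b - nn i) * uu z i
        = ∑ i, Polynomial.aeval (y e) (Polynomial.C (a (some i)) * Polynomial.X ^ (b - nn i)) * uu z i := by
      simp
    have h0 : a none = 0 := by
      by_contra h0
      obtain ⟨f, hf⟩ := hW
      apply hwW
      refine ⟨fun i => Polynomial.C ((a none)⁻¹) * (f i - Polynomial.C (a (some i)) * Polynomial.X ^ (b - nn i)), ?_⟩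
      have h1 : algebraMap (ke K y e) L (a none) ≠ 0 := by simpa using h0
      apply mul_left_cancel₀ h1
      rw [hsum] at hf
      rw [eq_sub_of_add_eq hf, ← Finset.sum_sub_distrib, Finset.mul_sum]
      refine Finset.sum_congr rfl fun i _ => ?_
      beta_reduce
      rw [map_mul (Polynomial.aeval (y e)) (Polynomial.C ((a none)⁻¹)), Polynomial.aeval_C, map_inv₀, mul_assoc _ _ (uu z i), mul_inv_cancel_left₀ h1, map_sub, sub_mul]
    rw [h0, map_zero, zero_mul, zero_add, hsum] at ha
    have := ls_deg htr (uu z) nn 1 le_rfl nn_le (BB_uu S e) (star1 S e) _ _ ha.2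
    funext i
    rcases i with _ | i
    · exact h0
    · have h2 := this i (b - nn i) (by have := nn_le i; omega)
      simpa using h2
  have dstar : ∀ x, BB (ke K y e) (y e) (b-1) x → ∃ f : Option (Option o) → Polynomial (ke K y e), x = ∑ i, Polynomial.aeval (y e) (f i) * u' i := by
    intro x hx
    obtain ⟨f, hf⟩ := hsmall x hx
    refine ⟨fun i => i.elim 0 f, ?_⟩
    rw [Fintype.sum_option, hf]; simp [u']
  have hfx : ∀ i, ∃ f : Option (Option o) → Polynomial (ke K y e), xs i = ∑ j, Polynomial.aeval (y e) (f j) * u' j := by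
    intro i
    obtain ⟨D1, D2, P, hD, h⟩ := hrank (xs i) w
    have hD1 : D1 ≠ 0 := by
      rintro rfl
      have hD2 : D2 ≠ 0 := by simpa using hD
      apply hwW
      exact L2_int S e w hw.1 (phi K y e D2) (phi_ne S.hy e hD2) (fun i => phi K y e (P i))
        (by simpa only [phi_aeval, map_zero, zero_mul, zero_add] using h)
    refine ls_int htr u' n' b hb1 hn' hu' dstar (phi K y e D1) (phi_ne S.hy e hD1) (xs i) (hx i).1
      (fun i => i.elim (-phi K y e D2) (fun i => phi K y e (P i))) ?_
    rw [Fintype.sum_option]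
    simp only [Option.elim, u', phi_aeval, map_neg]
    linear_combination h
  choose f hf using hfx
  have hdeg : ∀ i, (f i none).natDegree ≤ 1 := by
    intro i
    rw [Polynomial.natDegree_le_iff_coeff_eq_zero]
    intro N hN
    refine ls_deg htr u' n' b hb1 hn' hu' star (f i) 2 ?_ none N ?_
    · rw [← hf i]; exact (hx i).2
    · change 2 < N + b; omega
  obtain ⟨M, N, hM, hM0, hN, hMN⟩ := clear_poly S.hy e (o := J × Option (Option o)) (fun p => f p.1 p.2)
  have hxs : ∀ i, aeval y M * xs i = aeval y (N (i, none)) * w + ∑ j, aeval y (N (i, some j)) * uu z j := by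
    intro i
    rw [hf i, Finset.mul_sum, Fintype.sum_option]
    simp only [← hMN, u', Option.elim, mul_assoc]
  refine ⟨fun i => N (i, none), ?_, fun i => (hN (i, none)).trans (hdeg i), M, hM, ?_⟩
  · refine ⟨i0, fun h => hi0 M (fun j => N (i0, some j)) hM ?_⟩
    rw [hxs i0, show N (i0, none) = 0 from h]; simp
  · intro i k
    refine ⟨fun j => N (k, none) * N (i, some j) - N (i, none) * N (k, some j), ?_⟩
    have h1 := hxs i
    have h2 := hxs k
    simp only [map_sub, map_mul, sub_mul, Finset.sum_sub_distrib, mul_assoc, ← Finset.mul_sum]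
    linear_combination aeval y (N (k, none)) * h1 - aeval y (N (i, none)) * h2

end
end DP
end

noncomputable section
namespace DP
set_option linter.all false
open MvPolynomial

section
variable {K A L ι o : Type*} [Field K] [CommRing A] [IsDomain A] [Algebra K A] [Field L] [Algebra K L] [Algebra A L]
  [IsScalarTower K A L] [IsFractionRing A L] [Fintype ι] [DecidableEq ι] [Fintype o]

theorem aeval_L (y : ι → A) (P : MvPolynomial ι K) :
    aeval (fun i => algebraMap A L (y i)) P = algebraMap A L (aeval y P) := by
  have := aeval_algebraMap_apply (A := A) (B := L) y P
  exact this

/-- nonzero integral elements have nonzero multiples in `R` -/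
theorem mult_in_R {y : ι → A} (hy : AlgebraicIndependent K y) (b : A) (hb : b ≠ 0)
    (hi : (aeval y : MvPolynomial ι K →ₐ[K] A).toRingHom.IsIntegralElem b) :
    ∃ (D : MvPolynomial ι K) (b' : A), D ≠ 0 ∧ b * b' = aeval y D := by
  letI : Algebra (MvPolynomial ι K) A := (aeval y : MvPolynomial ι K →ₐ[K] A).toRingHom.toAlgebra
  have hinj : Function.Injective (algebraMap (MvPolynomial ι K) A) := hy
  have hi' : IsIntegral (MvPolynomial ι K) b := hi
  have halg : IsAlgebraic (MvPolynomial ι K) b := hi'.isAlgebraic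
  obtain ⟨D, hD, q, hq⟩ := halg.exists_nonzero_dvd (mem_nonZeroDivisors_of_ne_zero hb)
  exact ⟨D, q, hD, hq.symm⟩

theorem NN.genL {𝒜 : ℕ → Submodule K A} {y : ι → A} {θ : A} {n : ℕ} {c : ℕ → MvPolynomial ι K} {H : MvPolynomial ι K}
    (h : NN 𝒜 y θ n c H) (v : L) : ∃ (D : MvPolynomial ι K) (P : ℕ → MvPolynomial ι K), D ≠ 0 ∧
      aeval (fun i => algebraMap A L (y i)) D * v = ∑ i ∈ Finset.range n, aeval (fun i => algebraMap A L (y i)) (P i) * (algebraMap A L θ) ^ i := by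
  obtain ⟨a, b, hb, rfl⟩ := IsFractionRing.div_surjective (A := A) v
  have hb0 : b ≠ 0 := nonZeroDivisors.ne_zero hb
  obtain ⟨D, b', hD, hbb⟩ := mult_in_R h.ind b hb0 (h.int b)
  obtain ⟨D', P, hD', hP⟩ := h.gen (b' * a)
  refine ⟨D' * D, P, mul_ne_zero hD' hD, ?_⟩
  have hbL : algebraMap A L b ≠ 0 := by
    simpa using hb0
  have h1 := congrArg (algebraMap A L) hP
  simp only [map_mul, map_sum, map_pow, ← aeval_L] at h1
  rw [← h1, map_mul, aeval_L (L := L) y D, ← hbb, map_mul]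
  field_simp

theorem NN.setup [IsAlgClosed K] {𝒜 : ℕ → Submodule K A} [GradedAlgebra 𝒜] {y : ι → A} {θ : A} {n : ℕ} {c : ℕ → MvPolynomial ι K} {H : MvPolynomial ι K}
    (h : NN 𝒜 y θ n c H) (hH : ∀ e, eval (Pi.single e 1) H ≠ 0) (z : o → A) (hz : ∀ j, z j ∈ 𝒜 1)
    (hz0 : ∀ (a : o → K) (b : ι → K), ∑ j, a j • z j = ∑ i, b i • y i → a = 0) :
    Setup K (fun i => algebraMap A L (y i)) (fun i => algebraMap A L (z i)) := by
  have hinj : Function.Injective (algebraMap A L) := IsFractionRing.injective A L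
  have hyL : AlgebraicIndependent K (fun i => algebraMap A L (y i)) :=
    h.ind.map' (f := IsScalarTower.toAlgHom K A L) hinj
  have hn : n ≠ 0 := by
    rintro rfl
    have := h.root
    rw [gpol_eval₂] at this
    simp at this
  constructor
  · exact hyL
  · intro e v hv
    have hmon := gpol_deg n c
    set g := (gpol n c).map (eval (Pi.single e (1:K))) with hg
    have hgm : g.Monic := hmon.1.map _
    have hgd : g.natDegree = n := by rw [hg, hmon.1.natDegree_map, hmon.2]
    obtain ⟨ζ, hζ⟩ := IsAlgClosed.exists_root g (by
      rw [Polynomial.degree_eq_natDegree hgm.ne_zero, hgd]; exact_mod_cast hn)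
    refine AC_main hyL (algebraMap A L θ) n c h.hc ?_ ?_ h.genL e ζ hζ ?_ v hv
    · have := congrArg (algebraMap A L) h.root
      rw [gpol_eval₂] at this ⊢
      simp only [map_add, map_pow, map_sum, map_mul, map_zero] at this
      rw [← this]
      congr 1
      refine Finset.sum_congr rfl fun i _ => ?_
      congr 1
      exact aeval_L y _
    · intro P hP
      simp only [aeval_L, ← map_pow, ← map_mul, ← map_sum] at hP
      exact h.tind P (hinj (by rw [hP, map_zero]))
    · obtain ⟨a, b, hab⟩ := h.hH
      intro h0
      have := congrArg (fun q => (q.map (eval (Pi.single e (1:K)))).eval ζ) hab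
      simp only [Polynomial.map_add, Polynomial.map_mul, ← Polynomial.derivative_map, Polynomial.eval_add, Polynomial.eval_mul, Polynomial.map_C, Polynomial.eval_C] at this
      rw [← hg, hζ.eq_zero, h0] at this
      simp only [mul_zero, add_zero] at this
      exact hH e this.symm
  · intro j
    obtain ⟨p, hp, hx⟩ := h.int (z j)
    obtain ⟨c', hc', hr⟩ := hom_eqn 𝒜 h.hy1 (z j) (hz j) p hp hx
    refine ⟨p.natDegree, c', hc', ?_⟩
    rw [gpol_eval₂] at hr
    have := congrArg (algebraMap A L) hr
    simp only [map_add, map_pow, map_sum, map_mul, map_zero] at this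
    rw [← this]
    congr 1
    refine Finset.sum_congr rfl fun i _ => ?_
    congr 1
    exact aeval_L y _
  · intro a P hP
    have h1 : ∑ j, a j • z j = aeval y P := by
      apply hinj
      rw [← aeval_L, ← hP, map_sum]
      refine Finset.sum_congr rfl fun j _ => ?_
      rw [Algebra.smul_def, map_mul, ← IsScalarTower.algebraMap_apply]
    have h2 := congrArg (pr 𝒜 1) h1
    rw [pr_same 𝒜 (Submodule.sum_mem _ fun j _ => Submodule.smul_mem _ _ (hz j)), pr_aeval 𝒜 h.hy1] at h2
    rw [lf_of_hom _ (homogeneousComponent_isHomogeneous 1 P), aeval_lf] at h2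
    refine hz0 a (fun i => coeff (Finsupp.single i 1) ((homogeneousComponent 1) P)) (h2.trans ?_)
    refine Finset.sum_congr rfl fun j _ => ?_
    rw [Algebra.smul_def]
end
end DP
end

noncomputable section
namespace DP
set_option linter.all false
open MvPolynomial

section
variable {R : Type*} [CommRing R] [IsDomain R] [UniqueFactorizationMonoid R]

theorem dvd_of_noprime {J : Type*} (q : J → R) (hq0 : ∃ k, q k ≠ 0) (hq : ∀ p, Prime p → ∃ k, ¬ p ∣ q k) (a : R) :
    ∀ b, (∀ k, a ∣ b * q k) → a ∣ b := by
  induction a using UniqueFactorizationMonoid.induction_on_prime with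
  | h₁ =>
    intro b h
    obtain ⟨k, hk⟩ := hq0
    have := h k
    rw [zero_dvd_iff, mul_eq_zero] at this
    rw [this.resolve_right hk]
  | h₂ x hx => intro b _; exact hx.dvd
  | h₃ a p ha hp ih =>
    intro b h
    obtain ⟨b', rfl⟩ := ih b fun k => (dvd_mul_left a p).trans (h k)
    have : p ∣ b' := by
      obtain ⟨k, hk⟩ := hq p hp
      have := h k
      rw [mul_comm p a, mul_assoc] at this
      have := (mul_dvd_mul_iff_left ha).1 this
      exact (hp.dvd_or_dvd this).resolve_right hk
    rw [mul_comm p a]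
    exact mul_dvd_mul_left a this

theorem qdiv {J : Type*} (q F : J → R) (hq0 : ∃ k, q k ≠ 0) (hq : ∀ p, Prime p → ∃ k, ¬ p ∣ q k)
    (hF : ∃ k, F k ≠ 0) (h : ∀ i k, F k * q i = F i * q k) (i : J) : q i ∣ F i ∧ (q i ≠ 0 → F i ≠ 0) := by
  constructor
  · exact dvd_of_noprime q hq0 hq _ _ fun k => ⟨F k, by rw [← h i k, mul_comm]⟩
  · intro hi hFi
    obtain ⟨k, hk⟩ := hF
    have := h i k
    rw [hFi, zero_mul] at this
    exact (mul_ne_zero hk hi) this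
end

section
variable {K ι A o : Type*} [Field K] [Fintype ι] [CommRing A] [IsDomain A] [Algebra (MvPolynomial ι K) A] [Fintype o]

local notation "RR" => MvPolynomial ι K

theorem lam_ne {z : o → A} (h : Ctx RR z) (lam : A →ₗ[RR] RR) (hl : IsLam z lam) : ∃ i j, lam (z i * z j) ≠ 0 := by
  by_contra hc
  push_neg at hc
  obtain ⟨x, hx⟩ := h.neT
  have := single_lemma h lam hl ⊥ Ideal.isPrime_bot (fun i j => by simp [hc]) x
  exact hx ((hl x).1 (by simpa using this))

theorem qdeg {z : o → A} (h : Ctx RR z) (lam : A →ₗ[RR] RR) (hl : IsLam z lam)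
    (hp : ∀ p : RR, Prime p → ∃ x, ¬ p ∣ lam x)
    (HL : ∀ q : RR, q ≠ 0 → ∃ F : o × o → RR, (∃ i, F i ≠ 0) ∧ (∀ i, q ∣ F i → F i ≠ 0 → q.totalDegree ≤ 1) ∧
      ∃ M : RR, M ≠ 0 ∧ ∀ i k : o × o, M • (F k • (z i.1 * z i.2) - F i • (z k.1 * z k.2)) ∈ WW RR z) (i j : o) :
    (lam (z i * z j)).totalDegree ≤ 1 := by
  by_cases hq : lam (z i * z j) = 0
  · simp [hq]
  obtain ⟨F, hF, hFd, M, hM, hFM⟩ := HL _ hq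
  have hk : ∀ i k : o × o, F k * lam (z i.1 * z i.2) = F i * lam (z k.1 * z k.2) := by
    intro i k
    have := (hl _).2 (hFM i k)
    rw [map_smul, map_sub, map_smul, map_smul] at this
    simp only [smul_eq_mul, mul_eq_zero, hM, false_or] at this
    exact sub_eq_zero.1 this
  have := qdiv (fun i : o × o => lam (z i.1 * z i.2)) F ⟨(i, j), hq⟩
    (fun p hpp => by
      obtain ⟨i, j, h⟩ := q_noprime h lam hl hp p hpp
      exact ⟨(i, j), h⟩) hF hk (i, j)
  exact hFd _ this.1 (this.2 hq)

theorem homog_of_deg_le_one (q : RR) (h : q.totalDegree ≤ 1) (h0 : coeff 0 q = 0) : q.IsHomogeneous 1 := by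
  intro m hm
  rw [show Finsupp.weight (1 : ι → ℕ) m = m.degree by rw [Finsupp.degree_eq_weight_one]; rfl]
  have h1 : m.degree ≤ q.totalDegree := by
    rw [Finsupp.degree_apply]
    exact le_totalDegree (mem_support_iff.2 hm)
  have h2 : m.degree ≠ 0 := by
    intro h
    rw [Finsupp.degree_eq_zero_iff] at h
    rw [h] at hm; exact hm h0
  omega

theorem q_const_or_lin {z : o → A} (h : Ctx RR z) (lam : A →ₗ[RR] RR) (hl : IsLam z lam)
    (hp : ∀ p : RR, Prime p → ∃ x, ¬ p ∣ lam x) (hd : ∀ i j, (lam (z i * z j)).totalDegree ≤ 1)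
    (π : A →+ A) (hπ : ∀ x ∈ WW RR z, π x ∈ WW RR z)
    (hπ2 : ∀ (r : RR) i j, π (r • (z i * z j)) = (C (coeff 0 r) : RR) • (z i * z j)) :
    (∃ a : o → o → K, ∀ i j, lam (z i * z j) = C (a i j)) ∨ ∃ l : o → o → (ι → K), ∀ i j, lam (z i * z j) = lf (l i j) := by
  by_cases hc : ∀ i j, coeff 0 (lam (z i * z j)) = 0
  · right
    exact ⟨_, fun i j => lf_of_hom _ (homog_of_deg_le_one _ (hd i j) (hc i j))⟩
  · left
    push_neg at hc
    obtain ⟨k, l, hkl⟩ := hc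
    set a := fun i j => coeff 0 (lam (z i * z j)) with ha
    have h1 : ∀ i j, C (a k l) * lam (z i * z j) = C (a i j) * lam (z k * z l) := by
      intro i j
      have := hπ _ (lam_comm lam hl (z i * z j) (z k * z l))
      rw [map_sub, hπ2, hπ2, ← hl, map_sub, map_smul, map_smul] at this
      exact sub_eq_zero.1 this
    have hu : IsUnit (lam (z k * z l)) := by
      by_contra hu
      have h0 : lam (z k * z l) ≠ 0 := by intro h; rw [h] at hkl; simp at hkl
      obtain ⟨p, hpi, hpd⟩ := WfDvdMonoid.exists_irreducible_factor hu h0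
      obtain ⟨i, j, hij⟩ := q_noprime h lam hl hp p hpi.prime
      apply hij
      have : p ∣ C (a k l) * lam (z i * z j) := by rw [h1]; exact hpd.mul_left _
      have hcu : IsUnit (C (a k l) : RR) := (IsUnit.mk0 _ hkl).map C
      exact hcu.dvd_mul_left.1 this
    have : ∃ b : K, lam (z k * z l) = C b := by
      have := (MvPolynomial.isUnit_iff_eq_C_of_isReduced.1 hu)
      obtain ⟨b, _, hb⟩ := this
      exact ⟨b, hb⟩
    obtain ⟨b, hb⟩ := this
    refine ⟨fun i j => (a k l)⁻¹ * a i j * b, fun i j => ?_⟩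
    have h2 := h1 i j
    rw [hb] at h2
    apply mul_left_cancel₀ (show (C (a k l) : RR) ≠ 0 by simpa using hkl)
    rw [h2, ← C_mul, ← C_mul]
    congr 1
    rw [← mul_assoc, ← mul_assoc, mul_inv_cancel₀ hkl, one_mul]

theorem e1_false [IsIntegrallyClosed A] {z : o → A} (h : Ctx RR z) (lam : A →ₗ[RR] RR) (hl : IsLam z lam)
    (hp : ∀ p : RR, Prime p → ∃ x, ¬ p ∣ lam x)
    (l : o → o → (ι → K)) (hlin : ∀ i j, lam (z i * z j) = lf (l i j)) : False := by
  classical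
  haveI := h.fin
  haveI : Algebra.IsIntegral RR A := inferInstance
  obtain ⟨a, b, hab⟩ := lam_ne h lam hl
  set u0 := l a b with hu0
  have hu00 : u0 ≠ 0 := by intro h; apply hab; rw [hlin, ← hu0, h, map_zero]
  have hp0 := lf_prime u0 hu00
  obtain ⟨c, d, hcd⟩ := q_noprime h lam hl hp _ hp0
  set u1 := l c d with hu1
  rw [hlin, ← hu1] at hcd
  set q0 : RR := lf u0 with hq0
  set q1 : RR := lf u1 with hq1
  set α := z a * z b with hα
  set β := z c * z d with hβ
  have lα : lam α = q0 := hlin a b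
  have lβ : lam β = q1 := hlin c d
  have hq00 : q0 ≠ 0 := hp0.ne_zero
  have hq10 : q1 ≠ 0 := by intro h; rw [h] at hcd; exact hcd (dvd_zero _)
  have hrel : IsRelPrime q0 q1 := (hp0.irreducible.isRelPrime_iff_not_dvd).2 hcd
  set P : Ideal RR := Ideal.span {q0, q1} with hPdef
  let U : Submodule K (ι → K) := Submodule.span K {u0, u1}
  have hPU : Ideal.span (lf '' (U : Set (ι → K))) = P := by
    apply le_antisymm
    · rw [Ideal.span_le]
      rintro _ ⟨u, hu, rfl⟩
      obtain ⟨s, t, rfl⟩ := Submodule.mem_span_pair.1 hu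
      rw [map_add, map_smul, map_smul, MvPolynomial.smul_eq_C_mul, MvPolynomial.smul_eq_C_mul]
      exact Ideal.mem_span_pair.2 ⟨_, _, rfl⟩
    · rw [hPdef, Ideal.span_le]
      rintro _ (rfl | rfl)
      · exact Ideal.subset_span ⟨u0, Submodule.subset_span (by simp), rfl⟩
      · exact Ideal.subset_span ⟨u1, Submodule.subset_span (by simp), rfl⟩
  have hP : P.IsPrime := hPU ▸ lin_prime U
  have hq0P : q0 ∈ P := Ideal.subset_span (by simp)
  have hq1P : q1 ∈ P := Ideal.subset_span (by simp)
  have hε : q1 • α - q0 • β ∈ WW RR z := by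
    have := lam_comm lam hl α β
    rwa [lα, lβ] at this
  obtain ⟨e, he⟩ := (Submodule.mem_span_range_iff_exists_fun RR).1 hε
  have huniq : ∀ f g : Option o → RR, ∑ a, f a • uA z a = ∑ a, g a • uA z a → ∀ a, f a = g a := by
    intro f g hfg a
    have := Fintype.linearIndependent_iff.1 h.li (fun a => f a - g a) (by
      simp only [sub_smul, Finset.sum_sub_distrib, hfg, sub_self]) a
    exact sub_eq_zero.1 this
  have heP : ∀ a, e a ∈ P := by
    by_cases hcase : ∃ i j, lam (z i * z j) ∉ P
    · obtain ⟨i, j, hij⟩ := hcase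
      set γ := z i * z j
      set q2 := lam γ
      have h1 : q2 • α - q0 • γ ∈ WW RR z := by
        have := lam_comm lam hl α γ
        rwa [lα] at this
      have h2 : q2 • β - q1 • γ ∈ WW RR z := by
        have := lam_comm lam hl β γ
        rwa [lβ] at this
      obtain ⟨e1, he1⟩ := (Submodule.mem_span_range_iff_exists_fun RR).1 h1
      obtain ⟨e2, he2⟩ := (Submodule.mem_span_range_iff_exists_fun RR).1 h2
      intro a
      have := huniq (fun a => q2 * e a) (fun a => q1 * e1 a - q0 * e2 a) (by
        simp only [sub_smul, mul_smul, Finset.sum_sub_distrib, ← Finset.smul_sum, he, he1, he2]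
        simp only [smul_sub, smul_smul, mul_comm q1 q0, mul_comm q2]
        abel) a
      have hm : q2 * e a ∈ P := by
        rw [this]; exact P.sub_mem (P.mul_mem_right _ hq1P) (P.mul_mem_right _ hq0P)
      exact (hP.mem_or_mem hm).resolve_left hij
    · push_neg at hcase
      have hall := single_lemma h lam hl P hP hcase
      have hlU : ∀ i j, ∃ m n : K, m • u0 + n • u1 = l i j := by
        intro i j
        have := hcase i j
        rw [hlin, ← hPU] at this
        exact Submodule.mem_span_pair.1 (lf_ideal_mem U _ this)
      choose m n hmn using hlU
      have hq : ∀ i j, lam (z i * z j) = C (m i j) * q0 + C (n i j) * q1 := by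
        intro i j
        rw [hlin, ← hmn, map_add, map_smul, map_smul, MvPolynomial.smul_eq_C_mul, MvPolynomial.smul_eq_C_mul]
      have hMN : ∀ k, (∑ i, C (m i k) * e (some i) ∈ P) ∧ (∑ i, C (n i k) * e (some i) ∈ P) := by
        intro k
        have h1 : lam ((q1 • α - q0 • β) * z k) = q1 * lam (α * z k) - q0 * lam (β * z k) := by
          rw [sub_mul, smul_mul_assoc, smul_mul_assoc, map_sub, map_smul, map_smul, smul_eq_mul, smul_eq_mul]
        have h2 : lam ((q1 • α - q0 • β) * z k) = ∑ i, e (some i) * (C (m i k) * q0 + C (n i k) * q1) := by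
          rw [← he, Finset.sum_mul, map_sum, Fintype.sum_option]
          simp only [smul_mul_assoc, map_smul, uA_none, uA_some, one_mul, smul_eq_mul, hq, (hl _).2 (z_WW z k), mul_zero, zero_add]
        rw [h1] at h2
        have h3 : q0 * (∑ i, C (m i k) * e (some i) + lam (β * z k)) = q1 * (lam (α * z k) - ∑ i, C (n i k) * e (some i)) := by
          have : ∑ i, e (some i) * (C (m i k) * q0 + C (n i k) * q1) = q0 * ∑ i, C (m i k) * e (some i) + q1 * ∑ i, C (n i k) * e (some i) := by
            rw [Finset.mul_sum, Finset.mul_sum, ← Finset.sum_add_distrib]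
            exact Finset.sum_congr rfl fun i _ => by ring
          rw [this] at h2
          linear_combination -h2
        constructor
        · have h4 : q1 ∣ (∑ i, C (m i k) * e (some i) + lam (β * z k)) :=
            hrel.symm.dvd_of_dvd_mul_left ⟨_, h3⟩
          obtain ⟨t, ht⟩ := h4
          have : ∑ i, C (m i k) * e (some i) = q1 * t - lam (β * z k) := by rw [← ht]; ring
          rw [this]
          exact P.sub_mem (P.mul_mem_right _ hq1P) (hall _)
        · have h4 : q0 ∣ (lam (α * z k) - ∑ i, C (n i k) * e (some i)) :=
            hrel.dvd_of_dvd_mul_left ⟨_, h3.symm⟩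
          obtain ⟨t, ht⟩ := h4
          have : ∑ i, C (n i k) * e (some i) = lam (α * z k) - q0 * t := by rw [← ht]; ring
          rw [this]
          exact P.sub_mem (hall _) (P.mul_mem_right _ hq0P)
      -- left inverse
      let f : (o → K) →ₗ[K] ((o → K) × (o → K)) :=
        { toFun := fun v => (fun k => ∑ i, v i * m i k, fun k => ∑ i, v i * n i k)
          map_add' := fun v w => by ext k <;> simp [add_mul, Finset.sum_add_distrib]
          map_smul' := fun s v => by ext k <;> simp [Finset.mul_sum, mul_assoc] }
      have hfker : LinearMap.ker f = ⊥ := by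
        rw [LinearMap.ker_eq_bot']
        intro v hv
        have hv1 : ∀ k, ∑ i, v i * m i k = 0 := fun k => congrFun (congrArg Prod.fst hv) k
        have hv2 : ∀ k, ∑ i, v i * n i k = 0 := fun k => congrFun (congrArg Prod.snd hv) k
        set x : A := ∑ i, (C (v i) : RR) • z i with hx
        have hxW : x ∈ WW RR z := Submodule.sum_mem _ fun i _ => Submodule.smul_mem _ _ (z_WW z i)
        obtain ⟨r, hr⟩ := nondeg h lam hl x hxW (by
          intro k
          rw [← hl, hx, Finset.sum_mul, map_sum]
          simp only [smul_mul_assoc, map_smul, hq, smul_eq_mul]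
          have : ∑ i, (C (v i) : RR) * (C (m i k) * q0 + C (n i k) * q1) = C (∑ i, v i * m i k) * q0 + C (∑ i, v i * n i k) * q1 := by
            simp only [map_sum, C_mul, Finset.sum_mul, ← Finset.sum_add_distrib]
            exact Finset.sum_congr rfl fun i _ => by ring
          rw [this, hv1, hv2]; simp)
        funext i
        have := huniq (fun a => a.elim 0 (fun i => C (v i))) (fun a => a.elim r fun _ => 0) (by
          rw [Fintype.sum_option, Fintype.sum_option]
          simp [← hx, hr, Algebra.algebraMap_eq_smul_one]) (some i)
        simpa using this
      obtain ⟨g, hg⟩ := LinearMap.exists_leftInverse_of_injective f hfker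
      have hgj : ∀ i j, ∑ k, (m i k * g (Pi.single k 1, 0) j + n i k * g (0, Pi.single k 1) j) = if i = j then 1 else 0 := by
        intro i j
        have h1 : g (f (Pi.single i 1)) = Pi.single i 1 := LinearMap.congr_fun hg _
        have h2 : f (Pi.single i 1) = ∑ k, (m i k • ((Pi.single k 1, 0) : (o → K) × (o → K)) + n i k • ((0, Pi.single k 1) : (o → K) × (o → K))) := by
          ext k <;> simp [f, Pi.single_apply, Prod.fst_sum, Prod.snd_sum, Finset.sum_apply]
        rw [h2, map_sum] at h1
        have h3 := congrFun h1 j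
        simp only [map_add, map_smul, Finset.sum_apply, Pi.add_apply, Pi.smul_apply, smul_eq_mul] at h3
        rw [h3, Pi.single_apply]
        simp only [eq_comm]
      have hsome : ∀ j, e (some j) ∈ P := by
        intro j
        have h1 : e (some j) = ∑ k, (C (g (Pi.single k 1, 0) j) * (∑ i, C (m i k) * e (some i)) + C (g (0, Pi.single k 1) j) * (∑ i, C (n i k) * e (some i))) := by
          have h2 : e (some j) = ∑ i, C (if i = j then 1 else 0) * e (some i) := by simp
          rw [h2]
          simp only [← hgj, map_sum, Finset.sum_mul, Finset.mul_sum, ← Finset.sum_add_distrib]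
          rw [Finset.sum_comm]
          refine Finset.sum_congr rfl fun k _ => Finset.sum_congr rfl fun i _ => ?_
          simp only [C_add, C_mul]; ring
        rw [h1]
        exact Ideal.sum_mem _ fun k _ => P.add_mem (P.mul_mem_left _ (hMN k).1) (P.mul_mem_left _ (hMN k).2)
      intro a
      rcases a with _ | j
      swap
      · exact hsome j
      obtain ⟨Q, hQ1, hQ2⟩ : ∃ Q : Ideal A, Q.IsPrime ∧ Q.comap (algebraMap RR A) = P := by
        obtain ⟨Q, -, hQ, hQ'⟩ := Ideal.exists_ideal_over_prime_of_isIntegral P (⊥ : Ideal A) (by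
          intro x hx
          have : algebraMap RR A x = 0 := by simpa using hx
          have : x = 0 := h.inj (by rw [this, map_zero])
          rw [this]; exact P.zero_mem)
        exact ⟨Q, hQ, hQ'⟩
      rw [← hQ2, Ideal.mem_comap]
      have hPQ : ∀ r ∈ P, ∀ x : A, r • x ∈ Q := by
        intro r hr x
        rw [Algebra.smul_def]
        apply Q.mul_mem_right
        rw [← hQ2] at hr; exact hr
      have : algebraMap RR A (e none) = (q1 • α - q0 • β) - ∑ j, e (some j) • z j := by
        rw [← he, Fintype.sum_option]
        simp [Algebra.algebraMap_eq_smul_one]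
      rw [this]
      exact Q.sub_mem (Q.sub_mem (hPQ _ hq1P _) (hPQ _ hq0P _)) (Q.sum_mem fun j _ => hPQ _ (hsome j) _)
  have hfg : ∀ a, ∃ f g, f * q0 + g * q1 = e a := fun a => Ideal.mem_span_pair.1 (heP a)
  choose f g hfg using hfg
  set bf := ∑ a, f a • uA z a
  set bg := ∑ a, g a • uA z a
  have hbg : bg ∈ WW RR z := Submodule.sum_mem _ fun a _ => Submodule.smul_mem _ _ (Submodule.subset_span ⟨a, rfl⟩)
  have h1 : q1 • (α - bg) = q0 • (β + bf) := by
    have : q1 • α - q0 • β = q0 • bf + q1 • bg := by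
      rw [← he, Finset.smul_sum, Finset.smul_sum, ← Finset.sum_add_distrib]
      refine Finset.sum_congr rfl fun a _ => ?_
      rw [← hfg, add_smul, mul_smul, mul_smul, smul_comm q0, smul_comm q1]
    rw [smul_sub, smul_add]
    linear_combination this
  obtain ⟨v, hv⟩ := coprime_lemma h.inj q0 q1 hq00 hq10 hrel _ _ h1
  have h2 : lam v = 1 := by
    have := congrArg lam hv
    rw [map_sub, lα, (hl _).2 hbg, sub_zero, map_smul, smul_eq_mul] at this
    exact mul_left_cancel₀ hq00 (by rw [mul_one]; exact this.symm)
  have h3 := single_lemma h lam hl (RingHom.ker (constantCoeff : RR →+* K)) (RingHom.ker_isPrime _) (by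
    intro i j
    rw [RingHom.mem_ker, hlin]
    simp [lf_apply]) v
  rw [h2, RingHom.mem_ker, map_one] at h3
  exact one_ne_zero h3
end
end DP
end

noncomputable section
namespace DP
set_option linter.all false
open MvPolynomial

section
variable {K A ι o : Type*} [Field K] [CommRing A] [IsDomain A] [Algebra K A]
  [Fintype ι] [DecidableEq ι] [Fintype o] [Algebra (MvPolynomial ι K) A]

local notation "RR" => MvPolynomial ι K
local notation "LL" => FractionRing A

theorem mem_WW_iff {y : ι → A} (halg : ∀ P : RR, algebraMap RR A P = aeval y P) (z : o → A) (x : A) :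
    x ∈ WW RR z ↔ ∃ P : Option o → RR, x = ∑ i, aeval y (P i) * uA z i := by
  rw [WW, Submodule.mem_span_range_iff_exists_fun]
  constructor
  · rintro ⟨c, rfl⟩
    exact ⟨c, Finset.sum_congr rfl fun i _ => by rw [Algebra.smul_def, halg]⟩
  · rintro ⟨c, rfl⟩
    exact ⟨c, Finset.sum_congr rfl fun i _ => by rw [Algebra.smul_def, halg]⟩

theorem uu_uA (z : o → A) (i : Option o) : uu (fun i => algebraMap A LL (z i)) i = algebraMap A LL (uA z i) := by
  rcases i with _ | j
  · simp
  · simp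

theorem sumL (y : ι → A) (z : o → A) (P : Option o → RR) :
    ∑ i, aeval (fun i => algebraMap A LL (y i)) (P i) * uu (fun i => algebraMap A LL (z i)) i = algebraMap A LL (∑ i, aeval y (P i) * uA z i) := by
  rw [map_sum]
  refine Finset.sum_congr rfl fun i _ => ?_
  rw [uu_uA, aeval_L, map_mul]

/-- more than `n` vectors are dependent -/
theorem NN.dep {𝒜 : ℕ → Submodule K A} {y : ι → A} {θ : A} {n : ℕ} {c : ℕ → RR} {H : RR}
    (h : NN 𝒜 y θ n c H) {J : Type*} [Fintype J] (hJ : n < Fintype.card J) (x : J → A) :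
    ∃ P : J → RR, P ≠ 0 ∧ ∑ i, aeval y (P i) * x i = 0 := by
  choose D Q hD hQ using fun i => h.gen (x i)
  have : ¬ LinearIndependent RR (fun i : J => (fun k : Fin n => Q i k)) := by
    intro hli
    have := hli.fintype_card_le_finrank
    simp at this
    omega
  rw [Fintype.not_linearIndependent_iff] at this
  obtain ⟨g, hg, i0, hi0⟩ := this
  refine ⟨fun i => g i * D i, fun h0 => ?_, ?_⟩
  · exact mul_ne_zero hi0 (hD i0) (congrFun h0 i0)
  · have : ∀ i, aeval y (g i * D i) * x i = ∑ k ∈ Finset.range n, aeval y (g i * Q i k) * θ ^ k := by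
      intro i
      rw [map_mul, mul_assoc, hQ, Finset.mul_sum]
      simp only [map_mul, mul_assoc]
    rw [Finset.sum_congr rfl fun i _ => this i, Finset.sum_comm]
    refine Finset.sum_eq_zero fun k hk => ?_
    rw [← Finset.sum_mul, ← map_sum]
    have := congrFun hg ⟨k, Finset.mem_range.1 hk⟩
    simp only [Finset.sum_apply, Pi.smul_apply, smul_eq_mul, Pi.zero_apply] at this
    rw [this]; simp

theorem coeff_single_hom (P : RR) (t : ℕ) (hP : P.IsHomogeneous t) (e : ι) : eval (Pi.single e 1) P = coeff (Finsupp.single e t) P := by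
  rw [eval_eq']
  rw [Finset.sum_eq_single (Finsupp.single e t)]
  · rw [Finset.prod_eq_one, mul_one]
    intro i _
    by_cases h : i = e
    · subst h; simp
    · simp [Finsupp.single_apply, Ne.symm h]
  · intro b hb hbe
    have hd : b.degree = t := by
      have := hP (mem_support_iff.1 hb)
      rw [Finsupp.degree_eq_weight_one]; exact this
    have : ∃ i, i ≠ e ∧ b i ≠ 0 := by
      by_contra hcon
      push Not at hcon
      apply hbe
      have hbs : b = Finsupp.single e (b e) := by
        ext i
        by_cases h : i = e
        · subst h; simp
        · rw [hcon i h]; simp [Finsupp.single_apply, Ne.symm h]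
      rw [hbs, Finsupp.degree_single] at hd
      rw [hbs, hd]
    obtain ⟨i, hi, hbi⟩ := this
    rw [Finset.prod_eq_zero (Finset.mem_univ i), mul_zero]
    simp [Pi.single_apply, hi, hbi]
  · intro hs
    rw [notMem_support_iff.1 hs, zero_mul]

theorem totdeg_le (M : Matrix ι ι K) (q : RR) (e : ι) (h : eval (M e) (homogeneousComponent q.totalDegree q) ≠ 0) :
    q.totalDegree ≤ degreeOf e (lsub M q) := by
  set t := q.totalDegree with ht
  have hc : coeff (Finsupp.single e t) (lsub M q) = eval (M e) (homogeneousComponent t q) := by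
    conv_lhs => rw [← sum_homogeneousComponent q]
    rw [map_sum, coeff_sum, Finset.sum_eq_single t]
    · rw [← eval_lsub, coeff_single_hom _ t (lsub_hom M _ _ (homogeneousComponent_isHomogeneous t q))]
    · intro i _ hi
      by_contra hne
      have := lsub_hom M _ _ (homogeneousComponent_isHomogeneous i q) hne
      have h3 : (Finsupp.single e t).degree = i := by rw [Finsupp.degree_eq_weight_one]; exact this
      rw [Finsupp.degree_single] at h3
      exact hi h3.symm
    · intro h; simp at h; omega
  have hm : Finsupp.single e t ∈ (lsub M q).support := by
    rw [mem_support_iff, hc]; exact h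
  have := monomial_le_degreeOf e hm
  simpa using this

variable [IsAlgClosed K] {𝒜 : ℕ → Submodule K A} [GradedAlgebra 𝒜]

theorem NN.ctx {y : ι → A} {θ : A} {n : ℕ} {c : ℕ → RR} {H : RR}
    (h : NN 𝒜 y θ n c H) (halg : ∀ P : RR, algebraMap RR A P = aeval y P)
    (hH : ∀ e, eval (Pi.single e 1) H ≠ 0) (z : o → A) (hz : ∀ j, z j ∈ 𝒜 1)
    (hz0 : ∀ (a : o → K) (b : ι → K), ∑ j, a j • z j = ∑ i, b i • y i → a = 0)
    (hgen : Algebra.adjoin K (Set.range y ∪ Set.range z) = ⊤) (hn : n = Fintype.card o + 2) : Ctx RR z := by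
  have S : Setup K (fun i => algebraMap A LL (y i)) (fun i => algebraMap A LL (z i)) := h.setup hH z hz hz0
  have hinj : Function.Injective (algebraMap A LL) := IsFractionRing.injective A LL
  have hgen' : Algebra.adjoin RR (Set.range z) = ⊤ := by
    rw [eq_top_iff]
    intro x _
    have hx : x ∈ Algebra.adjoin K (Set.range y ∪ Set.range z) := by rw [hgen]; trivial
    induction hx using Algebra.adjoin_induction with
    | mem x hx =>
      rcases hx with ⟨i, rfl⟩ | ⟨j, rfl⟩
      · have := Subalgebra.algebraMap_mem (Algebra.adjoin RR (Set.range z)) (X i : RR)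
        rwa [halg, aeval_X] at this
      · exact Algebra.subset_adjoin ⟨j, rfl⟩
    | algebraMap r =>
      have := Subalgebra.algebraMap_mem (Algebra.adjoin RR (Set.range z)) (C r : RR)
      rwa [halg, aeval_C] at this
    | add x y _ _ hx hy => exact add_mem (hx trivial) (hy trivial)
    | mul x y _ _ hx hy => exact mul_mem (hx trivial) (hy trivial)
  have hhom : (algebraMap RR A) = (aeval y : RR →ₐ[K] A).toRingHom := RingHom.ext halg
  have hInteg : ∀ x : A, IsIntegral RR x := by
    intro x
    have := h.int x
    rw [← hhom] at this
    exact this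
  have hli : LinearIndependent RR (uA z) := by
    rw [Fintype.linearIndependent_iff]
    intro g hg i
    have := S.indep' g (by
      rw [sumL, ← map_zero (algebraMap A LL), ← hg]
      congr 1
      exact Finset.sum_congr rfl fun i _ => by rw [Algebra.smul_def, halg])
    exact congrFun this i
  constructor
  · exact hli
  · intro r x hr hx
    rw [mem_WW_iff halg] at hx ⊢
    obtain ⟨P, hP⟩ := hx
    have hxi : Int K (fun i => algebraMap A LL (y i)) (algebraMap A LL x) := by
      obtain ⟨p, hp, hpx⟩ := h.int x
      refine ⟨p, hp, ?_⟩
      have h1 : (aeval (fun i => algebraMap A LL (y i)) : RR →ₐ[K] LL).toRingHom = (algebraMap A LL).comp (aeval y : RR →ₐ[K] A).toRingHom :=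
        RingHom.ext fun P => aeval_L y P
      rw [h1, ← Polynomial.hom_eval₂, hpx, map_zero]
    obtain ⟨N, hN⟩ := S.sat (algebraMap A LL x) hxi r hr P (by
      rw [sumL, ← hP, Algebra.smul_def, halg, aeval_L, map_mul])
    rw [sumL] at hN
    exact ⟨N, hinj hN⟩
  · intro x1 x2
    obtain ⟨P, hP0, hP⟩ := h.dep (J := Option o ⊕ Fin 2) (by simp; omega) (Sum.elim (uA z) ![x1, x2])
    rw [Fintype.sum_sum_type] at hP
    simp only [Sum.elim_inl, Sum.elim_inr, Fin.sum_univ_two, Matrix.cons_val_zero, Matrix.cons_val_one] at hP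
    refine ⟨P (Sum.inr 0), P (Sum.inr 1), ?_, ?_⟩
    · by_contra hcon
      push Not at hcon
      rw [hcon.1, hcon.2] at hP
      simp only [map_zero, zero_mul, add_zero] at hP
      apply hP0
      have h1 := (Fintype.linearIndependent_iff.1 hli) (fun i => P (Sum.inl i)) (by
        rw [← hP]
        exact Finset.sum_congr rfl fun i _ => by rw [Algebra.smul_def, halg])
      funext i
      rcases i with i | i
      · exact h1 i
      · fin_cases i
        · exact hcon.1
        · exact hcon.2
    · rw [mem_WW_iff halg]
      refine ⟨fun i => - P (Sum.inl i), ?_⟩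
      simp only [map_neg, neg_mul, Finset.sum_neg_distrib, Algebra.smul_def, halg]
      linear_combination hP
  · by_contra hcon
    push Not at hcon
    have hpow : LinearIndependent RR (fun i : Fin n => θ ^ (i : ℕ)) := by
      rw [Fintype.linearIndependent_iff]
      intro g hg i
      have := h.tind (fun k => if hk : k < n then g ⟨k, hk⟩ else 0) (by
        rw [← hg, Finset.sum_range]
        refine Finset.sum_congr rfl fun i _ => ?_
        simp [Algebra.smul_def, halg]) i i.2
      simpa using this
    haveI : Fintype (Set.range (uA z)) := Fintype.ofFinite _
    have h1 := linearIndependent_le_span_aux' (fun i : Fin n => θ ^ (i : ℕ)) hpow (Set.range (uA z)) (by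
      rintro _ ⟨i, rfl⟩; exact hcon _)
    have h2 : Fintype.card (Set.range (uA z)) ≤ Fintype.card (Option o) := by
      classical
      exact Fintype.card_le_of_surjective (fun i => (⟨uA z i, i, rfl⟩ : Set.range (uA z))) (by
        rintro ⟨_, i, rfl⟩; exact ⟨i, rfl⟩)
    simp at h1 h2
    omega
  · exact hgen'
  · have := fg_adjoin_of_finite (R := RR) (Set.finite_range z) (fun x _ => hInteg x)
    rw [hgen'] at this
    exact ⟨this⟩

theorem NN.HL [Nonempty ι] {y : ι → A} {θ : A} {n : ℕ} {c : ℕ → RR} {H : RR}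
    (h : NN 𝒜 y θ n c H) (halg : ∀ P : RR, algebraMap RR A P = aeval y P)
    (z : o → A) (hz : ∀ j, z j ∈ 𝒜 1)
    (hz0 : ∀ (a : o → K) (b : ι → K), ∑ j, a j • z j = ∑ i, b i • y i → a = 0)
    (hC : Ctx RR z) (q : RR) (hq : q ≠ 0) :
    ∃ F : o × o → RR, (∃ i, F i ≠ 0) ∧ (∀ i, q ∣ F i → F i ≠ 0 → q.totalDegree ≤ 1) ∧
      ∃ M : RR, M ≠ 0 ∧ ∀ i k : o × o, M • (F k • (z i.1 * z i.2) - F i • (z k.1 * z k.2)) ∈ WW RR z := by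
  have hinj : Function.Injective (algebraMap A LL) := IsFractionRing.injective A LL
  have hT : homogeneousComponent q.totalDegree q ≠ 0 := by
    intro h0
    obtain ⟨m, hm, hmd⟩ := Finset.exists_mem_eq_sup q.support (support_nonempty.2 hq) (fun s => s.sum fun _ e => e)
    have hmd' : m.degree = q.totalDegree := hmd.symm
    have := congrArg (coeff m) h0
    rw [coeff_homogeneousComponent, if_pos hmd', coeff_zero] at this
    exact mem_support_iff.1 hm this
  obtain ⟨M, N, y', hMN, hNM, hM1, hN1, h', hH', hT'⟩ := h.good _ hT
  have hinjN : ∀ P, lsub N P = 0 → P = 0 := fun P hP => by rw [← lsub_comp N M hMN P, hP, map_zero]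
  have hinjM : ∀ P, lsub M P = 0 → P = 0 := fun P hP => by rw [← lsub_comp M N hNM P, hP, map_zero]
  have S := h'.setup (L := LL) hH' z hz (by
    intro a b hab
    have h1 : ∑ i, b i • y' i = aeval y (lsub N (lf b)) := by
      rw [hN1, aeval_lf]
      exact Finset.sum_congr rfl fun i _ => by rw [Algebra.smul_def]
    rw [h1, lf_of_hom _ (lsub_hom N _ _ (lf_hom b)), aeval_lf] at hab
    refine hz0 a (fun i => coeff (Finsupp.single i 1) (lsub N (lf b))) (hab.trans (Finset.sum_congr rfl fun i _ => ?_))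
    rw [Algebra.smul_def])
  obtain ⟨lam, hl⟩ := exists_lam hC
  obtain ⟨i0, j0, hij⟩ := lam_ne hC lam hl
  have e : ι := Classical.arbitrary ι
  have hpull : ∀ (x : A) (P : Option o → RR), x = ∑ i, aeval y' (P i) * uA z i → x ∈ WW RR z := by
    intro x P hx
    rw [mem_WW_iff halg]
    exact ⟨fun i => lsub N (P i), by simp only [hN1]; exact hx⟩
  have hpush : ∀ x ∈ WW RR z, ∃ P : Option o → RR, x = ∑ i, aeval y' (P i) * uA z i := by
    intro x hx
    rw [mem_WW_iff halg] at hx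
    obtain ⟨P, hP⟩ := hx
    exact ⟨fun i => lsub M (P i), by simp only [hM1]; exact hP⟩
  obtain ⟨F, ⟨i1, hi1⟩, hFd, M0, hM0, hF⟩ := L3 S e (fun p : o × o => algebraMap A LL (z p.1 * z p.2)) (fun i => by
      rw [map_mul]
      exact ((S.hz i.1).BB S.hy e).mul ((S.hz i.2).BB S.hy e)) (i0, j0) (by
      intro D P hD hDP
      rw [sumL, aeval_L, ← map_mul] at hDP
      have h1 := hpull _ P (hinj hDP)
      rw [← hN1, ← halg, ← Algebra.smul_def] at h1
      have := hC.sat _ _ (fun h0 => hD (hinjN _ h0)) h1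
      exact hij ((hl _).2 this)) (by
      intro x1 x2
      obtain ⟨a1, b1, hb1, rfl⟩ := IsFractionRing.div_surjective (A := A) x1
      obtain ⟨a2, b2, hb2, rfl⟩ := IsFractionRing.div_surjective (A := A) x2
      have hb1 : b1 ≠ 0 := nonZeroDivisors.ne_zero hb1
      have hb2 : b2 ≠ 0 := nonZeroDivisors.ne_zero hb2
      obtain ⟨D1, b1', hD1, hbb1⟩ := mult_in_R h'.ind b1 hb1 (h'.int b1)
      obtain ⟨D2, b2', hD2, hbb2⟩ := mult_in_R h'.ind b2 hb2 (h'.int b2)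
      obtain ⟨r1, r2, hr, hrr⟩ := hC.rank (b1' * a1) (b2' * a2)
      obtain ⟨P, hP⟩ := hpush _ hrr
      refine ⟨lsub M r1 * D1, lsub M r2 * D2, P, ?_, ?_⟩
      · rcases hr with hr | hr
        · left; exact mul_ne_zero (fun h0 => hr (hinjM _ h0)) hD1
        · right; exact mul_ne_zero (fun h0 => hr (hinjM _ h0)) hD2
      · rw [sumL, ← hP, map_add, Algebra.smul_def, Algebra.smul_def, halg, halg, ← hM1, ← hM1]
        have hb1L : algebraMap A LL b1 ≠ 0 := by simpa using hb1
        have hb2L : algebraMap A LL b2 ≠ 0 := by simpa using hb2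
        simp only [map_mul, aeval_L, ← hbb1, ← hbb2]
        field_simp)
  refine ⟨fun i => lsub N (F i), ⟨i1, fun h0 => hi1 (hinjN _ h0)⟩, ?_, lsub N M0, fun h0 => hM0 (hinjN _ h0), ?_⟩
  · intro i hqi hne
    refine (totdeg_le M q e (hT' e)).trans (le_trans ?_ (hFd i))
    obtain ⟨g, hg⟩ := hqi
    have h1 : F i = lsub M q * lsub M g := by
      rw [← map_mul, ← hg, lsub_comp N M hMN]
    have h2 : F i ≠ 0 := fun h0 => hne (by simp only [h0, map_zero])
    rw [h1] at h2 ⊢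
    rw [degreeOf_mul_eq (left_ne_zero_of_mul h2) (right_ne_zero_of_mul h2)]
    omega
  · intro i k
    obtain ⟨P, hP⟩ := hF i k
    rw [sumL] at hP
    simp only [aeval_L, ← map_mul, ← map_sub] at hP
    refine hpull _ P ?_
    simp only [Algebra.smul_def, halg, hN1]
    exact hinj hP
end
end DP
end

noncomputable section
namespace DP
set_option linter.all false
open MvPolynomial

section
variable {K A ι o : Type*} [Field K] [CommRing A] [IsDomain A] [Algebra K A]
  [Fintype ι] [DecidableEq ι] [Fintype o] [Algebra (MvPolynomial ι K) A]
  [IsAlgClosed K] {𝒜 : ℕ → Submodule K A} [GradedAlgebra 𝒜]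

local notation "RR" => MvPolynomial ι K

theorem NN.struct [Nonempty ι] [IsIntegrallyClosed A] {y : ι → A} {θ : A} {n : ℕ} {c : ℕ → RR} {H : RR}
    (h : NN 𝒜 y θ n c H) (halg : ∀ P : RR, algebraMap RR A P = aeval y P)
    (z : o → A) (hz : ∀ j, z j ∈ 𝒜 1)
    (hz0 : ∀ (a : o → K) (b : ι → K), ∑ j, a j • z j = ∑ i, b i • y i → a = 0)
    (hC : Ctx RR z) :
    ∃ (lam : A →ₗ[RR] RR) (a : o → o → K), IsLam z lam ∧ (∀ i j, lam (z i * z j) = C (a i j)) ∧ (∃ i j, a i j ≠ 0) ∧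
      (∀ t : o → K, (∀ j, ∑ i, t i * a i j = 0) → t = 0) := by
  obtain ⟨lam, hl, hp⟩ := exists_lam_min hC
  have hsm : ∀ (r : RR) (x : A), r • x = aeval y r * x := fun r x => by rw [Algebra.smul_def, halg]
  have hd := qdeg hC lam hl hp (h.HL halg z hz hz0 hC)
  have hδ : ∀ i : Option o, ∃ δ, uA z i ∈ 𝒜 δ := by
    rintro (_ | j)
    · exact ⟨0, SetLike.GradedOne.one_mem⟩
    · exact ⟨1, hz j⟩
  have hπ : ∀ x ∈ WW RR z, (pr 𝒜 2).toAddMonoidHom x ∈ WW RR z := by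
    intro x hx
    rw [mem_WW_iff halg] at hx
    obtain ⟨P, rfl⟩ := hx
    rw [map_sum]
    refine Submodule.sum_mem _ fun i _ => ?_
    obtain ⟨δ, hδ⟩ := hδ i
    change pr 𝒜 2 _ ∈ _
    rw [pr_aeval_mul 𝒜 h.hy1 _ δ 2 _ hδ]
    split_ifs
    · rw [← hsm]; exact Submodule.smul_mem _ _ (Submodule.subset_span ⟨i, rfl⟩)
    · exact zero_mem _
  have hπ2 : ∀ (r : RR) i j, (pr 𝒜 2).toAddMonoidHom (r • (z i * z j)) = (C (coeff 0 r) : RR) • (z i * z j) := by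
    intro r i j
    change pr 𝒜 2 _ = _
    rw [hsm, pr_aeval_mul 𝒜 h.hy1 _ 2 2 _ (SetLike.GradedMul.mul_mem (hz i) (hz j)), if_pos le_rfl, hsm, Nat.sub_self,
      homogeneousComponent_zero]
  rcases q_const_or_lin hC lam hl hp hd _ hπ hπ2 with ⟨a, ha⟩ | ⟨l, hlin⟩
  · refine ⟨lam, a, hl, ha, ?_, ?_⟩
    · obtain ⟨i, j, hij⟩ := lam_ne hC lam hl
      rw [ha] at hij
      exact ⟨i, j, fun h0 => hij (by rw [h0, map_zero])⟩
    · intro t ht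
      set v : A := ∑ i, (C (t i) : RR) • z i with hv
      obtain ⟨r, hr⟩ := nondeg hC lam hl v (Submodule.sum_mem _ fun i _ => Submodule.smul_mem _ _ (z_WW z i)) (by
        intro j
        rw [← hl, hv, Finset.sum_mul, map_sum]
        have : ∀ i, lam ((C (t i) : RR) • z i * z j) = C (t i * a i j) := fun i => by
          rw [smul_mul_assoc, map_smul, ha, smul_eq_mul, C_mul]
        rw [Finset.sum_congr rfl fun i _ => this i, ← map_sum, ht, map_zero])
      have h1 := Fintype.linearIndependent_iff.1 hC.li (fun i => i.elim (-r) (fun j => C (t j))) (by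
        rw [Fintype.sum_option]
        simp only [Option.elim, uA_none, uA_some]
        rw [← hv, hr, Algebra.smul_def]
        simp)
      funext j
      have := h1 (some j)
      simpa using this
  · exact (e1_false hC lam hl hp l hlin).elim
end
end DP
end

noncomputable section
namespace DP
set_option linter.all false
open MvPolynomial

section
variable {K A ι o : Type*} [Field K] [CommRing A] [Algebra K A] [Fintype ι] [Fintype o] 

local notation "RR" => MvPolynomial ι K

def u3 (z : o → A) (w : A) : Option (Option o) → A := fun i => i.elim w (uA z)
def d3 : Option (Option o) → ℕ := fun i => i.elim 2 (fun j => j.elim 0 (fun _ => 1))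

structure FB (𝒜 : ℕ → Submodule K A) (y : ι → A) (z : o → A) (w : A) (a : o → o → K) : Prop where
  hy1 : ∀ i, y i ∈ 𝒜 1
  hz : ∀ i, z i ∈ 𝒜 1
  hw : w ∈ 𝒜 2
  sp : ∀ x : A, ∃ P : Option (Option o) → RR, x = ∑ i, aeval y (P i) * u3 z w i
  ind : ∀ P : Option (Option o) → RR, ∑ i, aeval y (P i) * u3 z w i = 0 → P = 0
  mul : ∀ i j, ∃ (l : o → ι → K) (κ : RR), κ.IsHomogeneous 2 ∧
    z i * z j = algebraMap K A (a i j) * w + ∑ m, aeval y (lf (l m)) * z m + aeval y κ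
  ane : ∃ i j, a i j ≠ 0
  nd : ∀ t : o → K, (∀ j, ∑ i, t i * a i j = 0) → t = 0

theorem sum3 (y : ι → A) (z : o → A) (w : A) (P : Option (Option o) → RR) :
    ∑ i, aeval y (P i) * u3 z w i = aeval y (P none) * w + (aeval y (P (some none)) + ∑ j, aeval y (P (some (some j))) * z j) := by
  rw [Fintype.sum_option, Fintype.sum_option]
  simp [u3]

variable {𝒜 : ℕ → Submodule K A} [GradedAlgebra 𝒜]

theorem FB.hu {y : ι → A} {z : o → A} {w : A} {a : o → o → K} (F : FB 𝒜 y z w a) (i : Option (Option o)) : u3 z w i ∈ 𝒜 (d3 i) := by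
  rcases i with _ | _ | j
  · exact F.hw
  · exact SetLike.GradedOne.one_mem
  · exact F.hz j

theorem FB.hom {y : ι → A} {z : o → A} {w : A} {a : o → o → K} (F : FB 𝒜 y z w a) (x : A) (n : ℕ) (hx : x ∈ 𝒜 n) :
    ∃ P : Option (Option o) → RR, x = ∑ i, aeval y (P i) * u3 z w i ∧ ∀ i, (d3 i ≤ n → (P i).IsHomogeneous (n - d3 i)) ∧ (n < d3 i → P i = 0) := by
  obtain ⟨P, hP⟩ := F.sp x
  have h := hom_coords 𝒜 F.hy1 Finset.univ P (u3 z w) d3 (fun i _ => F.hu i) n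
  rw [← hP, pr_same 𝒜 hx] at h
  refine ⟨_, h, fun i => ⟨fun hi => ?_, fun hi => ?_⟩⟩
  · rw [if_pos hi]; exact homogeneousComponent_isHomogeneous _ _
  · rw [if_neg (by omega)]
end

section
variable {K A ι o : Type*} [Field K] [CommRing A] [IsDomain A] [Algebra K A]
  [Fintype ι] [DecidableEq ι] [Fintype o] [Algebra (MvPolynomial ι K) A]
  {𝒜 : ℕ → Submodule K A} [GradedAlgebra 𝒜]

local notation "RR" => MvPolynomial ι K

theorem FB.of_lam {y : ι → A} (hy1 : ∀ i, y i ∈ 𝒜 1) (halg : ∀ P : RR, algebraMap RR A P = aeval y P)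
    (z : o → A) (hz : ∀ j, z j ∈ 𝒜 1) (hC : Ctx RR z) (lam : A →ₗ[RR] RR) (a : o → o → K) (hl : IsLam z lam) 
    (ha : ∀ i j, lam (z i * z j) = C (a i j)) (ane : ∃ i j, a i j ≠ 0) (nd : ∀ t : o → K, (∀ j, ∑ i, t i * a i j = 0) → t = 0) :
    ∃ w, lam w = 1 ∧ FB 𝒜 y z w a := by
  obtain ⟨i0, j0, hij⟩ := ane
  have hsm : ∀ (r : RR) (x : A), r • x = aeval y r * x := fun r x => by rw [Algebra.smul_def, halg]
  set w : A := algebraMap K A (a i0 j0)⁻¹ * (z i0 * z j0) with hw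
  have hlw : lam w = 1 := by
    have : w = (C (a i0 j0)⁻¹ : RR) • (z i0 * z j0) := by rw [hsm, aeval_C]
    rw [this, map_smul, ha, smul_eq_mul, ← C_mul, inv_mul_cancel₀ hij, C_1]
  have hw2 : w ∈ 𝒜 2 := by
    rw [hw, ← Algebra.smul_def]
    exact Submodule.smul_mem _ _ (SetLike.GradedMul.mul_mem (hz i0) (hz j0))
  have hW : ∀ x, ∃ P : Option o → RR, x = aeval y (lam x) * w + ∑ i, aeval y (P i) * uA z i := by
    intro x
    have h1 : x - lam x • w ∈ WW RR z := by
      rw [← hl, map_sub, map_smul, hlw]; simp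
    rw [mem_WW_iff halg] at h1
    obtain ⟨P, hP⟩ := h1
    exact ⟨P, by rw [← hP, hsm]; ring⟩
  refine ⟨w, hlw, hy1, hz, hw2, ?_, ?_, ?_, ⟨i0, j0, hij⟩, nd⟩
  · intro x
    obtain ⟨P, hP⟩ := hW x
    refine ⟨fun i => i.elim (lam x) P, ?_⟩
    rw [Fintype.sum_option]
    exact hP
  · intro P hP
    rw [Fintype.sum_option] at hP
    have h1 := congrArg lam hP
    have h2 : ∑ i, aeval y (P (some i)) * u3 z w (some i) ∈ WW RR z := by
      rw [mem_WW_iff halg]; exact ⟨fun i => P (some i), rfl⟩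
    rw [map_add, (hl _).2 h2, ← hsm, map_smul] at h1
    have h3 : P none = 0 := by
      have : lam (u3 z w none) = 1 := hlw
      rw [this] at h1; simpa using h1
    rw [h3] at hP
    simp only [map_zero, zero_mul, zero_add] at hP
    have h4 := Fintype.linearIndependent_iff.1 hC.li (fun i => P (some i)) (by
      rw [← hP]
      exact Finset.sum_congr rfl fun i _ => by rw [hsm]; rfl)
    funext i
    rcases i with _ | i
    · exact h3
    · exact h4 i
  · intro i j
    obtain ⟨P, hP⟩ := hW (z i * z j)
    rw [ha, aeval_C, Fintype.sum_option] at hP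
    simp only [uA_none, uA_some, mul_one] at hP
    have h2 := congrArg (pr 𝒜 2) hP
    rw [pr_same 𝒜 (SetLike.GradedMul.mul_mem (hz i) (hz j)), map_add, ← Algebra.smul_def, map_smul, pr_same 𝒜 hw2, map_add,
      pr_aeval 𝒜 hy1, map_sum] at h2
    have h3 : ∀ m, pr 𝒜 2 (aeval y (P (some m)) * z m) = aeval y (lf (fun k => coeff (Finsupp.single k 1) (homogeneousComponent 1 (P (some m))))) * z m := by
      intro m
      rw [pr_aeval_mul 𝒜 hy1 _ 1 2 _ (hz m), if_pos (by norm_num), ← lf_of_hom _ (homogeneousComponent_isHomogeneous _ _)]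
    rw [Finset.sum_congr rfl fun m _ => h3 m] at h2
    refine ⟨fun m k => coeff (Finsupp.single k 1) (homogeneousComponent 1 (P (some m))), homogeneousComponent 2 (P none), homogeneousComponent_isHomogeneous _ _, h2.trans ?_⟩
    rw [Algebra.smul_def]; ring
end
end DP
end

noncomputable section
namespace DP
set_option linter.all false
open MvPolynomial

section
variable {K A ι o : Type*} [Field K] [CommRing A] [Algebra K A] [Fintype ι] [Fintype o] 
local notation "RR" => MvPolynomial ι K
variable {𝒜 : ℕ → Submodule K A} [GradedAlgebra 𝒜]

theorem FB.mem_map {y : ι → A} {z : o → A} {w : A} {a : o → o → K} (F : FB 𝒜 y z w a) (p : Ideal RR) (P : Option (Option o) → RR) :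
    ∑ i, aeval y (P i) * u3 z w i ∈ p.map (aeval y : RR →ₐ[K] A) ↔ ∀ i, P i ∈ p := by
  classical
  constructor
  · intro h
    have key : ∀ x ∈ p.map (aeval y : RR →ₐ[K] A), ∃ P : Option (Option o) → RR, (∀ i, P i ∈ p) ∧ x = ∑ i, aeval y (P i) * u3 z w i := by
      intro x hx
      induction hx using Submodule.span_induction with
      | mem x hx =>
        obtain ⟨q, hq, rfl⟩ := hx
        refine ⟨Pi.single (some none) q, fun i => ?_, ?_⟩
        · by_cases h : i = some none
          · subst h; simpa using hq
          · simp [Pi.single_apply, h]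
        · rw [Finset.sum_eq_single (some none)]
          · simp [u3]
          · intro i _ hi; simp [Pi.single_apply, hi]
          · simp
      | zero => exact ⟨0, by simp, by simp⟩
      | add x x' _ _ h1 h2 =>
        obtain ⟨P, hP, rfl⟩ := h1
        obtain ⟨Q, hQ, rfl⟩ := h2
        exact ⟨P + Q, fun i => p.add_mem (hP i) (hQ i), by simp [add_mul, Finset.sum_add_distrib]⟩
      | smul b x _ h1 =>
        obtain ⟨P, hP, rfl⟩ := h1
        choose Q hQ using fun i => F.sp (b * u3 z w i)
        refine ⟨fun j => ∑ i, P i * Q i j, fun j => Ideal.sum_mem _ fun i _ => p.mul_mem_right _ (hP i), ?_⟩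
        rw [smul_eq_mul, Finset.mul_sum]
        have : ∀ i, b * (aeval y (P i) * u3 z w i) = ∑ j, aeval y (P i * Q i j) * u3 z w j := by
          intro i
          rw [mul_left_comm, hQ, Finset.mul_sum]
          simp only [map_mul, mul_assoc]
        rw [Finset.sum_congr rfl fun i _ => this i, Finset.sum_comm]
        simp only [map_sum, Finset.sum_mul]
    obtain ⟨P', hP', he⟩ := key _ h
    have : P - P' = 0 := F.ind _ (by simp [sub_mul, Finset.sum_sub_distrib, he])
    rw [sub_eq_zero.1 this]; exact hP'
  · intro h
    exact Ideal.sum_mem _ fun i _ => Ideal.mul_mem_right _ _ (Ideal.mem_map_of_mem _ (h i))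

theorem X_mul_mem (s : Set ι) (k : ι) (hk : k ∉ s) (P : RR) (h : X k * P ∈ Ideal.span ((X : ι → RR) '' s)) :
    P ∈ Ideal.span ((X : ι → RR) '' s) := by
  classical
  rw [mem_ideal_span_X_image] at h ⊢
  intro m hm
  obtain ⟨j, hj, hjm⟩ := h (Finsupp.single k 1 + m) (by
    rw [mem_support_iff, coeff_X_mul]; exact mem_support_iff.1 hm)
  refine ⟨j, hj, ?_⟩
  have : k ≠ j := fun h => hk (h ▸ hj)
  simpa [Finsupp.single_apply, this] using hjm

theorem mem_mR (P : RR) : P ∈ Ideal.span ((X : ι → RR) '' Set.univ) ↔ coeff 0 P = 0 := by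
  rw [mem_ideal_span_X_image]
  constructor
  · intro h
    by_contra hne
    obtain ⟨i, _, hi⟩ := h 0 (mem_support_iff.2 hne)
    simp at hi
  · intro h m hm
    by_contra hcon
    push Not at hcon
    have : m = 0 := by ext i; simpa using hcon i trivial
    subst this
    exact mem_support_iff.1 hm h

theorem map_spanX (y : ι → A) (s : Set ι) : (Ideal.span ((X : ι → RR) '' s)).map (aeval y : RR →ₐ[K] A) = Ideal.span (y '' s) := by
  rw [Ideal.map_span, ← Set.image_comp]
  congr 1
  refine Set.image_congr fun i _ => ?_
  simp

theorem coeff0_hom (P : RR) (n : ℕ) (hn : n ≠ 0) (hP : P.IsHomogeneous n) : coeff 0 P = 0 := by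
  by_contra h
  have := hP h
  simp at this
  exact hn this.symm

/-- congruences modulo `(y)` -/
theorem FB.cong {y : ι → A} {z : o → A} {w : A} {a : o → o → K} (F : FB 𝒜 y z w a) :
    (∀ i j, z i * z j - algebraMap K A (a i j) * w ∈ Ideal.span (Set.range y)) ∧ (∀ i, z i * w ∈ Ideal.span (Set.range y)) := by
  have hy : Ideal.span (Set.range y) = (Ideal.span ((X : ι → RR) '' Set.univ)).map (aeval y : RR →ₐ[K] A) := by
    rw [map_spanX, Set.image_univ]
  constructor
  · intro i j
    obtain ⟨l, κ, hκ, he⟩ := F.mul i j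
    rw [he, hy]
    have h2 : algebraMap K A (a i j) * w + ∑ m, aeval y (lf (l m)) * z m + aeval y κ - algebraMap K A (a i j) * w =
      ∑ m, aeval y (lf (l m)) * z m + aeval y κ := by ring
    rw [h2]
    refine Ideal.add_mem _ (Ideal.sum_mem _ fun m _ => Ideal.mul_mem_right _ _ (Ideal.mem_map_of_mem _ ?_)) (Ideal.mem_map_of_mem _ ?_)
    · rw [mem_mR]; exact coeff0_hom _ 1 one_ne_zero (lf_hom _)
    · rw [mem_mR]; exact coeff0_hom _ 2 two_ne_zero hκ
  · intro i
    obtain ⟨P, hP, hh⟩ := F.hom (z i * w) 3 (SetLike.GradedMul.mul_mem (i := 1) (j := 2) (F.hz i) F.hw)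
    rw [hP, hy, F.mem_map]
    intro k
    rw [mem_mR]
    have hk : d3 k ≤ 2 := by rcases k with _ | _ | k <;> simp [d3]
    exact coeff0_hom _ (3 - d3 k) (by omega) ((hh k).1 (by omega))

theorem FB.coord0 {y : ι → A} {z : o → A} {w : A} {a : o → o → K} (F : FB 𝒜 y z w a) (P : Option (Option o) → RR) :
    ∑ i, aeval y (P i) * u3 z w i ∈ Ideal.span (Set.range y) ↔ ∀ i, coeff 0 (P i) = 0 := by
  have hy : Ideal.span (Set.range y) = (Ideal.span ((X : ι → RR) '' Set.univ)).map (aeval y : RR →ₐ[K] A) := by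
    rw [map_spanX, Set.image_univ]
  rw [hy, F.mem_map]
  simp only [mem_mR]
end

section
variable {K A o : Type} [Field K] [CommRing A] [Algebra K A] [Fintype o] {m : ℕ}
  {𝒜 : ℕ → Submodule K A} [GradedAlgebra 𝒜]

theorem FB.reg {y : Fin m → A} {z : o → A} {w : A} {a : o → o → K} (F : FB 𝒜 y z w a) : AMD.IsRegSeq (List.ofFn y) := by
  intro i b hb
  have him : i.1 < m := by have := i.2; simpa using this
  set k : Fin m := ⟨i.1, him⟩ with hk
  have hset : {x | x ∈ (List.ofFn y).take i.1} = y '' {j | j < k} := by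
    ext x
    simp only [Set.mem_setOf_eq, Set.mem_image, List.mem_take_iff_getElem]
    constructor
    · rintro ⟨j, hj, rfl⟩
      simp only [List.length_ofFn, lt_min_iff] at hj
      exact ⟨⟨j, hj.2⟩, hj.1, by simp⟩
    · rintro ⟨j, hj, rfl⟩
      refine ⟨j.1, ?_, by simp⟩
      simp only [List.length_ofFn, lt_min_iff]
      exact ⟨hj, j.2⟩
  have hget : (List.ofFn y).get i = y k := by
    rw [List.get_ofFn]; rfl
  rw [hset, ← map_spanX (K := K)] at hb ⊢
  rw [hget] at hb
  obtain ⟨P, rfl⟩ := F.sp b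
  have h1 : y k * ∑ i, aeval y (P i) * u3 z w i = ∑ i, aeval y (X k * P i) * u3 z w i := by
    rw [Finset.mul_sum]
    simp only [map_mul, aeval_X, mul_assoc]
  rw [h1, F.mem_map] at hb
  rw [F.mem_map]
  intro i
  exact X_mul_mem _ k (by simp) _ (hb i)

theorem FB.socle {y : Fin m → A} {z : o → A} {w : A} {a : o → o → K} (F : FB 𝒜 y z w a) (𝔪 : Ideal A)
    (h𝔪 : 𝔪 = Ideal.span (Set.range y ∪ Set.range z)) (J : Ideal A) (hJ : J = Ideal.span (Set.range y)) :
    Module.finrank K (AMD.socle K (A ⧸ J) (𝔪.map (Ideal.Quotient.mk J))) = 1 := by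
  classical
  have hasymm : ∀ i j, a i j = a j i := by
    intro i j
    have h1 := F.cong.1 i j
    have h2 := F.cong.1 j i
    have h3 := Ideal.sub_mem _ h2 h1
    have : z j * z i - algebraMap K A (a j i) * w - (z i * z j - algebraMap K A (a i j) * w) =
        ∑ k, aeval y ((Pi.single none (C (a i j - a j i)) : Option (Option o) → MvPolynomial (Fin m) K) k) * u3 z w k := by
      rw [sum3]; simp; ring
    rw [this, F.coord0] at h3
    have := h3 none
    simpa [sub_eq_zero] using this
  have hmem : ∀ b : A ⧸ J, b ∈ AMD.socle K (A ⧸ J) (𝔪.map (Ideal.Quotient.mk J)) ↔ ∀ j, Ideal.Quotient.mk J (z j) * b = 0 := by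
    intro b
    constructor
    · intro hb j
      exact hb _ (Ideal.mem_map_of_mem _ (by rw [h𝔪]; exact Ideal.subset_span (Or.inr ⟨j, rfl⟩)))
    · intro hb t ht
      rw [h𝔪, Ideal.map_span] at ht
      induction ht using Submodule.span_induction with
      | mem t ht =>
        obtain ⟨t, (⟨i, rfl⟩ | ⟨j, rfl⟩), rfl⟩ := ht
        · rw [Ideal.Quotient.eq_zero_iff_mem.2 (by rw [hJ]; exact Ideal.subset_span ⟨i, rfl⟩), zero_mul]
        · exact hb j
      | zero => rw [zero_mul]
      | add s t _ _ hs ht => rw [add_mul, hs, ht, add_zero]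
      | smul s t _ ht => rw [smul_eq_mul, mul_assoc, ht, mul_zero]
  have hw0 : Ideal.Quotient.mk J w ≠ 0 := by
    rw [Ne, Ideal.Quotient.eq_zero_iff_mem, hJ]
    intro h
    have : w = ∑ k, aeval y ((Pi.single none 1 : Option (Option o) → MvPolynomial (Fin m) K) k) * u3 z w k := by
      rw [sum3]; simp
    rw [this, F.coord0] at h
    simpa using h none
  have hws : Ideal.Quotient.mk J w ∈ AMD.socle K (A ⧸ J) (𝔪.map (Ideal.Quotient.mk J)) := by
    rw [hmem]
    intro j
    rw [← map_mul, Ideal.Quotient.eq_zero_iff_mem, hJ]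
    exact F.cong.2 j
  refine finrank_eq_one ⟨_, hws⟩ (fun h => hw0 (congrArg Subtype.val h)) ?_
  rintro ⟨b, hb⟩
  obtain ⟨x, rfl⟩ := Ideal.Quotient.mk_surjective b
  obtain ⟨P, hP⟩ := F.sp x
  rw [hmem] at hb
  set p0 := coeff 0 (P (some none)) with hp0
  set p : o → K := fun j => coeff 0 (P (some (some j))) with hp
  set pw := coeff 0 (P none) with hpw
  have hx : x - (algebraMap K A pw * w + (algebraMap K A p0 + ∑ j, algebraMap K A (p j) * z j)) ∈ J := by
    have : x - (algebraMap K A pw * w + (algebraMap K A p0 + ∑ j, algebraMap K A (p j) * z j)) =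
       ∑ i, aeval y (P i - C (coeff 0 (P i))) * u3 z w i := by
      rw [sum3, hP, sum3]
      simp only [map_sub, aeval_C, sub_mul, Finset.sum_sub_distrib]
      ring
    rw [this, hJ, F.coord0]
    intro i; simp
  have hz : ∀ k, p0 = 0 ∧ ∑ j, p j * a j k = 0 := by
    intro k
    have h1 := hb k
    rw [← map_mul, Ideal.Quotient.eq_zero_iff_mem] at h1
    have h2 := Ideal.sub_mem _ h1 (Ideal.mul_mem_left _ (z k) hx)
    have h4 : ∑ j, algebraMap K A (p j) * (z j * z k - algebraMap K A (a j k) * w) + algebraMap K A pw * (z k * w) ∈ J := by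
      rw [hJ]
      exact Ideal.add_mem _ (Ideal.sum_mem _ fun j _ => Ideal.mul_mem_left _ _ (F.cong.1 j k)) (Ideal.mul_mem_left _ _ (F.cong.2 k))
    have h5 := Ideal.sub_mem _ h2 h4
    have : z k * x - z k * (x - (algebraMap K A pw * w + (algebraMap K A p0 + ∑ j, algebraMap K A (p j) * z j))) -
       (∑ j, algebraMap K A (p j) * (z j * z k - algebraMap K A (a j k) * w) + algebraMap K A pw * (z k * w)) =
       ∑ i, aeval y ((fun i : Option (Option o) => i.elim (C (∑ j, p j * a j k)) (fun i => i.elim 0 (fun j => C (if j = k then p0 else 0))) : Option (Option o) → MvPolynomial (Fin m) K) i) * u3 z w i := by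
      rw [sum3]
      simp only [Option.elim, aeval_C, map_zero, zero_add]
      have e1 : ∑ j, algebraMap K A (if j = k then p0 else 0) * z j = algebraMap K A p0 * z k := by
        rw [Finset.sum_eq_single k]
        · simp
        · intro j _ hj; simp [hj]
        · simp
      rw [e1, map_sum, Finset.sum_mul]
      simp only [mul_sub, Finset.sum_sub_distrib, map_mul, mul_add, Finset.mul_sum]
      have e2 : ∀ j, z k * (algebraMap K A (p j) * z j) = algebraMap K A (p j) * (z j * z k) := fun j => by ring
      have e3 : ∀ j, algebraMap K A (p j) * (algebraMap K A (a j k) * w) = algebraMap K A (p j) * algebraMap K A (a j k) * w := fun j => by ring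
      simp only [e2, e3]
      ring
    rw [this, hJ, F.coord0] at h5
    have h6 : coeff 0 (C (∑ j, p j * a j k) : MvPolynomial (Fin m) K) = 0 := h5 none
    have h7 : coeff 0 (C (if k = k then p0 else 0) : MvPolynomial (Fin m) K) = 0 := h5 (some (some k))
    rw [coeff_zero_C] at h6 h7
    rw [if_pos rfl] at h7
    exact ⟨h7, h6⟩
  obtain ⟨i0, j0, -⟩ := F.ane
  have hp00 : p0 = 0 := (hz i0).1
  have hpz : p = 0 := F.nd p fun k => (hz k).2
  refine ⟨pw, Subtype.ext ?_⟩
  rw [hp00, hpz] at hx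
  simp only [map_zero, Pi.zero_apply, zero_mul, Finset.sum_const_zero, add_zero] at hx
  have h8 := (Ideal.Quotient.eq.2 hx).symm
  have h9 : pw • Ideal.Quotient.mk J w = Ideal.Quotient.mk J x := by
    rw [← h8, Algebra.smul_def, map_mul]
    rfl
  exact h9
end
end DP
end

noncomputable section
namespace DP
set_option linter.all false
open MvPolynomial

section
theorem pts_of_finType {K A : Type*} [Field K] [IsAlgClosed K] [CommRing A] [Algebra K A] [Algebra.FiniteType K A]
    (Q : Ideal A) (hQ : Q.IsMaximal) : ∃ ev : A →ₐ[K] K, RingHom.ker ev = Q := by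
  letI : Field (A ⧸ Q) := Ideal.Quotient.field Q
  have h1 : Module.Finite K (A ⧸ Q) := finite_of_finite_type_of_isJacobsonRing K (A ⧸ Q)
  have hb : Function.Bijective (algebraMap K (A ⧸ Q)) := IsAlgClosed.algebraMap_bijective_of_isIntegral
  let E : K ≃ₐ[K] (A ⧸ Q) := AlgEquiv.ofBijective (Algebra.ofId K (A ⧸ Q)) hb
  refine ⟨(E.symm : (A ⧸ Q) →ₐ[K] K).comp (Ideal.Quotient.mkₐ K Q), ?_⟩
  ext x
  simp [RingHom.mem_ker, Ideal.Quotient.eq_zero_iff_mem]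

variable {K A ι : Type*} [Field K] [IsAlgClosed K] [CommRing A] [Algebra K A] [Fintype ι] [DecidableEq ι]
local notation "RR" => MvPolynomial ι K

theorem NN.evs [hft : Algebra.FiniteType K A] {𝒜 : ℕ → Submodule K A} {y : ι → A} {θ : A} {n : ℕ} {c : ℕ → RR} {H : RR}
    (h : NN 𝒜 y θ n c H) (e : ι) (he : eval (Pi.single e 1) H ≠ 0) :
    ∃ ev : Fin n → (A →ₐ[K] K), Function.Injective ev ∧ ∀ p P, ev p (aeval y P) = eval (Pi.single e 1) P := by
  letI : DecidableEq K := Classical.decEq K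
  set φ : RR →+* K := eval (Pi.single e 1) with hφ
  set g := (gpol n c).map φ with hg
  have hgm : g.Monic := (gpol_deg n c).1.map _
  have hgd : g.natDegree = n := by rw [hg, (gpol_deg n c).1.natDegree_map, (gpol_deg n c).2]
  have hsep : g.Separable := by
    obtain ⟨a, b, hab⟩ := h.hH
    have h2 := congrArg (Polynomial.map φ) hab
    rw [Polynomial.map_add, Polynomial.map_mul, Polynomial.map_mul, Polynomial.map_C, ← Polynomial.derivative_map, ← hg] at h2
    refine ⟨Polynomial.C (φ H)⁻¹ * a.map φ, Polynomial.C (φ H)⁻¹ * b.map φ, ?_⟩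
    rw [mul_assoc, mul_assoc, ← mul_add, h2, ← Polynomial.C_mul, inv_mul_cancel₀ he, Polynomial.C_1]
  have hcard : g.roots.toFinset.card = n := by
    rw [Multiset.toFinset_card_of_nodup (Polynomial.nodup_roots hsep), ← hgd]
    exact ((IsAlgClosed.splits g).natDegree_eq_card_roots).symm
  let eqv := g.roots.toFinset.equivFinOfCardEq hcard
  let ζ : Fin n → K := fun p => (eqv.symm p).1
  have hζinj : Function.Injective ζ := fun p q hpq => eqv.symm.injective (Subtype.ext hpq)
  have hζ : ∀ p, g.eval (ζ p) = 0 := by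
    intro p
    have := (eqv.symm p).2
    rw [Multiset.mem_toFinset, Polynomial.mem_roots hgm.ne_zero] at this
    exact this
  set Φ : Polynomial RR →+* A := Polynomial.eval₂RingHom (aeval y : RR →ₐ[K] A).toRingHom θ with hΦ
  have main : ∀ p, ∃ ev : A →ₐ[K] K, (∀ P, ev (aeval y P) = φ P) ∧ ev θ = ζ p := by
    intro p
    set Ψ : Polynomial RR →+* K := Polynomial.eval₂RingHom φ (ζ p) with hΨ
    have hker : RingHom.ker Φ ≤ RingHom.ker Ψ := by
      intro P hP
      rw [RingHom.mem_ker] at hP ⊢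
      have hm := Polynomial.modByMonic_add_div P (gpol n c)
      have hr : P %ₘ (gpol n c) = 0 := by
        by_cases hn : n = 0
        · have : (gpol n c) = 1 := by
            exact Polynomial.eq_one_of_monic_natDegree_zero (gpol_deg n c).1 (by rw [(gpol_deg n c).2, hn])
          rw [this, Polynomial.modByMonic_one]
        have hlt : (P %ₘ (gpol n c)).natDegree < n := by
          have := Polynomial.natDegree_modByMonic_lt P (gpol_deg n c).1 (fun h1 => by
            have := (gpol_deg n c).2; rw [h1, Polynomial.natDegree_one] at this; exact hn this.symm)
          rwa [(gpol_deg n c).2] at this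
        have h0 : Φ (P %ₘ (gpol n c)) = 0 := by
          have := congrArg Φ hm
          rw [map_add, map_mul, hP] at this
          have hz : Φ (gpol n c) = 0 := h.root
          rwa [hz, zero_mul, add_zero] at this
        rw [hΦ, Polynomial.coe_eval₂RingHom, Polynomial.eval₂_eq_sum_range' _ hlt] at h0
        have h3 := h.tind (fun i => (P %ₘ (gpol n c)).coeff i) h0
        ext1 i
        by_cases hi : i < n
        · exact h3 i hi
        · exact Polynomial.coeff_eq_zero_of_natDegree_lt (by omega)
      rw [← hm, hr, zero_add, map_mul]
      have : Ψ (gpol n c) = 0 := by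
        rw [hΨ, Polynomial.coe_eval₂RingHom, Polynomial.eval₂_eq_eval_map]; exact hζ p
      rw [this, zero_mul]
    have hsur : Function.Surjective Ψ := fun k => ⟨Polynomial.C (C k), by simp [hΨ, hφ]⟩
    haveI hmax : (RingHom.ker Ψ).IsMaximal := RingHom.ker_isMaximal_of_surjective Ψ hsur
    letI : Algebra (Polynomial RR) A := Φ.toAlgebra
    haveI : Algebra.IsIntegral (Polynomial RR) A := by
      constructor
      intro x
      obtain ⟨q, hq, hq0⟩ := h.int x
      refine ⟨q.map Polynomial.C, hq.map _, ?_⟩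
      rw [Polynomial.eval₂_map]
      have : (algebraMap (Polynomial RR) A).comp Polynomial.C = (aeval y : RR →ₐ[K] A).toRingHom := by
        refine RingHom.ext fun P => ?_
        change Φ (Polynomial.C P) = _
        simp [hΦ]
      rw [this]; exact hq0
    obtain ⟨Q, hQ, hQc⟩ := Ideal.exists_ideal_over_maximal_of_isIntegral (S := A) (RingHom.ker Ψ) hker
    obtain ⟨ev, hev⟩ := pts_of_finType (K := K) Q hQ
    have key : ∀ b : Polynomial RR, ev (Φ b) = Ψ b := by
      intro b
      have h1 : b - Polynomial.C (C (Ψ b)) ∈ RingHom.ker Ψ := by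
        rw [RingHom.mem_ker, map_sub]; simp [hΨ, hφ]
      rw [← hQc, Ideal.mem_comap, ← hev, RingHom.mem_ker, map_sub, map_sub] at h1
      have h2 : algebraMap (Polynomial RR) A b = Φ b := rfl
      have h3 : algebraMap (Polynomial RR) A (Polynomial.C (C (Ψ b))) = algebraMap K A (Ψ b) := by
        change Φ _ = _
        simp [hΦ]
      rw [h2, h3, AlgHom.commutes] at h1
      exact sub_eq_zero.1 h1
    refine ⟨ev, fun P => ?_, ?_⟩
    · have := key (Polynomial.C P)
      simpa [hΦ, hΨ] using this
    · have := key Polynomial.X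
      simpa [hΦ, hΨ] using this
  choose ev h1 h2 using main
  exact ⟨ev, fun p q hpq => hζinj (by rw [← h2 p, ← h2 q, hpq]), h1⟩
end
end DP
end

noncomputable section
namespace DP
set_option linter.all false
open MvPolynomial

section
variable {K A ι o Pt : Type*} [Field K] [CommRing A] [Algebra K A] [Fintype ι] [DecidableEq ι] [Fintype o] [Fintype Pt]
local notation "RR" => MvPolynomial ι K

/-- the linear map from families of scalars on points to coordinates -/
def pairM {J : Type*} [Fintype J] (m : Pt → J → K) : (Pt → K) →ₗ[K] (J → K) where
  toFun f i := ∑ p, f p * m p i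
  map_add' f g := by funext i; simp [add_mul, Finset.sum_add_distrib]
  map_smul' c f := by funext i; simp [Finset.mul_sum, mul_assoc]

theorem pair_perfect {J : Type*} [Fintype J] [DecidableEq J] (m : Pt → J → K) (hcard : Fintype.card Pt = Fintype.card J)
    (hinj : ∀ f : Pt → K, (∀ i, ∑ p, f p * m p i = 0) → f = 0) :
    (∀ t : J → K, ∃ f : Pt → K, ∀ i, ∑ p, f p * m p i = t i) ∧ (∀ g : J → K, (∀ p, ∑ i, g i * m p i = 0) → g = 0) := by
  have h1 : Function.Injective (pairM m) := by
    rw [← LinearMap.ker_eq_bot, LinearMap.ker_eq_bot']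
    intro f hf
    exact hinj f fun i => congrFun hf i
  have h2 : Function.Surjective (pairM m) :=
    (LinearMap.injective_iff_surjective_of_finrank_eq_finrank (by simp [hcard])).1 h1
  have h3 : ∀ t : J → K, ∃ f : Pt → K, ∀ i, ∑ p, f p * m p i = t i := by
    intro t
    obtain ⟨f, hf⟩ := h2 t
    exact ⟨f, fun i => congrFun hf i⟩
  refine ⟨h3, fun g hg => ?_⟩
  funext j
  obtain ⟨f, hf⟩ := h3 (Pi.single j 1)
  have h4 : ∑ i, g i * (Pi.single j 1 : J → K) i = 0 := by
    simp_rw [← hf, Finset.mul_sum]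
    rw [Finset.sum_comm]
    refine Finset.sum_eq_zero fun p _ => ?_
    have := congrArg (fun q => f p * q) (hg p)
    simp only [Finset.mul_sum, mul_zero] at this
    rw [← this]
    exact Finset.sum_congr rfl fun i _ => by ring
  simpa [Pi.single_apply] using h4

theorem FB.points {𝒜 : ℕ → Submodule K A} [GradedAlgebra 𝒜] {y : ι → A} {z : o → A} {w : A} {a : o → o → K} (F : FB 𝒜 y z w a) [DecidableEq o] [DecidableEq Pt]
    (e : ι) (ev : Pt → (A →ₐ[K] K)) (hinj : Function.Injective ev) (hev : ∀ p P, ev p (aeval y P) = eval (Pi.single e 1) P)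
    (hcard : Fintype.card Pt = Fintype.card o + 2) :
    (∀ g : Option (Option o) → K, (∀ p, ∑ i, g i * ev p (u3 z w i) = 0) → g = 0) ∧
    ∃ μ : Pt → K, (∀ p, μ p ≠ 0) ∧
      (∀ P : Option (Option o) → RR, ∑ p, μ p * ev p (∑ i, aeval y (P i) * u3 z w i) = eval (Pi.single e 1) (P none)) ∧
      (∀ t : Pt → K, ∑ p, μ p * t p = 0 → ∃ (s : K) (r : o → K), ∀ p, ev p (s • y e + ∑ j, r j • z j) = t p) := by
  set φ : RR →+* K := eval (Pi.single e 1) with hφ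
  have hexp : ∀ p (P : Option (Option o) → RR), ev p (∑ i, aeval y (P i) * u3 z w i) = ∑ i, φ (P i) * ev p (u3 z w i) := by
    intro p P
    rw [map_sum]
    exact Finset.sum_congr rfl fun i _ => by rw [map_mul, hev]
  have hc2 : Fintype.card Pt = Fintype.card (Option (Option o)) := by simp [hcard]
  have hLI : LinearIndependent K (fun p => (ev p : A → K)) := by
    have h0 := linearIndependent_monoidHom A K
    have h1 := h0.comp (fun p : Pt => ((ev p : A →ₐ[K] K) : A →* K)) (by
      intro p q hpq
      apply hinj
      ext x
      exact DFunLike.congr_fun hpq x)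
    exact h1
  have hI1 : ∀ f : Pt → K, (∀ i, ∑ p, f p * ev p (u3 z w i) = 0) → f = 0 := by
    intro f hf
    have := Fintype.linearIndependent_iff.1 hLI f (by
      funext x
      obtain ⟨P, hP⟩ := F.sp x
      simp only [Finset.sum_apply, Pi.smul_apply, smul_eq_mul, Pi.zero_apply]
      rw [hP]
      simp_rw [hexp, Finset.mul_sum]
      rw [Finset.sum_comm]
      refine Finset.sum_eq_zero fun i _ => ?_
      have := congrArg (fun q => φ (P i) * q) (hf i)
      simp only [Finset.mul_sum, mul_zero] at this
      rw [← this]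
      exact Finset.sum_congr rfl fun i _ => by ring)
    funext p; exact this p
  obtain ⟨hsur, hI2⟩ := pair_perfect (fun p i => ev p (u3 z w i)) hc2 hI1
  refine ⟨hI2, ?_⟩
  have hsur2 := (pair_perfect (fun i p => ev p (u3 z w i)) hc2.symm hI2).1
  obtain ⟨μ, hμ⟩ := hsur (fun i => if i = none then 1 else 0)
  have hμ1 : ∀ P : Option (Option o) → RR, ∑ p, μ p * ev p (∑ i, aeval y (P i) * u3 z w i) = φ (P none) := by
    intro P
    simp_rw [hexp, Finset.mul_sum]
    rw [Finset.sum_comm]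
    have : ∀ i, ∑ p, μ p * (φ (P i) * ev p (u3 z w i)) = φ (P i) * (if i = none then 1 else 0) := by
      intro i
      rw [← hμ i, Finset.mul_sum]
      exact Finset.sum_congr rfl fun i _ => by ring
    simp [this]
  -- values in the span of 1, z
  have hval : ∀ t : Pt → K, ∑ p, μ p * t p = 0 → ∃ (s : K) (r : o → K), ∀ p, ev p (s • 1 + ∑ j, r j • z j) = t p := by
    intro t ht
    obtain ⟨g, hg⟩ := hsur2 t
    have h0 : g none = 0 := by
      have := hμ1 (fun i => C (g i))
      simp_rw [hexp] at this
      simp only [hφ, eval_C] at this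
      simp_rw [hg] at this
      rw [← this]; exact ht
    refine ⟨g (some none), fun j => g (some (some j)), fun p => ?_⟩
    rw [← hg p, Fintype.sum_option, Fintype.sum_option, h0]
    simp [u3]
  have hye : ∀ p, ev p (y e) = 1 := by
    intro p
    have := hev p (X e)
    simpa [hφ] using this
  refine ⟨μ, ?_, hμ1, ?_⟩
  · intro q hq
    obtain ⟨s, r, hsr⟩ := hval (Pi.single q 1) (by simp [Pi.single_apply, hq])
    have hr : r = 0 := by
      apply F.nd
      intro j
      -- expand (s + Σ r z) z_j
      have hm := fun i => F.mul i j
      choose l κ hκ hm using hm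
      have h1 : (s • 1 + ∑ i, r i • z i) * z j = ∑ i, aeval y ((fun i : Option (Option o) => (i.elim (C (∑ i, r i * a i j)) (fun k => k.elim (∑ i, C (r i) * κ i) (fun m => (if m = j then C s else 0) + ∑ i, C (r i) * lf (l i m)))) : Option (Option o) → RR) i) * u3 z w i := by
        rw [sum3]
        simp only [Option.elim_none, Option.elim_some, map_sum, map_mul, aeval_C, map_add, add_mul, Finset.sum_add_distrib, Finset.sum_mul, apply_ite (aeval y), map_zero, ite_mul, zero_mul, Finset.sum_ite_eq', Finset.mem_univ, if_true]
        simp only [Algebra.smul_def, mul_one]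
        rw [Finset.sum_comm (γ := o)]
        have : ∀ i, algebraMap K A (r i) * z i * z j = algebraMap K A (r i) * algebraMap K A (a i j) * w + (algebraMap K A (r i) * aeval y (κ i) + ∑ m, algebraMap K A (r i) * aeval y (lf (l i m)) * z m) := by
          intro i
          rw [mul_assoc, hm i, mul_add, mul_add, Finset.mul_sum]
          simp only [mul_assoc]; ring
        simp only [this, Finset.sum_add_distrib]
        ring
      have h2 := hμ1 (fun i : Option (Option o) => (i.elim (C (∑ i, r i * a i j)) (fun k => k.elim (∑ i, C (r i) * κ i) (fun m => (if m = j then C s else 0) + ∑ i, C (r i) * lf (l i m)))))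
      rw [← h1] at h2
      simp only [map_mul, Option.elim_none, hφ, eval_C] at h2
      rw [← h2]
      refine Finset.sum_eq_zero fun p _ => ?_
      rw [hsr p]
      by_cases hp : p = q
      · rw [hp, hq, zero_mul]
      · rw [Pi.single_eq_of_ne hp]; ring
    have hs : ∀ p, s = (Pi.single q 1 : Pt → K) p := by
      intro p
      rw [← hsr p, hr]; simp
    have : 1 < Fintype.card Pt := by omega
    obtain ⟨q', hq'⟩ := Fintype.exists_ne_of_one_lt_card this q
    have e1 := hs q
    have e2 := hs q'
    rw [Pi.single_eq_same] at e1
    rw [Pi.single_eq_of_ne hq'] at e2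
    rw [e1] at e2; exact one_ne_zero e2
  · intro t ht
    obtain ⟨s, r, hsr⟩ := hval t ht
    refine ⟨s, r, fun p => ?_⟩
    rw [← hsr p]
    simp [hye]
end
end DP
end

noncomputable section
namespace DP
open MvPolynomial
set_option linter.all false
section LinAlg
variable {K : Type*} [Field K] {V : Type*} [AddCommGroup V] [Module K V] [FiniteDimensional K V]

lemma finrank_le_of_forms {n : ℕ} (g : Fin n → (V →ₗ[K] K))
    (h : ∀ v, (∀ i, g i v = 0) → v = 0) : Module.finrank K V ≤ n := by
  have hinj : Function.Injective (LinearMap.pi g) := by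
    rw [injective_iff_map_eq_zero]
    intro v hv
    exact h v fun i => congrFun hv i
  simpa using LinearMap.finrank_le_finrank_of_injective hinj

lemma rank_two_three (p q : Fin 3 → (V →ₗ[K] K))
    (h : ∀ v k l, p k v * q l v = p l v * q k v)
    (hinj : ∀ v, (∀ i, p i v = 0) → (∀ i, q i v = 0) → v = 0) : Module.finrank K V ≤ 3 := by
  have pol : ∀ u v k l, p k u * q l v + p k v * q l u = p l u * q k v + p l v * q k u := by
    intro u v k l
    have h1 := h (u + v) k l
    have h2 := h u k l
    have h3 := h v k l
    simp only [map_add] at h1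
    linear_combination h1 - h2 - h3
  by_cases hp : ∀ v, (∀ i, p i v = 0) → v = 0
  · exact finrank_le_of_forms p hp
  push Not at hp
  obtain ⟨v0, hv0, hne⟩ := hp
  obtain ⟨k0, hk0⟩ : ∃ k, q k v0 ≠ 0 := by
    by_contra hcon
    push Not at hcon
    exact hne (hinj v0 hv0 hcon)
  have hpp : ∀ v, p k0 v = 0 → ∀ i, p i v = 0 := by
    intro v hv i
    have := pol v0 v i k0
    rw [hv0, hv0, hv] at this
    have h' : p i v * q k0 v0 = 0 := by linear_combination this
    exact (mul_eq_zero.1 h').resolve_right hk0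
  by_cases hf : ∀ v, p k0 v = 0
  · exact finrank_le_of_forms q fun v hv => hinj v (hpp v (hf v)) hv
  push Not at hf
  obtain ⟨v1, hv1⟩ := hf
  have : Module.finrank K V ≤ 2 := by
    apply finrank_le_of_forms ![p k0, q k0]
    intro v hv
    have h0 : p k0 v = 0 := hv 0
    have h1 : q k0 v = 0 := hv 1
    have h2 := hpp v h0
    refine hinj v h2 fun l => ?_
    have := pol v1 v k0 l
    rw [h0, h1, h2] at this
    have h' : p k0 v1 * q l v = 0 := by linear_combination this
    exact (mul_eq_zero.1 h').resolve_left hv1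
  omega

lemma plucker_aux (f p1 p2 p3 q1 q2 q3 n12 n13 n23 : V →ₗ[K] K)
    (h12 : ∀ v, f v * n12 v = p1 v * q2 v - p2 v * q1 v)
    (h13 : ∀ v, f v * n13 v = p1 v * q3 v - p3 v * q1 v)
    (h23 : ∀ v, f v * n23 v = p2 v * q3 v - p3 v * q2 v)
    (hinj : ∀ v, f v = 0 → p1 v = 0 → p2 v = 0 → p3 v = 0 → q1 v = 0 → q2 v = 0 → q3 v = 0 →
      n12 v = 0 → n13 v = 0 → n23 v = 0 → v = 0) (u : V) (hu : f u ≠ 0) :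
    Module.finrank K V ≤ 4 := by
  let W := LinearMap.ker f
  have hW : Module.finrank K W ≤ 3 := by
    apply rank_two_three (V := W) ![p1 ∘ₗ W.subtype, p2 ∘ₗ W.subtype, p3 ∘ₗ W.subtype]
      ![q1 ∘ₗ W.subtype, q2 ∘ₗ W.subtype, q3 ∘ₗ W.subtype]
    · rintro ⟨v, hv⟩ k l
      have hv' : f v = 0 := hv
      have e12 := h12 v
      have e13 := h13 v
      have e23 := h23 v
      rw [hv'] at e12 e13 e23
      fin_cases k <;> fin_cases l <;> simp <;> grind
    · rintro ⟨v, hv⟩ hp hq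
      have hv' : f v = 0 := hv
      have a1 : p1 v = 0 := hp 0
      have a2 : p2 v = 0 := hp 1
      have a3 : p3 v = 0 := hp 2
      have b1 : q1 v = 0 := hq 0
      have b2 : q2 v = 0 := hq 1
      have b3 : q3 v = 0 := hq 2
      have key : ∀ n p q p' q' : V →ₗ[K] K, (∀ v, f v * n v = p v * q' v - p' v * q v) →
          p v = 0 → q v = 0 → p' v = 0 → q' v = 0 → n v = 0 := by
        intro n p q p' q' h e1 e2 e3 e4
        have h1 := h (u + v)
        have h2 := h u
        simp only [map_add, e1, e2, e3, e4, hv'] at h1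
        have : f u * n v = 0 := by linear_combination h1 - h2
        exact (mul_eq_zero.1 this).resolve_left hu
      have := hinj v hv' a1 a2 a3 b1 b2 b3 (key n12 p1 q1 p2 q2 h12 a1 b1 a2 b2)
        (key n13 p1 q1 p3 q3 h13 a1 b1 a3 b3) (key n23 p2 q2 p3 q3 h23 a2 b2 a3 b3)
      exact Subtype.ext this
  have h1 := LinearMap.finrank_range_add_finrank_ker f
  have h2 : Module.finrank K (LinearMap.range f) ≤ 1 := by
    simpa using Submodule.finrank_le (LinearMap.range f)
  change _ + Module.finrank K W = _ at h1
  omega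

variable {ι : Type*}

/-- relation expression -/
def Phq (a : ι → ι → K) (i j k : ι) : K := (a j k - a i k) * a i j + a k j * a i k

lemma dim_le_four (a : Fin 5 → Fin 5 → (V →ₗ[K] K)) (s : V →ₗ[K] K)
    (hs : ∀ i j, i ≠ j → a i j + a j i = s) (h01 : a 0 1 = 0)
    (hrel : ∀ v j k l i i', [j, k, l, i, i'].Nodup →
      Phq (fun x y => a x y v) i j k - Phq (fun x y => a x y v) i j l
        = Phq (fun x y => a x y v) i' j k - Phq (fun x y => a x y v) i' j l)
    (hinj : ∀ v, (∀ i j, i ≠ j → a i j v = 0) → v = 0) : Module.finrank K V ≤ 4 := by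
  have S : ∀ v i j, i < j → a j i v = s v - a i j v := by
    intro v i j hij
    rw [← hs i j hij.ne]; simp
  have h01' : ∀ v, a 0 1 v = 0 := fun v => by rw [h01]; rfl
  let m01 := - a 0 1 - a 1 3 + s
  let m02 := a 0 2 - a 0 4 + a 2 3 + a 3 4 - s
  let m03 := a 0 1 - a 0 4 + a 1 2 + a 2 3 - s
  let m04 := - a 1 2 + a 1 4
  let m12 := a 0 1 - a 0 2 + a 1 3 - a 2 3
  let m13 := - a 2 3 + a 2 4
  let m14 := a 1 3 - a 1 4
  let m23 := a 0 1 - a 0 4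
  let m24 := - a 0 2 + a 0 4
  let m34 := - a 0 3 + a 0 4
  have S10 := fun v => S v 0 1 (by decide)
  have S20 := fun v => S v 0 2 (by decide)
  have S30 := fun v => S v 0 3 (by decide)
  have S40 := fun v => S v 0 4 (by decide)
  have S21 := fun v => S v 1 2 (by decide)
  have S31 := fun v => S v 1 3 (by decide)
  have S41 := fun v => S v 1 4 (by decide)
  have S32 := fun v => S v 2 3 (by decide)
  have S42 := fun v => S v 2 4 (by decide)
  have S43 := fun v => S v 3 4 (by decide)
  have r0 : ∀ v, m12 v * m34 v - m13 v * m24 v + m14 v * m23 v = 0 := by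
    intro v
    have := hrel v 0 1 2 3 4 (by decide)
    simp only [Phq, S10, S20, S30, S40, S21, S31, S41, S32, S42, S43] at this
    simp only [m12, m34, m13, m24, m14, m23, LinearMap.add_apply, LinearMap.sub_apply, LinearMap.neg_apply]
    linear_combination this
  have r1 : ∀ v, m02 v * m34 v - m03 v * m24 v + m04 v * m23 v = 0 := by
    intro v
    have := hrel v 0 1 3 4 2 (by decide)
    simp only [Phq, S10, S20, S30, S40, S21, S31, S41, S32, S42, S43] at this
    simp only [m02, m34, m03, m24, m04, m23, LinearMap.add_apply, LinearMap.sub_apply, LinearMap.neg_apply]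
    linear_combination this
  have r2 : ∀ v, m01 v * m34 v - m03 v * m14 v + m04 v * m13 v = 0 := by
    intro v
    have := hrel v 1 0 2 4 3 (by decide)
    simp only [Phq, S10, S20, S30, S40, S21, S31, S41, S32, S42, S43] at this
    simp only [m01, m34, m03, m14, m04, m13, LinearMap.add_apply, LinearMap.sub_apply, LinearMap.neg_apply]
    linear_combination this
  have r3 : ∀ v, m01 v * m24 v - m02 v * m14 v + m04 v * m12 v = 0 := by
    intro v
    have := hrel v 1 0 3 4 2 (by decide)
    simp only [Phq, S10, S20, S30, S40, S21, S31, S41, S32, S42, S43] at this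
    simp only [m01, m24, m02, m14, m04, m12, LinearMap.add_apply, LinearMap.sub_apply, LinearMap.neg_apply]
    linear_combination this
  have r4 : ∀ v, m01 v * m23 v - m02 v * m13 v + m03 v * m12 v = 0 := by
    intro v
    have := hrel v 2 0 3 1 4 (by decide)
    simp only [Phq, S10, S20, S30, S40, S21, S31, S41, S32, S42, S43] at this
    simp only [m01, m23, m02, m13, m03, m12, LinearMap.add_apply, LinearMap.sub_apply, LinearMap.neg_apply]
    linear_combination this
  have hm : ∀ v, m01 v = 0 → m02 v = 0 → m03 v = 0 → m04 v = 0 → m12 v = 0 → m13 v = 0 →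
      m14 v = 0 → m23 v = 0 → m24 v = 0 → m34 v = 0 → v = 0 := by
    intro v e01 e02 e03 e04 e12 e13 e14 e23 e24 e34
    simp only [m01, m02, m03, m04, m12, m13, m14, m23, m24, m34, LinearMap.add_apply,
      LinearMap.sub_apply, LinearMap.neg_apply, h01'] at e01 e02 e03 e04 e12 e13 e14 e23 e24 e34
    have t04 : a 0 4 v = 0 := by linear_combination -e23
    have t02 : a 0 2 v = 0 := by linear_combination -e24 + t04
    have t03 : a 0 3 v = 0 := by linear_combination -e34 + t04
    have u1 : a 1 3 v = a 2 3 v := by linear_combination e12 + t02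
    have u2 : s v = a 1 3 v := by linear_combination e01
    have t34 : a 3 4 v = 0 := by linear_combination e02 - t02 + t04 + u2 + u1
    have t12 : a 1 2 v = 0 := by linear_combination e03 + t04 + u2 + u1
    have t14 : a 1 4 v = 0 := by linear_combination e04 + t12
    have t13 : a 1 3 v = 0 := by linear_combination e14 + t14
    have t23 : a 2 3 v = 0 := by linear_combination t13 - u1
    have t24 : a 2 4 v = 0 := by linear_combination e13 + t23
    have ts : s v = 0 := by linear_combination u2 + t13
    have t01 := h01' v
    apply hinj v
    intro i j hij
    fin_cases i <;> fin_cases j <;>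
      first
      | exact absurd rfl hij
      | assumption
      | (simp only [Fin.mk_one, Fin.zero_eta, Fin.reduceFinMk, S10, S20, S30, S40, S21, S31, S41, S32, S42, S43, ts, t01, t02, t03, t04, t12, t13, t14, t23, t24, t34, sub_zero])
  by_cases z : ∀ v, m01 v = 0 ∧ m02 v = 0 ∧ m03 v = 0 ∧ m04 v = 0 ∧ m12 v = 0 ∧ m13 v = 0 ∧
      m14 v = 0 ∧ m23 v = 0 ∧ m24 v = 0 ∧ m34 v = 0
  · have : Module.finrank K V ≤ 0 := by
      apply finrank_le_of_forms (fun i : Fin 0 => (0 : V →ₗ[K] K))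
      intro v _
      obtain ⟨h1, h2, h3, h4, h5, h6, h7, h8, h9, h10⟩ := z v
      exact hm v h1 h2 h3 h4 h5 h6 h7 h8 h9 h10
    omega
  have z' : ∃ v, m01 v ≠ 0 ∨ m02 v ≠ 0 ∨ m03 v ≠ 0 ∨ m04 v ≠ 0 ∨ m12 v ≠ 0 ∨ m13 v ≠ 0 ∨
      m14 v ≠ 0 ∨ m23 v ≠ 0 ∨ m24 v ≠ 0 ∨ m34 v ≠ 0 := by
    by_contra hcon
    push Not at hcon
    exact z hcon
  clear_value m01 m02 m03 m04 m12 m13 m14 m23 m24 m34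
  clear z S S10 S20 S30 S40 S21 S31 S41 S32 S42 S43 h01' hrel hinj hs h01
  obtain ⟨u, h | h | h | h | h | h | h | h | h | h⟩ := z'
  -- f = m_ij, p_k = m_ik, q_k = m_jk ; f n_kl = p_k q_l - p_l q_k
  · refine plucker_aux m01 m02 m03 m04 m12 m13 m14 m23 m24 m34 ?_ ?_ ?_ ?_ u h
    · intro v; linear_combination r4 v
    · intro v; linear_combination r3 v
    · intro v; linear_combination r2 v
    · intros; apply hm <;> assumption
  · refine plucker_aux m02 (-m01) m03 m04 m12 m23 m24 (-m13) (-m14) m34 ?_ ?_ ?_ ?_ u h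
    · intro v; simp only [LinearMap.neg_apply]; linear_combination r4 v
    · intro v; simp only [LinearMap.neg_apply]; linear_combination r3 v
    · intro v; linear_combination r1 v
    · intro v; simp only [LinearMap.neg_apply, neg_eq_zero]; intros; apply hm <;> assumption
  · refine plucker_aux m03 m01 m02 m04 (-m13) (-m23) m34 m12 m14 m24 ?_ ?_ ?_ ?_ u h
    · intro v; simp only [LinearMap.neg_apply]; linear_combination r4 v
    · intro v; simp only [LinearMap.neg_apply]; linear_combination -r2 v
    · intro v; simp only [LinearMap.neg_apply]; linear_combination -r1 v
    · intro v; simp only [LinearMap.neg_apply, neg_eq_zero]; intros; apply hm <;> assumption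
  · refine plucker_aux m04 m01 m02 m03 (-m14) (-m24) (-m34) m12 m13 m23 ?_ ?_ ?_ ?_ u h
    · intro v; simp only [LinearMap.neg_apply]; linear_combination r3 v
    · intro v; simp only [LinearMap.neg_apply]; linear_combination r2 v
    · intro v; simp only [LinearMap.neg_apply]; linear_combination r1 v
    · intro v; simp only [LinearMap.neg_apply, neg_eq_zero]; intros; apply hm <;> assumption
  · refine plucker_aux m12 (-m01) m13 m14 (-m02) m23 m24 m03 m04 m34 ?_ ?_ ?_ ?_ u h
    · intro v; simp only [LinearMap.neg_apply]; linear_combination r4 v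
    · intro v; simp only [LinearMap.neg_apply]; linear_combination r3 v
    · intro v; linear_combination r0 v
    · intro v; simp only [LinearMap.neg_apply, neg_eq_zero]; intros; apply hm <;> assumption
  · refine plucker_aux m13 (-m01) m12 m14 (-m03) (-m23) m34 m02 m04 m24 ?_ ?_ ?_ ?_ u h
    · intro v; simp only [LinearMap.neg_apply]; linear_combination -r4 v
    · intro v; simp only [LinearMap.neg_apply]; linear_combination r2 v
    · intro v; simp only [LinearMap.neg_apply]; linear_combination -r0 v
    · intro v; simp only [LinearMap.neg_apply, neg_eq_zero]; intros; apply hm <;> assumption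
  · refine plucker_aux m14 (-m01) m12 m13 (-m04) (-m24) (-m34) m02 m03 m23 ?_ ?_ ?_ ?_ u h
    · intro v; simp only [LinearMap.neg_apply]; linear_combination -r3 v
    · intro v; simp only [LinearMap.neg_apply]; linear_combination -r2 v
    · intro v; simp only [LinearMap.neg_apply]; linear_combination r0 v
    · intro v; simp only [LinearMap.neg_apply, neg_eq_zero]; intros; apply hm <;> assumption
  · refine plucker_aux m23 (-m02) (-m12) m24 (-m03) (-m13) m34 m01 m04 m14 ?_ ?_ ?_ ?_ u h
    · intro v; simp only [LinearMap.neg_apply]; linear_combination r4 v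
    · intro v; simp only [LinearMap.neg_apply]; linear_combination r1 v
    · intro v; simp only [LinearMap.neg_apply]; linear_combination r0 v
    · intro v; simp only [LinearMap.neg_apply, neg_eq_zero]; intros; apply hm <;> assumption
  · refine plucker_aux m24 (-m02) (-m12) m23 (-m04) (-m14) (-m34) m01 m03 m13 ?_ ?_ ?_ ?_ u h
    · intro v; simp only [LinearMap.neg_apply]; linear_combination r3 v
    · intro v; simp only [LinearMap.neg_apply]; linear_combination -r1 v
    · intro v; simp only [LinearMap.neg_apply]; linear_combination -r0 v
    · intro v; simp only [LinearMap.neg_apply, neg_eq_zero]; intros; apply hm <;> assumption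
  · refine plucker_aux m34 (-m03) (-m13) (-m23) (-m04) (-m14) (-m24) m01 m02 m12 ?_ ?_ ?_ ?_ u h
    · intro v; simp only [LinearMap.neg_apply]; linear_combination r2 v
    · intro v; simp only [LinearMap.neg_apply]; linear_combination r1 v
    · intro v; simp only [LinearMap.neg_apply]; linear_combination r0 v
    · intro v; simp only [LinearMap.neg_apply, neg_eq_zero]; intros; apply hm <;> assumption

lemma dim_le_six (a : Fin 4 → Fin 4 → (V →ₗ[K] K)) (s : V →ₗ[K] K)
    (hs : ∀ i j, i ≠ j → a i j + a j i = s) (h01 : a 0 1 = 0)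
    (hinj : ∀ v, (∀ i j, i ≠ j → a i j v = 0) → v = 0) : Module.finrank K V ≤ 6 := by
  have S : ∀ v i j, i < j → a j i v = s v - a i j v := by
    intro v i j hij
    rw [← hs i j hij.ne]; simp
  apply finrank_le_of_forms ![s, a 0 2, a 0 3, a 1 2, a 1 3, a 2 3]
  intro v hv
  have ts : s v = 0 := hv 0
  have t02 : a 0 2 v = 0 := hv 1
  have t03 : a 0 3 v = 0 := hv 2
  have t12 : a 1 2 v = 0 := hv 3
  have t13 : a 1 3 v = 0 := hv 4
  have t23 : a 2 3 v = 0 := hv 5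
  have t01 : a 0 1 v = 0 := by rw [h01]; rfl
  have S10 := S v 0 1 (by decide)
  have S20 := S v 0 2 (by decide)
  have S30 := S v 0 3 (by decide)
  have S21 := S v 1 2 (by decide)
  have S31 := S v 1 3 (by decide)
  have S32 := S v 2 3 (by decide)
  apply hinj v
  intro i j hij
  fin_cases i <;> fin_cases j <;>
    first
    | exact absurd rfl hij
    | assumption
    | (simp only [Fin.mk_one, Fin.zero_eta, Fin.reduceFinMk, S10, S20, S30, S21, S31, S32, ts, t01, t02, t03, t12, t13, t23, sub_zero])
end LinAlg
end DP
end

noncomputable section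
namespace DP
open MvPolynomial
set_option linter.all false
section Flat
variable {K : Type*} [Field K] {V : Type*} [AddCommGroup V] [Module K V]
variable {ι : Type*} [DecidableEq ι]

lemma flat_ext (a : ι → ι → (V →ₗ[K] K)) (s : V →ₗ[K] K)
    (hs : ∀ i j, i ≠ j → a i j + a j i = s)
    (hrel : ∀ v j k l i i', [j, k, l, i, i'].Nodup →
      Phq (fun x y => a x y v) i j k - Phq (fun x y => a x y v) i j l
        = Phq (fun x y => a x y v) i' j k - Phq (fun x y => a x y v) i' j l)
    (hE : ∀ v m x x', [v, m, x, x'].Nodup → a v x = a m x → a v x' = a m x' → False)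
    (hS : ∀ v b b' b'', [v, b, b', b''].Nodup → a v b = a v b' → a v b = a v b'' → False)
    (ν : V) (τ : K) (x : Fin 4 → ι) (hx : Function.Injective x)
    (hflat : ∀ i j, i ≠ j → a (x i) (x j) ν = τ) (v : ι) (hv : ∀ i, v ≠ x i) (i : Fin 4) :
    a v (x i) ν = τ := by
  have S : ∀ u i j, i ≠ j → a i j u = s u - a j i u := by
    intro u i j hij
    rw [← hs i j hij]; simp
  have sτ : s ν = 2 * τ := by
    rw [← hs (x 0) (x 1) (by simp [hx.eq_iff]), LinearMap.add_apply, hflat 0 1 (by decide),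
      hflat 1 0 (by decide)]
    ring
  have hxne : ∀ i j, i ≠ j → x i ≠ x j := fun i j h => hx.ne h
  -- nodup helper
  have nd : ∀ j l p q : Fin 4, [j, l, p, q].Nodup → [x j, v, x l, x p, x q].Nodup := by
    intro j l p q h
    simp only [List.nodup_cons, List.mem_cons, List.not_mem_nil, or_false, not_or, not_false_eq_true, List.nodup_nil, and_true, hx.eq_iff] at h ⊢
    refine ⟨⟨(hv _).symm, h.1⟩, ⟨hv _, hv _, hv _⟩, h.2⟩
  set b : Fin 4 → K := fun i => a v (x i) ν - τ with hb
  have hvb : ∀ i, a v (x i) ν = τ + b i := by intro i; simp [hb]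
  have hbv : ∀ i, a (x i) v ν = τ - b i := by
    intro i; rw [S ν (x i) v (hv i).symm, hvb, sτ]; ring
  have key : ∀ j l p q : Fin 4, [j, l, p, q].Nodup → b j * (b p - b q) = 0 := by
    intro j l p q h
    have hr := hrel ν (x j) v (x l) (x p) (x q) (nd j l p q h)
    simp only [List.nodup_cons, List.mem_cons, List.not_mem_nil, or_false, not_or, not_false_eq_true, List.nodup_nil, and_true] at h
    obtain ⟨⟨h1, h2, h3⟩, ⟨h4, h5⟩, h6⟩ := h
    simp only [Phq, hvb, hbv, hflat j l h1, hflat l j (Ne.symm h1), hflat p l (Ne.symm h4),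
      hflat q l (Ne.symm h5), hflat p j (Ne.symm h2), hflat q j (Ne.symm h3)] at hr
    linear_combination -hr
  have pol : ∀ μ (j l p q : Fin 4), [j, l, p, q].Nodup →
      b p * a (x p) (x j) μ - b j * s μ * 0 - (b p) * a v (x j) μ - b j * a v (x p) μ
      = b q * a (x q) (x j) μ - (b q) * a v (x j) μ - b j * a v (x q) μ
        + b j * (a (x p) (x j) μ - a (x q) (x j) μ) := by
    intro μ j l p q h
    have hr := hrel (ν + μ) (x j) v (x l) (x p) (x q) (nd j l p q h)
    have hr1 := hrel ν (x j) v (x l) (x p) (x q) (nd j l p q h)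
    have hr2 := hrel μ (x j) v (x l) (x p) (x q) (nd j l p q h)
    simp only [List.nodup_cons, List.mem_cons, List.not_mem_nil, or_false, not_or, not_false_eq_true, List.nodup_nil, and_true] at h
    obtain ⟨⟨h1, h2, h3⟩, ⟨h4, h5⟩, h6⟩ := h
    have e1 := S μ (x j) v (hv j).symm
    have e2 := S μ (x p) v (hv p).symm
    have e3 := S μ (x q) v (hv q).symm
    have e4 := S μ (x l) (x j) (hxne _ _ (Ne.symm h1))
    simp only [Phq, map_add, hvb, hbv, hflat j l h1, hflat l j (Ne.symm h1), hflat p l (Ne.symm h4),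
      hflat q l (Ne.symm h5), hflat p j (Ne.symm h2), hflat q j (Ne.symm h3), e1, e2, e3, e4] at hr hr1 hr2
    linear_combination hr - hr1 - hr2
  by_contra hi
  have hi' : b i ≠ 0 := by simpa [hb, sub_eq_zero] using hi
  have cmp : ∀ i : Fin 4, b i ≠ 0 → ∀ p q, p ≠ i → q ≠ i → b p = b q := by
    intro i hi p q hp hq
    by_cases hpq : p = q
    · rw [hpq]
    obtain ⟨l, hl⟩ : ∃ l, [i, l, p, q].Nodup := by
      clear * - hp hq hpq
      revert i p q; decide
    exact sub_eq_zero.1 ((mul_eq_zero.1 (key i l p q hl)).resolve_left hi)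
  by_cases hstar : ∀ j, b j = b i
  · -- star
    have eqv : ∀ p q, p ≠ q → a v (x p) = a v (x q) := by
      intro p q hpq
      obtain ⟨j, l, hl⟩ : ∃ j l, [j, l, p, q].Nodup := by
        revert p q; decide
      ext μ
      have := pol μ j l p q hl
      rw [hstar p, hstar q, hstar j] at this
      have h' : b i * (a v (x p) μ - a v (x q) μ) = 0 := by linear_combination -this
      exact sub_eq_zero.1 ((mul_eq_zero.1 h').resolve_left hi')
    refine hS v (x 0) (x 1) (x 2) ?_ (eqv 0 1 (by decide)) (eqv 0 2 (by decide))
    simp [hv, hx.eq_iff]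
  · push Not at hstar
    obtain ⟨j, hj⟩ := hstar
    have hji : j ≠ i := by rintro rfl; exact hj rfl
    -- all others are zero
    have hz : ∀ p, p ≠ i → b p = 0 := by
      intro p hp
      by_contra hpb
      obtain ⟨q, hq1, hq2⟩ : ∃ q, q ≠ i ∧ q ≠ p := by
        clear * - hp
        revert i p; decide
      have h1 := cmp i hi' p q hp hq1
      have h2 := cmp p hpb i q (Ne.symm hp) hq2
      have h3 := cmp i hi' j p hji hp
      exact hj (by rw [h3, h1, ← h2])
    have eqv : ∀ e, e ≠ i → a v (x e) = a (x i) (x e) := by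
      intro e he
      obtain ⟨l, q, hl⟩ : ∃ l q, [e, l, i, q].Nodup := by
        clear * - he
        revert e i; decide
      ext μ
      have := pol μ e l i q hl
      have hq : q ≠ i := by
        simp only [List.nodup_cons, List.mem_cons, List.not_mem_nil, or_false, not_or, not_false_eq_true, List.nodup_nil, and_true] at hl
        exact Ne.symm hl.2.2
      rw [hz e he, hz q hq] at this
      have h' : b i * (a v (x e) μ - a (x i) (x e) μ) = 0 := by linear_combination -this
      exact sub_eq_zero.1 ((mul_eq_zero.1 h').resolve_left hi')
    obtain ⟨e, e', h1, h2, h3⟩ : ∃ e e' : Fin 4, e ≠ i ∧ e' ≠ i ∧ e ≠ e' := by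
      clear * -
      revert i; decide
    refine hE v (x i) (x e) (x e') ?_ (eqv e h1) (eqv e' h2)
    simp [hv, hx.eq_iff, h3, Ne.symm h1, Ne.symm h2]

lemma flat_all (a : ι → ι → (V →ₗ[K] K)) (s : V →ₗ[K] K)
    (hs : ∀ i j, i ≠ j → a i j + a j i = s)
    (hrel : ∀ v j k l i i', [j, k, l, i, i'].Nodup →
      Phq (fun x y => a x y v) i j k - Phq (fun x y => a x y v) i j l
        = Phq (fun x y => a x y v) i' j k - Phq (fun x y => a x y v) i' j l)
    (hE : ∀ v m x x', [v, m, x, x'].Nodup → a v x = a m x → a v x' = a m x' → False)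
    (hS : ∀ v b b' b'', [v, b, b', b''].Nodup → a v b = a v b' → a v b = a v b'' → False)
    (ν : V) (f : Fin 5 → ι) (hf : Function.Injective f)
    (hflat : ∀ i j, i ≠ j → a (f i) (f j) ν = 0) : ∀ u v, u ≠ v → a u v ν = 0 := by
  have s0 : s ν = 0 := by
    rw [← hs (f 0) (f 1) (by simp [hf.eq_iff]), LinearMap.add_apply, hflat 0 1 (by decide),
      hflat 1 0 (by decide), add_zero]
  have S : ∀ i j, i ≠ j → a i j ν = - a j i ν := by
    intro i j hij
    have : (a i j + a j i) ν = 0 := by rw [hs i j hij, s0]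
    simpa using eq_neg_of_add_eq_zero_left this
  have h1 : ∀ v, (∀ i, v ≠ f i) → ∀ i, a v (f i) ν = 0 := by
    intro v hv i
    obtain ⟨g, hg, k, hk⟩ : ∃ g : Fin 4 → Fin 5, Function.Injective g ∧ ∃ k, g k = i := by
      by_cases hi : i = 4
      · refine ⟨Fin.succ, Fin.succ_injective _, 3, ?_⟩; rw [hi]; rfl
      · refine ⟨Fin.castSucc, Fin.castSucc_injective _, i.castPred hi, by simp⟩
    have := flat_ext a s hs hrel hE hS ν 0 (f ∘ g) (hf.comp hg)
      (fun i j hij => hflat _ _ (hg.ne hij)) v (fun i => hv _) k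
    simpa [hk] using this
  have h2 : ∀ v, (∀ i, v ≠ f i) → ∀ i, a (f i) v ν = 0 := by
    intro v hv i
    rw [S _ _ (hv i).symm, h1 v hv, neg_zero]
  intro u v huv
  by_cases hu : ∀ i, u ≠ f i
  · by_cases hv : ∀ i, v ≠ f i
    · have := flat_ext a s hs hrel hE hS ν 0 ![f 0, f 1, f 2, v] ?_ ?_ u ?_ 3
      · simpa using this
      · intro i j hij
        have hv' := fun i => (hv i).symm
        fin_cases i <;> fin_cases j <;> simp [hf.eq_iff, hv, hv'] at hij ⊢
      · intro i j hij
        fin_cases i <;> fin_cases j <;> simp [h1 v hv, h2 v hv] at hij ⊢ <;> exact hflat _ _ (by decide)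
      · intro i
        fin_cases i <;> simp [hu, huv]
    · push Not at hv
      obtain ⟨j, rfl⟩ := hv
      exact h1 u hu j
  · push Not at hu
    obtain ⟨i, rfl⟩ := hu
    by_cases hv : ∀ i, v ≠ f i
    · exact h2 v hv i
    · push Not at hv
      obtain ⟨j, rfl⟩ := hv
      exact hflat i j (fun h => huv (by rw [h]))

/-- Final dimension bound. -/
theorem dim_bound [FiniteDimensional K V] {c : ℕ} (hc : 3 ≤ c) (a : Fin (c+1) → Fin (c+1) → (V →ₗ[K] K))
    (s : V →ₗ[K] K)
    (hs : ∀ i j, i ≠ j → a i j + a j i = s) (h01 : a 0 1 = 0)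
    (hrel : ∀ v j k l i i', [j, k, l, i, i'].Nodup →
      Phq (fun x y => a x y v) i j k - Phq (fun x y => a x y v) i j l
        = Phq (fun x y => a x y v) i' j k - Phq (fun x y => a x y v) i' j l)
    (hE : ∀ v m x x', [v, m, x, x'].Nodup → a v x = a m x → a v x' = a m x' → False)
    (hS : ∀ v b b' b'', [v, b, b', b''].Nodup → a v b = a v b' → a v b = a v b'' → False)
    (hinj : ∀ v, (∀ i j, i ≠ j → a i j v = 0) → v = 0) :
    Module.finrank K V ≤ 6 ∧ (4 ≤ c → Module.finrank K V ≤ 4) := by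
  have h4 : 4 ≤ c → Module.finrank K V ≤ 4 := by
    intro h4
    have h5 : 5 ≤ c + 1 := by omega
    have hf : Function.Injective (Fin.castLE h5) := Fin.castLE_injective h5
    refine dim_le_four (fun i j => a (Fin.castLE h5 i) (Fin.castLE h5 j)) s
      (fun i j hij => hs _ _ (hf.ne hij)) ?_ ?_ ?_
    · have e1 : Fin.castLE h5 1 = 1 := by
        apply Fin.ext
        rw [Fin.val_castLE, Fin.val_one', Fin.val_one', Nat.mod_eq_of_lt, Nat.mod_eq_of_lt] <;> omega
      have e0 : Fin.castLE h5 0 = 0 := Fin.ext (by simp)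
      show a (Fin.castLE h5 0) (Fin.castLE h5 1) = 0
      rw [e0, e1, h01]
    · intro v j k l i i' h
      refine hrel v _ _ _ _ _ ?_
      simpa [hf.eq_iff] using h
    · intro v hv
      exact hinj v (flat_all a s hs hrel hE hS v _ hf hv)
  refine ⟨?_, h4⟩
  rcases Nat.lt_or_ge 3 c with h | h
  · have := h4 h; omega
  · obtain rfl : c = 3 := by omega
    exact dim_le_six a s hs h01 hinj
end Flat
end DP
end

noncomputable section
namespace DP
set_option linter.all false
open MvPolynomial

section
variable {K A J : Type*} {d : ℕ} [Field K] [CommRing A] [IsDomain A] [Algebra (MvPolynomial (Fin d) K) A] [Fintype J] [DecidableEq J]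

local notation "RY" => MvPolynomial (Fin d) K

def Rel (X : J → A) (Om : A) (α : J → J → (Fin d → K)) (κ : J → J → RY) : Prop :=
  ∀ j k, j ≠ k → X j * X k = Om + (lf (α j k) : RY) • X j + (lf (α k j) : RY) • X k + κ j k • 1

def Ind (K : Type*) (d : ℕ) {A J : Type*} [Field K] [CommRing A] [Algebra (MvPolynomial (Fin d) K) A] [Fintype J] (X : J → A) (Om : A) : Prop :=
  ∀ (ω : MvPolynomial (Fin d) K) (v : J → MvPolynomial (Fin d) K) (t : MvPolynomial (Fin d) K),
    ω • Om + ∑ m, v m • X m + t • (1 : A) = 0 → ω = 0 ∧ v = 0 ∧ t = 0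

/-- linear form as functional -/
def dl (u : Fin d → K) : (Fin d → K) →ₗ[K] K where
  toFun v := ∑ i, u i * v i
  map_add' v w := by simp [mul_add, Finset.sum_add_distrib]
  map_smul' c v := by simp [Finset.mul_sum, mul_left_comm]

theorem eval_lf (u v : Fin d → K) : eval v (lf u) = dl u v := by
  simp [lf_apply, dl]

theorem dl_add (u v : Fin d → K) : dl (u + v) = dl u + dl v := by
  ext; simp [dl, add_mul, Finset.sum_add_distrib]

def Phr (α : J → J → (Fin d → K)) (i j k : J) : RY :=
  (lf (α j k) - lf (α i k)) * lf (α i j) + lf (α k j) * lf (α i k)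

theorem relE {X : J → A} {Om : A} {α : J → J → (Fin d → K)} {κ : J → J → RY} (hR : Rel X Om α κ) (hI : Ind K d X Om)
    (i j k l : J) (hd : [i, j, k, l].Nodup) :
    α j k + α k j - (α j l + α l j) = α i k + α k i - (α i l + α l i) ∧
    Phr α i j k - Phr α i j l = κ j l - κ j k := by
  simp only [List.nodup_cons, List.mem_cons, List.not_mem_nil, or_false, not_or, List.nodup_nil, and_true, not_false_eq_true] at hd
  obtain ⟨⟨hij, hik, hil⟩, ⟨hjk, hjl⟩, hkl⟩ := hd
  have e1 := hR j k hjk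
  have e2 := hR j l hjl
  have e3 := hR i k hik
  have e4 := hR i l hil
  have e5 := hR i j hij
  have h0 : (lf (α j k) - lf (α j l) + lf (α k j) - lf (α l j) - (lf (α i k) - lf (α i l) + lf (α k i) - lf (α l i)) : RY) • Om
     + ∑ m, (Pi.single i (Phr α i j k - Phr α i j l + κ j k - κ j l)
        - Pi.single j (Phr α j i k - Phr α j i l + κ i k - κ i l)
        + Pi.single k (lf (α k j) * lf (α k i) - lf (α k i) * lf (α k j))
        - Pi.single l (lf (α l j) * lf (α l i) - lf (α l i) * lf (α l j)) : J → RY) m • X m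
     + ((lf (α j k) - lf (α j l)) * κ i j + lf (α k j) * κ i k - lf (α l j) * κ i l
       - ((lf (α i k) - lf (α i l)) * κ i j + lf (α k i) * κ j k - lf (α l i) * κ j l) : RY) • (1:A) = 0 := by
    have hs : ∀ (i : J) (p : RY), ∑ m, (Pi.single i p : J → RY) m • X m = p • X i := by
      intro i p
      rw [Finset.sum_eq_single i]
      · simp
      · intro b _ hb; simp [hb]
      · simp
    simp only [Pi.add_apply, Pi.sub_apply, add_smul (R := RY) (M := A), sub_smul (R := RY) (M := A), Finset.sum_add_distrib, Finset.sum_sub_distrib, hs]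
    simp only [Phr]
    simp only [Algebra.smul_def, map_sub, map_add, map_mul, mul_one] at e1 e2 e3 e4 e5 ⊢
    generalize algebraMap RY A (lf (α i j)) = aij at *
    generalize algebraMap RY A (lf (α j i)) = aji at *
    generalize algebraMap RY A (lf (α i k)) = aik at *
    generalize algebraMap RY A (lf (α k i)) = aki at *
    generalize algebraMap RY A (lf (α j k)) = ajk at *
    generalize algebraMap RY A (lf (α k j)) = akj at *
    generalize algebraMap RY A (lf (α i l)) = ail at *
    generalize algebraMap RY A (lf (α l i)) = ali at *
    generalize algebraMap RY A (lf (α j l)) = ajl at *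
    generalize algebraMap RY A (lf (α l j)) = alj at *
    generalize algebraMap RY A (κ i j) = kij at *
    generalize algebraMap RY A (κ i k) = kik at *
    generalize algebraMap RY A (κ i l) = kil at *
    generalize algebraMap RY A (κ j k) = kjk at *
    generalize algebraMap RY A (κ j l) = kjl at *
    linear_combination -(X i - aki) * e1 + (X i - ali) * e2 + (X j - akj) * e3 - (X j - alj) * e4 - (ajk - ajl - aik + ail) * e5
  obtain ⟨h1, h2, -⟩ := hI _ _ _ h0
  constructor
  · apply lf_inj
    simp only [map_add, map_sub]
    linear_combination h1
  · have := congrFun h2 i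
    simp [hij, hik, hil] at this
    linear_combination this

theorem gauge_lemma {M : Type*} [AddCommGroup M] {c : ℕ} (hc : 3 ≤ c) (σ : Fin (c+1) → Fin (c+1) → M)
    (hsym : ∀ j k, σ j k = σ k j)
    (hrule : ∀ i j k l, [i, j, k, l].Nodup → σ j k - σ j l = σ i k - σ i l) :
    ∃ (ε : Fin (c+1) → M) (s : M), ∀ j k, j ≠ k → σ j k + ε j + ε k = s := by
  have h1 : (1 : Fin (c+1)) ≠ 0 := by rw [Ne, Fin.ext_iff]; simp; omega
  have hv1 : ((1 : Fin (c+1)) : ℕ) = 1 := by rw [Fin.val_one']; exact Nat.mod_eq_of_lt (by omega)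
  let two : Fin (c+1) := ⟨2, by omega⟩
  have h2 : two ≠ 0 := by rw [Ne, Fin.ext_iff]; simp [two]
  have h21 : two ≠ 1 := by rw [Ne, Fin.ext_iff, hv1]; simp [two]
  let m : Fin (c+1) → Fin (c+1) := fun j => if j = 1 then two else 1
  have hm0 : ∀ j, m j ≠ 0 := by intro j; simp only [m]; split_ifs <;> assumption
  have hmj : ∀ j, m j ≠ j := by
    intro j; simp only [m]; split_ifs with h
    · rw [h]; exact h21
    · exact fun h' => h h'.symm
  let ε : Fin (c+1) → M := fun j => if j = 0 then 0 else σ 0 (m j) - σ j (m j)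
  have F : ∀ j n, j ≠ 0 → n ≠ 0 → n ≠ j → ε j = σ 0 n - σ j n := by
    intro j n hj hn hnj
    simp only [ε, if_neg hj]
    by_cases h : n = m j
    · rw [h]
    · have := hrule 0 j n (m j) (by
        have := hm0 j; have := hmj j
        simp [Ne.symm hj, Ne.symm hn, Ne.symm (hm0 j), h, Ne.symm hnj, Ne.symm (hmj j)])
      rw [sub_eq_sub_iff_add_eq_add] at this ⊢
      rw [add_comm (σ 0 (m j))]
      exact this
  have hE0 : ε 0 = 0 := by simp [ε]
  have T1 : ∀ j k, j ≠ 0 → k ≠ 0 → j ≠ k → σ 0 k + ε k = σ 0 k + σ 0 j - σ j k := by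
    intro j k hj hk hjk
    rw [F k j hk hj hjk, hsym j k]; abel
  have T2 : ∀ j k, j ≠ 0 → k ≠ 0 → σ 0 k + ε k = σ 0 j + ε j := by
    intro j k hj hk
    by_cases hjk : j = k
    · rw [hjk]
    · rw [T1 j k hj hk hjk, T1 k j hk hj (Ne.symm hjk), hsym k j]; abel
  refine ⟨ε, σ 0 1 + ε 1, ?_⟩
  intro j k hjk
  by_cases hj : j = 0
  · subst hj
    rw [hE0, add_zero]
    exact T2 _ _ h1 (Ne.symm hjk)
  · by_cases hk : k = 0
    · subst hk
      rw [hE0, add_zero, hsym]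
      exact T2 _ _ h1 hj
    · rw [F j k hj hk (Ne.symm hjk), ← T2 1 k h1 hk]
      abel

theorem Ind.shift {X : J → A} {Om : A} (h : Ind K d X Om) (ε : J → RY) (ρ : RY) :
    Ind K d (fun j => X j + ε j • 1) (Om + ρ • 1) := by
  intro ω v t hz
  have := h ω v (ω * ρ + ∑ m, v m * ε m + t) (by
    rw [← hz]
    simp only [smul_add, Finset.sum_add_distrib, add_smul, mul_smul, Finset.sum_smul]
    abel)
  obtain ⟨h1, h2, h3⟩ := this
  refine ⟨h1, h2, ?_⟩
  rw [h1, h2] at h3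
  simpa using h3

theorem Rel.shift {X : J → A} {Om : A} {α : J → J → (Fin d → K)} {κ : J → J → RY} (hR : Rel X Om α κ)
    (ε : J → (Fin d → K)) (ρ : RY) :
    Rel (fun j => X j + (lf (ε j) : RY) • 1) (Om + ρ • 1) (fun j k => α j k + ε k)
      (fun j k => κ j k - lf (α j k + ε k) * lf (ε j) - lf (α k j + ε j) * lf (ε k) + lf (ε j) * lf (ε k) - ρ) := by
  intro j k hjk
  have := hR j k hjk
  simp only [Algebra.smul_def, map_sub, map_add, map_mul, mul_one] at this ⊢
  linear_combination this

theorem hE_lemma {X : J → A} {Om : A} {α : J → J → (Fin d → K)} {κ : J → J → RY} (hR : Rel X Om α κ) (hI : Ind K d X Om)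
    (s : Fin d → K) (hs : ∀ i j, i ≠ j → α i j + α j i = s)
    (v m x x' : J) (hd : [v, m, x, x'].Nodup) (h1 : α v x = α m x) (h2 : α v x' = α m x') : False := by
  simp only [List.nodup_cons, List.mem_cons, List.not_mem_nil, or_false, not_or, List.nodup_nil, and_true, not_false_eq_true] at hd
  obtain ⟨⟨hvm, hvx, hvx'⟩, ⟨hmx, hmx'⟩, hxx'⟩ := hd
  have key : ∀ x, x ≠ v → x ≠ m → α v x = α m x → ∃ ρ : RY, (X x - (lf (α v x) : RY) • 1) * (X v - X m) = ρ • 1 := by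
    intro x hxv hxm h
    refine ⟨κ v x - κ m x, ?_⟩
    have e1 := hR v x (Ne.symm hxv)
    have e2 := hR m x (Ne.symm hxm)
    have h3 : α x v = α x m := by
      have a1 := hs v x (Ne.symm hxv); have a2 := hs m x (Ne.symm hxm)
      rw [← a2, h] at a1; exact add_left_cancel a1
    rw [← h, h3.symm] at e2
    simp only [Algebra.smul_def, map_sub, mul_one] at e1 e2 ⊢
    linear_combination e1 - e2
  obtain ⟨ρ, hρ⟩ := key x (Ne.symm hvx) (Ne.symm hmx) h1
  obtain ⟨ρ', hρ'⟩ := key x' (Ne.symm hvx') (Ne.symm hmx') h2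
  have hs1 : ∀ (i : J) (p : RY), ∑ m, (Pi.single i p : J → RY) m • X m = p • X i := by
    intro i p
    rw [Finset.sum_eq_single i]
    · simp
    · intro b _ hb; simp [hb]
    · simp
  have hne : X v - X m ≠ 0 := by
    intro h
    have := hI 0 (Pi.single v 1 - Pi.single m 1) 0 (by
      simp only [Pi.sub_apply, sub_smul (R := RY) (M := A), Finset.sum_sub_distrib, hs1]; simp [h])
    have := congrFun this.2.1 v
    simp [hvm] at this
  have hne2 : X x - (lf (α v x) : RY) • 1 ≠ 0 := by
    intro h
    have := hI 0 (Pi.single x 1) (-lf (α v x)) (by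
      rw [hs1]; simp only [zero_smul, neg_smul, one_smul, zero_add]; rw [← sub_eq_add_neg]; exact h)
    have := congrFun this.2.1 x
    simp at this
  have h3 : ρ' • (X x - (lf (α v x) : RY) • 1) = ρ • (X x' - (lf (α v x') : RY) • 1) := by
    apply mul_right_cancel₀ hne
    simp only [Algebra.smul_def, mul_one] at hρ hρ' ⊢
    linear_combination (algebraMap RY A ρ') * hρ - (algebraMap RY A ρ) * hρ'
  have h4 := hI 0 (Pi.single x ρ' - Pi.single x' ρ) (ρ * lf (α v x') - ρ' * lf (α v x)) (by
    simp only [Pi.sub_apply, sub_smul (R := RY) (M := A), Finset.sum_sub_distrib, hs1]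
    simp only [smul_sub, smul_smul] at h3
    rw [zero_smul, zero_add]
    linear_combination h3)
  have h5 := congrFun h4.2.1 x'
  simp [Ne.symm hxx'] at h5
  rw [h5, zero_smul] at hρ
  exact (mul_ne_zero hne2 hne) hρ

theorem hS_lemma {X : J → A} {Om : A} {α : J → J → (Fin d → K)} {κ : J → J → RY} (hR : Rel X Om α κ) (hI : Ind K d X Om)
    (s : Fin d → K) (hs : ∀ i j, i ≠ j → α i j + α j i = s)
    (v b b' b'' : J) (hd : [v, b, b', b''].Nodup) (h1 : α v b = α v b') (h2 : α v b = α v b'') : False := by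
  simp only [List.nodup_cons, List.mem_cons, List.not_mem_nil, or_false, not_or, List.nodup_nil, and_true, not_false_eq_true] at hd
  obtain ⟨⟨hvb, hvb', hvb''⟩, ⟨hbb', hbb''⟩, hb'b''⟩ := hd
  have key : ∀ x, x ≠ v → α v b = α v x → ∃ ρ : RY, (X v - (lf (s - α v b) : RY) • 1) * (X b - X x) = ρ • 1 := by
    intro x hxv h
    refine ⟨κ v b - κ v x, ?_⟩
    have e1 := hR v b hvb
    have e2 := hR v x (Ne.symm hxv)
    have h3 : α x v = s - α v b := by
      have a1 := hs v x (Ne.symm hxv)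
      rw [← a1, h]; abel
    have h4 : α b v = s - α v b := by
      have a1 := hs v b hvb
      rw [← a1]; abel
    rw [h3, ← h] at e2
    rw [h4] at e1
    simp only [Algebra.smul_def, map_sub, mul_one] at e1 e2 ⊢
    linear_combination e1 - e2
  obtain ⟨ρ, hρ⟩ := key b' (Ne.symm hvb') h1
  obtain ⟨ρ', hρ'⟩ := key b'' (Ne.symm hvb'') h2
  have hs1 : ∀ (i : J) (p : RY), ∑ m, (Pi.single i p : J → RY) m • X m = p • X i := by
    intro i p
    rw [Finset.sum_eq_single i]
    · simp
    · intro b _ hb; simp [hb]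
    · simp
  have hne : X b - X b' ≠ 0 := by
    intro h
    have := hI 0 (Pi.single b 1 - Pi.single b' 1) 0 (by
      simp only [Pi.sub_apply, sub_smul (R := RY) (M := A), Finset.sum_sub_distrib, hs1]; simp [h])
    have := congrFun this.2.1 b
    simp [hbb'] at this
  have hne2 : X v - (lf (s - α v b) : RY) • 1 ≠ 0 := by
    intro h
    have := hI 0 (Pi.single v 1) (-lf (s - α v b)) (by
      rw [hs1]; simp only [zero_smul, neg_smul, one_smul, zero_add]; rw [← sub_eq_add_neg]; exact h)
    have := congrFun this.2.1 v
    simp at this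
  have h3 : ρ' • (X b - X b') = ρ • (X b - X b'') := by
    apply mul_left_cancel₀ hne2
    rw [mul_smul_comm, mul_smul_comm, hρ, hρ', smul_smul, smul_smul, mul_comm]
  have h4 := hI 0 (Pi.single b (ρ' - ρ) - Pi.single b' ρ' + Pi.single b'' ρ) 0 (by
    simp only [Pi.sub_apply, Pi.add_apply, add_smul (R := RY) (M := A), sub_smul (R := RY) (M := A), Finset.sum_add_distrib, Finset.sum_sub_distrib, hs1]
    simp only [smul_sub] at h3
    rw [zero_smul, zero_smul]
    linear_combination h3)
  have h5 := congrFun h4.2.1 b''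
  simp [Ne.symm hbb'', Ne.symm hb'b''] at h5
  rw [h5, zero_smul] at hρ
  exact (mul_ne_zero hne2 hne) hρ

end
end DP
end

noncomputable section
namespace DP
set_option linter.all false
open MvPolynomial

section
variable {K A : Type*} {d c : ℕ} [Field K] [CommRing A] [IsDomain A] [Algebra (MvPolynomial (Fin d) K) A]

local notation "RY" => MvPolynomial (Fin d) K

theorem gauged (hc : 3 ≤ c) {X : Fin (c+1) → A} {Om : A} {α : Fin (c+1) → Fin (c+1) → (Fin d → K)} {κ : Fin (c+1) → Fin (c+1) → RY}
    (hR : Rel X Om α κ) (hI : Ind K d X Om) :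
    ∃ (ε : Fin (c+1) → (Fin d → K)) (Om' : A) (α' : Fin (c+1) → Fin (c+1) → (Fin d → K)) (κ' : Fin (c+1) → Fin (c+1) → RY) (s : Fin d → K),
      Rel (fun j => X j + (lf (ε j) : RY) • 1) Om' α' κ' ∧ Ind K d (fun j => X j + (lf (ε j) : RY) • 1) Om' ∧
      (∀ i j, i ≠ j → α' i j + α' j i = s) ∧ α' 0 1 = 0 ∧ κ' 0 1 = 0 := by
  obtain ⟨ε0, s0, h0⟩ := gauge_lemma hc (fun j k => α j k + α k j) (fun j k => add_comm _ _)
    (fun i j k l hd => (relE hR hI i j k l hd).1)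
  set η := - (α 0 1 + ε0 1) with hη
  set ε := fun j => ε0 j + η with hε
  set ρ := κ 0 1 - lf (α 0 1 + ε 1) * lf (ε 0) - lf (α 1 0 + ε 0) * lf (ε 1) + lf (ε 0) * lf (ε 1) with hρ
  refine ⟨ε, Om + ρ • 1, _, _, s0 + η + η, hR.shift ε ρ, hI.shift (fun j => lf (ε j)) ρ, ?_, ?_, ?_⟩
  · intro i j hij
    rw [← h0 i j hij]
    simp only [hε]; abel
  · simp only [hε, hη]; abel
  · rw [← hρ, sub_self]

theorem rel_bound (hc : 3 ≤ c) {X : Fin (c+1) → A} {Om : A} {α : Fin (c+1) → Fin (c+1) → (Fin d → K)} {κ : Fin (c+1) → Fin (c+1) → RY}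
    (hR : Rel X Om α κ) (hI : Ind K d X Om) (s : Fin d → K) (hs : ∀ i j, i ≠ j → α i j + α j i = s) (h01 : α 0 1 = 0)
    (hinj : ∀ v : Fin d → K, (∀ i j, i ≠ j → dl (α i j) v = 0) → v = 0) : d ≤ 6 ∧ (4 ≤ c → d ≤ 4) := by
  have dlinj : ∀ u u' : Fin d → K, dl u = dl u' → u = u' := by
    intro u u' h
    funext i
    have := LinearMap.congr_fun h (Pi.single i 1)
    simpa [dl, Pi.single_apply] using this
  have := dim_bound (K := K) (V := Fin d → K) hc (fun i j => dl (α i j)) (dl s) (fun i j hij => by rw [← dl_add, hs i j hij])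
    (by rw [h01]; ext; simp [dl]) (by
      intro v j k l i i' hd
      simp only [List.nodup_cons, List.mem_cons, List.not_mem_nil, or_false, not_or, List.nodup_nil, and_true, not_false_eq_true] at hd
      obtain ⟨⟨hjk, hjl, hji, hji'⟩, ⟨hkl, hki, hki'⟩, ⟨hli, hli'⟩, hii'⟩ := hd
      have h1 := (relE hR hI i j k l (by simp [hjk, hjl, hkl, Ne.symm hji, Ne.symm hki, Ne.symm hli])).2
      have h2 := (relE hR hI i' j k l (by simp [hjk, hjl, hkl, Ne.symm hji', Ne.symm hki', Ne.symm hli'])).2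
      have h3 := congrArg (eval v) (h1.trans h2.symm)
      simpa [Phr, eval_lf, Phq] using h3)
    (fun v m x x' hd h1 h2 => hE_lemma hR hI s hs v m x x' hd (dlinj _ _ h1) (dlinj _ _ h2))
    (fun v b b' b'' hd h1 h2 => hS_lemma hR hI s hs v b b' b'' hd (dlinj _ _ h1) (dlinj _ _ h2)) hinj
  simpa using this

theorem tau_lemma {M : Type*} (hc : 3 ≤ c) (f : Fin (c+1) → Fin (c+1) → M) (i : Fin (c+1))
    (hsym : ∀ j k, j ≠ k → f j k = f k j) (hr : ∀ j k k', [i, j, k, k'].Nodup → f j k = f j k') :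
    ∃ τ, ∀ j k, j ≠ i → k ≠ i → j ≠ k → f j k = τ := by
  obtain ⟨j0, k0, h1, h2, h3⟩ : ∃ j0 k0 : Fin (c+1), j0 ≠ i ∧ k0 ≠ i ∧ j0 ≠ k0 := by
    have hcard : 2 ≤ (Finset.univ.erase i).card := by
      rw [Finset.card_erase_of_mem (Finset.mem_univ _)]; simp; omega
    obtain ⟨a, ha, b, hb, hab⟩ := Finset.one_lt_card.1 (by omega : 1 < (Finset.univ.erase i).card)
    exact ⟨a, b, (Finset.mem_erase.1 ha).1, (Finset.mem_erase.1 hb).1, hab⟩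
  have hr' : ∀ j k k', j ≠ i → k ≠ i → k' ≠ i → j ≠ k → j ≠ k' → f j k = f j k' := by
    intro j k k' hj hk hk' hjk hjk'
    by_cases h : k = k'
    · rw [h]
    · exact hr j k k' (by simp [Ne.symm hj, Ne.symm hk, Ne.symm hk', hjk, hjk', h])
  refine ⟨f j0 k0, ?_⟩
  intro j k hj hk hjk
  by_cases h : j = j0
  · subst h; exact hr' _ _ _ hj hk h2 hjk h3
  · rw [hr' j k j0 hj hk h1 hjk h, hsym j j0 h, hr' j0 j k0 h1 hj h2 (Ne.symm h) h3]

/-- multiplication data -/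
theorem to_rel (hc : 3 ≤ c) {X : Fin (c+1) → A} {y0 Om : A}
    (hind : ∀ (ω : RY) (u v : Fin (c+1) → RY) (t : RY), ω • Om + ∑ m, u m • (y0 * X m) + ∑ m, v m • X m + t • (1:A) = 0 →
      ω = 0 ∧ u = 0 ∧ v = 0 ∧ t = 0)
    (hmul : ∀ i j, ∃ (a b : K) (l : Fin (c+1) → (Fin d → K)) (κ : RY), (i = j → a ≠ 0) ∧ (i ≠ j → a = 0 ∧ b = 1) ∧
      X i * X j = (C a : RY) • (y0 * X i) + (C b : RY) • Om + ∑ m, (lf (l m) : RY) • X m + κ • (1:A)) :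
    ∃ (Om' : A) (α : Fin (c+1) → Fin (c+1) → (Fin d → K)) (κ : Fin (c+1) → Fin (c+1) → RY), Rel X Om' α κ ∧ Ind K d X Om' := by
  choose a b l κ ha hab hX using hmul
  have hXne : ∀ j k, j ≠ k → X j * X k = Om + ∑ m, (lf (l j k m) : RY) • X m + κ j k • (1:A) := by
    intro j k hjk
    rw [hX, (hab j k hjk).1, (hab j k hjk).2]; simp
  have hind' : ∀ (v v' : Fin (c+1) → RY) (t t' : RY), Om + ∑ m, v m • X m + t • (1:A) = Om + ∑ m, v' m • X m + t' • (1:A) → v = v' ∧ t = t' := by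
    intro v v' t t' h
    have := hind 0 0 (v - v') (t - t') (by
      simp only [Pi.sub_apply, sub_smul (R := RY) (M := A), Finset.sum_sub_distrib]
      simp
      linear_combination h)
    exact ⟨sub_eq_zero.1 this.2.2.1, sub_eq_zero.1 this.2.2.2⟩
  have hsym : ∀ j k, j ≠ k → l j k = l k j ∧ κ j k = κ k j := by
    intro j k hjk
    have h1 := hXne j k hjk
    rw [mul_comm, hXne k j (Ne.symm hjk)] at h1
    have := hind' _ _ _ _ h1
    refine ⟨?_, this.2.symm⟩
    funext m
    exact lf_inj (congrFun this.1 m).symm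
  have hT : ∀ (p : Fin (c+1) → RY) (π : RY) (i : Fin (c+1)), X i * (∑ m, p m • X m + π • 1) =
      (∑ m, p m * C (b i m)) • Om + ∑ n, (Pi.single i (∑ m, p m * C (a i m)) : Fin (c+1) → RY) n • (y0 * X n)
       + ∑ n, (∑ m, p m * lf (l i m n) + Pi.single (M := fun _ => RY) i π n) • X n + (∑ m, p m * κ i m) • (1:A) := by
    intro p π i
    have hs1 : ∀ (i : Fin (c+1)) (p : RY) (Z : Fin (c+1) → A), ∑ m, (Pi.single i p : Fin (c+1) → RY) m • Z m = p • Z i := by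
      intro i p Z
      rw [Finset.sum_eq_single i]
      · simp
      · intro b _ hb; simp [hb]
      · simp
    simp only [add_smul (R := RY) (M := A), Finset.sum_add_distrib, hs1, hs1 _ _ (fun n => y0 * X n)]
    rw [mul_add, Finset.mul_sum]
    have : ∀ m, X i * (p m • X m) = (p m * C (a i m)) • (y0 * X i) + (p m * C (b i m)) • Om + ∑ n, (p m * lf (l i m n)) • X n + (p m * κ i m) • (1:A) := by
      intro m
      rw [mul_smul_comm, hX]
      simp only [smul_add, smul_smul, Finset.smul_sum]
    simp only [this, Finset.sum_add_distrib]
    simp only [Finset.sum_smul]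
    rw [Finset.sum_comm (f := fun n m => (p n * lf (l i n m)) • X m)]
    simp only [mul_smul_comm, mul_one]
    abel
  have hr : ∀ i j k k', [i, j, k, k'].Nodup → l j k i = l j k' i := by
    intro i j k k' hd
    simp only [List.nodup_cons, List.mem_cons, List.not_mem_nil, or_false, not_or, List.nodup_nil, and_true, not_false_eq_true] at hd
    obtain ⟨⟨hij, hik, hik'⟩, ⟨hjk, hjk'⟩, hkk'⟩ := hd
    have h1 : ∀ j, j ≠ k → j ≠ k' → X j * X k - X j * X k' = ∑ m, (lf (l j k m) - lf (l j k' m) : RY) • X m + (κ j k - κ j k') • (1:A) := by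
      intro j hj hj'
      rw [hXne j k hj, hXne j k' hj']
      simp only [sub_smul (R := RY) (M := A), Finset.sum_sub_distrib]
      ring
    have h2 : X i * (X j * X k - X j * X k') = X j * (X i * X k - X i * X k') := by ring
    rw [h1 j hjk hjk', h1 i hik hik', hT (fun m => lf (l j k m) - lf (l j k' m)), hT (fun m => lf (l i k m) - lf (l i k' m))] at h2
    have h3 := hind ((∑ m, (lf (l j k m) - lf (l j k' m) : RY) * C (b i m)) - ∑ m, (lf (l i k m) - lf (l i k' m) : RY) * C (b j m))
      (Pi.single i (∑ m, (lf (l j k m) - lf (l j k' m) : RY) * C (a i m)) - Pi.single j (∑ m, (lf (l i k m) - lf (l i k' m) : RY) * C (a j m)))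
      (fun n => (∑ m, (lf (l j k m) - lf (l j k' m) : RY) * lf (l i m n) + Pi.single (M := fun _ => RY) i (κ j k - κ j k') n)
        - (∑ m, (lf (l i k m) - lf (l i k' m) : RY) * lf (l j m n) + Pi.single (M := fun _ => RY) j (κ i k - κ i k') n))
      ((∑ m, (lf (l j k m) - lf (l j k' m) : RY) * κ i m) - ∑ m, (lf (l i k m) - lf (l i k' m) : RY) * κ j m) (by
        have e : ∀ (ω ω' t t' : RY) (u u' v v' : Fin (c+1) → RY),
          ω • Om + ∑ n, u n • (y0 * X n) + ∑ n, v n • X n + t • (1:A) = ω' • Om + ∑ n, u' n • (y0 * X n) + ∑ n, v' n • X n + t' • (1:A) →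
          (ω - ω') • Om + ∑ n, (u - u') n • (y0 * X n) + ∑ n, (v n - v' n) • X n + (t - t') • (1:A) = 0 := by
          intro ω ω' t t' u u' v v' h
          simp only [Pi.sub_apply, sub_smul (R := RY) (M := A), Finset.sum_sub_distrib]
          linear_combination h
        exact e _ _ _ _ _ _ _ _ h2)
    have h4 := congrFun h3.2.1 i
    rw [Pi.sub_apply, Pi.single_eq_same, Pi.single_eq_of_ne hij, sub_zero, Finset.sum_eq_single i] at h4
    · rw [Pi.zero_apply, mul_eq_zero] at h4
      rcases h4 with h4 | h4
      · exact lf_inj (sub_eq_zero.1 h4)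
      · exact absurd ((C_eq_zero).1 h4) (ha i i rfl)
    · intro m _ hm
      rw [(hab i m (Ne.symm hm)).1, C_0, mul_zero]
    · simp
  have htau : ∀ i, ∃ τ, ∀ j k, j ≠ i → k ≠ i → j ≠ k → l j k i = τ := fun i =>
    tau_lemma hc (fun j k => l j k i) i (fun j k hjk => congrFun (hsym j k hjk).1 i) (fun j k k' hd => hr i j k k' hd)
  choose τ hτ using htau
  have hs1 : ∀ (i : Fin (c+1)) (p : RY), ∑ m, (Pi.single i p : Fin (c+1) → RY) m • X m = p • X i := by
    intro i p
    rw [Finset.sum_eq_single i]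
    · simp
    · intro b _ hb; simp [hb]
    · simp
  refine ⟨Om + ∑ m, (lf (τ m) : RY) • X m, fun j k => l j k j - τ j, κ, ?_, ?_⟩
  · intro j k hjk
    rw [hXne j k hjk]
    have : ∀ m, (lf (l j k m) : RY) = lf (τ m) + Pi.single (M := fun _ => RY) j (lf (l j k j - τ j)) m + Pi.single (M := fun _ => RY) k (lf (l k j k - τ k)) m := by
      intro m
      by_cases hmj : m = j
      · subst hmj; simp [hjk]
      · by_cases hmk : m = k
        · subst hmk
          simp [hmj, (hsym j m hjk).1]
        · simp [hmj, hmk, hτ m j k (Ne.symm hmj) (Ne.symm hmk) hjk]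
    simp only [this, add_smul (R := RY) (M := A), Finset.sum_add_distrib, hs1]
    ring
  · intro ω v t h
    have := hind ω 0 (fun m => ω * lf (τ m) + v m) t (by
      rw [← h]
      simp only [smul_add, Finset.smul_sum, smul_smul, add_smul, Finset.sum_add_distrib]
      simp
      ring)
    obtain ⟨h1, -, h3, h4⟩ := this
    refine ⟨h1, ?_, h4⟩
    funext m
    have := congrFun h3 m
    simpa [h1] using this
end
end DP
end

noncomputable section
namespace DP
set_option linter.all false
open MvPolynomial

section
variable {K : Type*} [Field K] {d : ℕ}

theorem fse_rename (Q : MvPolynomial (Fin d) K) : finSuccEquiv K d (rename Fin.succ Q) = Polynomial.C Q := by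
  have : ((finSuccEquiv K d : MvPolynomial (Fin (d+1)) K →ₐ[K] Polynomial (MvPolynomial (Fin d) K)).comp (rename Fin.succ)) = IsScalarTower.toAlgHom K (MvPolynomial (Fin d) K) (Polynomial (MvPolynomial (Fin d) K)) := by
    apply MvPolynomial.algHom_ext
    intro i
    simp [finSuccEquiv_X_succ]
  exact DFunLike.congr_fun this Q

theorem lf_split (b : Fin (d+1) → K) : lf b = C (b 0) * X 0 + rename Fin.succ (lf (fun i => b i.succ)) := by
  rw [lf_apply, lf_apply, Fin.sum_univ_succ, map_sum]
  simp

theorem eval_e0_rename (Q : MvPolynomial (Fin d) K) : eval (Pi.single 0 1 : Fin (d+1) → K) (rename Fin.succ Q) = eval 0 Q := by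
  rw [eval_rename]
  congr 2
  
theorem quad_split (P : MvPolynomial (Fin (d+1)) K) (hP : P.IsHomogeneous 2) (h0 : eval (Pi.single 0 1 : Fin (d+1) → K) P = 0) :
    ∃ (β : Fin d → K) (κ : MvPolynomial (Fin d) K), P = X 0 * rename Fin.succ (lf β) + rename Fin.succ κ := by
  set f := finSuccEquiv K d P with hf
  have hdeg : f.natDegree < 3 := by
    rw [hf, natDegree_finSuccEquiv]
    have := degreeOf_le_totalDegree P 0
    have := hP.totalDegree_le
    omega
  have h2 : f = Polynomial.C (f.coeff 0) + Polynomial.C (f.coeff 1) * Polynomial.X + Polynomial.C (f.coeff 2) * Polynomial.X ^ 2 := by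
    conv_lhs => rw [f.as_sum_range_C_mul_X_pow' hdeg]
    simp [Finset.sum_range_succ]
  have hc1 := hP.finSuccEquiv_coeff_isHomogeneous 1 1 rfl
  have hc0 := hP.finSuccEquiv_coeff_isHomogeneous 0 2 rfl
  have hc2 := hP.finSuccEquiv_coeff_isHomogeneous 2 0 rfl
  have hPe : P = rename Fin.succ (f.coeff 0) + rename Fin.succ (f.coeff 1) * X 0 + rename Fin.succ (f.coeff 2) * X 0 ^ 2 := by
    apply (finSuccEquiv K d).injective
    rw [← hf]
    conv_lhs => rw [h2]
    simp [fse_rename, finSuccEquiv_X_zero]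
  have hz : ∀ (Q : MvPolynomial (Fin d) K) n, Q.IsHomogeneous n → 0 < n → eval 0 Q = 0 := by
    intro Q n hQ hn
    rw [MvPolynomial.eval_zero, constantCoeff_eq]
    by_contra hne
    have := hQ hne
    simp at this; omega
  have hC2 : f.coeff 2 = C (coeff 0 (f.coeff 2)) := by
    rw [← totalDegree_eq_zero_iff_eq_C]
    exact Nat.le_zero.1 hc2.totalDegree_le
  have : f.coeff 2 = 0 := by
    have h3 := h0
    rw [hPe] at h3
    simp only [map_add, map_mul, map_pow, eval_e0_rename, eval_X, Pi.single_eq_same, mul_one, one_pow] at h3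
    rw [hz _ 2 hc0 (by norm_num), hz _ 1 hc1 (by norm_num), hC2] at h3
    rw [hC2]
    simpa using h3
  refine ⟨fun i => coeff (Finsupp.single i 1) (f.coeff 1), f.coeff 0, ?_⟩
  rw [← lf_of_hom _ hc1]
  conv_lhs => rw [hPe, this]
  rw [map_zero]; ring
end
end DP
end

noncomputable section
namespace DP
set_option linter.all false
open MvPolynomial

section
variable {K A : Type*} [Field K] [CommRing A] [Algebra K A] {d c : ℕ} [Algebra (MvPolynomial (Fin d) K) A]
local notation "RR" => MvPolynomial (Fin (d+1)) K
local notation "RY" => MvPolynomial (Fin d) K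

set_option maxHeartbeats 1000000 in
theorem FB.rel {𝒜 : ℕ → Submodule K A} [GradedAlgebra 𝒜] {y : Fin (d+1) → A} {z : Fin c → A} {w : A} {a : Fin c → Fin c → K} (F : FB 𝒜 y z w a)
    (halgY : ∀ P : RY, algebraMap RY A P = aeval y (rename Fin.succ P)) (hc : 1 ≤ c)
    (ev : Option (Fin (c+1)) → (A →ₐ[K] K)) (hinj : Function.Injective ev) (hev : ∀ p P, ev p (aeval y P) = eval (Pi.single 0 1) P) :
    ∃ (X : Fin (c+1) → A) (Om : A), (∀ m, X m ∈ 𝒜 1) ∧ y 0 ∈ Submodule.span K (Set.range X) ∧ (∀ j, z j ∈ Submodule.span K (Set.range X)) ∧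
      (∀ (ω : RY) (u v : Fin (c+1) → RY) (t : RY), ω • Om + ∑ m, u m • (y 0 * X m) + ∑ m, v m • X m + t • (1:A) = 0 →
        ω = 0 ∧ u = 0 ∧ v = 0 ∧ t = 0) ∧
      (∀ i j, ∃ (a b : K) (l : Fin (c+1) → (Fin d → K)) (κ : RY), (i = j → a ≠ 0) ∧ (i ≠ j → a = 0 ∧ b = 1) ∧
        X i * X j = (C a : RY) • (y 0 * X i) + (C b : RY) • Om + ∑ m, (lf (l m) : RY) • X m + κ • (1:A)) := by
  obtain ⟨hI2, μ, hμ0, hμ, hval⟩ := F.points 0 ev hinj hev (by simp)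
  have hsm : ∀ (P : RY) (x : A), P • x = aeval y (rename Fin.succ P) * x := fun P x => by rw [Algebra.smul_def, halgY]
  have hy0 : ∀ p, ev p (y 0) = 1 := by
    intro p
    have := hev p (X 0)
    simpa using this
  set t : Fin (c+1) → Option (Fin (c+1)) → K := fun j p => p.elim 1 (fun k => if k = j then - μ none / μ (some j) else 0) with ht
  have htn : ∀ j, t j none = 1 := fun j => rfl
  have hts : ∀ j k, t j (some k) = if k = j then - μ none / μ (some j) else 0 := fun j k => rfl
  have h1 := fun j => hval (t j) (by
    rw [Fintype.sum_option]
    simp only [htn, hts, mul_ite, mul_zero, Finset.sum_ite_eq', Finset.mem_univ, if_true]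
    have := hμ0 (some j)
    field_simp
    ring)
  choose s r hsr using h1
  -- general linear elements
  let V : K → (Fin c → K) → A := fun s r => s • y 0 + ∑ j, r j • z j
  have hV : ∀ s r, V s r = ∑ i, aeval y ((fun i : Option (Option (Fin c)) => (i.elim 0 (fun k => k.elim (C s * X 0) (fun j => C (r j)))) : Option (Option (Fin c)) → RR) i) * u3 z w i := by
    intro s r
    rw [sum3]
    simp [V, Algebra.smul_def]
  have hVs : ∀ s r, ∑ p, μ p * ev p (V s r) = 0 := by
    intro s r
    rw [hV, hμ]; simp
  have hVevp : ∀ s r p, ev p (V s r) = ∑ i, ((i.elim 0 (fun k => k.elim s r)) : K) * ev p (u3 z w i) := by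
    intro s r p
    rw [Fintype.sum_option, Fintype.sum_option]
    simp [V, hy0, u3]
  have hV0 : ∀ s r, (∀ p, ev p (V s r) = 0) → V s r = 0 := by
    intro s r h
    have h2 := hI2 (fun i => i.elim 0 (fun k => k.elim s r)) (fun p => by rw [← hVevp]; exact h p)
    have hs : s = 0 := congrFun h2 (some none)
    have hr : r = 0 := by funext j; exact congrFun h2 (some (some j))
    simp [V, hs, hr]
  set XX : Fin (c+1) → A := fun m => V (s m) (r m) with hXX
  have hXev : ∀ m p, ev p (XX m) = t m p := fun m p => hsr m p
  have hVspan : ∀ s' r', ∃ ρ : Fin (c+1) → K, V s' r' = ∑ m, ρ m • XX m := by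
    intro s' r'
    set ρ : Fin (c+1) → K := fun m => ev (some m) (V s' r') * (- μ (some m) / μ none) with hρ
    refine ⟨ρ, ?_⟩
    have hsub : V s' r' - ∑ m, ρ m • XX m = V (s' - ∑ m, ρ m * s m) (fun j => r' j - ∑ m, ρ m * r m j) := by
      simp only [V, XX, sub_smul, Finset.sum_smul, Finset.sum_sub_distrib, smul_add, Finset.smul_sum, mul_smul, Finset.sum_add_distrib]
      rw [Finset.sum_comm (γ := Fin c)]
      ring
    have hsome : ∀ k, ev (some k) (V s' r' - ∑ m, ρ m • XX m) = 0 := by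
      intro k
      rw [map_sub, map_sum]
      simp only [map_smul, hXev, hts, smul_eq_mul, mul_ite, mul_zero, Finset.sum_ite_eq, Finset.mem_univ, if_true, hρ]
      have := hμ0 (some k)
      have := hμ0 none
      field_simp
      ring
    rw [← sub_eq_zero, hsub]
    rw [hsub] at hsome
    apply hV0
    rintro (_ | k)
    · have := hVs (s' - ∑ m, ρ m * s m) (fun j => r' j - ∑ m, ρ m * r m j)
      rw [Fintype.sum_option] at this
      simp only [hsome, mul_zero, Finset.sum_const_zero, add_zero] at this
      exact (mul_eq_zero.1 this).resolve_left (hμ0 none)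
    · exact hsome k
  have hX1 : ∀ m, XX m ∈ 𝒜 1 := fun m => Submodule.add_mem _ (Submodule.smul_mem _ _ (F.hy1 0))
    (Submodule.sum_mem _ fun j _ => Submodule.smul_mem _ _ (F.hz j))
  have hy0V : y 0 = V 1 0 := by simp [V]
  have hzV : ∀ j, z j = V 0 (Pi.single j 1) := by
    intro j; simp [V, Pi.single_apply]
  obtain ⟨σ, hσ⟩ := hVspan 1 0
  rw [← hy0V] at hσ
  have hτ : ∀ j, ∃ ρ : Fin (c+1) → K, z j = ∑ m, ρ m • XX m := by
    intro j; rw [hzV j]; exact hVspan _ _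
  choose τ hτ using hτ
  have hquad : ∀ x ∈ 𝒜 2, (∀ p, ev p x = 0) → ∃ (l : Fin (c+1) → (Fin d → K)) (κ : RY), x = ∑ m, (lf (l m) : RY) • XX m + κ • (1:A) := by
    intro x hx hx0
    obtain ⟨P, hP, hPh⟩ := F.hom x 2 hx
    have he0 := hI2 (fun i => eval (Pi.single 0 1) (P i)) (fun p => by
      have := hx0 p
      rw [hP, map_sum] at this
      rw [← this]
      exact Finset.sum_congr rfl fun i _ => by rw [map_mul, hev])
    have he : ∀ i, eval (Pi.single 0 1) (P i) = 0 := fun i => congrFun he0 i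
    have hn : P none = 0 := by
      have h3 := (hPh none).1 (by simp [d3])
      have h4 : P none = C (coeff 0 (P none)) := by
        rw [← totalDegree_eq_zero_iff_eq_C]
        have := h3.totalDegree_le
        simpa [d3] using this
      have h5 := he none
      rw [h4, eval_C] at h5
      rw [h4, h5, C_0]
    obtain ⟨β, κ, hκ⟩ := quad_split (P (some none)) ((hPh (some none)).1 (by simp [d3])) (he _)
    have hlin : ∀ j, ∃ b : Fin d → K, P (some (some j)) = rename Fin.succ (lf b) := by
      intro j
      have h3 := (hPh (some (some j))).1 (by simp [d3])
      have h4 := lf_of_hom _ h3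
      rw [lf_split] at h4
      refine ⟨fun i => coeff (Finsupp.single i.succ 1) (P (some (some j))), h4.trans ?_⟩
      have h5 := he (some (some j))
      rw [coeff_single_hom _ 1 h3] at h5
      rw [h5]; simp
    choose b hb using hlin
    refine ⟨fun m => (∑ j, τ j m • b j) + σ m • β, κ, ?_⟩
    conv_lhs => rw [hP, sum3, hn, hκ]
    simp only [hb]
    have e1 : ∀ m, (lf ((∑ j, τ j m • b j) + σ m • β) : RY) • XX m = ∑ j, aeval y (rename Fin.succ (lf (b j))) * (τ j m • XX m) + aeval y (rename Fin.succ (lf β)) * (σ m • XX m) := by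
      intro m
      rw [hsm]
      simp only [map_add, map_sum, map_smul, add_mul, Finset.sum_mul, smul_mul_assoc, mul_smul_comm]
    rw [Finset.sum_congr rfl fun m _ => e1 m, Finset.sum_add_distrib, Finset.sum_comm]
    simp only [← Finset.mul_sum]
    rw [← hσ]
    simp only [← hτ]
    rw [hsm]
    simp only [map_zero, zero_mul, zero_add, map_add, map_mul, aeval_X]
    ring
  have h01 : (0 : Fin (c+1)) ≠ 1 := by
    intro h
    have := congrArg Fin.val h
    rw [Fin.val_one'] at this
    rw [Nat.mod_eq_of_lt (by omega)] at this
    simp at this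
  set Om := XX 0 * XX 1 with hOm
  have hOmev : ∀ p, ev p Om = if p = none then 1 else 0 := by
    intro p
    rw [hOm, map_mul, hXev, hXev]
    rcases p with _ | k
    · simp [htn]
    · simp only [hts]
      by_cases hk : k = 0
      · have : k ≠ 1 := fun h => h01 (hk.symm.trans h)
        simp [this]
      · simp [hk]
  have hOm2 : Om ∈ 𝒜 2 := SetLike.GradedMul.mul_mem (hX1 0) (hX1 1)
  refine ⟨XX, Om, hX1, ?_, ?_, ?_, ?_⟩
  · rw [hσ]
    exact Submodule.sum_mem _ fun m _ => Submodule.smul_mem _ _ (Submodule.subset_span ⟨m, rfl⟩)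
  · intro j
    rw [hτ j]
    exact Submodule.sum_mem _ fun m _ => Submodule.smul_mem _ _ (Submodule.subset_span ⟨m, rfl⟩)
  · intro ω u v tt hrel
    obtain ⟨Q, hQ, hQh⟩ := F.hom Om 2 hOm2
    have hQn : Q none = C (coeff 0 (Q none)) := by
      rw [← totalDegree_eq_zero_iff_eq_C]
      have := ((hQh none).1 (by simp [d3])).totalDegree_le
      simpa [d3] using this
    have hQ0 : coeff 0 (Q none) ≠ 0 := by
      have h3 := hμ Q
      rw [← hQ, hQn, eval_C] at h3
      rw [← h3, Fintype.sum_option]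
      simp only [hOmev]
      simp [hμ0]
    let x : Fin (c+1) → RR := fun m => rename Fin.succ (u m) * X 0 + rename Fin.succ (v m)
    let QX : Fin (c+1) → Option (Option (Fin c)) → RR := fun m i => (i.elim 0 (fun k => k.elim (C (s m) * X 0) (fun j => C (r m j))))
    have hQX : ∀ m, XX m = ∑ i, aeval y (QX m i) * u3 z w i := fun m => hV _ _
    have hall := F.ind (fun i => rename Fin.succ ω * Q i + ∑ m, x m * QX m i + (if i = some none then rename Fin.succ tt else 0)) (by
      rw [← hrel]
      simp only [map_add, map_mul, add_mul, map_sum, Finset.sum_add_distrib, Finset.sum_mul, hsm]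
      have e12 : ∑ i, ∑ m, aeval y (x m) * aeval y (QX m i) * u3 z w i = ∑ m, ∑ i, aeval y (x m) * aeval y (QX m i) * u3 z w i := Finset.sum_comm
      rw [e12]
      have e1 : ∑ i, aeval y (rename Fin.succ ω) * aeval y (Q i) * u3 z w i = aeval y (rename Fin.succ ω) * Om := by
        conv_rhs => rw [hQ, Finset.mul_sum]
        exact Finset.sum_congr rfl fun i _ => by ring
      have e2 : ∀ m, ∑ i, aeval y (x m) * aeval y (QX m i) * u3 z w i = aeval y (rename Fin.succ (u m)) * (y 0 * XX m) + aeval y (rename Fin.succ (v m)) * XX m := by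
        intro m
        have : ∑ i, aeval y (x m) * aeval y (QX m i) * u3 z w i = aeval y (x m) * XX m := by
          rw [hQX, Finset.mul_sum]
          exact Finset.sum_congr rfl fun i _ => by ring
        rw [this]
        simp only [x, map_add, map_mul, aeval_X]
        ring
      have e3 : ∑ i : Option (Option (Fin c)), aeval y ((if i = some none then rename Fin.succ tt else 0 : RR)) * u3 z w i = aeval y (rename Fin.succ tt) * 1 := by
        rw [Finset.sum_eq_single (some none)]
        · simp [u3]
        · intro b _ hb; simp [hb]
        · simp
      rw [e1, e3, Finset.sum_congr rfl fun m _ => e2 m, Finset.sum_add_distrib]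
      ring)
    have hω : ω = 0 := by
      have h3 := congrFun hall none
      simp only [QX, Option.elim_none, mul_zero, Finset.sum_const_zero, add_zero, Pi.zero_apply, reduceCtorEq, if_false] at h3
      rw [hQn] at h3
      have h4 := (mul_eq_zero.1 h3).resolve_right (fun h => hQ0 (C_eq_zero.1 h))
      exact rename_injective _ (Fin.succ_injective d) (by rw [h4, map_zero])
    have hfin : ∀ k, x k * X 0 * C (- μ none / μ (some k)) + rename Fin.succ tt = 0 := by
      intro k
      have h3 : ∑ i, (rename Fin.succ ω * Q i + ∑ m, x m * QX m i + (if i = some none then rename Fin.succ tt else 0)) * (C (ev (some k) (u3 z w i)) * X 0 ^ d3 i) = 0 := by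
        refine Finset.sum_eq_zero fun i _ => ?_
        have := congrFun hall i
        simp only [Pi.zero_apply] at this
        rw [this, zero_mul]
      rw [hω] at h3
      simp only [map_zero, zero_mul, zero_add, add_mul, Finset.sum_add_distrib, Finset.sum_mul] at h3
      rw [Finset.sum_comm] at h3
      have e1 : ∀ m, ∑ i, x m * QX m i * (C (ev (some k) (u3 z w i)) * X 0 ^ d3 i) = x m * X 0 * C (t m (some k)) := by
        intro m
        rw [← hXev, hVevp, Fintype.sum_option, Fintype.sum_option, Fintype.sum_option, Fintype.sum_option]
        simp only [QX, d3, Option.elim_none, Option.elim_some, map_add, map_sum, map_mul, C_0, mul_add, Finset.mul_sum, pow_one, pow_zero]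
        simp only [u3, uA_none, Option.elim_some, map_one, map_zero, mul_one, mul_zero, zero_mul, zero_add, C_1]
        congr 1
        · ring
        · exact Finset.sum_congr rfl fun j _ => by ring
      have e3 : ∑ i : Option (Option (Fin c)), (if i = some none then rename Fin.succ tt else 0 : RR) * (C (ev (some k) (u3 z w i)) * X 0 ^ d3 i) = rename Fin.succ tt := by
        rw [Finset.sum_eq_single (some none)]
        · simp [u3, d3]
        · intro b _ hb; simp [hb]
        · simp
      rw [e3, Finset.sum_congr rfl fun m _ => e1 m] at h3
      rw [← h3]
      simp only [hts]
      rw [Finset.sum_eq_single k]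
      · simp
      · intro b _ hb; simp [hb.symm]
      · simp
    have hpol : ∀ k, u k = 0 ∧ v k = 0 ∧ tt = 0 := by
      intro k
      have h3 := congrArg (finSuccEquiv K d) (hfin k)
      simp only [x, map_add, map_mul, fse_rename, finSuccEquiv_X_zero, map_zero] at h3
      have hCC : finSuccEquiv K d (C (- μ none / μ (some k))) = Polynomial.C (C (- μ none / μ (some k))) := by
        simp [finSuccEquiv_apply]
      rw [hCC] at h3
      have hne : (C (- μ none / μ (some k)) : RY) ≠ 0 := by
        rw [Ne, C_eq_zero]
        exact div_ne_zero (neg_ne_zero.2 (hμ0 _)) (hμ0 _)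
      have h4 : Polynomial.C (u k * C (- μ none / μ (some k))) * Polynomial.X ^ 2 + Polynomial.C (v k * C (- μ none / μ (some k))) * Polynomial.X + Polynomial.C tt = 0 := by
        rw [← h3]
        simp only [map_mul]; ring
      have c2 := congrArg (fun q => Polynomial.coeff q 2) h4
      have c1 := congrArg (fun q => Polynomial.coeff q 1) h4
      have c0 := congrArg (fun q => Polynomial.coeff q 0) h4
      simp [Polynomial.coeff_C, Polynomial.coeff_X, Polynomial.coeff_X_pow, -map_mul, -map_neg, -map_div₀] at c2 c1 c0
      exact ⟨c2.resolve_right (by simpa using hne), c1.resolve_right (by simpa using hne), c0⟩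
    exact ⟨hω, funext fun k => (hpol k).1, funext fun k => (hpol k).2.1, (hpol 0).2.2⟩
  · intro i j
    have hsC : ∀ (q : K) (x : A), (C q : RY) • x = q • x := by
      intro q x
      rw [hsm, rename_C, aeval_C, Algebra.smul_def]
    by_cases hij : i = j
    · subst hij
      set a' := - μ none / μ (some i) with ha'
      have ha0 : a' ≠ 0 := div_ne_zero (neg_ne_zero.2 (hμ0 _)) (hμ0 _)
      obtain ⟨l, κ, hl⟩ := hquad (XX i * XX i - (a' • (y 0 * XX i) + (1 - a') • Om)) 
        (Submodule.sub_mem _ (SetLike.GradedMul.mul_mem (hX1 i) (hX1 i)) (Submodule.add_mem _ (Submodule.smul_mem _ _ (SetLike.GradedMul.mul_mem (F.hy1 0) (hX1 i))) (Submodule.smul_mem _ _ hOm2)))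
        (by
          intro p
          simp only [map_sub, map_add, map_mul, map_smul, hXev, hy0, hOmev, smul_eq_mul]
          rcases p with _ | k
          · simp [htn]
          · simp only [hts, reduceCtorEq, if_false]
            split_ifs <;> simp [ha'])
      refine ⟨a', 1 - a', l, κ, fun _ => ha0, fun h => absurd rfl h, ?_⟩
      rw [hsC, hsC, add_assoc, ← hl]; ring
    · obtain ⟨l, κ, hl⟩ := hquad (XX i * XX j - Om) 
        (Submodule.sub_mem _ (SetLike.GradedMul.mul_mem (hX1 i) (hX1 j)) hOm2)
        (by
          intro p
          simp only [map_sub, map_mul, hXev, hOmev]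
          rcases p with _ | k
          · simp [htn]
          · simp only [hts]
            by_cases hk : k = i
            · have : k ≠ j := fun h => hij (hk.symm.trans h)
              simp [this]
            · simp [hk])
      refine ⟨0, 1, l, κ, fun h => absurd h hij, fun _ => ⟨rfl, rfl⟩, ?_⟩
      rw [hsC, hsC, add_assoc, ← hl]; simp
end
end DP
end

noncomputable section
namespace DP
set_option linter.all false
open MvPolynomial

section
variable {K A : Type*} [Field K] [CommRing A] [IsDomain A] [Algebra K A]

theorem alg_quad (S : Subalgebra K A) {x g b c : A} (hg : g ∈ S) (hb : b ∈ S) (hc : c ∈ S) (h0 : g ≠ 0 ∨ b ≠ 0) (h : g * x^2 + b * x + c = 0) :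
    IsAlgebraic S x := by
  refine ⟨Polynomial.C ⟨g, hg⟩ * Polynomial.X ^ 2 + Polynomial.C ⟨b, hb⟩ * Polynomial.X + Polynomial.C ⟨c, hc⟩, ?_, ?_⟩
  · intro hp
    have c2 := congrArg (fun q => Polynomial.coeff q 2) hp
    have c1 := congrArg (fun q => Polynomial.coeff q 1) hp
    simp [Polynomial.coeff_C, Polynomial.coeff_X, Polynomial.coeff_X_pow] at c2 c1
    have e1 := congrArg Subtype.val c1
    have e2 := congrArg Subtype.val c2
    rcases h0 with h0 | h0
    · exact h0 e2
    · exact h0 e1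
  · simp only [map_add, map_mul, map_pow, Polynomial.aeval_C, Polynomial.aeval_X]
    exact h

theorem trdeg_contra {e m : ℕ} (hem : e < m) (s : Fin e → A) (y : Fin m → A) (hy : AlgebraicIndependent K y)
    (h : ∀ x : A, IsAlgebraic (Algebra.adjoin K (Set.range s)) x) : False := by
  have : Algebra.IsAlgebraic (Algebra.adjoin K (Set.range s)) A := ⟨h⟩
  have h1 := Algebra.IsAlgebraic.trdeg_le_cardinalMk K (Set.range s)
  have h2 := hy.lift_cardinalMk_le_trdeg
  have h3 : Cardinal.mk (Set.range s) ≤ e := by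
    have := Cardinal.mk_range_le_lift (f := s)
    simpa using this
  have h4 := Cardinal.lift_le.{0}.2 (h1.trans h3)
  simp only [Cardinal.mk_fin, Cardinal.lift_natCast, Cardinal.lift_id] at h2 h4
  have h5 := h2.trans (Cardinal.lift_le.2 (h1.trans h3))
  simp at h5
  omega
end

section
variable {K A : Type*} [Field K] [CommRing A] [IsDomain A] [Algebra K A] {d c : ℕ} [Algebra (MvPolynomial (Fin d) K) A]
local notation "RY" => MvPolynomial (Fin d) K

theorem kap_mem (hc : 3 ≤ c) {X : Fin (c+1) → A} {Om : A} {α : Fin (c+1) → Fin (c+1) → (Fin d → K)} {κ : Fin (c+1) → Fin (c+1) → RY}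
    (hR : Rel X Om α κ) (hI : Ind K d X Om) (hκ : κ 0 1 = 0) (B : Subalgebra K RY) (hB : ∀ i j, i ≠ j → lf (α i j) ∈ B) :
    ∀ i j, i ≠ j → κ i j ∈ B := by
  have hsym : ∀ j k, j ≠ k → κ j k = κ k j := by
    intro j k h
    have h1 := hR j k h
    have h2 := hR k j h.symm
    have h3 : (κ j k - κ k j) • (1:A) = 0 := by
      have e := h1.symm.trans ((mul_comm _ _).trans h2)
      rw [sub_smul]
      linear_combination e
    have := (hI 0 0 (κ j k - κ k j) (by simpa using h3)).2.2
    exact sub_eq_zero.1 this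
  have hstep : ∀ j k l, j ≠ k → j ≠ l → k ≠ l → κ j k ∈ B → κ j l ∈ B := by
    intro j k l hjk hjl hkl hk
    obtain ⟨i, hi⟩ : ∃ i : Fin (c+1), i ∉ ({j, k, l} : Finset (Fin (c+1))) := by
      by_contra hcon
      push Not at hcon
      have h1 : (Finset.univ : Finset (Fin (c+1))) ⊆ {j, k, l} := fun i _ => hcon i
      have h2 := Finset.card_le_card h1
      have h3 := Finset.card_le_three (a := j) (b := k) (c := l)
      simp at h2
      omega
    simp only [Finset.mem_insert, Finset.mem_singleton, not_or] at hi
    obtain ⟨hij, hik, hil⟩ := hi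
    have h1 := (relE hR hI i j k l (by simp [*])).2
    have hP : ∀ m, m ≠ i → m ≠ j → Phr α i j m ∈ B := by
      intro m hmi hmj
      exact B.add_mem (B.mul_mem (B.sub_mem (hB _ _ hmj.symm) (hB _ _ hmi.symm)) (hB _ _ hij)) (B.mul_mem (hB _ _ hmj) (hB _ _ hmi.symm))
    have h2 := B.sub_mem (hP k (Ne.symm hik) hjk.symm) (hP l (Ne.symm hil) hjl.symm)
    rw [h1] at h2
    simpa using B.add_mem h2 hk
  have h01 : (0 : Fin (c+1)) ≠ 1 := by
    intro h
    have := congrArg Fin.val h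
    rw [Fin.val_one', Nat.mod_eq_of_lt (by omega)] at this
    simp at this
  have h0 : ∀ l, 0 ≠ l → κ 0 l ∈ B := by
    intro l hl
    by_cases h1 : 1 = l
    · rw [← h1, hκ]; exact B.zero_mem
    · exact hstep 0 1 l h01 hl h1 (by rw [hκ]; exact B.zero_mem)
  intro i j hij
  by_cases hi : 0 = i
  · subst hi; exact h0 j hij
  · by_cases hj : 0 = j
    · subst hj; rw [hsym _ _ hij]; exact h0 i hi
    · exact hstep i 0 j (Ne.symm hi) hij hj (by rw [hsym _ _ (Ne.symm hi)]; exact h0 i hi)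

theorem transc {e : ℕ} [IsScalarTower K RY A] (hde : d = e + 1) (hc : 3 ≤ c) {X : Fin (c+1) → A} {Om : A} {α : Fin (c+1) → Fin (c+1) → (Fin d → K)} {κ : Fin (c+1) → Fin (c+1) → RY}
    (hR : Rel X Om α κ) (hI : Ind K d X Om) (hκ : κ 0 1 = 0) (bb : Fin e → (Fin d → K))
    (hα : ∀ i j, i ≠ j → α i j ∈ Submodule.span K (Set.range bb)) (t : A)
    (hgen : Algebra.adjoin K (insert t (Set.range X ∪ Set.range fun i => algebraMap RY A (lf (bb i)))) = ⊤)
    (y : Fin (d+1) → A) (hy : AlgebraicIndependent K y) :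
    Transcendental (Algebra.adjoin K (Set.range X ∪ Set.range fun i => algebraMap RY A (lf (bb i)))) t := by
  intro halg
  let s : Fin (e+1) → A := Fin.cons (X 0) fun i => algebraMap RY A (lf (bb i))
  let B : Subalgebra K RY := Algebra.adjoin K (Set.range fun i => lf (bb i))
  have hBα : ∀ i j, i ≠ j → lf (α i j) ∈ B := by
    intro i j h
    have : Submodule.span K (Set.range bb) ≤ (Subalgebra.toSubmodule B).comap lf := by
      rw [Submodule.span_le]
      rintro _ ⟨i, rfl⟩
      exact Algebra.subset_adjoin ⟨i, rfl⟩
    exact this (hα i j h)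
  have hBκ := kap_mem hc hR hI hκ B hBα
  let R0 := Algebra.adjoin K (Set.range s)
  have hs0 : X 0 ∈ R0 := Algebra.subset_adjoin ⟨0, rfl⟩
  have hss : ∀ i, algebraMap RY A (lf (bb i)) ∈ R0 := fun i => Algebra.subset_adjoin ⟨i.succ, rfl⟩
  have hBR : ∀ P ∈ B, algebraMap RY A P ∈ R0 := by
    have : B ≤ R0.comap (IsScalarTower.toAlgHom K RY A) := by
      apply Algebra.adjoin_le
      rintro _ ⟨i, rfl⟩
      exact hss i
    exact fun P hP => this hP
  have hne : ∀ u : Fin d → K, X 0 - algebraMap RY A (lf u) ≠ 0 := by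
    intro u h
    have := (hI 0 (Pi.single 0 1) (- lf u) (by
      rw [Finset.sum_eq_single 0]
      · simpa [Algebra.smul_def, ← sub_eq_add_neg] using h
      · intro b _ hb; simp [hb]
      · simp)).2.1
    have := congrFun this 0
    simp at this
  set a : Fin (c+1) → Fin (c+1) → A := fun i j => algebraMap RY A (lf (α i j)) with ha
  set k : Fin (c+1) → Fin (c+1) → A := fun i j => algebraMap RY A (κ i j) with hk
  have haR : ∀ i j, i ≠ j → a i j ∈ R0 := fun i j h => hBR _ (hBα i j h)
  have hkR : ∀ i j, i ≠ j → k i j ∈ R0 := fun i j h => hBR _ (hBκ i j h)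
  have hRel : ∀ i j, i ≠ j → X i * X j = Om + a i j * X i + a j i * X j + k i j := by
    intro i j h
    rw [hR i j h]; simp [Algebra.smul_def, ha, hk]
  have h01 : (0 : Fin (c+1)) ≠ 1 := by
    intro h
    have := congrArg Fin.val h
    rw [Fin.val_one', Nat.mod_eq_of_lt (by omega)] at this
    simp at this
  obtain ⟨q, hq0, hq1⟩ : ∃ q : Fin (c+1), 0 ≠ q ∧ 1 ≠ q := by
    refine ⟨⟨2, by omega⟩, ?_, ?_⟩
    · intro h; have := congrArg Fin.val h; simp at this
    · intro h
      have := congrArg Fin.val h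
      rw [Fin.val_one', Nat.mod_eq_of_lt (by omega)] at this
      simp at this
  have hX1 : IsAlgebraic R0 (X 1) := by
    have r1 := hRel 0 1 h01
    have r2 := hRel 0 q hq0
    have r3 := hRel 1 q hq1
    have i1 := haR 0 1 h01
    have i2 := haR 1 0 h01.symm
    have i3 := haR 0 q hq0
    have i4 := haR q 0 hq0.symm
    have i5 := haR 1 q hq1
    have i6 := haR q 1 hq1.symm
    have k1 := hkR 0 1 h01
    have k2 := hkR 0 q hq0
    have k3 := hkR 1 q hq1
    set g := X 0 - a 1 0 with hg
    set f := X 0 - a q 0 with hf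
    have hgR : g ∈ R0 := R0.sub_mem hs0 i2
    have hfR : f ∈ R0 := R0.sub_mem hs0 i4
    set h := (a 0 1 - a 0 q) * X 0 + k 0 1 - k 0 q with hh
    have hhR : h ∈ R0 := R0.sub_mem (R0.add_mem (R0.mul_mem (R0.sub_mem i1 i3) hs0) k1) k2
    refine alg_quad R0 (g := g) (b := - h - f * X 0 - f * (a 1 q - a 1 0) - a q 1 * g) (c := a q 1 * h - f * (k 1 q - a 0 1 * X 0 - k 0 1)) hgR ?_ ?_ (Or.inl (hne _)) ?_
    · exact R0.sub_mem (R0.sub_mem (R0.sub_mem (R0.neg_mem hhR) (R0.mul_mem hfR hs0)) (R0.mul_mem hfR (R0.sub_mem i5 i2))) (R0.mul_mem i6 hgR)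
    · exact R0.sub_mem (R0.mul_mem i6 hhR) (R0.mul_mem hfR (R0.sub_mem (R0.sub_mem k3 (R0.mul_mem i1 hs0)) k1))
    · have e1 : f * X q = g * X 1 - h := by
        simp only [hf, hg, hh]; linear_combination r2 - r1
      have e2 : f * (X 1 * X q) - f * (X 0 * X 1) = f * (a 1 q * X 1 + a q 1 * X q + k 1 q - a 0 1 * X 0 - a 1 0 * X 1 - k 0 1) := by
        rw [r1, r3]; ring
      linear_combination e2 - (X 1 - a q 1) * e1
  have hX1' : ∀ x ∈ insert (X 1) (Set.range s), IsAlgebraic R0 x := by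
    intro x hx
    rcases hx with rfl | hx
    · exact hX1
    · exact isAlgebraic_algebraMap (⟨x, Algebra.subset_adjoin hx⟩ : R0)
  have hXj : ∀ j, IsAlgebraic R0 (X j) := by
    intro j
    by_cases hj0 : 0 = j
    · subst hj0; exact hX1' _ (Or.inr ⟨0, rfl⟩)
    by_cases hj1 : 1 = j
    · subst hj1; exact hX1
    have hle : R0 ≤ Algebra.adjoin K (insert (X 1) (Set.range s)) := Algebra.adjoin_mono (Set.subset_insert _ _)
    have h1 : IsAlgebraic (Algebra.adjoin K (insert (X 1) (Set.range s))) (X j) := by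
      set R1 := Algebra.adjoin K (insert (X 1) (Set.range s))
      have hx1 : X 1 ∈ R1 := Algebra.subset_adjoin (Set.mem_insert _ _)
      refine alg_quad R1 (g := 0) (b := X 0 - a j 0) (c := (a 0 1 - a 0 j) * X 0 + k 0 1 - k 0 j - (X 0 - a 1 0) * X 1) R1.zero_mem 
        (hle (R0.sub_mem hs0 (haR _ _ (Ne.symm hj0)))) ?_ (Or.inr (hne _)) ?_
      · exact R1.sub_mem (hle (R0.sub_mem (R0.add_mem (R0.mul_mem (R0.sub_mem (haR _ _ h01) (haR _ _ hj0)) hs0) (hkR _ _ h01)) (hkR _ _ hj0)))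
          (R1.mul_mem (hle (R0.sub_mem hs0 (haR _ _ h01.symm))) hx1)
      · linear_combination hRel 0 j hj0 - hRel 0 1 h01
    exact h1.adjoin_of_forall_isAlgebraic fun x hx => hX1' x hx.1
  have hG : ∀ x ∈ (Set.range X ∪ Set.range fun i => algebraMap RY A (lf (bb i))), IsAlgebraic R0 x := by
    rintro x (⟨j, rfl⟩ | ⟨i, rfl⟩)
    · exact hXj j
    · exact isAlgebraic_algebraMap (⟨_, hss i⟩ : R0)
  have ht : IsAlgebraic R0 t := halg.adjoin_of_forall_isAlgebraic fun x hx => hG x hx.1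
  apply trdeg_contra (by omega) s y hy
  have htop : (Algebra.adjoin K (insert t (Set.range X ∪ Set.range fun i => algebraMap RY A (lf (bb i))))) ≤ (Subalgebra.algebraicClosure R0 A).restrictScalars K := by
    apply Algebra.adjoin_le
    rintro x (rfl | hx)
    · exact ht
    · exact hG x hx
  rw [hgen] at htop
  exact fun x => htop (Algebra.mem_top (x := x))
end
end DP
end

noncomputable section
namespace DP
set_option linter.all false
open MvPolynomial

theorem pth_power {K ι : Type*} [Field K] [IsAlgClosed K] [Fintype ι] (f : MvPolynomial ι K) (hf : 0 < f.totalDegree)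
    (h : ∀ i, pderiv i f = 0) : ∃ (p : ℕ) (g : MvPolynomial ι K), 1 < p ∧ f = g ^ p := by
  classical
  obtain ⟨p, hp⟩ := CharP.exists K
  have hco : ∀ σ ∈ f.support, ∀ i, ((σ i : ℕ) : K) = 0 := by
    intro σ hσ i
    by_contra h0
    have hi : σ i ≠ 0 := fun h1 => h0 (by rw [h1]; simp)
    have h1 := congrArg (coeff (σ - Finsupp.single i 1)) (h i)
    have hs : σ - Finsupp.single i 1 + Finsupp.single i 1 = σ := by
      apply tsub_add_cancel_of_le
      rw [Finsupp.single_le_iff]; omega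
    rw [coeff_pderiv, coeff_zero, hs] at h1
    have h2 : (((σ - Finsupp.single i 1 : ι →₀ ℕ) i : ℕ) : K) + 1 = ((σ i : ℕ) : K) := by
      have : (σ - Finsupp.single i 1 : ι →₀ ℕ) i + 1 = σ i := by
        rw [Finsupp.tsub_apply, Finsupp.single_eq_same]; omega
      rw [← this]; push_cast; ring
    rw [h2] at h1
    rcases mul_eq_zero.1 h1 with h3 | h3
    · exact mem_support_iff.1 hσ h3
    · exact h0 h3
  have hp0 : p ≠ 0 := by
    rintro rfl
    haveI := CharP.charP_to_charZero K
    have : f.totalDegree = 0 := by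
      rw [totalDegree_eq_zero_iff]
      intro σ hσ i
      exact_mod_cast hco σ hσ i
    omega
  have hpp : p.Prime := (CharP.char_is_prime_or_zero K p).resolve_right hp0
  haveI : Fact p.Prime := ⟨hpp⟩
  refine ⟨p, ∑ σ ∈ f.support, monomial (σ.mapRange (fun k => k / p) (Nat.zero_div p)) (Classical.choose (IsAlgClosed.exists_pow_nat_eq (coeff σ f) hpp.pos)), hpp.one_lt, ?_⟩
  rw [sum_pow_char]
  conv_lhs => rw [as_sum f]
  refine Finset.sum_congr rfl fun σ hσ => ?_
  rw [monomial_pow, Classical.choose_spec (IsAlgClosed.exists_pow_nat_eq (coeff σ f) hpp.pos)]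
  have e : p • σ.mapRange (fun k => k / p) (Nat.zero_div p) = σ := by
    ext i
    rw [Finsupp.smul_apply, Finsupp.mapRange_apply, smul_eq_mul]
    exact Nat.mul_div_cancel' ((CharP.cast_eq_zero_iff K p _).1 (hco σ hσ i))
  rw [e]

theorem der_aeval {K L ι : Type*} [Field K] [CommRing L] [Algebra K L] [Fintype ι] (D : Derivation K L L) (y : ι → L) (P : MvPolynomial ι K) :
    D (aeval y P) = ∑ i, aeval y (pderiv i P) * D (y i) := by
  classical
  induction P using MvPolynomial.induction_on with
  | C a => simp
  | add p q hp hq => simp [hp, hq, add_mul, Finset.sum_add_distrib]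
  | mul_X p j hp =>
    simp only [map_mul, aeval_X, Derivation.leibniz, hp, pderiv_X, smul_eq_mul, map_add, add_mul, Finset.sum_add_distrib]
    have e : ∀ i, aeval y p * aeval y ((Pi.single i 1 : ι → MvPolynomial ι K) j) * D (y i) = if i = j then aeval y p * D (y j) else 0 := by
      intro i
      split_ifs with h
      · subst h; simp
      · rw [Pi.single_eq_of_ne (Ne.symm h)]; simp
    simp only [e, Finset.sum_ite_eq', Finset.mem_univ, if_true, Finset.mul_sum]
    congr 1
    refine Finset.sum_congr rfl fun i _ => by ring

section
variable {K A ι : Type*} [Field K] [CommRing A] [IsDomain A] [Algebra K A] (𝒜 : ℕ → Submodule K A) [GradedAlgebra 𝒜]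

/-- homogeneous relation of minimal degree with a nonvanishing partial -/
theorem good_rel [IsAlgClosed K] [Fintype ι] {y : ι → A} (hy : ∀ i, y i ∈ 𝒜 1) (hni : ¬ AlgebraicIndependent K y) :
    ∃ (f : MvPolynomial ι K) (n : ℕ), f ≠ 0 ∧ f.IsHomogeneous n ∧ aeval y f = 0 ∧ ∃ i, aeval y (pderiv i f) ≠ 0 := by
  classical
  have hex : ∃ n : ℕ, ∃ f : MvPolynomial ι K, f ≠ 0 ∧ aeval y f = 0 ∧ f.totalDegree = n := by
    rw [algebraicIndependent_iff] at hni
    push Not at hni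
    obtain ⟨f, h1, h2⟩ := hni
    exact ⟨_, f, h2, h1, rfl⟩
  obtain ⟨f0, hf0, hf1, hf2⟩ := Nat.find_spec hex
  set n := Nat.find hex with hn
  have hmin : ∀ g : MvPolynomial ι K, g.totalDegree < n → aeval y g = 0 → g = 0 := by
    intro g hg h0
    by_contra hne
    exact Nat.find_min hex hg ⟨g, hne, h0, rfl⟩
  set f := homogeneousComponent n f0 with hf
  have hfh : f.IsHomogeneous n := homogeneousComponent_isHomogeneous _ _
  have hfne : f ≠ 0 := by
    intro h0
    obtain ⟨m, hm, hmd⟩ := Finset.exists_mem_eq_sup f0.support (support_nonempty.2 hf0) (fun s => s.sum fun _ e => e)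
    have hmd' : m.degree = n := by rw [← hf2]; exact hmd.symm
    have := congrArg (coeff m) h0
    rw [hf, coeff_homogeneousComponent, if_pos hmd', coeff_zero] at this
    exact mem_support_iff.1 hm this
  have hfa : aeval y f = 0 := by
    rw [hf, ← pr_aeval 𝒜 hy, hf1, map_zero]
  have hdeg : f.totalDegree = n := hfh.totalDegree hfne
  have hn0 : 0 < n := by
    rcases Nat.eq_zero_or_pos n with h | h
    · exfalso
      rw [h] at hdeg
      rw [totalDegree_eq_zero_iff_eq_C] at hdeg
      rw [hdeg, aeval_C] at hfa
      apply hfne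
      rw [hdeg, (FaithfulSMul.algebraMap_injective K A) (hfa.trans (map_zero _).symm), map_zero]
    · exact h
  refine ⟨f, n, hfne, hfh, hfa, ?_⟩
  by_contra hcon
  push Not at hcon
  have hz : ∀ i, pderiv i f = 0 := by
    intro i
    refine hmin _ ?_ (hcon i)
    have := hfh.pderiv (i := i)
    have := this.totalDegree_le
    omega
  obtain ⟨p, g, hp, hg⟩ := pth_power f (by omega) hz
  have hg0 : g ≠ 0 := by rintro rfl; exact hfne (by rw [hg]; exact zero_pow (by omega))
  have hgd : p * g.totalDegree = n := by
    rw [← hdeg, hg]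
    clear hp hg
    induction p with
    | zero => simp
    | succ k ih => rw [pow_succ, totalDegree_mul_of_isDomain (pow_ne_zero _ hg0) hg0, ← ih]; ring
  refine hg0 (hmin g ?_ ?_)
  · nlinarith
  · rw [hg, map_pow] at hfa
    exact pow_eq_zero_iff (by omega) |>.1 hfa
end
end DP
end

noncomputable section
namespace DP
set_option linter.all false
open MvPolynomial

section
variable {K A : Type*} [Field K] [CommRing A] [Algebra K A]

theorem int_lemma {m n : ℕ} (y : Fin (m+1) → A) (f : MvPolynomial (Fin (m+1)) K) (hf : f.IsHomogeneous n)
    (h1 : eval (Pi.single 0 1) f ≠ 0) (h0 : aeval y f = 0) :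
    (aeval (fun k : Fin m => y k.succ) : MvPolynomial (Fin m) K →ₐ[K] A).toRingHom.IsIntegralElem (y 0) := by
  classical
  set φ := (aeval (fun k : Fin m => y k.succ) : MvPolynomial (Fin m) K →ₐ[K] A).toRingHom with hφ
  set p := finSuccEquiv K m f with hp
  have hf0 : f ≠ 0 := by rintro rfl; simp at h1
  have hdeg : p.natDegree ≤ n := by
    rw [hp, natDegree_finSuccEquiv]
    exact (degreeOf_le_totalDegree f 0).trans hf.totalDegree_le
  have hc : p.coeff n = C (eval (Pi.single 0 1) f) := by
    have h2 := hf.finSuccEquiv_coeff_isHomogeneous n 0 (add_zero n)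
    have h3 := h2.totalDegree_le
    rw [totalDegree_eq_zero_iff_eq_C.1 (Nat.le_zero.1 h3), finSuccEquiv_coeff_coeff]
    congr 1
    rw [show (Finsupp.cons n (0 : Fin m →₀ ℕ)) = Finsupp.single 0 n by
      ext i; refine Fin.cases ?_ (fun j => ?_) i <;> simp]
    exact (coeff_single_hom f n hf 0).symm
  have hev : p.eval₂ φ (y 0) = 0 := by
    rw [← h0, hp]
    have : ((Polynomial.eval₂RingHom φ (y 0)).comp (finSuccEquiv K m).toRingEquiv.toRingHom) = (aeval y : MvPolynomial (Fin (m+1)) K →ₐ[K] A).toRingHom := by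
      apply MvPolynomial.ringHom_ext
      · intro a
        simp [hφ, finSuccEquiv_apply]
      · intro i
        refine Fin.cases ?_ (fun j => ?_) i
        · simp [hφ, finSuccEquiv_X_zero]
        · simp [hφ, finSuccEquiv_X_succ]
    exact RingHom.congr_fun this f
  set a := eval (Pi.single 0 1) f with ha
  refine ⟨Polynomial.C (C a⁻¹) * p, ?_, ?_⟩
  · apply Polynomial.monic_of_natDegree_le_of_coeff_eq_one n
    · exact (Polynomial.natDegree_C_mul_le _ _).trans hdeg
    · rw [Polynomial.coeff_C_mul, hc, ← C_mul, inv_mul_cancel₀ h1, C_1]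
  · rw [Polynomial.eval₂_mul, hev, mul_zero]

theorem int_trans {ι κ : Type*} (y : ι → A) (y' : κ → A)
    (h : ∀ i, (aeval y' : MvPolynomial κ K →ₐ[K] A).toRingHom.IsIntegralElem (y i)) (x : A)
    (hx : (aeval y : MvPolynomial ι K →ₐ[K] A).toRingHom.IsIntegralElem x) :
    (aeval y' : MvPolynomial κ K →ₐ[K] A).toRingHom.IsIntegralElem x := by
  letI : Algebra (MvPolynomial κ K) A := (aeval y' : MvPolynomial κ K →ₐ[K] A).toRingHom.toAlgebra
  set B := integralClosure (MvPolynomial κ K) A with hB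
  have hmem : ∀ P, (aeval y : MvPolynomial ι K →ₐ[K] A).toRingHom P ∈ B := by
    intro P
    induction P using MvPolynomial.induction_on with
    | C a =>
      have := Subalgebra.algebraMap_mem B (C a)
      have e : algebraMap (MvPolynomial κ K) A (C a) = (aeval y : MvPolynomial ι K →ₐ[K] A).toRingHom (C a) := by
        change aeval y' (C a) = aeval y (C a)
        rw [aeval_C, aeval_C]
      rwa [e] at this
    | add p q hp hq => rw [map_add]; exact B.add_mem hp hq
    | mul_X p i hp =>
      rw [map_mul]; refine B.mul_mem hp ?_
      have : (aeval y : MvPolynomial ι K →ₐ[K] A).toRingHom (X i) = y i := aeval_X _ _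
      rw [this]; exact h i
  obtain ⟨q, hq, hqx⟩ := hx
  have h2 : IsIntegral B x := by
    refine ⟨q.map ((aeval y : MvPolynomial ι K →ₐ[K] A).toRingHom.codRestrict B hmem), hq.map _, ?_⟩
    rw [Polynomial.eval₂_map]
    exact hqx
  have h3 : IsIntegral (MvPolynomial κ K) x := isIntegral_trans (A := B) x h2
  exact h3
end

section
variable {K A : Type*} [Field K] [IsAlgClosed K] [CommRing A] [IsDomain A] [Algebra K A] (𝒜 : ℕ → Submodule K A) [GradedAlgebra 𝒜]
  (L : Type*) [Field L] [Algebra A L] [Algebra K L] [IsScalarTower K A L] [FaithfulSMul A L]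

def PN (m : ℕ) : Prop := ∃ y : Fin m → A, (∀ i, y i ∈ 𝒜 1) ∧
  (∀ x : A, (aeval y : MvPolynomial (Fin m) K →ₐ[K] A).toRingHom.IsIntegralElem x) ∧
  ∀ D : Derivation K L L, (∀ i, D (algebraMap A L (y i)) = 0) → D = 0

theorem PN_step (m : ℕ) (y : Fin (m+1) → A) (hy : ∀ i, y i ∈ 𝒜 1)
    (hi : ∀ x : A, (aeval y : MvPolynomial (Fin (m+1)) K →ₐ[K] A).toRingHom.IsIntegralElem x)
    (hd : ∀ D : Derivation K L L, (∀ i, D (algebraMap A L (y i)) = 0) → D = 0) (hni : ¬ AlgebraicIndependent K y) :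
    PN 𝒜 L m := by
  classical
  obtain ⟨f, n, hf0, hfh, hfa, i0, hi0⟩ := good_rel 𝒜 hy hni
  haveI : Infinite K := IsAlgClosed.instInfinite
  obtain ⟨b, hb⟩ := good_basis f hf0
  have hex : ∃ j, ∑ i, algebraMap K A (b j i) * aeval y (pderiv i f) ≠ 0 := by
    by_contra hcon
    push Not at hcon
    let ℓ : (Fin (m+1) → K) →ₗ[K] A := ∑ i, (LinearMap.proj i : (Fin (m+1) → K) →ₗ[K] K).smulRight (aeval y (pderiv i f))
    have hl : ∀ v, ℓ v = ∑ i, algebraMap K A (v i) * aeval y (pderiv i f) := by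
      intro v; simp [ℓ, Algebra.smul_def]
    have : ℓ = 0 := b.ext fun j => by rw [hl, hcon, LinearMap.zero_apply]
    have h2 := hl (Pi.single i0 1)
    rw [this, LinearMap.zero_apply, Finset.sum_eq_single i0] at h2
    · apply hi0; rw [h2]; simp
    · intro k _ hk; simp [hk]
    · simp
  obtain ⟨j0, hj0⟩ := hex
  set b' := b.reindex (Equiv.swap j0 0) with hb'
  have hb'0 : b' 0 = b j0 := by simp [hb']
  set M : Matrix (Fin (m+1)) (Fin (m+1)) K := fun i j => b' i j with hM
  have hM1 : M = ((Pi.basisFun K _).toMatrix b').transpose := by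
    ext i j; simp [hM, Module.Basis.toMatrix_apply, Matrix.transpose_apply]
  set N : Matrix (Fin (m+1)) (Fin (m+1)) K := (b'.toMatrix (Pi.basisFun K _)).transpose with hN
  have hNM : N * M = 1 := by
    rw [hM1, hN, ← Matrix.transpose_mul, Module.Basis.toMatrix_mul_toMatrix_flip, Matrix.transpose_one]
  set y' : Fin (m+1) → A := fun j => ∑ i, algebraMap K A (N i j) * y i with hy'
  have h1 : ∀ P, aeval y' P = aeval y (lsub N P) := fun P => (aeval_lsub N y P).symm
  have h2 : ∀ P, aeval y' (lsub M P) = aeval y P := fun P => by rw [h1, lsub_comp M N hNM]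
  have hyy : ∀ i, y i = ∑ j, algebraMap K A (M j i) * y' j := by
    intro i
    have := h2 (X i)
    rw [aeval_lsub, aeval_X, aeval_X] at this
    exact this.symm
  have hint0 := int_lemma y' (lsub M f) (lsub_hom M f n hfh) (by rw [eval_lsub]; change eval (b' 0) f ≠ 0; rw [hb'0]; exact hb j0) (by rw [h2, hfa])
  refine ⟨fun k => y' k.succ, fun k => ?_, ?_, ?_⟩
  · refine Submodule.sum_mem _ fun j _ => ?_
    rw [← Algebra.smul_def]
    exact Submodule.smul_mem _ _ (hy j)
  · intro x
    refine int_trans y _ (fun i => ?_) x (hi x)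
    letI : Algebra (MvPolynomial (Fin m) K) A := (aeval (fun k : Fin m => y' k.succ) : MvPolynomial (Fin m) K →ₐ[K] A).toRingHom.toAlgebra
    have hyi : ∀ j, IsIntegral (MvPolynomial (Fin m) K) (y' j) := by
      intro j
      refine Fin.cases ?_ (fun k => ?_) j
      · exact hint0
      · have : algebraMap (MvPolynomial (Fin m) K) A (X k) = y' k.succ := aeval_X _ _
        rw [← this]; exact isIntegral_algebraMap
    have hK : ∀ a : K, IsIntegral (MvPolynomial (Fin m) K) (algebraMap K A a) := by
      intro a
      have : algebraMap (MvPolynomial (Fin m) K) A (C a) = algebraMap K A a := aeval_C _ _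
      rw [← this]; exact isIntegral_algebraMap
    have : IsIntegral (MvPolynomial (Fin m) K) (y i) := by
      rw [hyy]
      exact IsIntegral.sum _ fun j _ => (hK _).mul (hyi j)
    exact this
  · intro D hD
    apply hd D
    have hDy : ∀ i, D (algebraMap A L (y i)) = algebraMap K L (b j0 i) * D (algebraMap A L (y' 0)) := by
      intro i
      have e : ∀ (a : K) (t : A), D (algebraMap A L (algebraMap K A a * t)) = algebraMap K L a * D (algebraMap A L t) := by
        intro a t
        rw [map_mul, ← IsScalarTower.algebraMap_apply, ← Algebra.smul_def, D.map_smul, Algebra.smul_def]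
      rw [hyy, map_sum, map_sum, Fin.sum_univ_succ]
      simp only [e, hD, mul_zero, Finset.sum_const_zero, add_zero]
      change algebraMap K L (b' 0 i) * _ = _
      rw [hb'0]
    have hal : ∀ P : MvPolynomial (Fin (m+1)) K, aeval (fun i => algebraMap A L (y i)) P = algebraMap A L (aeval y P) := fun P =>
      aeval_algebraMap_apply L y P
    have h3 := der_aeval D (fun i => algebraMap A L (y i)) f
    rw [hal, hfa, map_zero, map_zero] at h3
    simp only [hDy, hal] at h3
    have h4 : algebraMap A L (∑ i, algebraMap K A (b j0 i) * aeval y (pderiv i f)) * D (algebraMap A L (y' 0)) = 0 := by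
      rw [h3, map_sum, Finset.sum_mul]
      refine Finset.sum_congr rfl fun i _ => ?_
      rw [map_mul, ← IsScalarTower.algebraMap_apply]; ring
    rcases mul_eq_zero.1 h4 with h5 | h5
    · exact absurd ((FaithfulSMul.algebraMap_injective A L) (h5.trans (map_zero _).symm)) hj0
    · intro i; rw [hDy, h5, mul_zero]

theorem noether [IsFractionRing A L] (N : ℕ) (x : Fin N → A) (hx : ∀ i, x i ∈ 𝒜 1) (hgen : Algebra.adjoin K (Set.range x) = ⊤) :
    ∃ (m : ℕ) (y : Fin m → A), AlgebraicIndependent K y ∧ (∀ i, y i ∈ 𝒜 1) ∧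
  (∀ x : A, (aeval y : MvPolynomial (Fin m) K →ₐ[K] A).toRingHom.IsIntegralElem x) ∧
  ∀ D : Derivation K L L, (∀ i, D (algebraMap A L (y i)) = 0) → D = 0 := by
  classical
  have hN : PN 𝒜 L N := by
    refine ⟨x, hx, ?_, ?_⟩
    · intro a
      have : a ∈ (aeval x : MvPolynomial (Fin N) K →ₐ[K] A).range := by
        rw [← Algebra.adjoin_range_eq_range_aeval, hgen]; trivial
      obtain ⟨P, rfl⟩ := this
      exact RingHom.isIntegralElem_map _
    · intro D hD
      have hA : ∀ a : A, D (algebraMap A L a) = 0 := by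
        intro a
        have : a ∈ (aeval x : MvPolynomial (Fin N) K →ₐ[K] A).range := by
          rw [← Algebra.adjoin_range_eq_range_aeval, hgen]; trivial
        obtain ⟨P, rfl⟩ := this
        have h3 := der_aeval D (fun i => algebraMap A L (x i)) P
        have hal : aeval (fun i => algebraMap A L (x i)) P = algebraMap A L (aeval x P) := aeval_algebraMap_apply L x P
        rw [hal] at h3
        exact h3.trans (Finset.sum_eq_zero fun i _ => by rw [hD, mul_zero])
      ext v
      obtain ⟨a, b, hb, rfl⟩ := IsFractionRing.div_surjective (A := A) v
      have hbL : algebraMap A L b ≠ 0 := by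
        simpa using nonZeroDivisors.ne_zero hb
      have h1 := D.leibniz (algebraMap A L a / algebraMap A L b) (algebraMap A L b)
      rw [div_mul_cancel₀ _ hbL, hA, hA, smul_zero, zero_add, smul_eq_mul] at h1
      simpa [hbL] using h1.symm
  have hex : ∃ m, PN 𝒜 L m := ⟨N, hN⟩
  obtain ⟨y, h1, h2, h3⟩ := Nat.find_spec hex
  refine ⟨Nat.find hex, y, ?_, h1, h2, h3⟩
  by_contra hni
  rcases hm : Nat.find hex with _ | m
  · have : IsEmpty (Fin (Nat.find hex)) := by rw [hm]; infer_instance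
    exact hni (algebraicIndependent_empty_type_iff.2 (FaithfulSMul.algebraMap_injective K A))
  · have hm' : m < Nat.find hex := by omega
    refine Nat.find_min hex hm' ?_
    generalize Nat.find hex = q at *
    subst hm
    exact PN_step 𝒜 L m y h1 h2 h3 hni
end
end DP
end

noncomputable section
namespace DP
set_option linter.all false
open MvPolynomial

section
open IntermediateField
theorem prim_V {K F L : Type*} [Field K] [Field F] [Field L] [Algebra K F] [Algebra K L] [Algebra F L] [IsScalarTower K F L] [Infinite K]
    [FiniteDimensional F L] [Algebra.IsSeparable F L] (V : Submodule K L)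
    (hV : ∀ φ ψ : L →ₐ[F] AlgebraicClosure F, (∀ v ∈ V, φ v = ψ v) → φ = ψ) : ∃ θ ∈ V, F⟮θ⟯ = ⊤ := by
  classical
  let Ω := AlgebraicClosure F
  let P := {p : (L →ₐ[F] Ω) × (L →ₐ[F] Ω) // p.1 ≠ p.2}
  let W : P → Submodule K V := fun p =>
    { carrier := {v | p.1.1 v.1 = p.1.2 v.1}
      add_mem' := by intro a b ha hb; simp only [Set.mem_setOf_eq, Submodule.coe_add, map_add] at *; rw [ha, hb]
      zero_mem' := by simp
      smul_mem' := by
        intro c v hv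
        simp only [Set.mem_setOf_eq, Submodule.coe_smul] at *
        rw [← algebraMap_smul F c v.1, map_smul, map_smul, hv] }
  have hfin : Finite P := inferInstance
  by_contra hcon
  push Not at hcon
  have hcov : (⋃ p, (W p : Set V)) = Set.univ := by
    rw [Set.eq_univ_iff_forall]
    intro v
    have h1 := hcon v.1 v.2
    have h2 : ¬ Function.Injective (fun φ : L →ₐ[F] Ω => φ v.1) := by
      intro hinj
      exact h1 ((Field.primitive_element_iff_algHom_eq_of_eval' F Ω (fun x => IsAlgClosed.splits _) v.1).2 hinj)
    unfold Function.Injective at h2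
    push Not at h2
    obtain ⟨φ, ψ, h3, h4⟩ := h2
    rw [Set.mem_iUnion]
    exact ⟨⟨(φ, ψ), h4⟩, h3⟩
  obtain ⟨p, hp⟩ := Subspace.exists_eq_top_of_iUnion_eq_univ hcov
  apply p.2
  apply hV
  intro v hv
  have : (⟨v, hv⟩ : V) ∈ W p := by rw [hp]; trivial
  exact this

theorem sep_of_der {K F L : Type*} [Field K] [Field F] [Field L] [Algebra K F] [Algebra K L] [Algebra F L] [IsScalarTower K F L]
    [FiniteDimensional F L] (h : ∀ D : Derivation K L L, (∀ a : F, D (algebraMap F L a) = 0) → D = 0) : Algebra.IsSeparable F L := by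
  have : Algebra.FormallyUnramified F L := by
    refine ⟨⟨fun a b => ?_⟩⟩
    rw [← sub_eq_zero]
    rw [← Module.forall_dual_apply_eq_zero_iff L]
    intro f
    let D := KaehlerDifferential.linearMapEquivDerivation F L (f : Ω[L⁄F] →ₗ[L] L)
    have hD : D.restrictScalars K = 0 := h _ fun a => D.map_algebraMap a
    have hD' : D = 0 := by
      ext x
      exact congrArg (fun E : Derivation K L L => E x) hD
    have : (f : Ω[L⁄F] →ₗ[L] L) = 0 := (KaehlerDifferential.linearMapEquivDerivation F L).map_eq_zero_iff.1 hD'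
    rw [this]; rfl
  exact Algebra.FormallyUnramified.isSeparable F L
end
end DP
end

noncomputable section
namespace DP
set_option linter.all false
open MvPolynomial

section
open IntermediateField
open scoped nonZeroDivisors
theorem clear_den {R F : Type*} [CommRing R] [IsDomain R] [Field F] [Algebra R F] [IsFractionRing R F] (p : Polynomial F) :
    ∃ b : R, b ≠ 0 ∧ ∃ q : Polynomial R, q.map (algebraMap R F) = Polynomial.C (algebraMap R F b) * p := by
  obtain ⟨b, hb, h⟩ := IsLocalization.integerNormalization_spec R⁰ p
  refine ⟨b, nonZeroDivisors.ne_zero hb, IsLocalization.integerNormalization R⁰ p, ?_⟩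
  rw [h, Algebra.smul_def]; rfl

theorem NN_of {K A : Type*} [Field K] [IsAlgClosed K] [CommRing A] [IsDomain A] [IsIntegrallyClosed A] [Algebra K A] {m : ℕ}
    (𝒜 : ℕ → Submodule K A) [GradedAlgebra 𝒜]
    {F L : Type*} [Field F] [Field L] [Algebra (MvPolynomial (Fin m) K) A] [Algebra (MvPolynomial (Fin m) K) F] [Algebra A L]
    [IsScalarTower K (MvPolynomial (Fin m) K) A] [Algebra (MvPolynomial (Fin m) K) L] [Algebra F L]
    [IsScalarTower (MvPolynomial (Fin m) K) A L] [IsScalarTower (MvPolynomial (Fin m) K) F L]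
    [IsFractionRing (MvPolynomial (Fin m) K) F] [IsFractionRing A L]
    [Algebra K F] [Algebra K L] [IsScalarTower K F L] [IsScalarTower K A L]
    [FiniteDimensional F L] [Algebra.IsSeparable F L]
    (hgen : Algebra.adjoin K (𝒜 1 : Set A) = ⊤)
    (y : Fin m → A) (halg : ∀ P : MvPolynomial (Fin m) K, algebraMap _ A P = aeval y P)
    (ind : AlgebraicIndependent K y) (hy : ∀ i, y i ∈ 𝒜 1)
    (int : ∀ x, (aeval y : MvPolynomial (Fin m) K →ₐ[K] A).toRingHom.IsIntegralElem x) :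
    ∃ (θ : A) (n : ℕ) (c : ℕ → MvPolynomial (Fin m) K) (H : MvPolynomial (Fin m) K), NN 𝒜 y θ n c H := by
  classical
  let R := MvPolynomial (Fin m) K
  have halg' : (algebraMap R A) = (aeval y : MvPolynomial (Fin m) K →ₐ[K] A).toRingHom := RingHom.ext halg
  have hinjA : Function.Injective (algebraMap A L) := IsFractionRing.injective A L
  have hinjR : Function.Injective (algebraMap R F) := IsFractionRing.injective R F
  have hinjF : Function.Injective (algebraMap F L) := (algebraMap F L).injective
  have hinjRA : Function.Injective (algebraMap R A) := by
    rw [halg']; exact ind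
  have : FaithfulSMul R A := (faithfulSMul_iff_algebraMap_injective R A).2 hinjRA
  obtain ⟨t, ht, hprim⟩ := prim_V (K := K) (F := F) (L := L) ((𝒜 1).map (Algebra.linearMap A L |>.restrictScalars K)) (by
    intro φ ψ hv
    have h1 : ∀ a : A, φ (algebraMap A L a) = ψ (algebraMap A L a) := by
      intro a
      have ha : a ∈ Algebra.adjoin K (𝒜 1 : Set A) := by rw [hgen]; trivial
      induction ha using Algebra.adjoin_induction with
      | mem x hx => exact hv _ ⟨x, hx, rfl⟩
      | algebraMap r =>
        rw [← IsScalarTower.algebraMap_apply K A L, IsScalarTower.algebraMap_apply K F L]; simp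
      | add a b _ _ h1 h2 => simp [h1, h2]
      | mul a b _ _ h1 h2 => simp [h1, h2]
    ext v
    obtain ⟨a, b, hb, rfl⟩ := IsFractionRing.div_surjective (A := A) v
    simp [h1])
  obtain ⟨θ, hθ, rfl⟩ := ht
  simp only [LinearMap.coe_restrictScalars, Algebra.linearMap_apply] at hprim
  have hθint : IsIntegral R θ := by
    have := int θ
    rw [← halg'] at this; exact this
  obtain ⟨c, hc, hroot⟩ := hom_eqn 𝒜 hy θ hθ (minpoly R θ) (minpoly.monic hθint) (by
    rw [← halg']; exact minpoly.aeval R θ)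
  set n := (minpoly R θ).natDegree with hn
  set tL := algebraMap A L θ with htL
  have hmp : minpoly F tL = (minpoly R θ).map (algebraMap R F) := minpoly.isIntegrallyClosed_eq_field_fractions F L hθint
  have hdeg : (minpoly F tL).natDegree = n := by
    rw [hmp, (minpoly.monic hθint).natDegree_map]
  have hintF : IsIntegral F tL := Algebra.IsIntegral.isIntegral _
  -- evaluation compat
  have hev : ∀ q : Polynomial R, Polynomial.aeval tL (q.map (algebraMap R F)) = algebraMap A L (q.eval₂ (algebraMap R A) θ) := by
    intro q
    rw [Polynomial.aeval_map_algebraMap, ← Polynomial.aeval_def, htL, Polynomial.aeval_algebraMap_apply]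
  have hg : (gpol n c).map (algebraMap R F) = minpoly F tL := by
    have hd := gpol_deg (R := F) n (fun i => algebraMap R F (c i))
    rw [gpol_map]
    have hdvd : minpoly F tL ∣ gpol n (fun i => algebraMap R F (c i)) := by
      apply minpoly.dvd
      rw [← gpol_map, hev]
      rw [halg', hroot, map_zero]
    exact Polynomial.eq_of_monic_of_dvd_of_natDegree_le (minpoly.monic hintF) hd.1 hdvd (by rw [hd.2, hdeg])
  have hnpos : 0 < n := by rw [← hdeg]; exact minpoly.natDegree_pos hintF
  have hsum : ∀ (P : ℕ → R), (∑ i ∈ Finset.range n, Polynomial.C (P i) * Polynomial.X ^ i : Polynomial R).eval₂ (algebraMap R A) θ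
      = ∑ i ∈ Finset.range n, aeval y (P i) * θ ^ i := by
    intro P
    simp only [Polynomial.eval₂_finset_sum, Polynomial.eval₂_mul, Polynomial.eval₂_C, Polynomial.eval₂_X_pow]
    exact Finset.sum_congr rfl fun i _ => by rw [halg]
  have hdlt : ∀ (P : ℕ → R), (∑ i ∈ Finset.range n, Polynomial.C (P i) * Polynomial.X ^ i : Polynomial R).degree < n := by
    intro P
    refine (Polynomial.degree_sum_le _ _).trans_lt ?_
    rw [Finset.sup_lt_iff (WithBot.bot_lt_coe _)]
    intro i hi
    exact (Polynomial.degree_C_mul_X_pow_le i _).trans_lt (by exact_mod_cast Finset.mem_range.1 hi)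
  have hcoef : ∀ (q : Polynomial R), q.degree < n → q = ∑ i ∈ Finset.range n, Polynomial.C (q.coeff i) * Polynomial.X ^ i := by
    intro q hq
    exact Polynomial.as_sum_range_C_mul_X_pow' q (by
      rcases eq_or_ne q 0 with rfl | h0
      · simpa using hnpos
      · rwa [Polynomial.natDegree_lt_iff_degree_lt h0])
  have key : ∀ q : Polynomial R, q.degree < n → q.eval₂ (algebraMap R A) θ = 0 → q = 0 := by
    intro q hq h0
    have h1 := hev q
    rw [h0, map_zero] at h1
    by_contra hne
    have hne' : q.map (algebraMap R F) ≠ 0 := by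
      rwa [Ne, Polynomial.map_eq_zero_iff hinjR]
    have h2 := minpoly.degree_le_of_ne_zero F tL hne' h1
    rw [Polynomial.degree_map_eq_of_injective hinjR, Polynomial.degree_eq_natDegree (minpoly.ne_zero hintF), hdeg] at h2
    exact absurd hq (not_lt.2 h2)
  have hsep : (minpoly F tL).Separable := Algebra.IsSeparable.isSeparable F tL
  obtain ⟨H, hH, hH0⟩ : ∃ H : R, (∃ a b : Polynomial R, a * gpol n c + b * (gpol n c).derivative = Polynomial.C H) ∧ H ≠ 0 := by
    obtain ⟨a, b, hab⟩ := hsep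
    obtain ⟨s, hs, a', ha'⟩ := clear_den (R := R) a
    obtain ⟨t, ht, b', hb'⟩ := clear_den (R := R) b
    refine ⟨s * t, ⟨Polynomial.C t * a', Polynomial.C s * b', ?_⟩, mul_ne_zero hs ht⟩
    apply Polynomial.map_injective _ hinjR
    simp only [Polynomial.map_add, Polynomial.map_mul, Polynomial.map_C, ← Polynomial.derivative_map, hg, ha', hb', map_mul]
    linear_combination (Polynomial.C (algebraMap R F s) * Polynomial.C (algebraMap R F t)) * hab
  refine ⟨θ, n, c, H, ⟨hy, hθ, ind, int, hc, hroot, ?_, ?_, hH, hH0⟩⟩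
  · intro P hP i hi
    have h1 := key _ (hdlt P) (by rw [hsum, hP])
    have h2 := congrArg (fun q : Polynomial R => q.coeff i) h1
    simp only [Polynomial.finset_sum_coeff, Polynomial.coeff_C_mul, Polynomial.coeff_X_pow] at h2
    simpa [hi] using h2
  · intro x
    have hx : algebraMap A L x ∈ F⟮tL⟯ := by rw [hprim]; trivial
    rw [← IntermediateField.mem_toSubalgebra, IntermediateField.adjoin_simple_toSubalgebra_of_isAlgebraic hintF.isAlgebraic, Algebra.adjoin_singleton_eq_range_aeval] at hx
    obtain ⟨p, hp⟩ := hx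
    obtain ⟨D, hD, q, hq⟩ := clear_den (R := R) (p %ₘ minpoly F tL)
    have hqd : q.degree < n := by
      rw [← Polynomial.degree_map_eq_of_injective hinjR, hq]
      refine (Polynomial.degree_C_mul (by simpa using hD)).trans_lt ?_
      refine (Polynomial.degree_modByMonic_lt _ (minpoly.monic hintF)).trans_le ?_
      rw [Polynomial.degree_eq_natDegree (minpoly.ne_zero hintF), hdeg]
    refine ⟨D, fun i => q.coeff i, hD, ?_⟩
    rw [← hsum, ← hcoef q hqd]
    apply hinjA
    rw [← hev, hq, map_mul, map_mul, Polynomial.aeval_C, ← IsScalarTower.algebraMap_apply R F L, IsScalarTower.algebraMap_apply R A L, halg]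
    congr 1
    have h5 : Polynomial.aeval tL p = algebraMap A L x := hp
    rw [← h5]
    conv_lhs => rw [← Polynomial.modByMonic_add_div p (minpoly F tL)]
    simp
end
end DP
end

noncomputable section
namespace DP
set_option linter.all false
open MvPolynomial

section
open scoped nonZeroDivisors
attribute [local instance] FractionRing.liftAlgebra FractionRing.isScalarTower_liftAlgebra
theorem exists_NN {K A : Type*} [Field K] [IsAlgClosed K] [CommRing A] [IsDomain A] [IsIntegrallyClosed A] [Algebra K A]
    (𝒜 : ℕ → Submodule K A) [GradedAlgebra 𝒜] (N : ℕ) (x : Fin N → A) (hx : ∀ i, x i ∈ 𝒜 1) (hgen : Algebra.adjoin K (Set.range x) = ⊤) :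
    ∃ (m : ℕ) (y : Fin m → A) (θ : A) (n : ℕ) (c : ℕ → MvPolynomial (Fin m) K) (H : MvPolynomial (Fin m) K), NN 𝒜 y θ n c H := by
  classical
  let L := FractionRing A
  obtain ⟨m, y, ind, hy, int, hD⟩ := noether 𝒜 L N x hx hgen
  let R := MvPolynomial (Fin m) K
  letI : Algebra R A := (aeval y : MvPolynomial (Fin m) K →ₐ[K] A).toRingHom.toAlgebra
  have halg : ∀ P : R, algebraMap R A P = aeval y P := fun P => rfl
  haveI : IsScalarTower K R A := IsScalarTower.of_algebraMap_eq fun k => by rw [halg]; simp [R]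
  have hinjRA : Function.Injective (algebraMap R A) := ind
  haveI : FaithfulSMul R A := (faithfulSMul_iff_algebraMap_injective R A).2 hinjRA
  haveI : Algebra.IsIntegral R A := ⟨int⟩
  haveI : Algebra.FiniteType K A := ⟨⟨Finset.univ.image x, by rw [Finset.coe_image, Finset.coe_univ, Set.image_univ, hgen]⟩⟩
  haveI : Algebra.FiniteType R A := Algebra.FiniteType.of_restrictScalars_finiteType K R A
  haveI : Module.Finite R A := Algebra.IsIntegral.finite
  haveI : FaithfulSMul R L := (faithfulSMul_iff_algebraMap_injective R L).2 (by
    rw [IsScalarTower.algebraMap_eq R A L]; exact (IsFractionRing.injective A L).comp hinjRA)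
  let F := FractionRing R
  haveI : IsIntegralClosure A R L := IsIntegralClosure.of_isIntegrallyClosed ..
  haveI : Algebra.IsAlgebraic F L := isAlgebraic_of_isFractionRing R A ..
  haveI := IsIntegralClosure.isLocalization R F L A
  haveI : FiniteDimensional F L := .of_isLocalization R A R⁰
  haveI : IsScalarTower K F L := IsScalarTower.of_algebraMap_eq fun k => by
    rw [IsScalarTower.algebraMap_apply K R F, ← IsScalarTower.algebraMap_apply R F L, IsScalarTower.algebraMap_apply R A L,
      ← IsScalarTower.algebraMap_apply K R A, ← IsScalarTower.algebraMap_apply K A L]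
  haveI : Algebra.IsSeparable F L := sep_of_der (K := K) (fun D hDF => hD D fun i => by
    have := hDF (algebraMap R F (X i))
    rw [← IsScalarTower.algebraMap_apply R F L, IsScalarTower.algebraMap_apply R A L, halg, aeval_X] at this
    exact this)
  obtain ⟨θ, n, c, H, h⟩ := NN_of 𝒜 (F := F) (L := L) (by
    rw [eq_top_iff, ← hgen]
    exact Algebra.adjoin_mono (by rintro _ ⟨i, rfl⟩; exact hx i)) y halg ind hy int
  exact ⟨m, y, θ, n, c, H, h⟩
end
end DP
end

noncomputable section
namespace DP
set_option linter.all false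
open MvPolynomial

section
theorem finrank_hom {K : Type*} [Field K] (m k : ℕ) :
    Module.finrank K (homogeneousSubmodule (Fin m) K k) = m.multichoose k := by
  classical
  rw [homogeneousSubmodule_eq_finsupp_supported]
  rw [LinearEquiv.finrank_eq (AddMonoidAlgebra.supportedEquivFinsupp (R := K) (S := K) {d : Fin m →₀ ℕ | d.degree = k})]
  let e : {d : Fin m →₀ ℕ | d.degree = k} ≃ Sym (Fin m) k :=
    (Equiv.subtypeEquivRight (fun d => Iff.rfl)).trans (Sym.equivNatSum (Fin m) k).symm
  rw [LinearEquiv.finrank_eq (Finsupp.domLCongr (R := K) (M := K) e), Module.finrank_finsupp_self, Sym.card_sym_eq_multichoose, Fintype.card_fin]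

def mcSer (m : ℕ) : PowerSeries ℤ := PowerSeries.mk fun k => (m.multichoose k : ℤ)

theorem mcSer_mul (m : ℕ) : mcSer m * (1 - PowerSeries.X) ^ m = 1 := by
  induction m with
  | zero =>
    ext k
    rcases k with _ | k <;> simp [mcSer, PowerSeries.coeff_one]
  | succ m ih =>
    have h : mcSer (m+1) * (1 - PowerSeries.X) = mcSer m := by
      ext k
      rcases k with _ | k
      · simp [mcSer, mul_sub]
      · simp [mcSer, mul_sub, PowerSeries.coeff_succ_mul_X, Nat.multichoose_succ_succ]
    rw [pow_succ', ← mul_assoc, h, ih]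

theorem neg_lemma (m : ℕ) (q : Polynomial ℤ) (hq : q.eval 1 < 0) :
    ∀ F : PowerSeries ℤ, F * (1 - PowerSeries.X) ^ (m+1) = (q : PowerSeries ℤ) → ∃ N, ∀ k, N ≤ k → PowerSeries.coeff k F < 0 := by
  induction m with
  | zero =>
    intro F hF
    have h1 : ∀ k, PowerSeries.coeff k F = ∑ i ∈ Finset.range (k+1), q.coeff i := by
      intro k
      induction k with
      | zero =>
        have := congrArg (PowerSeries.coeff 0) hF
        simpa [mul_sub] using this
      | succ k ih =>
        have := congrArg (PowerSeries.coeff (k+1)) hF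
        simp [mul_sub, PowerSeries.coeff_succ_mul_X] at this
        rw [Finset.sum_range_succ, ← ih, ← this]; ring
    refine ⟨q.natDegree, fun k hk => ?_⟩
    rw [h1]
    rw [Polynomial.eval_eq_sum_range' (n := k+1) (by omega)] at hq
    simpa using hq
  | succ m ih =>
    intro F hF
    obtain ⟨N, hN⟩ := ih (F * (1 - PowerSeries.X)) (by rw [← hF]; ring)
    have h2 : ∀ k, N ≤ k → PowerSeries.coeff (k+1) F ≤ PowerSeries.coeff k F - 1 := by
      intro k hk
      have := hN (k+1) (by omega)
      simp [mul_sub, PowerSeries.coeff_succ_mul_X] at this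
      omega
    have h3 : ∀ j : ℕ, PowerSeries.coeff (N + j) F ≤ PowerSeries.coeff N F - j := by
      intro j
      induction j with
      | zero => simp
      | succ j ih =>
        have := h2 (N+j) (by omega)
        push_cast
        rw [← add_assoc]
        linarith
    refine ⟨N + (PowerSeries.coeff N F).toNat + 1, fun k hk => ?_⟩
    obtain ⟨j, rfl⟩ := Nat.exists_eq_add_of_le (show N ≤ k by omega)
    have := h3 j
    have h4 := Int.self_le_toNat (PowerSeries.coeff N F)
    have h5 : ((PowerSeries.coeff N F).toNat : ℤ) + 1 ≤ j := by exact_mod_cast (by omega)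
    linarith

theorem nonneg_lemma (m : ℕ) (hm : 0 < m) (q : Polynomial ℤ) (F : PowerSeries ℤ) (hF : F * (1 - PowerSeries.X) ^ m = (q : PowerSeries ℤ))
    (h : ∀ k, 0 ≤ PowerSeries.coeff k F) : 0 ≤ q.eval 1 := by
  by_contra hcon
  obtain ⟨m, rfl⟩ : ∃ k, m = k + 1 := ⟨m - 1, by omega⟩
  obtain ⟨N, hN⟩ := neg_lemma m q (not_le.1 hcon) F hF
  exact absurd (h N) (not_le.2 (hN N le_rfl))

/-- comparison of Hilbert series -/
theorem hilb_cmp (F : PowerSeries ℤ) (d m n s : ℕ) (hn : 0 < n) (h : Polynomial ℤ) (hF : F * (1 - PowerSeries.X) ^ (d+1) = (h : PowerSeries ℤ))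
    (hpos : 0 < h.eval 1)
    (lo : ∀ k, PowerSeries.coeff k (((∑ i ∈ Finset.range n, Polynomial.X ^ i : Polynomial ℤ) : PowerSeries ℤ) * mcSer m) ≤ PowerSeries.coeff k F)
    (hi : ∀ k, PowerSeries.coeff k (PowerSeries.X ^ s * F) ≤ PowerSeries.coeff k (((∑ i ∈ Finset.range n, Polynomial.X ^ i : Polynomial ℤ) : PowerSeries ℤ) * mcSer m)) :
    m = d + 1 ∧ (n : ℤ) = h.eval 1 := by
  set g : Polynomial ℤ := ∑ i ∈ Finset.range n, Polynomial.X ^ i with hg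
  have hg1 : g.eval 1 = n := by simp [hg, Polynomial.eval_finset_sum]
  have hR := mcSer_mul m
  have hone : ((1 - Polynomial.X : Polynomial ℤ) : PowerSeries ℤ) = 1 - PowerSeries.X := by simp
  have case1 : m ≤ d + 1 → 0 ≤ (g * (1 - Polynomial.X) ^ (d + 1 - m) - Polynomial.X ^ s * h).eval 1 := by
    intro hm
    refine nonneg_lemma (d+1) (by omega) _ ((g : PowerSeries ℤ) * mcSer m - PowerSeries.X ^ s * F) ?_ ?_
    · push_cast
      rw [sub_mul, mul_assoc _ F, hF]
      obtain ⟨t, ht⟩ := Nat.exists_eq_add_of_le hm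
      rw [ht, Nat.add_sub_cancel_left, pow_add]
      linear_combination (g : PowerSeries ℤ) * (1 - PowerSeries.X)^t * hR
    · intro k; rw [map_sub]; linarith [hi k]
  have case2 : d + 1 ≤ m → 0 ≤ (h * (1 - Polynomial.X) ^ (m - (d + 1)) - g).eval 1 := by
    intro hm
    refine nonneg_lemma m (by omega) _ (F - (g : PowerSeries ℤ) * mcSer m) ?_ ?_
    · push_cast
      obtain ⟨t, rfl⟩ := Nat.exists_eq_add_of_le hm
      rw [Nat.add_sub_cancel_left]
      rw [pow_add] at hR ⊢
      linear_combination (1 - PowerSeries.X)^t * hF - (g : PowerSeries ℤ) * hR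
    · intro k; rw [map_sub]; linarith [lo k]
  have hn' : (0:ℤ) < n := by exact_mod_cast hn
  rcases lt_trichotomy m (d+1) with hlt | heq | hgt
  · have := case1 hlt.le
    have h0 : d + 1 - m ≠ 0 := by omega
    simp [hg1, h0] at this
    linarith
  · refine ⟨heq, ?_⟩
    have h1 := case1 heq.le
    have h2 := case2 heq.ge
    simp [hg1, heq] at h1 h2
    linarith
  · have := case2 hgt.le
    have h0 : m - (d+1) ≠ 0 := by omega
    simp [hg1, h0] at this
    linarith
end
end DP
end

noncomputable section
namespace DP
set_option linter.all false
open MvPolynomial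

section
variable {K A : Type*} [Field K] [CommRing A] [IsDomain A] [Algebra K A] {m : ℕ}

def Vh (K : Type*) [Field K] (m k i : ℕ) : Submodule K (MvPolynomial (Fin m) K) := if i ≤ k then homogeneousSubmodule (Fin m) K (k - i) else ⊥

theorem Vh_pos {k i : ℕ} (h : i ≤ k) : Vh K m k i = homogeneousSubmodule (Fin m) K (k - i) := if_pos h
theorem Vh_neg {k i : ℕ} (h : ¬ i ≤ k) : Vh K m k i = ⊥ := if_neg h

instance Vh_fin (k i : ℕ) : Module.Finite K (Vh K m k i) := by
  by_cases h : i ≤ k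
  · rw [Vh_pos h]; exact Module.Finite.of_fg (homogeneousSubmodule_fg (Fin m) K _)
  · rw [Vh_neg h]; infer_instance

theorem finrank_Vh (k i : ℕ) : Module.finrank K (Vh K m k i) = if i ≤ k then m.multichoose (k - i) else 0 := by
  split_ifs with h
  · rw [Vh_pos h]; exact finrank_hom _ _
  · rw [Vh_neg h]; simp

theorem Vh_mem {k i : ℕ} {P : MvPolynomial (Fin m) K} (h : P ∈ Vh K m k i) : (i ≤ k ∧ P.IsHomogeneous (k - i)) ∨ P = 0 := by
  unfold Vh at h
  split_ifs at h with hik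
  · exact Or.inl ⟨hik, h⟩
  · exact Or.inr h

def Phi (y : Fin m → A) (θ : A) (n k : ℕ) : (∀ i : Fin n, Vh K m k i) →ₗ[K] A where
  toFun P := ∑ i, aeval y (P i).1 * θ ^ (i : ℕ)
  map_add' P Q := by simp [add_mul, Finset.sum_add_distrib]
  map_smul' c P := by simp [Finset.smul_sum]

theorem dom_rank (n k : ℕ) : (Module.finrank K (∀ i : Fin n, Vh K m k i) : ℤ) =
    PowerSeries.coeff k (((∑ i ∈ Finset.range n, Polynomial.X ^ i : Polynomial ℤ) : PowerSeries ℤ) * mcSer m) := by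
  rw [Module.finrank_pi_fintype]
  simp only [finrank_Vh]
  rw [Fin.sum_univ_eq_sum_range (fun i => if i ≤ k then m.multichoose (k - i) else 0)]
  have : ((∑ i ∈ Finset.range n, Polynomial.X ^ i : Polynomial ℤ) : PowerSeries ℤ) = ∑ i ∈ Finset.range n, PowerSeries.X ^ i := by
    rw [← Polynomial.coeToPowerSeries.ringHom_apply, map_sum]
    simp
  rw [this, Finset.sum_mul, map_sum]
  push_cast
  refine Finset.sum_congr rfl fun i _ => ?_
  rw [PowerSeries.coeff_X_pow_mul']
  simp [mcSer]

theorem NN.Phi_inj {𝒜 : ℕ → Submodule K A} {y : Fin m → A} {θ : A} {n : ℕ} {c : ℕ → MvPolynomial (Fin m) K} {H : MvPolynomial (Fin m) K}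
    (h : NN 𝒜 y θ n c H) (k : ℕ) : Function.Injective (Phi (K := K) y θ n k) := by
  rw [injective_iff_map_eq_zero]
  intro P hP
  have h1 := h.tind (fun i => if hi : i < n then (P ⟨i, hi⟩).1 else 0) (by
    rw [← hP]
    simp only [Phi, LinearMap.coe_mk, AddHom.coe_mk]
    rw [← Fin.sum_univ_eq_sum_range (fun i => aeval y (if hi : i < n then (P ⟨i, hi⟩).1 else 0) * θ ^ i)]
    simp)
  funext i
  have := h1 i i.2
  simpa using this

theorem NN.unif {𝒜 : ℕ → Submodule K A} {y : Fin m → A} {θ : A} {n : ℕ} {c : ℕ → MvPolynomial (Fin m) K} {H : MvPolynomial (Fin m) K}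
    (h : NN 𝒜 y θ n c H) (hft : Algebra.FiniteType K A) : ∃ D : MvPolynomial (Fin m) K, D ≠ 0 ∧ ∀ x : A, ∃ P : ℕ → MvPolynomial (Fin m) K,
      aeval y D * x = ∑ i ∈ Finset.range n, aeval y (P i) * θ ^ i := by
  classical
  let R := MvPolynomial (Fin m) K
  letI : Algebra R A := (aeval y : MvPolynomial (Fin m) K →ₐ[K] A).toRingHom.toAlgebra
  have halg : ∀ P : R, algebraMap R A P = aeval y P := fun P => rfl
  haveI : IsScalarTower K R A := IsScalarTower.of_algebraMap_eq fun k => by rw [halg]; simp [R]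
  haveI : Algebra.IsIntegral R A := ⟨h.int⟩
  haveI : Algebra.FiniteType R A := Algebra.FiniteType.of_restrictScalars_finiteType K R A
  haveI : Module.Finite R A := Algebra.IsIntegral.finite
  obtain ⟨S, hS⟩ := Module.Finite.fg_top (R := R) (M := A)
  choose D P hD hP using h.gen
  refine ⟨∏ x ∈ S, D x, Finset.prod_ne_zero_iff.2 fun x _ => hD x, fun x => ?_⟩
  have hx : x ∈ Submodule.span R (S : Set A) := by rw [hS]; trivial
  induction hx using Submodule.span_induction with
  | mem x hx =>
    refine ⟨fun i => (∏ x ∈ S.erase x, D x) * P x i, ?_⟩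
    rw [← Finset.prod_erase_mul S D hx, map_mul, mul_assoc, hP, Finset.mul_sum]
    exact Finset.sum_congr rfl fun i _ => by rw [map_mul, mul_assoc]
  | zero => exact ⟨0, by simp⟩
  | add a b _ _ ha hb =>
    obtain ⟨P, hP⟩ := ha
    obtain ⟨Q, hQ⟩ := hb
    exact ⟨P + Q, by rw [mul_add, hP, hQ, ← Finset.sum_add_distrib]; exact Finset.sum_congr rfl fun i _ => by simp [add_mul]⟩
  | smul r a _ ha =>
    obtain ⟨P, hP⟩ := ha
    refine ⟨fun i => r * P i, ?_⟩
    rw [Algebra.smul_def, halg, mul_left_comm, hP, Finset.mul_sum]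
    exact Finset.sum_congr rfl fun i _ => by rw [map_mul, mul_assoc]

theorem NN.degree {𝒜 : ℕ → Submodule K A} [GradedAlgebra 𝒜] {y : Fin m → A} {θ : A} {n : ℕ} {c : ℕ → MvPolynomial (Fin m) K} {H : MvPolynomial (Fin m) K}
    (h : NN 𝒜 y θ n c H) (hft : Algebra.FiniteType K A) (hfin : ∀ k, Module.Finite K (𝒜 k)) (d : ℕ) (e : ℕ) (he : 0 < e) (q : Polynomial ℤ)
    (hq : (PowerSeries.mk fun k => (Module.finrank K (𝒜 k) : ℤ)) * (1 - PowerSeries.X) ^ (d+1) = (q : PowerSeries ℤ))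
    (hq1 : q.eval 1 = e) : m = d + 1 ∧ n = e := by
  classical
  have hn : 0 < n := by
    by_contra h0
    obtain rfl : n = 0 := by omega
    obtain ⟨D, P, hD, hP⟩ := h.gen 1
    simp at hP
    exact hD (h.ind (by rw [hP, map_zero]))
  have hθk : ∀ i, θ ^ i ∈ 𝒜 i := fun i => by
    have := SetLike.pow_mem_graded (A := 𝒜) i h.hθ; simpa using this
  obtain ⟨D, hD, hDP⟩ := h.unif hft
  obtain ⟨s, hs⟩ : ∃ s, homogeneousComponent s D ≠ 0 := by
    by_contra hcon
    push Not at hcon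
    apply hD
    rw [← sum_homogeneousComponent D]
    exact Finset.sum_eq_zero fun i _ => hcon i
  have hDs : aeval y (homogeneousComponent s D) ≠ 0 := fun h0 => hs (h.ind (by rw [h0, map_zero]))
  have := hilb_cmp _ d m n s hn q hq (by rw [hq1]; exact_mod_cast he) (by
    intro k
    rw [← dom_rank (K := K), PowerSeries.coeff_mk]
    have hmem : ∀ P, Phi (K := K) y θ n k P ∈ 𝒜 k := by
      intro P
      show ∑ i, aeval y (P i).1 * θ ^ (i : ℕ) ∈ 𝒜 k
      refine Submodule.sum_mem _ fun i _ => ?_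
      rcases Vh_mem (P i).2 with ⟨h1, h2⟩ | h1
      · have := SetLike.mul_mem_graded (aeval_mem 𝒜 h.hy1 _ _ h2) (hθk i)
        rwa [Nat.sub_add_cancel h1] at this
      · rw [h1]; simp
    have := LinearMap.finrank_le_finrank_of_injective (f := (Phi (K := K) y θ n k).codRestrict (𝒜 k) hmem) (by
      intro a b hab
      exact h.Phi_inj k (congrArg Subtype.val hab))
    exact_mod_cast this) (by
    intro k
    rw [← dom_rank (K := K), PowerSeries.coeff_X_pow_mul']
    split_ifs with hsk
    · rw [PowerSeries.coeff_mk]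
      have hmem : ∀ x : 𝒜 (k - s), aeval y (homogeneousComponent s D) * x.1 ∈ LinearMap.range (Phi (K := K) y θ n k) := by
        intro x
        obtain ⟨P, hP⟩ := hDP x.1
        have h1 := congrArg (pr 𝒜 k) hP
        rw [hom_coords 𝒜 h.hy1 (Finset.range n) P (fun i => θ ^ i) (fun i => i) (fun i _ => hθk i), pr_aeval_mul 𝒜 h.hy1 _ _ _ _ x.2, if_pos (Nat.sub_le _ _), Nat.sub_sub_self hsk] at h1
        rw [h1]
        refine ⟨fun i => ⟨if (i:ℕ) ≤ k then homogeneousComponent (k - i) (P i) else 0, ?_⟩, ?_⟩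
        · unfold Vh
          split_ifs
          · exact homogeneousComponent_isHomogeneous _ _
          · exact Submodule.zero_mem _
        · simp only [Phi, LinearMap.coe_mk, AddHom.coe_mk]
          rw [← Fin.sum_univ_eq_sum_range (fun i => aeval y (if i ≤ k then homogeneousComponent (k - i) (P i) else 0) * θ ^ i)]
      have h2 := LinearMap.finrank_le_finrank_of_injective (f := (((LinearMap.mulLeft K (aeval y (homogeneousComponent s D))).comp (𝒜 (k-s)).subtype).codRestrict (LinearMap.range (Phi (K := K) y θ n k)) hmem)) (by
        intro a b hab
        have h3 : aeval y (homogeneousComponent s D) * a.1 = aeval y (homogeneousComponent s D) * b.1 := congrArg Subtype.val hab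
        exact Subtype.ext (mul_left_cancel₀ hDs h3))
      have h4 := LinearMap.finrank_range_le (Phi (K := K) y θ n k)
      exact_mod_cast h2.trans h4
    · exact_mod_cast Nat.zero_le _)
  refine ⟨this.1, ?_⟩
  have h2 := this.2
  rw [hq1] at h2
  exact_mod_cast h2
end
end DP
end

noncomputable section
namespace DP
set_option linter.all false
open MvPolynomial

section
variable {K : Type} [Field K] {r : ℕ}

theorem qc_mem {I : Ideal (PS K r)} {n : ℕ} {x : PS K r ⧸ I} (hx : x ∈ AMD.quotComponent K r I n) :
    ∃ p : PS K r, p.IsHomogeneous n ∧ Ideal.Quotient.mk I p = x := by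
  obtain ⟨p, hp, rfl⟩ := hx
  exact ⟨p, hp, rfl⟩

theorem mk_mem_qc (I : Ideal (PS K r)) {n : ℕ} {p : PS K r} (hp : p.IsHomogeneous n) : Ideal.Quotient.mk I p ∈ AMD.quotComponent K r I n :=
  ⟨p, hp, rfl⟩

theorem qc_internal (I : Ideal (PS K r)) (hI : AMD.IsHomIdeal K r I) : DirectSum.IsInternal (AMD.quotComponent K r I) := by
  classical
  constructor
  · rw [injective_iff_map_eq_zero]
    intro f hf
    have hsum : ∑ i ∈ f.support, (f i : PS K r ⧸ I) = 0 := by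
      rw [← hf, DirectSum.coeAddMonoidHom_eq_dfinsuppSum]
      rfl
    choose p hp hpf using fun i => qc_mem (f i).2
    have h1 : ∑ i ∈ f.support, p i ∈ I := by
      rw [← Ideal.Quotient.eq_zero_iff_mem, map_sum]
      rw [← hsum]
      exact Finset.sum_congr rfl fun i _ => hpf i
    ext i
    by_cases hi : i ∈ f.support
    · have h2 := hI _ h1 i
      rw [map_sum, Finset.sum_eq_single i] at h2
      · rw [homogeneousComponent_of_mem (hp i), if_pos rfl] at h2
        rw [← hpf i]
        simpa using Ideal.Quotient.eq_zero_iff_mem.2 h2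
      · intro j _ hj
        rw [homogeneousComponent_of_mem (hp j), if_neg (fun h => hj h.symm)]
      · intro h; exact absurd hi h
    · have : f i = 0 := by simpa using hi
      rw [this]; rfl
  · intro x
    obtain ⟨p, rfl⟩ := Ideal.Quotient.mk_surjective x
    refine ⟨∑ i ∈ Finset.range (p.totalDegree + 1), DirectSum.of (fun i => AMD.quotComponent K r I i) i
      ⟨Ideal.Quotient.mk I (homogeneousComponent i p), mk_mem_qc I (homogeneousComponent_isHomogeneous _ _)⟩, ?_⟩
    rw [map_sum]
    conv_rhs => rw [← sum_homogeneousComponent p, map_sum]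
    refine Finset.sum_congr rfl fun i _ => ?_
    rw [DirectSum.coeAddMonoidHom_of]

def qcGraded (I : Ideal (PS K r)) (hI : AMD.IsHomIdeal K r I) : GradedAlgebra (AMD.quotComponent K r I) :=
  letI := (qc_internal I hI).chooseDecomposition
  { one_mem := by
      rw [← map_one (Ideal.Quotient.mk I)]
      exact mk_mem_qc I (isHomogeneous_one _ _)
    mul_mem := by
      intro i j a b ha hb
      obtain ⟨p, hp, rfl⟩ := qc_mem ha
      obtain ⟨q, hq, rfl⟩ := qc_mem hb
      rw [← map_mul]
      exact mk_mem_qc I (hp.mul hq) }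

instance qc_fin (I : Ideal (PS K r)) (n : ℕ) : Module.Finite K (AMD.quotComponent K r I n) :=
  Module.Finite.of_fg ((homogeneousSubmodule_fg (Fin (r+1)) K n).map _)

theorem hom1_eq (p : PS K r) (hp : p.IsHomogeneous 1) : p = ∑ i, C (coeff (Finsupp.single i 1) p) * X i := by
  have : p ∈ homogeneousSubmodule (Fin (r+1)) K 1 := hp
  rw [homogeneousSubmodule_one_eq_span_X, Submodule.mem_span_range_iff_exists_fun] at this
  obtain ⟨c, rfl⟩ := this
  refine Finset.sum_congr rfl fun i _ => ?_
  rw [coeff_sum, Finset.sum_eq_single i]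
  · simp [MvPolynomial.smul_eq_C_mul]
  · intro j _ hj
    rw [coeff_smul, coeff_X', if_neg (by rw [Finsupp.single_left_inj one_ne_zero]; exact hj), smul_zero]
  · simp

/-- the degree one part is spanned by the variables, which are independent -/
theorem qc1_basis (I : Ideal (PS K r)) (hnd : AMD.Nondeg K r I) :
    (∀ x ∈ AMD.quotComponent K r I 1, ∃ c : Fin (r+1) → K, x = ∑ i, c i • Ideal.Quotient.mk I (X i)) ∧
    LinearIndependent K (fun i : Fin (r+1) => Ideal.Quotient.mk I (X i)) := by
  have hs : ∀ c : Fin (r+1) → K, ∑ i, c i • Ideal.Quotient.mk I (X i : PS K r) = Ideal.Quotient.mk I (∑ i, C (c i) * X i) := by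
    intro c
    rw [map_sum]
    refine Finset.sum_congr rfl fun i _ => ?_
    rw [← MvPolynomial.smul_eq_C_mul]; rfl
  constructor
  · intro x hx
    obtain ⟨p, hp, rfl⟩ := qc_mem hx
    exact ⟨_, by rw [hs, ← hom1_eq p hp]⟩
  · rw [Fintype.linearIndependent_iff]
    intro c hc i
    rw [hs, Ideal.Quotient.eq_zero_iff_mem] at hc
    have h1 : (∑ i, C (c i) * X i : PS K r).IsHomogeneous 1 := IsHomogeneous.sum _ _ _ fun i _ => by
      simpa using (isHomogeneous_C _ (c i)).mul (isHomogeneous_X K i)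
    have h2 := hnd _ hc h1
    have h3 := congrArg (coeff (Finsupp.single i 1)) h2
    rw [coeff_sum, Finset.sum_eq_single i] at h3
    · simpa using h3
    · intro j _ hj
      rw [coeff_C_mul, coeff_X', if_neg (by rw [Finsupp.single_left_inj one_ne_zero]; exact hj), mul_zero]
    · simp

theorem finrank_qc1 (I : Ideal (PS K r)) (hnd : AMD.Nondeg K r I) : Module.finrank K (AMD.quotComponent K r I 1) = r + 1 := by
  obtain ⟨h1, h2⟩ := qc1_basis I hnd
  have : AMD.quotComponent K r I 1 = Submodule.span K (Set.range fun i : Fin (r+1) => Ideal.Quotient.mk I (X i)) := by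
    apply le_antisymm
    · intro x hx
      obtain ⟨c, rfl⟩ := h1 x hx
      exact Submodule.sum_mem _ fun i _ => Submodule.smul_mem _ _ (Submodule.subset_span ⟨i, rfl⟩)
    · rw [Submodule.span_le]
      rintro _ ⟨i, rfl⟩
      exact mk_mem_qc I (isHomogeneous_X K i)
  rw [this, finrank_span_eq_card h2, Fintype.card_fin]

theorem qc_gen (I : Ideal (PS K r)) : Algebra.adjoin K (Set.range fun i : Fin (r+1) => Ideal.Quotient.mk I (X i)) = ⊤ := by
  have h : (Set.range fun i : Fin (r+1) => Ideal.Quotient.mk I (X i)) = (Ideal.Quotient.mkₐ K I) '' Set.range X := by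
    rw [← Set.range_comp]; rfl
  rw [h, ← AlgHom.map_adjoin, adjoin_range_X, Algebra.map_top]
  rw [AlgHom.range_eq_top]
  exact Ideal.Quotient.mkₐ_surjective K I

/-- complement -/
theorem exists_compl {V : Type*} [AddCommGroup V] [Module K V] (U : Submodule K V) [Module.Finite K U] {m c : ℕ} (y : Fin m → V) (hy : ∀ i, y i ∈ U)
    (hli : LinearIndependent K y) (hU : Module.finrank K U = m + c) :
    ∃ z : Fin c → V, (∀ j, z j ∈ U) ∧ (∀ (a : Fin c → K) (b : Fin m → K), ∑ j, a j • z j = ∑ i, b i • y i → a = 0) ∧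
      ∀ x ∈ U, ∃ (a : Fin c → K) (b : Fin m → K), x = ∑ i, b i • y i + ∑ j, a j • z j := by
  classical
  let y' : Fin m → U := fun i => ⟨y i, hy i⟩
  have hli' : LinearIndependent K y' := by
    rw [← LinearMap.linearIndependent_iff U.subtype (by simp)]; exact hli
  let W := Submodule.span K (Set.range y')
  obtain ⟨T, hT⟩ := Submodule.exists_isCompl W
  have hW : Module.finrank K W = m := by rw [finrank_span_eq_card hli', Fintype.card_fin]
  have hTc : Module.finrank K T = c := by
    have := Submodule.finrank_add_eq_of_isCompl hT
    omega
  let b := Module.finBasisOfFinrankEq K T hTc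
  refine ⟨fun j => (b j : U).1, fun j => (b j : U).2, ?_, ?_⟩
  · intro a e h
    have h1 : (∑ j, a j • (b j : U)) = ∑ i, e i • y' i := by
      apply Subtype.ext
      push_cast
      exact h
    have h2 : (∑ j, a j • (b j : U)) ∈ T := Submodule.sum_mem _ fun j _ => Submodule.smul_mem _ _ (b j).2
    have h3 : (∑ j, a j • (b j : U)) ∈ W := by
      rw [h1]; exact Submodule.sum_mem _ fun i _ => Submodule.smul_mem _ _ (Submodule.subset_span ⟨i, rfl⟩)
    have h4 := (Submodule.disjoint_def.1 hT.disjoint) _ h3 h2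
    have h5 : ∑ j, a j • b j = 0 := by
      apply Subtype.ext; push_cast; exact h4
    funext j
    exact Fintype.linearIndependent_iff.1 b.linearIndependent a h5 j
  · intro x hx
    have h1 : (⟨x, hx⟩ : U) ∈ W ⊔ T := by rw [hT.sup_eq_top]; trivial
    obtain ⟨w, hw, t, ht, hwt⟩ := Submodule.mem_sup.1 h1
    obtain ⟨e, he⟩ := (Submodule.mem_span_range_iff_exists_fun K).1 hw
    refine ⟨fun j => b.repr ⟨t, ht⟩ j, e, ?_⟩
    have h2 := congrArg Subtype.val hwt
    have h3 := congrArg (fun q : T => (q : U).1) (b.sum_repr ⟨t, ht⟩)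
    have h4 := congrArg Subtype.val he
    push_cast at h3 h4 h2
    rw [← h2, ← h4, ← h3]
end
end DP
end

noncomputable section
namespace DP
set_option linter.all false
open MvPolynomial

section
variable {K : Type} [Field K] {r : ℕ}

theorem cone_of_basis (I : Ideal (PS K r)) (hnd : AMD.Nondeg K r I) (b : Fin (r+1) → PS K r ⧸ I) (hb : ∀ i, b i ∈ AMD.quotComponent K r I 1)
    (hsp : ∀ i, Ideal.Quotient.mk I (X i) ∈ Submodule.span K (Set.range b))
    (S : Subalgebra K (PS K r ⧸ I)) (hS : ∀ i : Fin r, b i.castSucc ∈ S) (ht : Transcendental S (b (Fin.last r))) : AMD.IsConeIdeal K r I := by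
  obtain ⟨h1, hli⟩ := qc1_basis I hnd
  choose N hN using fun j => h1 (b j) (hb j)
  have h2 : ∀ i, ∃ c : Fin (r+1) → K, ∑ j, c j • b j = Ideal.Quotient.mk I (X i) := fun i => (Submodule.mem_span_range_iff_exists_fun K).1 (hsp i)
  choose M hM using h2
  have hMN : Matrix.of M * Matrix.of N = 1 := by
    ext i k
    have h3 : ∑ k, ((Matrix.of M * Matrix.of N) i k - (1 : Matrix (Fin (r+1)) (Fin (r+1)) K) i k) • Ideal.Quotient.mk I (X k : PS K r) = 0 := by
      simp only [sub_smul, Finset.sum_sub_distrib, Matrix.mul_apply, Matrix.of_apply, Finset.sum_smul, mul_smul]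
      rw [Finset.sum_comm]
      simp only [← Finset.smul_sum, ← hN, hM]
      simp [Matrix.one_apply]
    exact sub_eq_zero.1 (Fintype.linearIndependent_iff.1 hli _ h3 k)
  have hNM : Matrix.of N * Matrix.of M = 1 := mul_eq_one_comm.1 hMN
  let f : Matrix (Fin (r+1)) (Fin (r+1)) K → (PS K r →ₐ[K] PS K r) := fun L => aeval fun i => ∑ j, C (L i j) * X j
  have hff : ∀ L L' : Matrix (Fin (r+1)) (Fin (r+1)) K, L * L' = 1 → (f L').comp (f L) = AlgHom.id K _ := by
    intro L L' h
    ext1 i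
    simp only [f, AlgHom.comp_apply, aeval_X, map_sum, map_mul, AlgHom.id_apply, algHom_C, MvPolynomial.algebraMap_eq]
    have h4 : ∀ k, ∑ j, L i j * L' j k = (1 : Matrix (Fin (r+1)) (Fin (r+1)) K) i k := fun k => by rw [← h, Matrix.mul_apply]
    simp only [Finset.mul_sum]
    rw [Finset.sum_comm]
    simp only [← mul_assoc, ← C_mul, ← Finset.sum_mul, ← map_sum, h4]
    simp [Matrix.one_apply]
  let φ : PS K r ≃ₐ[K] PS K r := AlgEquiv.ofAlgHom (f (Matrix.of M)) (f (Matrix.of N)) (hff _ _ hNM) (hff _ _ hMN)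
  have hφX : ∀ i, φ (X i) = ∑ j, C (M i j) * X j := by
    intro i
    simp [φ, f]
  let ψ : PS K r →ₐ[K] (PS K r ⧸ I) := aeval b
  have hψ : ∀ p, ψ (φ p) = Ideal.Quotient.mk I p := by
    have : ψ.comp (φ : PS K r →ₐ[K] PS K r) = Ideal.Quotient.mkₐ K I := by
      ext1 i
      change ψ (φ (X i)) = Ideal.Quotient.mk I (X i)
      rw [hφX, ← hM i]
      simp only [ψ, map_sum, map_mul, aeval_C, aeval_X]
      exact Finset.sum_congr rfl fun j _ => (Algebra.smul_def _ _).symm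
    intro p
    exact DFunLike.congr_fun this p
  refine ⟨φ, ?_, RingHom.ker (ψ.comp (rename Fin.castSucc)), ?_⟩
  · intro i
    rw [hφX]
    refine IsHomogeneous.sum _ _ _ fun j _ => ?_
    simpa using (isHomogeneous_C _ (M i j)).mul (isHomogeneous_X K j)
  · apply le_antisymm
    · rw [Ideal.map_le_iff_le_comap]
      intro p hp
      rw [Ideal.mem_comap]
      have h5 : ψ (φ p) = 0 := by rw [hψ, Ideal.Quotient.eq_zero_iff_mem]; exact hp
      generalize (φ p : PS K r) = P at h5
      let g : Polynomial (MvPolynomial (Fin r) K) →+* PS K r := Polynomial.eval₂RingHom (rename (Fin.castSucc : Fin r → Fin (r+1))).toRingHom (X (Fin.last r))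
      have hg : ∀ P, ∃ q, g q = P := by
        intro P
        induction P using MvPolynomial.induction_on with
        | C a => exact ⟨Polynomial.C (C a), by simp [g]⟩
        | add p q hp hq =>
          obtain ⟨u, rfl⟩ := hp
          obtain ⟨v, rfl⟩ := hq
          exact ⟨u + v, map_add _ _ _⟩
        | mul_X p i hp =>
          obtain ⟨u, rfl⟩ := hp
          refine Fin.lastCases ⟨u * Polynomial.X, ?_⟩ (fun i => ⟨u * Polynomial.C (X i), ?_⟩) i
          · rw [map_mul]; simp [g]
          · rw [map_mul]; simp [g]
      obtain ⟨q, rfl⟩ := hg P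
      have hSm : ∀ p : MvPolynomial (Fin r) K, ψ (rename Fin.castSucc p) ∈ S := by
        intro p
        simp only [ψ, aeval_rename]
        have : (aeval (b ∘ Fin.castSucc) : MvPolynomial (Fin r) K →ₐ[K] _).range ≤ S := by
          rw [← Algebra.adjoin_range_eq_range_aeval]
          apply Algebra.adjoin_le
          rintro _ ⟨i, rfl⟩
          exact hS i
        exact this ⟨p, rfl⟩
      let τ : MvPolynomial (Fin r) K →ₐ[K] S := (ψ.comp (rename Fin.castSucc)).codRestrict S hSm
      have h6 : Polynomial.aeval (b (Fin.last r)) (q.map τ.toRingHom) = 0 := by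
        rw [← h5, Polynomial.aeval_def, Polynomial.eval₂_map]
        simp only [g, Polynomial.coe_eval₂RingHom]
        have := Polynomial.hom_eval₂ q (rename (Fin.castSucc : Fin r → Fin (r+1)) : MvPolynomial (Fin r) K →ₐ[K] PS K r).toRingHom ψ.toRingHom (X (Fin.last r))
        refine Eq.trans ?_ this.symm
        congr 1
        simp [ψ]
      have h7 : q.map τ.toRingHom = 0 := by
        by_contra hcon
        exact ht ⟨_, hcon, h6⟩
      have h8 : ∀ n, q.coeff n ∈ RingHom.ker (ψ.comp (rename (Fin.castSucc : Fin r → Fin (r+1)))) := by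
        intro n
        have h9 := congrArg (fun p => ((Polynomial.coeff p n : S) : PS K r ⧸ I)) h7
        simp only [Polynomial.coeff_map, Polynomial.coeff_zero] at h9
        exact h9
      have h10 : g q = ∑ n ∈ Finset.range (q.natDegree + 1), rename Fin.castSucc (q.coeff n) * X (Fin.last r) ^ n := by
        simp only [g, Polynomial.coe_eval₂RingHom]
        rw [Polynomial.eval₂_eq_sum_range]
        rfl
      rw [h10]
      exact Ideal.sum_mem _ fun n _ => Ideal.mul_mem_right _ _ (Ideal.mem_map_of_mem _ (h8 n))
    · rw [Ideal.map_le_iff_le_comap]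
      intro p hp
      rw [Ideal.mem_comap]
      have h5 : ψ (rename Fin.castSucc p) = 0 := hp
      have h6 : φ (φ.symm (rename Fin.castSucc p)) = rename Fin.castSucc p := φ.apply_symm_apply _
      rw [← h6]
      apply Ideal.mem_map_of_mem
      rw [← Ideal.Quotient.eq_zero_iff_mem, ← hψ, h6, h5]
end
end DP
end

noncomputable section
namespace DP
set_option linter.all false
open MvPolynomial

section
variable {K : Type} [Field K] {r d c : ℕ}
local notation "RY" => MvPolynomial (Fin d) K

theorem cone_step (I : Ideal (PS K r)) [IsDomain (PS K r ⧸ I)] (hnd : AMD.Nondeg K r I) (hr : d + c = r) (hc : 3 ≤ c)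
    [Algebra RY (PS K r ⧸ I)] (y : Fin (d+1) → PS K r ⧸ I) (hy1 : ∀ i, y i ∈ AMD.quotComponent K r I 1) (hy : AlgebraicIndependent K y)
    (halgY : ∀ P : RY, algebraMap RY (PS K r ⧸ I) P = aeval y (rename Fin.succ P))
    {X' : Fin (c+1) → PS K r ⧸ I} {Om : PS K r ⧸ I} {α : Fin (c+1) → Fin (c+1) → (Fin d → K)} {κ : Fin (c+1) → Fin (c+1) → RY}
    (hX1 : ∀ m, X' m ∈ AMD.quotComponent K r I 1) (hspan : ∀ x ∈ AMD.quotComponent K r I 1, x ∈ Submodule.span K (Set.range X' ∪ Set.range fun i : Fin d => y i.succ))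
    (hR : Rel X' Om α κ) (hI : Ind K d X' Om) (hκ : κ 0 1 = 0)
    (ν : Fin d → K) (hν : ν ≠ 0) (hα : ∀ i j, i ≠ j → dl (α i j) ν = 0) : AMD.IsConeIdeal K r I := by
  classical
  obtain ⟨i0, hi0⟩ : ∃ i, ν i ≠ 0 := by
    by_contra h
    push Not at h
    exact hν (funext h)
  obtain ⟨e, hde⟩ : ∃ e, d = e + 1 := ⟨d - 1, by have := i0.2; omega⟩
  have hsc : IsScalarTower K RY (PS K r ⧸ I) := by
    apply IsScalarTower.of_algebraMap_eq
    intro a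
    rw [halgY, MvPolynomial.algebraMap_eq, rename_C, aeval_C]
  let u0 : Fin d → K := Pi.single i0 (ν i0)⁻¹
  have hu0 : dl ν u0 = 1 := by
    change ∑ i, ν i * u0 i = 1
    rw [Finset.sum_eq_single i0]
    · simp [u0, hi0]
    · intro b _ hb; simp [u0, hb]
    · simp
  let U := LinearMap.ker (dl ν)
  have hU : Module.finrank K U = e := by
    have h1 := LinearMap.finrank_range_add_finrank_ker (dl ν)
    have h2 : LinearMap.range (dl ν) = ⊤ := by
      rw [LinearMap.range_eq_top]
      intro q
      exact ⟨q • u0, by rw [map_smul, hu0]; simp⟩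
    rw [h2] at h1
    simp at h1
    change Module.finrank K (LinearMap.ker (dl ν)) = e
    omega
  let B := Module.finBasisOfFinrankEq K U hU
  let bb : Fin e → (Fin d → K) := fun i => (B i : Fin d → K)
  have hbb : ∀ u, dl ν u = 0 → u ∈ Submodule.span K (Set.range bb) := by
    intro u hu
    have h1 := B.sum_repr ⟨u, hu⟩
    have h2 := congrArg (Subtype.val) h1
    rw [← (show ((⟨u, hu⟩ : U) : Fin d → K) = u from rfl), ← h1]
    rw [Submodule.coe_sum]
    exact Submodule.sum_mem _ fun i _ => Submodule.smul_mem _ _ (Submodule.subset_span ⟨i, rfl⟩)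
  have hdl : ∀ u v : Fin d → K, dl u v = dl v u := fun u v => by
    change ∑ i, u i * v i = ∑ i, v i * u i
    exact Finset.sum_congr rfl fun i _ => mul_comm _ _
  let L : (Fin d → K) →ₗ[K] (PS K r ⧸ I) := (IsScalarTower.toAlgHom K RY (PS K r ⧸ I)).toLinearMap.comp lf
  have hLdef : ∀ u, L u = algebraMap RY (PS K r ⧸ I) (lf u) := fun u => rfl
  have hL1 : ∀ u, L u ∈ AMD.quotComponent K r I 1 := by
    intro u
    rw [hLdef, halgY, lf_apply]
    simp only [map_sum, map_mul, rename_C, rename_X, aeval_C, aeval_X]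
    refine Submodule.sum_mem _ fun i _ => ?_
    rw [← Algebra.smul_def]
    exact Submodule.smul_mem _ _ (hy1 _)
  have hLs : ∀ i : Fin d, y i.succ = L (Pi.single i 1) := by
    intro i
    rw [hLdef, halgY, lf_apply]
    simp only [map_sum, map_mul, rename_C, rename_X, aeval_C, aeval_X]
    rw [Finset.sum_eq_single i]
    · simp
    · intro b _ hb; simp [hb]
    · simp
  set t := L u0 with ht
  set G : Set (PS K r ⧸ I) := Set.range X' ∪ Set.range fun i => algebraMap RY (PS K r ⧸ I) (lf (bb i)) with hG
  have hA1 : ∀ x ∈ AMD.quotComponent K r I 1, x ∈ Submodule.span K (insert t G) := by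
    intro x hx
    refine (Submodule.span_le.2 ?_) (hspan x hx)
    rintro _ (⟨m, rfl⟩ | ⟨i, rfl⟩)
    · exact Submodule.subset_span (Or.inr (Or.inl ⟨m, rfl⟩))
    · change y i.succ ∈ Submodule.span K (insert t G)
      rw [hLs]
      set u : Fin d → K := Pi.single i 1
      have h1 : u - (dl ν u) • u0 ∈ Submodule.span K (Set.range bb) := hbb _ (by rw [map_sub, map_smul, hu0]; simp)
      have h2 : L u = L (u - (dl ν u) • u0) + (dl ν u) • t := by rw [map_sub, map_smul]; simp [t]
      rw [h2]
      refine Submodule.add_mem _ ?_ (Submodule.smul_mem _ _ (Submodule.subset_span (Or.inl rfl)))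
      have h3 : Submodule.span K (Set.range bb) ≤ (Submodule.span K (insert t G)).comap L := by
        rw [Submodule.span_le]
        rintro _ ⟨k, rfl⟩
        exact Submodule.subset_span (Or.inr (Or.inr ⟨k, rfl⟩))
      exact h3 h1
  have hmk : ∀ i, Ideal.Quotient.mk I (X i) ∈ AMD.quotComponent K r I 1 := fun i => mk_mem_qc I (isHomogeneous_X K i)
  have htr := transc hde hc hR hI hκ bb (fun i j h => hbb _ (by rw [hdl]; exact hα i j h)) t (by
    rw [eq_top_iff, ← qc_gen I]
    apply Algebra.adjoin_le
    rintro _ ⟨i, rfl⟩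
    exact Algebra.span_le_adjoin K _ (hA1 _ (hmk i))) y hy
  let eq : Fin r ≃ Fin (c+1) ⊕ Fin e := Fintype.equivOfCardEq (by simp; omega)
  let b' : Fin r → PS K r ⧸ I := fun i => Sum.elim X' (fun i => algebraMap RY (PS K r ⧸ I) (lf (bb i))) (eq i)
  have hb'G : ∀ x ∈ G, ∃ i, b' i = x := by
    rintro _ (⟨m, rfl⟩ | ⟨i, rfl⟩)
    · exact ⟨eq.symm (Sum.inl m), by simp [b']⟩
    · exact ⟨eq.symm (Sum.inr i), by simp [b']⟩
  have hb'm : ∀ i, b' i ∈ G := by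
    intro i
    rcases h : eq i with m | k
    · exact Or.inl ⟨m, by simp [b', h]⟩
    · exact Or.inr ⟨k, by simp [b', h]⟩
  let b : Fin (r+1) → PS K r ⧸ I := Fin.snoc b' t
  have hbc : ∀ i : Fin r, b i.castSucc = b' i := fun i => by simp [b]
  have hbl : b (Fin.last r) = t := by simp [b]
  have hGb : insert t G ⊆ Set.range b := by
    rintro x (rfl | hx)
    · exact ⟨_, hbl⟩
    · obtain ⟨i, hi⟩ := hb'G x hx
      exact ⟨i.castSucc, by rw [hbc, hi]⟩
  refine cone_of_basis I hnd b ?_ ?_ (Algebra.adjoin K G) ?_ ?_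
  · intro i
    refine Fin.lastCases ?_ (fun i => ?_) i
    · rw [hbl]; exact hL1 _
    · rw [hbc]
      rcases hb'm i with ⟨m, hm⟩ | ⟨k, hk⟩
      · rw [← hm]; exact hX1 m
      · rw [← hk]; exact hL1 _
  · intro i
    exact Submodule.span_mono hGb (hA1 _ (hmk i))
  · intro i
    rw [hbc]
    exact Algebra.subset_adjoin (hb'm i)
  · rw [hbl]; exact htr
end
end DP
end

noncomputable section
namespace DP
set_option linter.all false
open MvPolynomial

section
variable {K : Type} [Field K] [IsAlgClosed K] {r d c : ℕ}

set_option maxHeartbeats 1000000 in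
theorem bounds (I : Ideal (PS K r)) [IsDomain (PS K r ⧸ I)] [GradedAlgebra (AMD.quotComponent K r I)] (hnd : AMD.Nondeg K r I) (hcodim : d + c = r)
    (hcone : ¬ AMD.IsConeIdeal K r I) {y : Fin (d+1) → PS K r ⧸ I} {θ : PS K r ⧸ I} {cc : ℕ → MvPolynomial (Fin (d+1)) K} {H : MvPolynomial (Fin (d+1)) K}
    (h : NN (AMD.quotComponent K r I) y θ (c+2) cc H) (hH : ∀ e, eval (Pi.single e 1) H ≠ 0) {z : Fin c → PS K r ⧸ I} {w : PS K r ⧸ I} {a : Fin c → Fin c → K}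
    (F : FB (AMD.quotComponent K r I) y z w a)
    (hsp : ∀ x ∈ AMD.quotComponent K r I 1, ∃ (a : Fin c → K) (b : Fin (d+1) → K), x = ∑ i, b i • y i + ∑ j, a j • z j) (hc : 3 ≤ c) :
    d ≤ 6 ∧ (4 ≤ c → d ≤ 4) := by
  have hft : Algebra.FiniteType K (PS K r ⧸ I) := inferInstance
  obtain ⟨ev0, hinj0, hev0⟩ := h.evs 0 (hH 0)
  let eq : Option (Fin (c+1)) ≃ Fin (c+2) := Fintype.equivOfCardEq (by simp)
  letI : Algebra (MvPolynomial (Fin d) K) (PS K r ⧸ I) := (aeval (fun i : Fin d => y i.succ)).toRingHom.toAlgebra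
  have halgY : ∀ P : MvPolynomial (Fin d) K, algebraMap (MvPolynomial (Fin d) K) (PS K r ⧸ I) P = aeval y (rename Fin.succ P) := by
    intro P
    rw [aeval_rename]
    rfl
  obtain ⟨X0, Om0, hX1, hy0, hz0, hind, hmul⟩ := F.rel halgY (by omega) (fun p => ev0 (eq p)) (hinj0.comp eq.injective) (fun p P => hev0 _ P)
  obtain ⟨Om1, α1, κ1, hR1, hI1⟩ := to_rel hc hind hmul
  obtain ⟨ε, Om, α, κ, s, hR, hI, hs, h01, hκ⟩ := gauged hc hR1 hI1
  refine rel_bound hc hR hI s hs h01 ?_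
  intro ν hν
  by_contra hne
  apply hcone
  have hlf : ∀ u : Fin d → K, (lf u : MvPolynomial (Fin d) K) • (1 : PS K r ⧸ I) = ∑ i, u i • y i.succ := by
    intro u
    rw [Algebra.smul_def, mul_one, halgY, lf_apply]
    simp only [map_sum, map_mul, rename_C, rename_X, aeval_C, aeval_X]
    exact Finset.sum_congr rfl fun i _ => (Algebra.smul_def _ _).symm
  refine cone_step I hnd hcodim hc y F.hy1 h.ind halgY (fun m => ?_) ?_ hR hI hκ ν hne hν
  · refine Submodule.add_mem _ (hX1 m) ?_
    rw [hlf]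
    exact Submodule.sum_mem _ fun i _ => Submodule.smul_mem _ _ (F.hy1 _)
  · intro x hx
    set W := Submodule.span K (Set.range (fun j => X0 j + (lf (ε j) : MvPolynomial (Fin d) K) • (1 : PS K r ⧸ I)) ∪ Set.range fun i : Fin d => y i.succ) with hW
    have hyW : ∀ i : Fin d, y i.succ ∈ W := fun i => Submodule.subset_span (Or.inr ⟨i, rfl⟩)
    have hXW : ∀ m, X0 m ∈ W := by
      intro m
      have h1 : X0 m + (lf (ε m) : MvPolynomial (Fin d) K) • (1 : PS K r ⧸ I) ∈ W := Submodule.subset_span (Or.inl ⟨m, rfl⟩)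
      have h2 : (lf (ε m) : MvPolynomial (Fin d) K) • (1 : PS K r ⧸ I) ∈ W := by
        rw [hlf]
        exact Submodule.sum_mem _ fun i _ => Submodule.smul_mem _ _ (hyW _)
      have h3 := Submodule.sub_mem _ h1 h2
      rwa [add_sub_cancel_right] at h3
    have hXs : Submodule.span K (Set.range X0) ≤ W := by
      rw [Submodule.span_le]
      rintro _ ⟨m, rfl⟩
      exact hXW m
    obtain ⟨a', b', rfl⟩ := hsp x hx
    refine Submodule.add_mem _ (Submodule.sum_mem _ fun i _ => Submodule.smul_mem _ _ ?_) (Submodule.sum_mem _ fun j _ => Submodule.smul_mem _ _ (hXs (hz0 j)))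
    exact Fin.cases (hXs hy0) hyW i

set_option maxHeartbeats 1000000 in
theorem main (I : Ideal (PS K r)) (hprime : I.IsPrime)
    (hhom : AMD.IsHomIdeal K r I) (hnd : AMD.Nondeg K r I)
    (hnormal : IsIntegrallyClosed (PS K r ⧸ I))
    (hdim : AMD.DimEq K r I d) (hcodim : d + c = r)
    (hdeg : AMD.DegreeEq K r I d (c + 2))
    (hcone : ¬ AMD.IsConeIdeal K r I) :
    AMD.IsArithGorenstein K r I ∧ (3 ≤ c → d ≤ 6) ∧ (4 ≤ c → d ≤ 4) := by
  classical
  haveI : IsDomain (PS K r ⧸ I) := Ideal.Quotient.isDomain I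
  letI := qcGraded I hhom
  have hft : Algebra.FiniteType K (PS K r ⧸ I) := inferInstance
  have hmk : ∀ i, Ideal.Quotient.mk I (X i) ∈ AMD.quotComponent K r I 1 := fun i => mk_mem_qc I (isHomogeneous_X K i)
  obtain ⟨m, y0, θ, n, cc0, H0, h0⟩ := exists_NN (AMD.quotComponent K r I) (r+1) (fun i => Ideal.Quotient.mk I (X i)) hmk (qc_gen I)
  obtain ⟨q, hq, hq1⟩ := hdeg
  obtain ⟨hm, hn⟩ := h0.degree hft (fun k => inferInstance) d (c+2) (by omega) q (by
    refine hq.trans ?_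
    ext n; simp) hq1
  subst hm
  subst hn
  haveI : Infinite K := IsAlgClosed.instInfinite
  obtain ⟨M, N, y, -, -, -, -, h, hH, -⟩ := h0.good 1 one_ne_zero
  have hyli : LinearIndependent K y := h.ind.linearIndependent
  obtain ⟨z, hz, hz0, hsp⟩ := exists_compl (AMD.quotComponent K r I 1) y h.hy1 hyli (c := c) (by rw [finrank_qc1 I hnd]; omega)
  have hgen : Algebra.adjoin K (Set.range y ∪ Set.range z) = ⊤ := by
    rw [eq_top_iff, ← qc_gen I]
    apply Algebra.adjoin_le
    rintro _ ⟨i, rfl⟩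
    obtain ⟨a, b, hab⟩ := hsp _ (hmk i)
    change Ideal.Quotient.mk I (X i) ∈ Algebra.adjoin K (Set.range y ∪ Set.range z)
    rw [hab]
    have hyG : ∀ i, y i ∈ Algebra.adjoin K (Set.range y ∪ Set.range z) :=
      fun i => Algebra.subset_adjoin (Set.mem_union_left _ ⟨i, rfl⟩)
    have hzG : ∀ i, z i ∈ Algebra.adjoin K (Set.range y ∪ Set.range z) :=
      fun i => Algebra.subset_adjoin (Set.mem_union_right _ ⟨i, rfl⟩)
    exact Subalgebra.add_mem _ (Subalgebra.sum_mem _ fun i _ => Subalgebra.smul_mem _ (hyG i) _)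
      (Subalgebra.sum_mem _ fun i _ => Subalgebra.smul_mem _ (hzG i) _)
  have hF : ∃ w a, FB (AMD.quotComponent K r I) y z w a := by
    letI : Algebra (MvPolynomial (Fin (d+1)) K) (PS K r ⧸ I) := (aeval y).toRingHom.toAlgebra
    have halg : ∀ P : MvPolynomial (Fin (d+1)) K, algebraMap (MvPolynomial (Fin (d+1)) K) (PS K r ⧸ I) P = aeval y P := fun P => rfl
    have hctx := h.ctx halg hH z hz hz0 hgen (by simp)
    obtain ⟨lam, a, hlam, hla, hane, hnd'⟩ := h.struct halg z hz hz0 hctx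
    obtain ⟨w, -, F⟩ := FB.of_lam h.hy1 halg z hz hctx lam a hlam hla hane hnd'
    exact ⟨w, a, F⟩
  obtain ⟨w, a, F⟩ := hF
  refine ⟨?_, fun hc => (bounds I hnd hcodim hcone h hH F hsp hc).1, fun hc => (bounds I hnd hcodim hcone h hH F hsp (by omega)).2 hc⟩
  have h𝔪 : AMD.maxIdl K r I = Ideal.span (Set.range y ∪ Set.range z) := by
    have hmem : ∀ x ∈ AMD.quotComponent K r I 1, x ∈ AMD.maxIdl K r I := by
      intro x hx
      obtain ⟨c', rfl⟩ := (qc1_basis I hnd).1 x hx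
      refine Ideal.sum_mem _ fun i _ => ?_
      exact Submodule.smul_of_tower_mem _ _ (Ideal.mem_map_of_mem _ (Ideal.subset_span ⟨i, rfl⟩))
    apply le_antisymm
    · rw [AMD.maxIdl, Ideal.map_span, Ideal.span_le]
      rintro _ ⟨_, ⟨i, rfl⟩, rfl⟩
      obtain ⟨a, b, hab⟩ := hsp _ (hmk i)
      rw [hab]
      exact Ideal.add_mem _ (Ideal.sum_mem _ fun i _ => Submodule.smul_of_tower_mem _ _ (Ideal.subset_span (Or.inl ⟨i, rfl⟩)))
        (Ideal.sum_mem _ fun i _ => Submodule.smul_of_tower_mem _ _ (Ideal.subset_span (Or.inr ⟨i, rfl⟩)))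
    · rw [Ideal.span_le]
      rintro _ (⟨i, rfl⟩ | ⟨i, rfl⟩)
      · exact hmem _ (h.hy1 i)
      · exact hmem _ (hz i)
  refine ⟨d+1, List.ofFn y, ?_, by simp, ?_, F.reg, F.socle _ h𝔪 _ ?_⟩
  · rw [show _ = _ from hdim]; simp
  · intro x hx
    rw [List.mem_ofFn] at hx
    obtain ⟨i, rfl⟩ := hx
    rw [h𝔪]
    exact Ideal.subset_span (Or.inl ⟨i, rfl⟩)
  · congr 1
    ext x
    exact List.mem_ofFn
end
end DP
end



/-- **Remark 3.3 B).**  An arithmetically normal variety `X ⊆ ℙ^r_K` of almost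
minimal degree which is not a cone is arithmetically Gorenstein (a maximal Del Pezzo
variety); moreover `dim X ≤ 6` if `codim X ≥ 3`, and `dim X ≤ 4` if `codim X ≥ 4`. -/
theorem arithmetically_normal_del_pezzo
    (K : Type) [Field K] [IsAlgClosed K] (r : ℕ)
    (I : Ideal (PS K r)) (hprime : I.IsPrime)
    (hhom : AMD.IsHomIdeal K r I) (hnd : AMD.Nondeg K r I)
    (hnormal : IsIntegrallyClosed (PS K r ⧸ I))
    (d c : ℕ) (hdim : AMD.DimEq K r I d) (hcodim : d + c = r)
    (hdeg : AMD.DegreeEq K r I d (c + 2))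
    (hcone : ¬ AMD.IsConeIdeal K r I) :
    AMD.IsArithGorenstein K r I ∧ (3 ≤ c → d ≤ 6) ∧ (4 ≤ c → d ≤ 4) := by
  exact DP.main I hprime hhom hnd hnormal hdim hcodim hdeg hcone
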